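/- Let H ∈ (0,1/2) and T ∈ (0,∞). Almost surely, lim_{ε→0⁺} sup_{t ≤ T} sup_{a ∈ ℝ} |ε^{1/H − 1} U_{0,t}(ε, B − a) − (c_H/2) L_t(a)| = 0. -/

import Mathlib

open MeasureTheory ProbabilityTheory Filter Set ENNReal Asymptotics
open scoped NNReal Classical Topology

noncomputable section

/-- The grid `εℤ` of levels. -/
def lvGrid (ε : ℝ) : Set ℝ := {x | ∃ k : ℤ, x = ε * k}

/-- The successive times at which the path `w` crosses to a new point of the grid `εℤ`,
with values in `ℝ≥0∞` (`∞` meaning "never", corresponding to the convention `inf ∅ = +∞`). -/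
def hitT (ε : ℝ) (w : ℝ → ℝ) : ℕ → ℝ≥0∞
  | 0 => 0
  | n + 1 =>
      ⨅ (r : ℝ) (_ : hitT ε w n < ENNReal.ofReal r ∧ w r ∈ lvGrid ε ∧
          w r ≠ w ((hitT ε w n).toReal)), ENNReal.ofReal r

/-- `K_{s,t}(ε,w)`: the number of `ε`-level crossings of `w` in the interval `[s,t]`,
namely `#{n ≥ 2 : T_n(ε, w_{s+·}) ≤ t-s} + 1_{w_s ∈ εℤ}·1_{T_1(ε, w_{s+·}) ≤ t-s}`,
as an extended natural number. -/
def crossK (ε : ℝ) (w : ℝ → ℝ) (s t : ℝ) : ℕ∞ :=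
  {n : ℕ | 2 ≤ n ∧ hitT ε (fun r => w (s + r)) n ≤ ENNReal.ofReal (t - s)}.encard
    + (if w s ∈ lvGrid ε ∧ hitT ε (fun r => w (s + r)) 1 ≤ ENNReal.ofReal (t - s)
        then 1 else 0)

/-- `K_{s,t}(ε,w)` as an extended nonnegative real. -/
def crossKe (ε : ℝ) (w : ℝ → ℝ) (s t : ℝ) : ℝ≥0∞ := (crossK ε w s t : ℝ≥0∞)

/-- `K_{s,t}(ε,w)` as a real number (junk value `0` if the count is infinite). -/
def crossKR (ε : ℝ) (w : ℝ → ℝ) (s t : ℝ) : ℝ := (crossKe ε w s t).toReal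

/-- The averaged crossing count `K̄_{s,t}(ε,w) = ε⁻¹ ∫_{-ε/2}^{ε/2} K_{s,t}(ε, w+ρ) dρ`. -/
def avgK (ε : ℝ) (w : ℝ → ℝ) (s t : ℝ) : ℝ≥0∞ :=
  ENNReal.ofReal ε⁻¹ * ∫⁻ ρ in Set.Ioo (-(ε / 2)) (ε / 2), crossKe ε (fun r => w r + ρ) s t

/-- `B` is a fractional Brownian motion with Hurst parameter `H` under `P`:
a centered Gaussian process with continuous paths, `B 0 = 0`, and
`E[(B_t - B_s)^2] = a_H |t-s|^(2H)` for some constant `a_H > 0`. -/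
def IsFBM {Ω : Type*} [MeasurableSpace Ω] (H : ℝ) (P : Measure Ω) (B : ℝ → Ω → ℝ) : Prop :=
  (∀ ω, Continuous fun t => B t ω) ∧ (∀ ω, B 0 ω = 0) ∧ (∀ t, Measurable (B t)) ∧
  (∀ (n : ℕ) (t : Fin n → ℝ) (c : Fin n → ℝ), ∃ v : ℝ≥0,
      Measure.map (fun ω => ∑ i, c i * B (t i) ω) P = gaussianReal 0 v) ∧
  (∃ aH : ℝ, 0 < aH ∧ ∀ s t : ℝ, ∫ ω, (B t ω - B s ω) ^ 2 ∂P = aH * |t - s| ^ (2 * H))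

/-- The constant `c_H = sup_{t>0} t⁻¹ E[K̄_{0,t}(1,B)] (= lim_{t→∞} t⁻¹ E[K̄_{0,t}(1,B)]`,
the limit existing by superadditivity and Fekete's lemma), as an extended nonnegative real. -/
def cHe {Ω : Type*} [MeasurableSpace Ω] (P : Measure Ω) (B : ℝ → Ω → ℝ) : ℝ≥0∞ :=
  ⨆ (t : ℝ) (_ : 0 < t), (ENNReal.ofReal t)⁻¹ * ∫⁻ ω, avgK 1 (fun r => B r ω) 0 t ∂P

/-- The constant `c_H` as a real number. -/
def cH {Ω : Type*} [MeasurableSpace Ω] (P : Measure Ω) (B : ℝ → Ω → ℝ) : ℝ :=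
  (cHe P B).toReal

/-- The set of pairs (u,v) realizing an upcrossing of the interval `[0,ε]` by `w`
during `[s,t]`. -/
def upSet (ε : ℝ) (w : ℝ → ℝ) (s t : ℝ) : Set (ℝ × ℝ) :=
  {p | p.1 ∈ Set.Icc s t ∧ p.2 ∈ Set.Icc s t ∧ p.1 < p.2 ∧ w p.1 = 0 ∧ w p.2 = ε ∧
    ∀ r ∈ Set.Ioo p.1 p.2, w r ∈ Set.Ioo 0 ε}

/-- `U_{s,t}(ε,w)`: the number of upcrossings of `[0,ε]` by `w` during `[s,t]`. -/
def upE (ε : ℝ) (w : ℝ → ℝ) (s t : ℝ) : ℕ∞ := (upSet ε w s t).encard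

/-- `U_{s,t}(ε,w)` as a real number (junk value `0` if the count is infinite). -/
def upR (ε : ℝ) (w : ℝ → ℝ) (s t : ℝ) : ℝ := ((upE ε w s t : ℝ≥0∞)).toReal

namespace UL
section
/-- existence of a chain of `m` strict upcrossings of `[x,y]` after `r`, with times in `S`. -/
def UC {α : Type*} [LinearOrder α] (w : α → ℝ) (S : Set α) (x y : ℝ) : ℕ → α → Prop
  | 0, _ => True
  | m + 1, r => ∃ u ∈ S, ∃ v ∈ S, r ≤ u ∧ u < v ∧ w u < x ∧ y < w v ∧ UC w S x y m v

/-- the maximal number of strict upcrossings -/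
def V {α : Type*} [LinearOrder α] (w : α → ℝ) (S : Set α) (x y : ℝ) : ℝ≥0∞ :=
  ⨆ m : ℕ, ⨆ (_ : ∃ r, UC w S x y m r), (m : ℝ≥0∞)

section comb
variable {α : Type*} [LinearOrder α] {w : α → ℝ} {S S' : Set α} {x y x' y' : ℝ}

lemma UC_r {m : ℕ} {r r' : α} (h : r' ≤ r) (hu : UC w S x y m r) : UC w S x y m r' := by
  cases m with
  | zero => trivial
  | succ m =>
    obtain ⟨u, hu1, v, hv1, h1, h2, h3, h4, h5⟩ := hu
    exact ⟨u, hu1, v, hv1, h.trans h1, h2, h3, h4, h5⟩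

lemma UC_mono {m : ℕ} {r : α} (hS : S ⊆ S') (hx : x ≤ x') (hy : y' ≤ y)
    (hu : UC w S x y m r) : UC w S' x' y' m r := by
  induction m generalizing r with
  | zero => trivial
  | succ m ih =>
    obtain ⟨u, hu1, v, hv1, h1, h2, h3, h4, h5⟩ := hu
    exact ⟨u, hS hu1, v, hS hv1, h1, h2, h3.trans_le hx, hy.trans_lt h4, ih h5⟩

/-- only times `≥ r` matter -/
lemma UC_restrict {m : ℕ} {r t : α} (hr : t ≤ r) (hu : UC w S x y m r) :
    UC w (S ∩ Ici t) x y m r := by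
  induction m generalizing r with
  | zero => trivial
  | succ m ih =>
    obtain ⟨u, hu1, v, hv1, h1, h2, h3, h4, h5⟩ := hu
    exact ⟨u, ⟨hu1, hr.trans h1⟩, v, ⟨hv1, (hr.trans h1).trans h2.le⟩, h1, h2, h3, h4,
      ih ((hr.trans h1).trans h2.le) h5⟩

lemma UC_start {m : ℕ} {r t : α} (hS : ∀ u ∈ S, t ≤ u) (hu : UC w S x y m r) :
    UC w S x y m t := by
  cases m with
  | zero => trivial
  | succ m =>
    obtain ⟨u, hu1, v, hv1, h1, h2, h3, h4, h5⟩ := hu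
    exact ⟨u, hu1, v, hv1, hS u hu1, h2, h3, h4, h5⟩

lemma le_V {m : ℕ} {r : α} (hu : UC w S x y m r) : (m : ℝ≥0∞) ≤ V w S x y :=
  le_iSup_of_le m (le_iSup_of_le ⟨r, hu⟩ le_rfl)

lemma V_le {c : ℝ≥0∞} (h : ∀ m r, UC w S x y m r → (m : ℝ≥0∞) ≤ c) : V w S x y ≤ c :=
  iSup_le fun m => iSup_le fun ⟨r, hr⟩ => h m r hr

lemma V_mono (hS : S ⊆ S') (hx : x ≤ x') (hy : y' ≤ y) : V w S x y ≤ V w S' x' y' :=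
  V_le fun _ _ h => le_V (UC_mono hS hx hy h)

lemma V_zero (h : ∀ u ∈ S, ∀ v ∈ S, u < v → w u < x → ¬ y < w v) : V w S x y = 0 := by
  refine le_antisymm (V_le fun m r hm => ?_) bot_le
  cases m with
  | zero => simp
  | succ m =>
    obtain ⟨u, hu1, v, hv1, h1, h2, h3, h4, h5⟩ := hm
    exact absurd h4 (h u hu1 v hv1 h2 h3)

lemma UC_concat {S1 S2 : Set α} {t : α} (h1 : ∀ u ∈ S1, u ≤ t) {m n : ℕ} {r : α}
    (hr : r ≤ t) (hm : UC w S1 x y m r) (hn : UC w S2 x y n t) :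
    UC w (S1 ∪ S2) x y (m + n) r := by
  induction m generalizing r with
  | zero => rw [zero_add]; exact UC_r hr (UC_mono subset_union_right le_rfl le_rfl hn)
  | succ m ih =>
    obtain ⟨u, hu1, v, hv1, g1, g2, g3, g4, g5⟩ := hm
    rw [Nat.succ_add]
    exact ⟨u, Or.inl hu1, v, Or.inl hv1, g1, g2, g3, g4, ih (h1 v hv1) g5⟩

lemma V_superadd {S1 S2 : Set α} {t : α} (h1 : ∀ u ∈ S1, u ≤ t) (h2 : ∀ u ∈ S2, t ≤ u) :
    V w S1 x y + V w S2 x y ≤ V w (S1 ∪ S2) x y := by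
  suffices key : ∀ m n : ℕ, (⨆ (_ : ∃ r, UC w S1 x y m r), (m : ℝ≥0∞)) +
      (⨆ (_ : ∃ r, UC w S2 x y n r), (n : ℝ≥0∞)) ≤ V w (S1 ∪ S2) x y by
    exact ENNReal.iSup_add_iSup_le key
  intro m n
  by_cases hm : ∃ r, UC w S1 x y m r
  swap
  · simp only [hm, iSup_false, bot_eq_zero, zero_add]
    refine iSup_le fun hn => ?_
    obtain ⟨r, hr⟩ := hn
    exact le_V (UC_mono subset_union_right le_rfl le_rfl hr)
  by_cases hn : ∃ r, UC w S2 x y n r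
  swap
  · simp only [hn, iSup_false, bot_eq_zero, add_zero]
    refine iSup_le fun hn => ?_
    obtain ⟨r, hr⟩ := hn
    exact le_V (UC_mono subset_union_left le_rfl le_rfl hr)
  obtain ⟨r, hr⟩ := hm
  obtain ⟨r', hr'⟩ := hn
  have := le_V (UC_concat h1 (min_le_right r t) (UC_r (min_le_left r t) hr) (UC_start h2 hr'))
  rw [iSup_pos ⟨r, hr⟩, iSup_pos ⟨r', hr'⟩]
  exact_mod_cast this

lemma UC_split {t : α} (ht : t ∈ S) {m : ℕ} {r : α} (hm : UC w S x y m r) :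
    ∃ m1 m2 : ℕ, m ≤ m1 + m2 + (if x ≤ w t ∧ w t ≤ y then 1 else 0) ∧
      UC w (S ∩ Iic t) x y m1 r ∧ UC w (S ∩ Ici t) x y m2 t := by
  induction m generalizing r with
  | zero => exact ⟨0, 0, by simp, trivial, trivial⟩
  | succ m ih =>
    obtain ⟨u, hu1, v, hv1, g1, g2, g3, g4, g5⟩ := hm
    by_cases hvt : v ≤ t
    · obtain ⟨m1, m2, h, h1, h2⟩ := ih g5
      exact ⟨m1 + 1, m2, by omega, ⟨u, ⟨hu1, g2.le.trans hvt⟩, v, ⟨hv1, hvt⟩, g1, g2, g3, g4, h1⟩, h2⟩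
    have hvt' : t < v := not_le.1 hvt
    have hrest := UC_restrict hvt'.le g5
    by_cases hut : t ≤ u
    · exact ⟨0, m + 1, by omega, trivial, u, ⟨hu1, hut⟩, v, ⟨hv1, hvt'.le⟩, hut, g2, g3, g4, hrest⟩
    have hut' : u < t := not_le.1 hut
    by_cases hx : w t < x
    · exact ⟨0, m + 1, by omega, trivial, t, ⟨ht, le_rfl⟩, v, ⟨hv1, hvt'.le⟩, le_rfl, hvt', hx, g4, hrest⟩
    by_cases hy : y < w t
    · exact ⟨1, m, by omega, ⟨u, ⟨hu1, hut'.le⟩, t, ⟨ht, le_rfl⟩, g1, hut', g3, hy, trivial⟩,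
        UC_r hvt'.le hrest⟩
    · refine ⟨0, m, ?_, trivial, UC_r hvt'.le hrest⟩
      rw [if_pos ⟨not_lt.1 hx, not_lt.1 hy⟩]; omega

lemma V_subadd {t : α} (ht : t ∈ S) :
    V w S x y ≤ V w (S ∩ Iic t) x y + V w (S ∩ Ici t) x y +
      (if x ≤ w t ∧ w t ≤ y then 1 else 0) := by
  refine V_le fun m r hm => ?_
  obtain ⟨m1, m2, h, h1, h2⟩ := UC_split ht hm
  calc (m : ℝ≥0∞) ≤ ((m1 + m2 + (if x ≤ w t ∧ w t ≤ y then 1 else 0) : ℕ) : ℝ≥0∞) := by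
        exact_mod_cast h
    _ = m1 + m2 + (if x ≤ w t ∧ w t ≤ y then 1 else 0) := by push_cast; rfl
    _ ≤ _ := by gcongr; exacts [le_V h1, le_V h2]

lemma UC_comp {β : Type*} [LinearOrder β] {τ : β → α} (hτ : StrictMono τ) {S : Set β} {m : ℕ}
    {r : β} : UC (fun i => w (τ i)) S x y m r ↔ UC w (τ '' S) x y m (τ r) := by
  induction m generalizing r with
  | zero => exact Iff.rfl
  | succ m ih =>
    constructor
    · rintro ⟨u, hu1, v, hv1, g1, g2, g3, g4, g5⟩
      exact ⟨τ u, ⟨u, hu1, rfl⟩, τ v, ⟨v, hv1, rfl⟩, hτ.monotone g1, hτ g2, g3, g4, ih.1 g5⟩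
    · rintro ⟨_, ⟨u, hu1, rfl⟩, _, ⟨v, hv1, rfl⟩, g1, g2, g3, g4, g5⟩
      exact ⟨u, hu1, v, hv1, hτ.le_iff_le.1 g1, hτ.lt_iff_lt.1 g2, g3, g4, ih.2 g5⟩

lemma V_comp {β : Type*} [LinearOrder β] [Nonempty β] {τ : β → α} (hτ : StrictMono τ) (S : Set β) :
    V (fun i => w (τ i)) S x y = V w (τ '' S) x y := by
  refine le_antisymm (V_le fun m r h => le_V ((UC_comp hτ).1 h)) (V_le fun m r h => ?_)
  cases m with
  | zero => simp
  | succ m =>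
    obtain ⟨_, ⟨u, hu1, rfl⟩, _, ⟨v, hv1, rfl⟩, g1, g2, g3, g4, g5⟩ := h
    have : UC (fun i => w (τ i)) S x y (m + 1) u :=
      (UC_comp hτ).2 ⟨τ u, ⟨u, hu1, rfl⟩, τ v, ⟨v, hv1, rfl⟩, le_rfl, g2, g3, g4, g5⟩
    exact le_V this

lemma UC_congr {w' : α → ℝ} (h : ∀ u ∈ S, w u = w' u) {m : ℕ} {r : α}
    (hm : UC w S x y m r) : UC w' S x y m r := by
  induction m generalizing r with
  | zero => trivial
  | succ m ih =>
    obtain ⟨u, hu1, v, hv1, g1, g2, g3, g4, g5⟩ := hm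
    exact ⟨u, hu1, v, hv1, g1, g2, h u hu1 ▸ g3, h v hv1 ▸ g4, ih g5⟩

lemma V_congr {w' : α → ℝ} (h : ∀ u ∈ S, w u = w' u) : V w S x y = V w' S x y :=
  le_antisymm (V_le fun _ _ hm => le_V (UC_congr h hm))
    (V_le fun _ _ hm => le_V (UC_congr (fun u hu => (h u hu).symm) hm))

lemma UC_shift {c : ℝ} {m : ℕ} {r : α} :
    UC (fun i => w i + c) S x y m r ↔ UC w S (x - c) (y - c) m r := by
  induction m generalizing r with
  | zero => exact Iff.rfl
  | succ m ih => simp only [UC, ih, lt_sub_iff_add_lt, sub_lt_iff_lt_add]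

lemma V_shift (c : ℝ) : V (fun i => w i + c) S x y = V w S (x - c) (y - c) := by
  simp only [V, UC_shift]

lemma UC_scale {c : ℝ} (hc : 0 < c) {m : ℕ} {r : α} :
    UC (fun i => c * w i) S (c * x) (c * y) m r ↔ UC w S x y m r := by
  induction m generalizing r with
  | zero => exact Iff.rfl
  | succ m ih => simp only [UC, ih, mul_lt_mul_iff_right₀ hc]

lemma V_scale {c : ℝ} (hc : 0 < c) : V (fun i => c * w i) S (c * x) (c * y) = V w S x y := by
  simp only [V, UC_scale hc]

end comb

lemma measurableSet_UC {Ω : Type*} [MeasurableSpace Ω] {α : Type*} [LinearOrder α] [Countable α]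
    {w : Ω → α → ℝ} (hw : ∀ i, Measurable fun p => w p i) {x y : Ω → ℝ} (hx : Measurable x)
    (hy : Measurable y) (S : Set α) (m : ℕ) (r : α) :
    MeasurableSet {p | UC (w p) S (x p) (y p) m r} := by
  induction m generalizing r with
  | zero => simp [UC]
  | succ m ih =>
    have : {p | UC (w p) S (x p) (y p) (m + 1) r} = ⋃ u : α, ⋃ v : α,
        {p | u ∈ S ∧ v ∈ S ∧ r ≤ u ∧ u < v} ∩ ({p | w p u < x p} ∩ ({p | y p < w p v} ∩
          {p | UC (w p) S (x p) (y p) m v})) := by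
      ext p
      simp only [UC, mem_ofPred_eq, mem_iUnion, mem_inter_iff]
      constructor
      · rintro ⟨u, hu1, v, hv1, g1, g2, g3, g4, g5⟩
        exact ⟨u, v, ⟨hu1, hv1, g1, g2⟩, g3, g4, g5⟩
      · rintro ⟨u, v, ⟨hu1, hv1, g1, g2⟩, g3, g4, g5⟩
        exact ⟨u, hu1, v, hv1, g1, g2, g3, g4, g5⟩
    rw [this]
    refine MeasurableSet.iUnion fun u => MeasurableSet.iUnion fun v => ?_
    exact (MeasurableSet.const _).inter ((measurableSet_lt (hw u) hx).inter
      ((measurableSet_lt hy (hw v)).inter (ih v)))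

lemma measurable_V {Ω : Type*} [MeasurableSpace Ω] {α : Type*} [LinearOrder α] [Countable α]
    {w : Ω → α → ℝ} (hw : ∀ i, Measurable fun p => w p i) {x y : Ω → ℝ} (hx : Measurable x)
    (hy : Measurable y) (S : Set α) : Measurable fun p => V (w p) S (x p) (y p) := by
  unfold V
  refine Measurable.iSup fun m => ?_
  have hm : MeasurableSet {p | ∃ r, UC (w p) S (x p) (y p) m r} := by
    rw [ofPred_exists]
    exact MeasurableSet.iUnion fun r => measurableSet_UC hw hx hy S m r
  have : (fun p => ⨆ (_ : ∃ r, UC (w p) S (x p) (y p) m r), (m : ℝ≥0∞)) =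
      fun p => indicator {p | ∃ r, UC (w p) S (x p) (y p) m r} (fun _ => (m : ℝ≥0∞)) p := by
    funext p
    by_cases h : ∃ r, UC (w p) S (x p) (y p) m r
    · simp [indicator, h]
    · simp [indicator, h]
  rw [this]
  exact measurable_const.indicator hm

/-- dyadic grid in `[s,t]` -/
def grd (s t : ℝ) (k : ℕ) : Set ℝ := {x | ∃ i : ℕ, i ≤ 2 ^ k ∧ x = s + (t - s) * (i / 2 ^ k)}

lemma grd_mono (s t : ℝ) : Monotone (grd s t) := by
  refine monotone_nat_of_le_succ fun k => ?_
  rintro x ⟨i, hi, rfl⟩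
  refine ⟨2 * i, by rw [pow_succ]; omega, ?_⟩
  push_cast
  rw [pow_succ]
  field_simp

lemma grd_subset {s t : ℝ} (hst : s ≤ t) (k : ℕ) : grd s t k ⊆ Icc s t := by
  rintro x ⟨i, hi, rfl⟩
  have h1 : (i : ℝ) / 2 ^ k ≤ 1 := by
    rw [div_le_one (by positivity)]; exact_mod_cast hi
  have h0 : (0 : ℝ) ≤ (i : ℝ) / 2 ^ k := by positivity
  constructor <;> nlinarith

/-- rounding up to the dyadic grid -/
def rnd (s t : ℝ) (k : ℕ) (u : ℝ) : ℝ := s + (t - s) * ((⌈(u - s) / (t - s) * 2 ^ k⌉₊ : ℝ) / 2 ^ k)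

lemma rnd_mem {s t : ℝ} (hst : s < t) (k : ℕ) {u : ℝ} (hu : u ∈ Icc s t) :
    rnd s t k u ∈ grd s t k := by
  refine ⟨_, ?_, rfl⟩
  rw [Nat.ceil_le]
  push_cast
  have : (u - s) / (t - s) ≤ 1 := by
    rw [div_le_one (by linarith)]; linarith [hu.2]
  nlinarith [pow_pos (two_pos (α := ℝ)) k]

lemma rnd_mono {s t : ℝ} (hst : s < t) (k : ℕ) {u v : ℝ} (h : u ≤ v) : rnd s t k u ≤ rnd s t k v := by
  have := sub_pos.2 hst
  unfold rnd
  gcongr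

lemma rnd_tendsto {s t : ℝ} (hst : s < t) {u : ℝ} (hu : u ∈ Icc s t) :
    Tendsto (fun k => rnd s t k u) atTop (𝓝 u) := by
  have hd := sub_pos.2 hst
  have h0 : 0 ≤ (u - s) / (t - s) := div_nonneg (by linarith [hu.1]) hd.le
  have key : Tendsto (fun k : ℕ => (⌈(u - s) / (t - s) * 2 ^ k⌉₊ : ℝ) / 2 ^ k) atTop
      (𝓝 ((u - s) / (t - s))) := by
    have := (tendsto_nat_ceil_mul_div_atTop (R := ℝ) h0).comp
      (tendsto_pow_atTop_atTop_of_one_lt (one_lt_two (α := ℝ)))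
    exact this
  have h2 : Tendsto (fun k => rnd s t k u) atTop (𝓝 (s + (t - s) * ((u - s) / (t - s)))) :=
    tendsto_const_nhds.add (tendsto_const_nhds.mul key)
  rwa [mul_div_cancel₀ _ hd.ne', add_sub_cancel] at h2

lemma UC_grid {s t x y : ℝ} (hst : s < t) (hxy : x ≤ y) {w : ℝ → ℝ} (hw : Continuous w) {m : ℕ} {r : ℝ}
    (hm : UC w (Icc s t) x y m r) : ∀ᶠ k in atTop, UC w (grd s t k) x y m (rnd s t k r) := by
  induction m generalizing r with
  | zero => exact Eventually.of_forall fun _ => trivial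
  | succ m ih =>
    obtain ⟨u, hu1, v, hv1, g1, g2, g3, g4, g5⟩ := hm
    have e1 := ((hw.tendsto u).comp (rnd_tendsto hst hu1)).eventually (gt_mem_nhds g3)
    have e2 := ((hw.tendsto v).comp (rnd_tendsto hst hv1)).eventually (lt_mem_nhds g4)
    filter_upwards [ih g5, e1, e2] with k h5 h3 h4
    refine ⟨_, rnd_mem hst k hu1, _, rnd_mem hst k hv1, rnd_mono hst k g1, ?_, h3, h4, h5⟩
    refine lt_of_le_of_ne (rnd_mono hst k g2.le) fun h => ?_
    simp only [Function.comp, h] at h3 h4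
    linarith

lemma V_grid {s t x y : ℝ} (hst : s < t) (hxy : x ≤ y) {w : ℝ → ℝ} (hw : Continuous w) :
    V w (Icc s t) x y = ⨆ k, V w (grd s t k) x y := by
  refine le_antisymm (V_le fun m r hm => ?_)
    (iSup_le fun k => V_mono (grd_subset hst.le k) le_rfl le_rfl)
  obtain ⟨k, hk⟩ := (UC_grid hst hxy hw hm).exists
  exact le_iSup_of_le k (le_V hk)

lemma V_grd_mono (w : ℝ → ℝ) (s t x y : ℝ) : Monotone fun k => V w (grd s t k) x y :=
  fun _ _ h => V_mono (grd_mono s t h) le_rfl le_rfl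

lemma V_Icc_subadd {w : ℝ → ℝ} {s t u x y : ℝ} (h1 : s ≤ t) (h2 : t ≤ u) :
    V w (Icc s u) x y ≤ V w (Icc s t) x y + V w (Icc t u) x y + (if x ≤ w t ∧ w t ≤ y then 1 else 0) := by
  have := V_subadd (w := w) (S := Icc s u) (x := x) (y := y) (t := t) ⟨h1, h2⟩
  have e1 : Icc s u ∩ Iic t = Icc s t := by
    ext z; simp only [mem_inter_iff, mem_Icc, mem_Iic]; constructor
    · rintro ⟨⟨a, b⟩, c⟩; exact ⟨a, c⟩
    · rintro ⟨a, b⟩; exact ⟨⟨a, b.trans h2⟩, b⟩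
  have e2 : Icc s u ∩ Ici t = Icc t u := by
    ext z; simp only [mem_inter_iff, mem_Icc, mem_Ici]; constructor
    · rintro ⟨⟨a, b⟩, c⟩; exact ⟨c, b⟩
    · rintro ⟨a, b⟩; exact ⟨⟨h1.trans a, b⟩, a⟩
  rwa [e1, e2] at this

lemma V_Icc_superadd {w : ℝ → ℝ} {s t u x y : ℝ} (h1 : s ≤ t) (h2 : t ≤ u) :
    V w (Icc s t) x y + V w (Icc t u) x y ≤ V w (Icc s u) x y := by
  have := V_superadd (w := w) (S1 := Icc s t) (S2 := Icc t u) (x := x) (y := y) (t := t)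
    (fun _ h => h.2) (fun _ h => h.1)
  rwa [Icc_union_Icc_eq_Icc h1 h2] at this

lemma V_Icc_self {w : ℝ → ℝ} {s x y : ℝ} : V w (Icc s s) x y = 0 := by
  refine V_zero fun u hu v hv huv => ?_
  have h1 : u = s := le_antisymm hu.2 hu.1
  have h2 : v = s := le_antisymm hv.2 hv.1
  exact absurd huv (by rw [h1, h2]; exact lt_irrefl _)

/-- block decomposition, lower bound -/
lemma V_blocks_le {w : ℝ → ℝ} {s h x y : ℝ} (hh : 0 ≤ h) (n : ℕ) :
    ∑ j ∈ Finset.range n, V w (Icc (s + j * h) (s + (j + 1) * h)) x y ≤ V w (Icc s (s + n * h)) x y := by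
  induction n with
  | zero => simp
  | succ n ih =>
    rw [Finset.sum_range_succ]
    have hn : (0 : ℝ) ≤ n := n.cast_nonneg
    have := V_Icc_superadd (w := w) (s := s) (t := s + n * h) (u := s + (n + 1) * h) (x := x) (y := y)
      (by nlinarith) (by nlinarith)
    push_cast
    exact (add_le_add_left ih _).trans this

lemma V_blocks_ge {w : ℝ → ℝ} {s h x y : ℝ} (hh : 0 ≤ h) (n : ℕ) :
    V w (Icc s (s + n * h)) x y ≤ ∑ j ∈ Finset.range n, V w (Icc (s + j * h) (s + (j + 1) * h)) x y
      + ∑ j ∈ Finset.range n, (if 0 < j ∧ x ≤ w (s + j * h) ∧ w (s + j * h) ≤ y then 1 else 0) := by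
  induction n with
  | zero =>
    have := V_Icc_self (w := w) (s := s) (x := x) (y := y)
    simp only [Nat.cast_zero, zero_mul, add_zero, this]
    exact bot_le
  | succ n ih =>
    rw [Finset.sum_range_succ, Finset.sum_range_succ]
    have hn : (0 : ℝ) ≤ n := n.cast_nonneg
    by_cases h0 : n = 0
    · subst h0; simp
    have h0' : 0 < n := Nat.pos_of_ne_zero h0
    have := V_Icc_subadd (w := w) (s := s) (t := s + n * h) (u := s + (n + 1) * h) (x := x) (y := y)
      (by nlinarith) (by nlinarith)
    push_cast
    simp only [h0', true_and]
    refine this.trans ?_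
    calc _ ≤ (∑ j ∈ Finset.range n, V w (Icc (s + j * h) (s + (j + 1) * h)) x y
      + ∑ j ∈ Finset.range n, (if 0 < j ∧ x ≤ w (s + j * h) ∧ w (s + j * h) ≤ y then 1 else 0))
      + V w (Icc (s + n * h) (s + (n + 1) * h)) x y + 
        (if x ≤ w (s + n * h) ∧ w (s + n * h) ≤ y then 1 else 0) := by gcongr
      _ = _ := by ring

/-- total upcrossing mass -/
def Wt (w : ℝ → ℝ) (s t ε : ℝ) : ℝ≥0∞ := ∫⁻ b, V w (Icc s t) b (b + ε)

lemma measurable_V_Icc {w : ℝ → ℝ} (hw : Continuous w) (s t : ℝ) {ε : ℝ} (hε : 0 ≤ ε) :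
    Measurable fun b => V w (Icc s t) b (b + ε) := by
  rcases lt_trichotomy s t with h | h | h
  · have : (fun b => V w (Icc s t) b (b + ε)) = fun b => ⨆ k, V w (grd s t k) b (b + ε) := by
      funext b; exact V_grid h (by linarith) hw
    rw [this]
    refine Measurable.iSup fun k => ?_
    have e : (fun b => V w (grd s t k) b (b + ε)) = fun b =>
        V (fun i : ℕ => w (s + (t - s) * (i / 2 ^ k))) {i | i ≤ 2 ^ k} b (b + ε) := by
      funext b
      rw [V_comp (w := w) (τ := fun i : ℕ => s + (t - s) * (i / 2 ^ k))]
      · congr 1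
        ext z; simp only [grd, mem_ofPred_eq, mem_image]
        exact ⟨fun ⟨i, a, b⟩ => ⟨i, a, b.symm⟩, fun ⟨i, a, b⟩ => ⟨i, a, b.symm⟩⟩
      · intro i j hij
        have := sub_pos.2 h
        have : (i : ℝ) < j := by exact_mod_cast hij
        dsimp only; gcongr
    rw [e]
    exact measurable_V (w := fun _ => fun i : ℕ => w (s + (t - s) * (i / 2 ^ k)))
      (fun i => measurable_const) measurable_id (measurable_id.add_const ε) _
  · subst h; simp only [V_Icc_self]; exact measurable_const
  · have : ∀ b, V w (Icc s t) b (b + ε) = 0 := fun b => V_zero fun u hu => by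
      rw [Icc_eq_empty (not_le.2 h)] at hu; exact absurd hu (notMem_empty _)
    simp only [this]; exact measurable_const

lemma lint_ind (z ε : ℝ) : ∫⁻ b : ℝ, (if b ≤ z ∧ z ≤ b + ε then (1 : ℝ≥0∞) else 0) = ENNReal.ofReal ε := by
  have : (fun b : ℝ => (if b ≤ z ∧ z ≤ b + ε then (1 : ℝ≥0∞) else 0)) =
      indicator (Icc (z - ε) z) (fun _ => 1) := by
    funext b; simp only [indicator, mem_Icc]
    congr 1
    exact propext ⟨fun h => ⟨by linarith [h.2], h.1⟩, fun h => ⟨h.2, by linarith [h.1]⟩⟩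
  rw [this, lintegral_indicator measurableSet_Icc]
  simp

lemma Wt_superadd {w : ℝ → ℝ} (hw : Continuous w) {s t u ε : ℝ} (hε : 0 ≤ ε) (h1 : s ≤ t) (h2 : t ≤ u) :
    Wt w s t ε + Wt w t u ε ≤ Wt w s u ε := by
  unfold Wt
  rw [← lintegral_add_left (measurable_V_Icc hw s t hε)]
  exact lintegral_mono fun b => V_Icc_superadd h1 h2

lemma Wt_subadd {w : ℝ → ℝ} (hw : Continuous w) {s t u ε : ℝ} (hε : 0 ≤ ε) (h1 : s ≤ t) (h2 : t ≤ u) :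
    Wt w s u ε ≤ Wt w s t ε + Wt w t u ε + ENNReal.ofReal ε := by
  unfold Wt
  rw [← lint_ind (w t) ε, ← lintegral_add_left (measurable_V_Icc hw s t hε),
    ← lintegral_add_left]
  · exact lintegral_mono fun b => V_Icc_subadd h1 h2
  · exact (measurable_V_Icc hw s t hε).add (measurable_V_Icc hw t u hε)

lemma Wt_self (w : ℝ → ℝ) (s ε : ℝ) : Wt w s s ε = 0 := by
  unfold Wt; simp only [V_Icc_self, lintegral_zero]

lemma Wt_blocks_le {w : ℝ → ℝ} (hw : Continuous w) {s h ε : ℝ} (hε : 0 ≤ ε) (hh : 0 ≤ h) (n : ℕ) :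
    ∑ j ∈ Finset.range n, Wt w (s + j * h) (s + (j + 1) * h) ε ≤ Wt w s (s + n * h) ε := by
  unfold Wt
  rw [← lintegral_finsetSum _ fun j _ => measurable_V_Icc hw _ _ hε]
  exact lintegral_mono fun b => V_blocks_le hh n

lemma Wt_blocks_ge {w : ℝ → ℝ} (hw : Continuous w) {s h ε : ℝ} (hε : 0 ≤ ε) (hh : 0 ≤ h) (n : ℕ) :
    Wt w s (s + n * h) ε ≤ ∑ j ∈ Finset.range n, Wt w (s + j * h) (s + (j + 1) * h) ε
      + n * ENNReal.ofReal ε := by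
  induction n with
  | zero => simp [Wt_self]
  | succ n ih =>
    have hn : (0 : ℝ) ≤ n := n.cast_nonneg
    have := Wt_subadd hw hε (s := s) (t := s + n * h) (u := s + (n + 1) * h) (by nlinarith) (by nlinarith)
    rw [Finset.sum_range_succ]
    push_cast
    refine this.trans ?_
    calc _ ≤ (∑ j ∈ Finset.range n, Wt w (s + j * h) (s + (j + 1) * h) ε + n * ENNReal.ofReal ε)
        + Wt w (s + n * h) (s + (n + 1) * h) ε + ENNReal.ofReal ε := by gcongr
      _ = _ := by ring

/-- no upcrossings when the oscillation is `≤ ε` -/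
lemma V_osc {w : ℝ → ℝ} {s t x y : ℝ} (h : ∀ u ∈ Icc s t, ∀ v ∈ Icc s t, w v - w u ≤ y - x) :
    V w (Icc s t) x y = 0 :=
  V_zero fun u hu v hv _ h3 h4 => by linarith [h u hu v hv]

lemma V_osc_blocks {w : ℝ → ℝ} {s h x y : ℝ} (hh : 0 ≤ h) (n : ℕ)
    (hosc : ∀ u ∈ Icc s (s + n * h), ∀ v ∈ Icc s (s + n * h), |u - v| ≤ h → w v - w u ≤ y - x) :
    V w (Icc s (s + n * h)) x y ≤ n := by
  refine (V_blocks_ge hh n).trans ?_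
  have : ∀ j ∈ Finset.range n, V w (Icc (s + j * h) (s + (j + 1) * h)) x y = 0 := by
    intro j hj
    have hj1 : (j : ℝ) + 1 ≤ n := by exact_mod_cast Finset.mem_range.1 hj
    have hj0 : (0 : ℝ) ≤ j := j.cast_nonneg
    refine V_osc fun u hu v hv => hosc u ⟨?_, ?_⟩ v ⟨?_, ?_⟩ ?_
    · nlinarith [hu.1]
    · nlinarith [hu.2]
    · nlinarith [hv.1]
    · nlinarith [hv.2]
    · rw [abs_le]; constructor <;> nlinarith [hu.1, hu.2, hv.1, hv.2]
  rw [Finset.sum_eq_zero this, zero_add]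
  calc _ ≤ ∑ j ∈ Finset.range n, (1 : ℝ≥0∞) := by
        gcongr; split_ifs <;> simp
    _ = n := by simp

lemma Wt_osc_blocks {w : ℝ → ℝ} (hw : Continuous w) {s h ε : ℝ} (hε : 0 ≤ ε) (hh : 0 ≤ h) (n : ℕ)
    (hosc : ∀ u ∈ Icc s (s + n * h), ∀ v ∈ Icc s (s + n * h), |u - v| ≤ h → w v - w u ≤ ε) :
    Wt w s (s + n * h) ε ≤ n * ENNReal.ofReal ε := by
  refine (Wt_blocks_ge hw hε hh n).trans ?_
  have : ∀ j ∈ Finset.range n, Wt w (s + j * h) (s + (j + 1) * h) ε = 0 := by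
    intro j hj
    have hj1 : (j : ℝ) + 1 ≤ n := by exact_mod_cast Finset.mem_range.1 hj
    have hj0 : (0 : ℝ) ≤ j := j.cast_nonneg
    unfold Wt
    rw [lintegral_eq_zero_iff' (measurable_V_Icc hw _ _ hε).aemeasurable]
    refine Eventually.of_forall fun b => V_osc fun u hu v hv => ?_
    rw [add_sub_cancel_left]
    refine hosc u ⟨?_, ?_⟩ v ⟨?_, ?_⟩ ?_
    · nlinarith [hu.1]
    · nlinarith [hu.2]
    · nlinarith [hv.1]
    · nlinarith [hv.2]
    · rw [abs_le]; constructor <;> nlinarith [hu.1, hu.2, hv.1, hv.2]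
  rw [Finset.sum_eq_zero this, zero_add]

/-- finiteness of the number of upcrossings -/
lemma V_lt_top {w : ℝ → ℝ} (hw : Continuous w) {s t x y : ℝ} (hxy : x < y) :
    V w (Icc s t) x y < ⊤ := by
  by_cases hst : s ≤ t
  swap
  · rw [Icc_eq_empty hst, V_zero (by simp)]; exact ENNReal.zero_lt_top
  have huc := (isCompact_Icc (a := s) (b := t)).uniformContinuousOn_of_continuous hw.continuousOn
  rw [Metric.uniformContinuousOn_iff] at huc
  obtain ⟨δ, hδ, H⟩ := huc (y - x) (sub_pos.2 hxy)
  obtain ⟨n, hn⟩ := exists_nat_gt ((t - s) / δ)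
  have hn0 : 0 < (n : ℝ) := lt_of_le_of_lt (div_nonneg (sub_nonneg.2 hst) hδ.le) hn
  have e : s + n * ((t - s) / n) = t := by field_simp; ring
  have := V_osc_blocks (w := w) (s := s) (h := (t - s) / n) (x := x) (y := y)
    (div_nonneg (sub_nonneg.2 hst) hn0.le) n (by
      rw [e]
      intro u hu v hv huv
      have : dist u v < δ := by
        rw [Real.dist_eq]
        refine huv.trans_lt ?_
        rw [div_lt_iff₀ hn0]; rw [div_lt_iff₀ hδ] at hn; linarith
      have := H v hv u hu (by rwa [dist_comm])
      rw [Real.dist_eq] at this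
      exact (le_abs_self _).trans this.le)
  rw [e] at this
  exact this.trans_lt (ENNReal.natCast_lt_top n)
end

section
lemma upSet_UC {w : ℝ → ℝ} {s t a ε x y : ℝ} (hx : a < x) (hy : y < a + ε) (m : ℕ) (r : ℝ)
    (F : Finset (ℝ × ℝ)) (hF : ∀ p ∈ F, p ∈ upSet ε (fun r => w r - a) s t) (hr : ∀ p ∈ F, r ≤ p.1)
    (hm : F.card = m) : UC w (Icc s t) x y m r := by
  induction m generalizing r F with
  | zero => trivial
  | succ m ih =>
    have hne : F.Nonempty := Finset.card_pos.1 (by omega)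
    obtain ⟨p, hp, hmin⟩ := F.exists_min_image (fun p => p.1) hne
    obtain ⟨h1, h2, h3, h4, h5, h6⟩ := hF p hp
    refine ⟨p.1, h1, p.2, h2, hr p hp, h3, by linarith, by linarith,
      ih p.2 (F.erase p) (fun q hq => hF q (Finset.mem_of_mem_erase hq)) ?_ ?_⟩
    · intro q hq
      have hqF := Finset.mem_of_mem_erase hq
      have hqp := Finset.ne_of_mem_erase hq
      obtain ⟨g1, g2, g3, g4, g5, g6⟩ := hF q hqF
      by_contra hlt
      rw [not_le] at hlt
      rcases (hmin q hqF).lt_or_eq with h | h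
      · have := (h6 q.1 ⟨h, hlt⟩).1
        rw [g4] at this; exact lt_irrefl _ this
      · rcases lt_trichotomy p.2 q.2 with h' | h' | h'
        · have := (g6 p.2 ⟨h ▸ h3, h'⟩).2
          rw [h5] at this; exact lt_irrefl _ this
        · exact hqp (Prod.ext h.symm h'.symm)
        · have := (h6 q.2 ⟨by rw [h]; exact g3, h'⟩).2
          rw [g5] at this; exact lt_irrefl _ this
    · rw [Finset.card_erase_of_mem hp]; omega

lemma up_le_V {w : ℝ → ℝ} {s t a ε x y : ℝ} (hx : a < x) (hy : y < a + ε) :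
    (upE ε (fun r => w r - a) s t : ℝ≥0∞) ≤ V w (Icc s t) x y := by
  have key : ∀ m : ℕ, (m : ℕ∞) ≤ upE ε (fun r => w r - a) s t → (m : ℝ≥0∞) ≤ V w (Icc s t) x y := by
    intro m hm
    obtain ⟨F, hF, hc⟩ := Set.exists_subset_encard_eq hm
    have hfin : F.Finite := Set.finite_of_encard_eq_coe hc
    have := upSet_UC (w := w) (s := s) (t := t) hx hy m s hfin.toFinset
      (fun p hp => hF (hfin.mem_toFinset.1 hp)) (fun p hp => (hF (hfin.mem_toFinset.1 hp)).1.1)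
      (by
        have := hfin.encard_eq_coe_toFinset_card
        rw [hc] at this; exact_mod_cast this.symm)
    exact le_V this
  generalize upE ε (fun r => w r - a) s t = N at key
  induction N using ENat.recTopCoe with
  | top =>
    have : ∀ m : ℕ, (m : ℝ≥0∞) ≤ V w (Icc s t) x y := fun m => key m le_top
    rw [ENat.toENNReal_top, top_le_iff]
    exact ENNReal.eq_top_of_forall_nnreal_le fun r => by
      obtain ⟨n, hn⟩ := exists_nat_ge r
      exact le_trans (by exact_mod_cast hn) (this n)
  | coe n => simpa using key n le_rfl

lemma exists_up {w : ℝ → ℝ} (hw : Continuous w) {u v a b : ℝ} (huv : u < v) (hab : a < b)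
    (hu : w u < a) (hv : b < w v) :
    ∃ σ τ, u ≤ σ ∧ σ < τ ∧ τ ≤ v ∧ w σ = a ∧ w τ = b ∧ (∀ z ∈ Ioo σ τ, w z ∈ Ioo a b) ∧
      (∀ z ∈ Ico u τ, w z < b) := by
  have hne : ({z | z ∈ Icc u v ∧ w z = b}).Nonempty := by
    obtain ⟨z, hz, hz'⟩ := intermediate_value_Icc huv.le hw.continuousOn (show b ∈ Icc (w u) (w v) from
      ⟨by linarith, hv.le⟩)
    exact ⟨z, hz, hz'⟩
  have hcl : IsCompact {z | z ∈ Icc u v ∧ w z = b} :=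
    isCompact_Icc.inter_right (isClosed_eq hw continuous_const)
  obtain ⟨τ, ⟨hτ, hτb⟩, hτmin⟩ := hcl.exists_isLeast hne
  have huτ : u < τ := lt_of_le_of_ne hτ.1 fun h => by rw [← h] at hτb; linarith
  have hbelow : ∀ z ∈ Ico u τ, w z < b := by
    intro z hz
    by_contra hcon
    rw [not_lt] at hcon
    obtain ⟨z', hz', hz''⟩ := intermediate_value_Icc hz.1 hw.continuousOn (show b ∈ Icc (w u) (w z) from
      ⟨by linarith, hcon⟩)
    have := hτmin ⟨⟨hz'.1, hz'.2.trans (hz.2.le.trans hτ.2)⟩, hz''⟩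
    linarith [hz'.2, hz.2]
  have hne2 : ({z | z ∈ Icc u τ ∧ w z = a}).Nonempty := by
    obtain ⟨z, hz, hz'⟩ := intermediate_value_Icc huτ.le hw.continuousOn (show a ∈ Icc (w u) (w τ) from
      ⟨hu.le, by linarith⟩)
    exact ⟨z, hz, hz'⟩
  have hcl2 : IsCompact {z | z ∈ Icc u τ ∧ w z = a} :=
    isCompact_Icc.inter_right (isClosed_eq hw continuous_const)
  obtain ⟨σ, ⟨hσ, hσa⟩, hσmax⟩ := hcl2.exists_isGreatest hne2
  have hστ : σ < τ := lt_of_le_of_ne hσ.2 fun h => by rw [h, hτb] at hσa; linarith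
  refine ⟨σ, τ, hσ.1, hστ, hτ.2, hσa, hτb, ?_, hbelow⟩
  intro z hz
  refine ⟨?_, hbelow z ⟨hσ.1.trans hz.1.le, hz.2⟩⟩
  by_contra hcon
  rw [not_lt] at hcon
  obtain ⟨z', hz', hz''⟩ := intermediate_value_Icc hz.2.le hw.continuousOn (show a ∈ Icc (w z) (w τ) from
    ⟨hcon, by linarith⟩)
  have := hσmax ⟨⟨hσ.1.trans (hz.1.le.trans hz'.1), hz'.2⟩, hz''⟩
  linarith [hz'.1, hz.1]

lemma UC_le_up {w : ℝ → ℝ} (hw : Continuous w) {s t a ε x y : ℝ} (hε : 0 < ε) (hx : x ≤ a) (hy : a + ε ≤ y)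
    (m : ℕ) (r : ℝ) (h : UC w (Icc s t) x y m r) :
    (m : ℕ∞) ≤ {p ∈ upSet ε (fun r => w r - a) s t | r ≤ p.1}.encard := by
  induction m generalizing r with
  | zero => simp
  | succ m ih =>
    obtain ⟨u, hu1, v, hv1, g1, g2, g3, g4, g5⟩ := h
    obtain ⟨σ, τ, k1, k2, k3, k4, k5, k6, -⟩ := exists_up hw g2 (show a < a + ε by linarith)
      (g3.trans_le hx) (hy.trans_lt g4)
    have hmem : (σ, τ) ∈ upSet ε (fun r => w r - a) s t := by
      refine ⟨⟨hu1.1.trans k1, (k2.le.trans k3).trans hv1.2⟩,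
        ⟨(hu1.1.trans k1).trans k2.le, k3.trans hv1.2⟩, k2, by simp [k4], by simp [k5], ?_⟩
      intro z hz
      have := k6 z hz
      exact ⟨by linarith [this.1], by linarith [this.2]⟩
    have hsub : insert (σ, τ) {p ∈ upSet ε (fun r => w r - a) s t | v ≤ p.1} ⊆
        {p ∈ upSet ε (fun r => w r - a) s t | r ≤ p.1} := by
      intro p hp
      rcases hp with rfl | hp
      · exact ⟨hmem, g1.trans k1⟩
      · exact ⟨hp.1, (g1.trans g2.le).trans hp.2⟩
    refine le_trans ?_ (Set.encard_le_encard hsub)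
    rw [Set.encard_insert_of_notMem]
    · push_cast; gcongr; exact ih v g5
    · rintro ⟨-, h⟩
      have : v ≤ σ := h
      linarith

lemma V_le_up {w : ℝ → ℝ} (hw : Continuous w) {s t a ε x y : ℝ} (hε : 0 < ε) (hx : x ≤ a)
    (hy : a + ε ≤ y) : V w (Icc s t) x y ≤ (upE ε (fun r => w r - a) s t : ℝ≥0∞) := by
  refine V_le fun m r h => ?_
  have := (UC_le_up hw hε hx hy m r h).trans (Set.encard_le_encard (sep_subset _ _))
  exact_mod_cast (ENat.toENNReal_le.2 this)

lemma up_lt_top {w : ℝ → ℝ} (hw : Continuous w) {s t a ε : ℝ} (hε : 0 < ε) :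
    (upE ε (fun r => w r - a) s t : ℝ≥0∞) < ⊤ :=
  (up_le_V (x := a + ε / 3) (y := a + 2 * ε / 3) (by linarith) (by linarith)).trans_lt
    (V_lt_top hw (by linarith))

lemma upR_mono {w : ℝ → ℝ} (hw : Continuous w) {s t t' a ε : ℝ} (hε : 0 < ε) (ht : t ≤ t') :
    upR ε (fun r => w r - a) s t ≤ upR ε (fun r => w r - a) s t' := by
  unfold upR
  refine ENNReal.toReal_mono (up_lt_top hw hε).ne (ENat.toENNReal_le.2 (Set.encard_le_encard ?_))
  rintro p ⟨h1, h2, h3⟩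
  exact ⟨⟨h1.1, h1.2.trans ht⟩, ⟨h2.1, h2.2.trans ht⟩, h3⟩
end

section
lemma mem_lvGrid_one {x : ℝ} : x ∈ lvGrid 1 ↔ ∃ k : ℤ, x = k := by simp [lvGrid]

lemma hitT_neg (z : ℝ → ℝ) (n : ℕ) : hitT 1 (fun r => -z r) n = hitT 1 z n := by
  induction n with
  | zero => rfl
  | succ n ih =>
    simp only [hitT, ih]
    have : ∀ x : ℝ, -x ∈ lvGrid 1 ↔ x ∈ lvGrid 1 := by
      intro x; rw [mem_lvGrid_one, mem_lvGrid_one]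
      constructor
      · rintro ⟨k, hk⟩; exact ⟨-k, by push_cast; linarith⟩
      · rintro ⟨k, hk⟩; exact ⟨-k, by push_cast; linarith⟩
    simp only [this, ne_eq, neg_inj]

/-- the set of candidate next hitting times -/
def hS (z : ℝ → ℝ) (n : ℕ) : Set ℝ :=
  {r | (hitT 1 z n).toReal < r ∧ z r ∈ lvGrid 1 ∧ z r ≠ z ((hitT 1 z n).toReal)}

lemma hitT_succ_top {z : ℝ → ℝ} {n : ℕ} (h : hitT 1 z n = ⊤) : hitT 1 z (n + 1) = ⊤ := by
  simp [hitT, h]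

lemma hitT_succ {z : ℝ → ℝ} {n : ℕ} (h : hitT 1 z n ≠ ⊤) :
    hitT 1 z (n + 1) = ⨅ r ∈ hS z n, ENNReal.ofReal r := by
  have : ∀ r, (hitT 1 z n < ENNReal.ofReal r ↔ (hitT 1 z n).toReal < r) := by
    intro r; rw [ENNReal.lt_ofReal_iff_toReal_lt h]
  simp only [hitT, this]; rfl

lemma hS_least {z : ℝ → ℝ} (hz : Continuous z) {n : ℕ} (hne : (hS z n).Nonempty) :
    ∃ m, IsLeast (hS z n) m := by
  set p := (hitT 1 z n).toReal with hp
  set G : Set ℝ := {x | x ∈ lvGrid 1 ∧ x ≠ z p} with hG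
  have hGc : IsClosed G := by
    have : G = (fun k : ℤ => (k : ℝ)) '' {k : ℤ | (k : ℝ) ≠ z p} := by
      ext x; simp only [hG, mem_lvGrid_one, mem_ofPred_eq, mem_image]
      constructor
      · rintro ⟨⟨k, rfl⟩, h⟩; exact ⟨k, h, rfl⟩
      · rintro ⟨k, h, rfl⟩; exact ⟨⟨k, rfl⟩, h⟩
    rw [this]
    exact Int.isClosedEmbedding_coe_real.isClosedMap _ (isClosed_discrete _)
  have hcl : IsClosed {r | p ≤ r ∧ z r ∈ G} := isClosed_Ici.inter (hGc.preimage hz)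
  have heq : hS z n = {r | p ≤ r ∧ z r ∈ G} := by
    ext r
    constructor
    · rintro ⟨h1, h2, h3⟩; exact ⟨h1.le, h2, h3⟩
    · rintro ⟨h1, h2, h3⟩
      exact ⟨lt_of_le_of_ne h1 fun h => h3 (by rw [← h]), h2, h3⟩
  rw [heq] at hne ⊢
  exact ⟨_, hcl.isLeast_csInf hne ⟨p, fun r hr => hr.1⟩⟩

lemma hitT_succ_eq {z : ℝ → ℝ} {n : ℕ} (h : hitT 1 z n ≠ ⊤) {m : ℝ} (hm : IsLeast (hS z n) m) :
    hitT 1 z (n + 1) = ENNReal.ofReal m := by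
  rw [hitT_succ h]
  refine le_antisymm (iInf₂_le m hm.1) (le_iInf₂ fun r hr => ENNReal.ofReal_le_ofReal (hm.2 hr))

/-- structure of a finite hitting time -/
lemma hitT_spec {z : ℝ → ℝ} (hz : Continuous z) {n : ℕ} (h : hitT 1 z (n + 1) ≠ ⊤) :
    hitT 1 z n ≠ ⊤ ∧ IsLeast (hS z n) (hitT 1 z (n + 1)).toReal := by
  have h1 : hitT 1 z n ≠ ⊤ := fun h' => h (hitT_succ_top h')
  refine ⟨h1, ?_⟩
  have hne : (hS z n).Nonempty := by
    by_contra hemp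
    rw [not_nonempty_iff_eq_empty] at hemp
    rw [hitT_succ h1, hemp] at h
    simp at h
  obtain ⟨m, hm⟩ := hS_least hz hne
  have hm0 : 0 ≤ m := ENNReal.toReal_nonneg.trans hm.1.1.le
  rw [hitT_succ_eq h1 hm, ENNReal.toReal_ofReal hm0]
  exact hm

lemma hitT_mono (z : ℝ → ℝ) (hz : Continuous z) : Monotone (hitT 1 z) := by
  refine monotone_nat_of_le_succ fun n => ?_
  by_cases h : hitT 1 z (n + 1) = ⊤
  · rw [h]; exact le_top
  · obtain ⟨h1, h2⟩ := hitT_spec hz h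
    rw [← ENNReal.toReal_le_toReal h1 h]
    exact h2.1.1.le

/-- indices of crossings from `k` to `k+1` -/
def Aup (z : ℝ → ℝ) (t : ℝ) (k : ℤ) : Set ℕ :=
  {n | 2 ≤ n ∧ hitT 1 z n ≤ ENNReal.ofReal t ∧ z ((hitT 1 z (n - 1)).toReal) = k ∧
    z ((hitT 1 z n).toReal) = k + 1}

lemma Aup_UC {z : ℝ → ℝ} (hz : Continuous z) {t η : ℝ} (ht : 0 ≤ t) (hη : 0 < η) (k : ℤ) (m : ℕ) (r : ℝ)
    (F : Finset ℕ) (hF : ∀ n ∈ F, n ∈ Aup z t k) (hr : ∀ n ∈ F, r ≤ (hitT 1 z (n - 1)).toReal)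
    (hm : F.card = m) : UC z (Icc 0 t) (k + η) (k + 1 - η) m r := by
  induction m generalizing r F with
  | zero => trivial
  | succ m ih =>
    have hne : F.Nonempty := Finset.card_pos.1 (by omega)
    obtain ⟨n, hn, hmin⟩ := F.exists_min_image (fun n => n) hne
    obtain ⟨h1, h2, h3, h4⟩ := hF n hn
    obtain ⟨n', rfl⟩ : ∃ n', n = n' + 1 := ⟨n - 1, by omega⟩
    rw [Nat.add_sub_cancel] at h3
    have hnt : hitT 1 z (n' + 1) ≠ ⊤ := ne_top_of_le_ne_top ENNReal.ofReal_ne_top h2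
    obtain ⟨g1, g2⟩ := hitT_spec hz hnt
    have hle : (hitT 1 z (n' + 1)).toReal ≤ t := by
      rw [← ENNReal.toReal_ofReal ht]; exact ENNReal.toReal_mono ENNReal.ofReal_ne_top h2
    refine ⟨(hitT 1 z n').toReal, ⟨ENNReal.toReal_nonneg, g2.1.1.le.trans hle⟩,
      (hitT 1 z (n' + 1)).toReal, ⟨ENNReal.toReal_nonneg, hle⟩, hr _ hn, g2.1.1, by linarith,
      by linarith, ih _ (F.erase (n' + 1)) (fun q hq => hF q (Finset.mem_of_mem_erase hq)) ?_ ?_⟩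
    · intro q hq
      have hqF := Finset.mem_of_mem_erase hq
      have hqp := Finset.ne_of_mem_erase hq
      have hlt : n' + 1 ≤ q - 1 := by have := hmin q hqF; omega
      have hqt : hitT 1 z (q - 1) ≠ ⊤ :=
        ne_top_of_le_ne_top ENNReal.ofReal_ne_top
          ((hitT_mono z hz (Nat.sub_le q 1)).trans (hF q hqF).2.1)
      exact ENNReal.toReal_mono hqt (hitT_mono z hz hlt)
    · rw [Finset.card_erase_of_mem hn]; omega

lemma encard_le_of {β : Type*} {A : Set β} {c : ℝ≥0∞} (h : ∀ F : Finset β, (∀ n ∈ F, n ∈ A) → (F.card : ℝ≥0∞) ≤ c) :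
    (A.encard : ℝ≥0∞) ≤ c := by
  by_cases hA : A.Finite
  · have := h hA.toFinset (fun n hn => hA.mem_toFinset.1 hn)
    rw [hA.encard_eq_coe_toFinset_card]
    exact_mod_cast this
  · rw [Set.not_finite] at hA
    have : ∀ m : ℕ, (m : ℝ≥0∞) ≤ c := by
      intro m
      obtain ⟨F, hF, hc⟩ := hA.exists_subset_card_eq m
      rw [← hc]; exact h F (fun n hn => hF hn)
    rw [hA.encard_eq, ENat.toENNReal_top, top_le_iff]
    exact ENNReal.eq_top_of_forall_nnreal_le fun r => by
      obtain ⟨n, hn⟩ := exists_nat_ge r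
      exact le_trans (by exact_mod_cast hn) (this n)

lemma Aup_le_V {z : ℝ → ℝ} (hz : Continuous z) {t η : ℝ} (ht : 0 ≤ t) (hη : 0 < η) (k : ℤ) :
    ((Aup z t k).encard : ℝ≥0∞) ≤ V z (Icc 0 t) (k + η) (k + 1 - η) :=
  encard_le_of fun F hF => le_V (Aup_UC hz ht hη k F.card 0 F hF (fun _ _ => ENNReal.toReal_nonneg) rfl)

lemma grid_dist {x y : ℝ} (hx : x ∈ lvGrid 1) (hy : y ∈ lvGrid 1) (h : x ≠ y) : 1 ≤ |x - y| := by
  rw [mem_lvGrid_one] at hx hy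
  obtain ⟨k, rfl⟩ := hx
  obtain ⟨l, rfl⟩ := hy
  have : k ≠ l := fun h' => h (by rw [h'])
  have := Int.one_le_abs (sub_ne_zero.2 this)
  exact_mod_cast this

/-- only finitely many hits before time `σ` -/
lemma hitT_finite {z : ℝ → ℝ} (hz : Continuous z) (σ : ℝ) (hσ : 0 ≤ σ) :
    ∃ N : ℕ, ∀ n, hitT 1 z n ≤ ENNReal.ofReal σ → n ≤ N := by
  have huc := (isCompact_Icc (a := 0) (b := σ)).uniformContinuousOn_of_continuous hz.continuousOn
  rw [Metric.uniformContinuousOn_iff] at huc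
  obtain ⟨δ, hδ, H⟩ := huc 1 one_pos
  have key : ∀ n : ℕ, hitT 1 z (n + 1) ≤ ENNReal.ofReal σ → n * δ ≤ (hitT 1 z (n + 1)).toReal := by
    intro n
    induction n with
    | zero => intro _; simp
    | succ n ih =>
      intro h
      have hnt : hitT 1 z (n + 1 + 1) ≠ ⊤ := ne_top_of_le_ne_top ENNReal.ofReal_ne_top h
      obtain ⟨g1, g2⟩ := hitT_spec hz hnt
      obtain ⟨g3, g4⟩ := hitT_spec hz g1
      have h' := (hitT_mono z hz (Nat.le_succ (n + 1))).trans h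
      have i1 := ih h'
      have hle : (hitT 1 z (n + 1 + 1)).toReal ≤ σ := by
        rw [← ENNReal.toReal_ofReal hσ]; exact ENNReal.toReal_mono ENNReal.ofReal_ne_top h
      have hlt := g2.1.1
      by_contra hcon
      push Not at hcon
      push_cast at hcon
      have := H _ ⟨ENNReal.toReal_nonneg, hle⟩ _ ⟨ENNReal.toReal_nonneg, hlt.le.trans hle⟩
        (show dist (hitT 1 z (n + 1 + 1)).toReal (hitT 1 z (n + 1)).toReal < δ by
          rw [Real.dist_eq, abs_of_pos (by linarith)]; linarith)
      rw [Real.dist_eq] at this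
      have := grid_dist g2.1.2.1 g4.1.2.1 g2.1.2.2
      linarith
  obtain ⟨N, hN⟩ := exists_nat_gt (σ / δ)
  refine ⟨N + 1, fun n hn => ?_⟩
  by_contra hcon
  obtain ⟨n', rfl⟩ : ∃ n', n = n' + 1 := ⟨n - 1, by omega⟩
  have h1 := key n' hn
  have hle : (hitT 1 z (n' + 1)).toReal ≤ σ := by
    rw [← ENNReal.toReal_ofReal hσ]; exact ENNReal.toReal_mono ENNReal.ofReal_ne_top hn
  rw [div_lt_iff₀ hδ] at hN
  have : (N : ℝ) ≤ n' := by exact_mod_cast (by omega : N ≤ n')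
  nlinarith

lemma exists_cross {z : ℝ → ℝ} (hz : Continuous z) (hz0 : z 0 ∉ lvGrid 1) {u v : ℝ} (hu0 : 0 ≤ u) (huv : u < v)
    (k : ℤ) (hu : z u < k) (hv : k + 1 < z v) :
    ∃ n, 2 ≤ n ∧ z ((hitT 1 z (n - 1)).toReal) = k ∧ z ((hitT 1 z n).toReal) = k + 1 ∧
      ENNReal.ofReal u < hitT 1 z n ∧ hitT 1 z n ≤ ENNReal.ofReal v := by
  obtain ⟨σ, τ, k1, k2, k3, k4, k5, k6, -⟩ := exists_up hz huv (show (k : ℝ) < k + 1 by linarith) hu hv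
  have hσ0 : 0 ≤ σ := hu0.trans k1
  have hσg : z σ ∈ lvGrid 1 := mem_lvGrid_one.2 ⟨k, k4⟩
  have hσpos : 0 < σ := lt_of_le_of_ne hσ0 fun h => hz0 (by rw [h]; exact hσg)
  obtain ⟨N, hN⟩ := hitT_finite hz σ hσ0
  have hT0 : hitT 1 z 0 ≠ ⊤ := by simp [hitT]
  have hT00 : (hitT 1 z 0).toReal = 0 := by simp [hitT]
  have h1 : hitT 1 z 1 ≤ ENNReal.ofReal σ := by
    rw [hitT_succ hT0]
    refine iInf₂_le σ ⟨by rw [hT00]; exact hσpos, hσg, ?_⟩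
    rw [hT00]; exact fun h => hz0 (by rw [← h]; exact hσg)
  set n := Nat.findGreatest (fun n => hitT 1 z n ≤ ENNReal.ofReal σ) N with hn
  have hn1 : hitT 1 z n ≤ ENNReal.ofReal σ :=
    Nat.findGreatest_spec (P := fun n => hitT 1 z n ≤ ENNReal.ofReal σ) (hN 1 h1) h1
  have hn2 : 1 ≤ n := Nat.le_findGreatest (hN 1 h1) h1
  have hn3 : ENNReal.ofReal σ < hitT 1 z (n + 1) := by
    by_contra hcon
    rw [not_lt] at hcon
    have := Nat.le_findGreatest (P := fun n => hitT 1 z n ≤ ENNReal.ofReal σ) (hN _ hcon) hcon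
    omega
  have hnt : hitT 1 z n ≠ ⊤ := ne_top_of_le_ne_top ENNReal.ofReal_ne_top hn1
  have hpn : (hitT 1 z n).toReal ≤ σ := by
    rw [← ENNReal.toReal_ofReal hσ0]; exact ENNReal.toReal_mono ENNReal.ofReal_ne_top hn1
  have hzk : z ((hitT 1 z n).toReal) = k := by
    by_contra hcon
    have : σ ∈ hS z n := by
      refine ⟨lt_of_le_of_ne hpn fun h => hcon (by rw [h, k4]), hσg, ?_⟩
      rw [k4]; exact fun h => hcon h.symm
    rw [hitT_succ hnt] at hn3
    exact absurd (iInf₂_le σ this) (not_le.2 hn3)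
  have hτS : τ ∈ hS z n := by
    refine ⟨hpn.trans_lt k2, mem_lvGrid_one.2 ⟨k + 1, by push_cast; exact k5⟩, ?_⟩
    rw [k5, hzk]; linarith
  obtain ⟨m, hm⟩ := hS_least hz ⟨τ, hτS⟩
  have hTm := hitT_succ_eq hnt hm
  have hm0 : 0 ≤ m := ENNReal.toReal_nonneg.trans hm.1.1.le
  have hmτ : m = τ := by
    by_contra hne
    have hlt : m < τ := lt_of_le_of_ne (hm.2 hτS) hne
    have hσm : σ < m := by
      rw [hTm] at hn3
      exact (ENNReal.ofReal_lt_ofReal_iff_of_nonneg hσ0).1 hn3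
    have h6 := k6 m ⟨hσm, hlt⟩
    obtain ⟨l, hl⟩ := mem_lvGrid_one.1 hm.1.2.1
    rw [hl] at h6
    have a1 : k < l := by exact_mod_cast h6.1
    have a2 : l < k + 1 := by exact_mod_cast h6.2
    omega
  subst hmτ
  refine ⟨n + 1, by omega, hzk, ?_, ?_, ?_⟩
  · rw [hTm, ENNReal.toReal_ofReal hm0, k5]
  · exact lt_of_le_of_lt (ENNReal.ofReal_le_ofReal k1) hn3
  · rw [hTm]; exact ENNReal.ofReal_le_ofReal k3

lemma UC_le_Aup {z : ℝ → ℝ} (hz : Continuous z) (hz0 : z 0 ∉ lvGrid 1) {t : ℝ} (k : ℤ)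
    (m : ℕ) (r : ℝ) (h : UC z (Icc 0 t) k (k + 1) m r) :
    (m : ℕ∞) ≤ {n ∈ Aup z t k | ENNReal.ofReal r < hitT 1 z n}.encard := by
  induction m generalizing r with
  | zero => simp
  | succ m ih =>
    obtain ⟨u, hu1, v, hv1, g1, g2, g3, g4, g5⟩ := h
    obtain ⟨n, j1, j2, j3, j4, j5⟩ := exists_cross hz hz0 hu1.1 g2 k g3 g4
    have hmem : n ∈ Aup z t k := ⟨j1, j5.trans (ENNReal.ofReal_le_ofReal hv1.2), j2, j3⟩
    have hsub : insert n {n ∈ Aup z t k | ENNReal.ofReal v < hitT 1 z n} ⊆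
        {n ∈ Aup z t k | ENNReal.ofReal r < hitT 1 z n} := by
      intro p hp
      rcases hp with rfl | hp
      · exact ⟨hmem, lt_of_le_of_lt (ENNReal.ofReal_le_ofReal g1) j4⟩
      · exact ⟨hp.1, lt_of_le_of_lt (ENNReal.ofReal_le_ofReal (g1.trans g2.le)) hp.2⟩
    refine le_trans ?_ (Set.encard_le_encard hsub)
    rw [Set.encard_insert_of_notMem]
    · push_cast; gcongr; exact ih v g5
    · rintro ⟨-, h⟩
      exact absurd h (not_lt.2 j5)

lemma V_le_Aup {z : ℝ → ℝ} (hz : Continuous z) (hz0 : z 0 ∉ lvGrid 1) {t : ℝ} (k : ℤ) :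
    V z (Icc 0 t) k (k + 1) ≤ ((Aup z t k).encard : ℝ≥0∞) := by
  refine V_le fun m r h => ?_
  have := (UC_le_Aup hz hz0 k m r h).trans (Set.encard_le_encard (sep_subset _ _))
  exact_mod_cast (ENat.toENNReal_le.2 this)

/-- the set of labelled crossings -/
def Alab (z : ℝ → ℝ) (t : ℝ) (l : ℤ × Bool) : Set ℕ :=
  if l.2 then Aup z t l.1 else Aup (fun r => -z r) t l.1

lemma Alab_union {z : ℝ → ℝ} (hz : Continuous z) (t : ℝ) :
    {n : ℕ | 2 ≤ n ∧ hitT 1 z n ≤ ENNReal.ofReal t} = ⋃ l, Alab z t l := by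
  ext n
  simp only [mem_ofPred_eq, mem_iUnion]
  constructor
  · rintro ⟨h1, h2⟩
    obtain ⟨n', rfl⟩ : ∃ n', n = n' + 1 + 1 := ⟨n - 2, by omega⟩
    have hnt : hitT 1 z (n' + 1 + 1) ≠ ⊤ := ne_top_of_le_ne_top ENNReal.ofReal_ne_top h2
    obtain ⟨g1, g2⟩ := hitT_spec hz hnt
    obtain ⟨g3, g4⟩ := hitT_spec hz g1
    obtain ⟨k, hk⟩ := mem_lvGrid_one.1 g4.1.2.1
    obtain ⟨l, hl⟩ := mem_lvGrid_one.1 g2.1.2.1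
    have hkl : l ≠ k := fun h => g2.1.2.2 (by rw [hk, hl, h])
    have hno : ∀ x : ℤ, (x : ℝ) ∈ z '' Icc (hitT 1 z (n' + 1)).toReal (hitT 1 z (n' + 1 + 1)).toReal →
        x = k ∨ x = l := by
      rintro x ⟨r, hr, hrx⟩
      by_contra hcon
      push Not at hcon
      have hr1 : (hitT 1 z (n' + 1)).toReal < r := lt_of_le_of_ne hr.1 fun h => by
        rw [← h, hk] at hrx; exact hcon.1 (by exact_mod_cast hrx.symm)
      have : r ∈ hS z (n' + 1) := ⟨hr1, mem_lvGrid_one.2 ⟨x, hrx⟩, by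
        rw [hrx, hk]; exact_mod_cast hcon.1⟩
      have := g2.2 this
      have : r = (hitT 1 z (n' + 1 + 1)).toReal := le_antisymm hr.2 this
      rw [this, hl] at hrx
      exact hcon.2 (by exact_mod_cast hrx.symm)
    rcases lt_or_gt_of_ne hkl with h | h
    · have : (((k - 1 : ℤ)) : ℝ) ∈ z '' Icc (hitT 1 z (n' + 1)).toReal (hitT 1 z (n' + 1 + 1)).toReal := by
        refine intermediate_value_Icc' g2.1.1.le hz.continuousOn ?_
        rw [hk, hl]
        exact ⟨by exact_mod_cast (by omega : l ≤ k - 1), by exact_mod_cast (by omega : k - 1 ≤ k)⟩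
      have := hno _ this
      refine ⟨(-k, false), ?_⟩
      have hle : l = k - 1 := by omega
      simp only [Alab, Aup, hitT_neg]
      refine ⟨by omega, h2, ?_, ?_⟩
      · simp [hk]
      · rw [hl, hle]; push_cast; ring
    · have : (((k + 1 : ℤ)) : ℝ) ∈ z '' Icc (hitT 1 z (n' + 1)).toReal (hitT 1 z (n' + 1 + 1)).toReal := by
        refine intermediate_value_Icc g2.1.1.le hz.continuousOn ?_
        rw [hk, hl]
        exact ⟨by exact_mod_cast (by omega : k ≤ k + 1), by exact_mod_cast (by omega : k + 1 ≤ l)⟩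
      have := hno _ this
      refine ⟨(k, true), ?_⟩
      have hle : l = k + 1 := by omega
      simp only [Alab, Aup]
      refine ⟨by omega, h2, ?_, ?_⟩
      · simp [hk]
      · rw [hl, hle]; push_cast; ring
  · rintro ⟨⟨k, b⟩, h⟩
    cases b
    · simp only [Alab, Aup, hitT_neg] at h
      exact ⟨h.1, h.2.1⟩
    · simp only [Alab, Aup] at h
      exact ⟨h.1, h.2.1⟩

lemma Alab_disj {z : ℝ → ℝ} (t : ℝ) : Pairwise (Function.onFun Disjoint (Alab z t)) := by
  rintro ⟨k, b⟩ ⟨l, c⟩ hne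
  rw [Function.onFun, Set.disjoint_left]
  intro n h1 h2
  apply hne
  cases b <;> cases c
  · have h3 := h1.2.2.1.symm.trans h2.2.2.1
    have : k = l := by exact_mod_cast h3
    rw [this]
  · exfalso
    simp only [Alab, Aup, hitT_neg] at h1 h2
    have a1 := h1.2.2.1; have a2 := h1.2.2.2; have a3 := h2.2.2.1; have a4 := h2.2.2.2
    linarith
  · exfalso
    simp only [Alab, Aup, hitT_neg] at h1 h2
    have a1 := h1.2.2.1; have a2 := h1.2.2.2; have a3 := h2.2.2.1; have a4 := h2.2.2.2
    linarith
  · have h3 := h1.2.2.1.symm.trans h2.2.2.1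
    have : k = l := by exact_mod_cast h3
    rw [this]

lemma crossKe_eq {z : ℝ → ℝ} (hz : Continuous z) (hz0 : z 0 ∉ lvGrid 1) (t : ℝ) :
    crossKe 1 z 0 t = ∑' k : ℤ, (((Aup z t k).encard : ℝ≥0∞) +
      ((Aup (fun r => -z r) t k).encard : ℝ≥0∞)) := by
  unfold crossKe crossK
  simp only [zero_add, sub_zero, hz0, false_and, if_false, add_zero]
  rw [Alab_union hz t, ← Measure.count_apply (MeasurableSet.of_discrete),
    measure_iUnion (Alab_disj t) (fun _ => MeasurableSet.of_discrete),
    ENNReal.tsum_prod (f := fun k b => Measure.count (Alab z t (k, b)))]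
  refine tsum_congr fun k => ?_
  rw [tsum_bool, add_comm]
  simp [Alab, Measure.count_apply MeasurableSet.of_discrete]

lemma lint_int_sum {f : ℝ → ℝ≥0∞} (hf : Measurable f) :
    ∫⁻ ρ in Ioo (-(1 / 2 : ℝ)) (1 / 2), ∑' k : ℤ, f (k + ρ) = ∫⁻ x, f x := by
  rw [lintegral_tsum (f := fun (k : ℤ) (ρ : ℝ) => f (k + ρ)) (fun k => (hf.comp (measurable_const_add _)).aemeasurable)]
  have h1 : ∀ k : ℤ, ∫⁻ ρ in Ioo (-(1 / 2 : ℝ)) (1 / 2), f (k + ρ) =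
      ∫⁻ x in Ioc (-(1 / 2 : ℝ) + k) (-(1 / 2) + k + 1), f x := by
    intro k
    rw [setLIntegral_congr Ioo_ae_eq_Ioc, ← lintegral_indicator measurableSet_Ioc,
      ← lintegral_indicator measurableSet_Ioc,
      ← lintegral_add_left_eq_self (indicator (Ioc (-(1 / 2 : ℝ) + k) (-(1 / 2) + k + 1)) f) (k : ℝ)]
    refine lintegral_congr fun x => ?_
    simp only [indicator, mem_Ioc]
    congr 1
    exact propext ⟨fun h => ⟨by linarith [h.1], by linarith [h.2]⟩, fun h => ⟨by linarith [h.1], by linarith [h.2]⟩⟩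
  simp only [h1]
  rw [← lintegral_iUnion (fun _ => measurableSet_Ioc) (pairwise_disjoint_Ioc_add_intCast _),
    iUnion_Ioc_add_intCast, Measure.restrict_univ]

lemma lint_int_sum_neg {f : ℝ → ℝ≥0∞} (hf : Measurable f) :
    ∫⁻ ρ in Ioo (-(1 / 2 : ℝ)) (1 / 2), ∑' k : ℤ, f (k - ρ) = ∫⁻ x, f x := by
  rw [← lint_int_sum hf, ← lintegral_indicator measurableSet_Ioo, ← lintegral_indicator measurableSet_Ioo,
    ← lintegral_neg_eq_self]
  refine lintegral_congr fun x => ?_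
  simp only [indicator, mem_Ioo, sub_neg_eq_add]
  congr 1
  exact propext ⟨fun h => ⟨by linarith [h.2], by linarith [h.1]⟩, fun h => ⟨by linarith [h.2], by linarith [h.1]⟩⟩

lemma ae_ne_zero_half : ∀ᵐ ρ ∂(volume.restrict (Ioo (-(1 / 2 : ℝ)) (1 / 2))), ρ ∉ lvGrid 1 := by
  have h0 : ∀ᵐ ρ : ℝ, ρ ≠ 0 := by
    rw [ae_iff]; simp
  filter_upwards [ae_restrict_of_ae h0, ae_restrict_mem measurableSet_Ioo] with ρ h1 h2
  rw [mem_lvGrid_one]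
  rintro ⟨k, rfl⟩
  have a1 : -1 < k := by
    have := h2.1
    have : (-1 : ℝ) < k := by linarith
    exact_mod_cast this
  have a2 : k < 1 := by
    have := h2.2
    have : (k : ℝ) < 1 := by linarith
    exact_mod_cast this
  exact h1 (by have : k = 0 := by omega
               simp [this])

lemma avg_sum {w : ℝ → ℝ} (hw : Continuous w) (t η ε : ℝ) (hε : 0 ≤ ε) :
    ∫⁻ ρ in Ioo (-(1 / 2 : ℝ)) (1 / 2), ∑' k : ℤ, (V (fun r => w r + ρ) (Icc 0 t) (k + η) (k + η + ε) +
      V (fun r => -(w r + ρ)) (Icc 0 t) (k + η) (k + η + ε)) = Wt w 0 t ε + Wt (fun r => -w r) 0 t ε := by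
  have hm1 : Measurable fun x => V w (Icc 0 t) (x + η) (x + η + ε) :=
    (measurable_V_Icc hw 0 t hε).comp (measurable_id.add_const η)
  have hm2 : Measurable fun x => V (fun r => -w r) (Icc 0 t) (x + η) (x + η + ε) :=
    (measurable_V_Icc hw.neg 0 t hε).comp (measurable_id.add_const η)
  have e1 : ∀ (k : ℤ) (ρ : ℝ), V (fun r => w r + ρ) (Icc 0 t) (k + η) (k + η + ε) =
      (fun x => V w (Icc 0 t) (x + η) (x + η + ε)) (k - ρ) := by
    intro k ρ; rw [V_shift]; dsimp only; congr 1 <;> ring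
  have e2 : ∀ (k : ℤ) (ρ : ℝ), V (fun r => -(w r + ρ)) (Icc 0 t) (k + η) (k + η + ε) =
      (fun x => V (fun r => -w r) (Icc 0 t) (x + η) (x + η + ε)) (k + ρ) := by
    intro k ρ
    have := V_shift (w := fun r => -w r) (S := Icc 0 t) (x := k + η) (y := k + η + ε) (-ρ)
    simp only [neg_add]
    rw [this]; congr 1 <;> ring
  simp only [e1, e2]
  have e3 : ∀ ρ : ℝ, ∑' k : ℤ, ((fun x => V w (Icc 0 t) (x + η) (x + η + ε)) (k - ρ) +
      (fun x => V (fun r => -w r) (Icc 0 t) (x + η) (x + η + ε)) (k + ρ)) =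
      ∑' k : ℤ, (fun x => V w (Icc 0 t) (x + η) (x + η + ε)) (k - ρ) +
      ∑' k : ℤ, (fun x => V (fun r => -w r) (Icc 0 t) (x + η) (x + η + ε)) (k + ρ) :=
    fun ρ => ENNReal.tsum_add
  simp only [e3]
  rw [lintegral_add_left]
  · rw [lint_int_sum_neg hm1, lint_int_sum hm2]
    congr 1
    · exact lintegral_add_right_eq_self (fun x => V w (Icc 0 t) x (x + ε)) η
    · exact lintegral_add_right_eq_self (fun x => V (fun r => -w r) (Icc 0 t) x (x + ε)) η
  · exact Measurable.tsum fun k => hm1.comp (measurable_const.sub measurable_id)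

lemma avgK_ge {w : ℝ → ℝ} (hw : Continuous w) (hw0 : w 0 = 0) (t : ℝ) :
    Wt w 0 t 1 + Wt (fun r => -w r) 0 t 1 ≤ avgK 1 w 0 t := by
  rw [← avg_sum hw t 0 1 zero_le_one]
  unfold avgK
  rw [inv_one, ENNReal.ofReal_one, one_mul]
  refine lintegral_mono_ae ?_
  filter_upwards [ae_ne_zero_half] with ρ hρ
  have hc : Continuous fun r => w r + ρ := hw.add continuous_const
  have hz0 : (fun r => w r + ρ) 0 ∉ lvGrid 1 := by simpa [hw0] using hρ
  have hz0' : (fun r => -(w r + ρ)) 0 ∉ lvGrid 1 := by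
    intro h; apply hz0
    obtain ⟨k, hk⟩ := mem_lvGrid_one.1 h
    exact mem_lvGrid_one.2 ⟨-k, by push_cast; rw [← hk]; ring⟩
  rw [crossKe_eq hc hz0]
  refine ENNReal.tsum_le_tsum fun k => ?_
  rw [add_zero]
  exact add_le_add (V_le_Aup hc hz0 k) (V_le_Aup hc.neg hz0' k)

lemma avgK_le {w : ℝ → ℝ} (hw : Continuous w) (hw0 : w 0 = 0) {t η : ℝ} (ht : 0 ≤ t) (hη : 0 < η)
    (hη' : η < 1 / 2) :
    avgK 1 w 0 t ≤ Wt w 0 t (1 - 2 * η) + Wt (fun r => -w r) 0 t (1 - 2 * η) := by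
  rw [← avg_sum hw t η (1 - 2 * η) (by linarith)]
  unfold avgK
  rw [inv_one, ENNReal.ofReal_one, one_mul]
  refine lintegral_mono_ae ?_
  filter_upwards [ae_ne_zero_half] with ρ hρ
  have hc : Continuous fun r => w r + ρ := hw.add continuous_const
  have hz0 : (fun r => w r + ρ) 0 ∉ lvGrid 1 := by simpa [hw0] using hρ
  rw [crossKe_eq hc hz0]
  refine ENNReal.tsum_le_tsum fun k => ?_
  rw [show (k : ℝ) + η + (1 - 2 * η) = k + 1 - η by ring]
  exact add_le_add (Aup_le_V hc ht hη k) (Aup_le_V hc.neg ht hη k)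
end

section
/-- covariance of unit-step fractional Gaussian noise, `p = 2H` -/
def rk (p : ℝ) (d : ℝ) : ℝ := (|d + 1| ^ p + |d - 1| ^ p - 2 * |d| ^ p) / 2

lemma rk_neg (p d : ℝ) : rk p (-d) = rk p d := by
  unfold rk
  rw [show -d + 1 = -(d - 1) by ring, show -d - 1 = -(d + 1) by ring, abs_neg, abs_neg, abs_neg]
  ring

lemma rk_mvt {p : ℝ} (hp : 0 < p) {d : ℝ} (hd : 1 ≤ d) :
    ∃ ζ, d - 1 < ζ ∧ ζ < d + 1 ∧ -(2 * rk p d) = p * (1 - p) * ζ ^ (p - 2) := by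
  have hder : ∀ x : ℝ, 0 < x → HasDerivAt (fun x : ℝ => (x + 1) ^ p - x ^ p)
      (p * (x + 1) ^ (p - 1) - p * x ^ (p - 1)) x := by
    intro x hx
    have h1 : HasDerivAt (fun x : ℝ => (x + 1) ^ p) (p * (x + 1) ^ (p - 1)) x := by
      have := (Real.hasDerivAt_rpow_const (x := x + 1) (p := p) (Or.inl (by linarith))).comp_add_const x 1
      simpa using this
    exact h1.sub (Real.hasDerivAt_rpow_const (Or.inl hx.ne'))
  have hcont : ContinuousOn (fun x : ℝ => (x + 1) ^ p - x ^ p) (Icc (d - 1) d) := by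
    refine Continuous.continuousOn ?_
    exact ((Real.continuous_rpow_const hp.le).comp (continuous_id.add continuous_const)).sub
      (Real.continuous_rpow_const hp.le)
  obtain ⟨ξ, hξ, h1⟩ := exists_hasDerivAt_eq_slope _ _ (show d - 1 < d by linarith) hcont
    (fun x hx => hder x (by linarith [hx.1]))
  have hξ0 : 0 < ξ := by linarith [hξ.1]
  obtain ⟨ζ, hζ, h2⟩ := exists_hasDerivAt_eq_slope (fun x : ℝ => x ^ (p - 1))
    (fun x => (p - 1) * x ^ (p - 1 - 1)) (show ξ < ξ + 1 by linarith)
    (fun x hx => (Real.continuousAt_rpow_const _ _ (Or.inl (by linarith [hx.1]))).continuousWithinAt)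
    (fun x hx => Real.hasDerivAt_rpow_const (Or.inl (by linarith [hx.1])))
  refine ⟨ζ, by linarith [hζ.1, hξ.1], by linarith [hζ.2, hξ.2], ?_⟩
  rw [show d - (d - 1) = 1 by ring, div_one, show d - 1 + 1 = d by ring] at h1
  rw [show ξ + 1 - ξ = 1 by ring, div_one, show p - 1 - 1 = p - 2 by ring] at h2
  unfold rk
  rw [abs_of_pos (by linarith : 0 < d + 1), abs_of_nonneg (by linarith : 0 ≤ d - 1),
    abs_of_pos (by linarith : 0 < d)]
  linear_combination h1 + p * h2

lemma rk_lower {p : ℝ} (hp : 0 < p) (hp1 : p < 1) {d : ℝ} (hd : 1 ≤ d) :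
    p * (1 - p) / 8 * d ^ (p - 2) ≤ -rk p d := by
  obtain ⟨ζ, h1, h2, h3⟩ := rk_mvt hp hd
  have : (2 * d) ^ (p - 2) ≤ ζ ^ (p - 2) :=
    Real.rpow_le_rpow_of_nonpos (by linarith) (by linarith) (by linarith)
  rw [Real.mul_rpow (by norm_num) (by linarith)] at this
  have h4 : (1 / 4 : ℝ) ≤ 2 ^ (p - 2) := by
    have : (2 : ℝ) ^ (-2 : ℝ) ≤ 2 ^ (p - 2) := Real.rpow_le_rpow_of_exponent_le (by norm_num) (by linarith)
    refine le_trans (le_of_eq ?_) this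
    rw [Real.rpow_neg (by norm_num)]; norm_num
  have h5 : 0 ≤ d ^ (p - 2) := by positivity
  have h6 : 0 < p * (1 - p) := mul_pos hp (by linarith)
  have h7 : 1 / 4 * d ^ (p - 2) ≤ ζ ^ (p - 2) := le_trans (by gcongr) this
  have h8 : p * (1 - p) * (1 / 4 * d ^ (p - 2)) ≤ p * (1 - p) * ζ ^ (p - 2) := by gcongr
  nlinarith

lemma rk_upper {p : ℝ} (hp : 0 < p) (hp1 : p < 1) {d : ℝ} (hd : 1 < d) :
    |rk p d| ≤ (d - 1) ^ (p - 2) := by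
  obtain ⟨ζ, h1, h2, h3⟩ := rk_mvt hp hd.le
  have h4 : ζ ^ (p - 2) ≤ (d - 1) ^ (p - 2) :=
    Real.rpow_le_rpow_of_nonpos (by linarith) (by linarith) (by linarith)
  have h0 : 0 < ζ := by linarith
  have h5 : 0 ≤ ζ ^ (p - 2) := by positivity
  have h6 : 0 < p * (1 - p) := mul_pos hp (by linarith)
  have h7 : p * (1 - p) ≤ 1 := by nlinarith
  have h8 : p * (1 - p) * ζ ^ (p - 2) ≤ 1 * ζ ^ (p - 2) := by gcongr
  rw [abs_le]; constructor <;> nlinarith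

lemma rk_nonpos {p : ℝ} (hp : 0 < p) (hp1 : p < 1) {i j : ℕ} (h : i ≠ j) : rk p ((i : ℝ) - j) ≤ 0 := by
  have key : ∀ i j : ℕ, i < j → rk p ((j : ℝ) - i) ≤ 0 := by
    intro i j h
    have hd : (1 : ℝ) ≤ (j : ℝ) - i := by
      have : (i : ℝ) + 1 ≤ j := by exact_mod_cast h
      linarith
    have := rk_lower hp hp1 hd
    have h2 : 0 ≤ p * (1 - p) / 8 * ((j : ℝ) - i) ^ (p - 2) := by
      have : 0 < p * (1 - p) := mul_pos hp (by linarith)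
      have : (0 : ℝ) ≤ (j : ℝ) - i := by linarith
      positivity
    linarith
  rcases lt_or_gt_of_ne h with hij | hij
  · rw [← neg_sub, rk_neg]; exact key i j hij
  · exact key j i hij

/-- quadratic form -/
def Qf (p : ℝ) (N : ℕ) (ψ : ℕ → ℝ) : ℝ :=
  ∑ i ∈ Finset.range N, ∑ j ∈ Finset.range N, ψ i * ψ j * rk p ((i : ℝ) - j)

/-- row sums -/
def kap (p : ℝ) (N : ℕ) (i : ℕ) : ℝ := ∑ j ∈ Finset.range N, rk p ((i : ℝ) - j)

lemma kap_eq (p : ℝ) (N i : ℕ) :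
    kap p N i = ((|(i : ℝ) + 1| ^ p - |(i : ℝ)| ^ p) - (|(i : ℝ) - N + 1| ^ p - |(i : ℝ) - N| ^ p)) / 2 := by
  unfold kap
  induction N with
  | zero => simp
  | succ N ih =>
    rw [Finset.sum_range_succ, ih]
    unfold rk
    push_cast
    rw [show (i : ℝ) - (N + 1) + 1 = i - N by ring, show (i : ℝ) - (N + 1) = i - N - 1 by ring]
    ring

lemma concave_incr {p : ℝ} (hp : 0 < p) (hp1 : p < 1) {m : ℝ} (hm : 0 ≤ m) :
    p * (m + 1) ^ (p - 1) ≤ (m + 1) ^ p - m ^ p := by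
  obtain ⟨ξ, hξ, h1⟩ := exists_hasDerivAt_eq_slope (fun x : ℝ => x ^ p)
    (fun x => p * x ^ (p - 1)) (show m < m + 1 by linarith)
    (Real.continuous_rpow_const hp.le).continuousOn
    (fun x hx => Real.hasDerivAt_rpow_const (Or.inl (by linarith [hx.1])))
  rw [show m + 1 - m = 1 by ring, div_one] at h1
  rw [← h1]
  have := Real.rpow_le_rpow_of_nonpos (show 0 < ξ by linarith [hξ.1]) hξ.2.le (show p - 1 ≤ 0 by linarith)
  gcongr

lemma kap_ge {p : ℝ} (hp : 0 < p) (hp1 : p < 1) {N i : ℕ} (hi : i < N) :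
    p * (N : ℝ) ^ (p - 1) ≤ kap p N i := by
  rw [kap_eq]
  have hN : (i : ℝ) + 1 ≤ N := by exact_mod_cast hi
  have hi0 : (0 : ℝ) ≤ i := i.cast_nonneg
  rw [abs_of_nonneg (by linarith : (0 : ℝ) ≤ i + 1), abs_of_nonneg hi0,
    abs_of_nonpos (by linarith : (i : ℝ) - N + 1 ≤ 0), abs_of_nonpos (by linarith : (i : ℝ) - N ≤ 0)]
  have h1 := concave_incr hp hp1 hi0
  have h2 := concave_incr hp hp1 (show (0 : ℝ) ≤ -((i : ℝ) - N + 1) by linarith)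
  rw [show -((i : ℝ) - N + 1) + 1 = -((i : ℝ) - N) by ring] at h2
  have h3 := Real.rpow_le_rpow_of_nonpos (show (0 : ℝ) < i + 1 by linarith) hN (show p - 1 ≤ 0 by linarith)
  have h4 := Real.rpow_le_rpow_of_nonpos (show (0 : ℝ) < -((i : ℝ) - N) by linarith)
    (show -((i : ℝ) - N) ≤ N by linarith) (show p - 1 ≤ 0 by linarith)
  nlinarith

lemma Qf_eq (p : ℝ) (N : ℕ) (ψ : ℕ → ℝ) :
    Qf p N ψ = (∑ i ∈ Finset.range N, ∑ j ∈ Finset.range N, -rk p ((i : ℝ) - j) * (ψ i - ψ j) ^ 2) / 2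
      + ∑ i ∈ Finset.range N, ψ i ^ 2 * kap p N i := by
  have h1 : ∑ i ∈ Finset.range N, ψ i ^ 2 * kap p N i =
      ∑ i ∈ Finset.range N, ∑ j ∈ Finset.range N, ψ i ^ 2 * rk p ((i : ℝ) - j) := by
    simp only [kap, Finset.mul_sum]
  have h2 : ∑ i ∈ Finset.range N, ∑ j ∈ Finset.range N, ψ i ^ 2 * rk p ((i : ℝ) - j) =
      ∑ i ∈ Finset.range N, ∑ j ∈ Finset.range N, ψ j ^ 2 * rk p ((i : ℝ) - j) := by
    rw [Finset.sum_comm]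
    refine Finset.sum_congr rfl fun i _ => Finset.sum_congr rfl fun j _ => ?_
    rw [← neg_sub, rk_neg]
  have h3 : (∑ i ∈ Finset.range N, ∑ j ∈ Finset.range N, -rk p ((i : ℝ) - j) * (ψ i - ψ j) ^ 2) =
      2 * Qf p N ψ - ∑ i ∈ Finset.range N, ∑ j ∈ Finset.range N, ψ i ^ 2 * rk p ((i : ℝ) - j)
      - ∑ i ∈ Finset.range N, ∑ j ∈ Finset.range N, ψ j ^ 2 * rk p ((i : ℝ) - j) := by
    unfold Qf
    rw [Finset.mul_sum, ← Finset.sum_sub_distrib, ← Finset.sum_sub_distrib]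
    refine Finset.sum_congr rfl fun i _ => ?_
    rw [Finset.mul_sum, ← Finset.sum_sub_distrib, ← Finset.sum_sub_distrib]
    refine Finset.sum_congr rfl fun j _ => ?_
    ring
  rw [h3, h1]
  linarith

lemma dir_nonneg {p : ℝ} (hp : 0 < p) (hp1 : p < 1) (ψ : ℕ → ℝ) (i j : ℕ) :
    0 ≤ -rk p ((i : ℝ) - j) * (ψ i - ψ j) ^ 2 := by
  by_cases h : i = j
  · subst h; simp
  · have := rk_nonpos hp hp1 h
    exact mul_nonneg (by linarith) (sq_nonneg _)

lemma Qf_ge_sq {p : ℝ} (hp : 0 < p) (hp1 : p < 1) (N : ℕ) (ψ : ℕ → ℝ) :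
    p * (N : ℝ) ^ (p - 1) * ∑ i ∈ Finset.range N, ψ i ^ 2 ≤ Qf p N ψ := by
  rw [Qf_eq]
  have h1 : 0 ≤ ∑ i ∈ Finset.range N, ∑ j ∈ Finset.range N, -rk p ((i : ℝ) - j) * (ψ i - ψ j) ^ 2 :=
    Finset.sum_nonneg fun i _ => Finset.sum_nonneg fun j _ => dir_nonneg hp hp1 ψ i j
  have h2 : p * (N : ℝ) ^ (p - 1) * ∑ i ∈ Finset.range N, ψ i ^ 2 ≤
      ∑ i ∈ Finset.range N, ψ i ^ 2 * kap p N i := by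
    rw [Finset.mul_sum]
    refine Finset.sum_le_sum fun i hi => ?_
    rw [mul_comm]
    exact mul_le_mul_of_nonneg_left (kap_ge hp hp1 (Finset.mem_range.1 hi)) (sq_nonneg _)
  linarith

lemma Qf_nonneg {p : ℝ} (hp : 0 < p) (hp1 : p < 1) (N : ℕ) (ψ : ℕ → ℝ) : 0 ≤ Qf p N ψ := by
  refine le_trans ?_ (Qf_ge_sq hp hp1 N ψ)
  have : 0 ≤ ∑ i ∈ Finset.range N, ψ i ^ 2 := Finset.sum_nonneg fun i _ => sq_nonneg _
  positivity

lemma Qf_ge_dir {p : ℝ} (hp : 0 < p) (hp1 : p < 1) (N : ℕ) (ψ : ℕ → ℝ) :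
    ∑ i ∈ Finset.range N, ∑ j ∈ Finset.range N, -rk p ((i : ℝ) - j) * (ψ i - ψ j) ^ 2 ≤ 2 * Qf p N ψ := by
  rw [Qf_eq]
  have h2 : 0 ≤ ∑ i ∈ Finset.range N, ψ i ^ 2 * kap p N i := by
    refine Finset.sum_nonneg fun i hi => mul_nonneg (sq_nonneg _)
      (le_trans ?_ (kap_ge hp hp1 (Finset.mem_range.1 hi)))
    positivity
  linarith

lemma Qf_ext {p : ℝ} {R N : ℕ} (hRN : R ≤ N) {ψ : ℕ → ℝ} (hψ : ∀ i, R ≤ i → ψ i = 0) :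
    Qf p N ψ = Qf p R ψ := by
  unfold Qf
  have hs : Finset.range R ⊆ Finset.range N := Finset.range_mono hRN
  rw [← Finset.sum_subset hs]
  · refine Finset.sum_congr rfl fun i _ => ?_
    rw [← Finset.sum_subset hs]
    intro j _ hj
    rw [hψ j (by simpa using hj)]; ring
  · intro i _ hi
    refine Finset.sum_eq_zero fun j _ => ?_
    rw [hψ i (by simpa using hi)]; ring

/-- comparing averages -/
lemma avg_diff {p : ℝ} (hp : 0 < p) (hp1 : p < 1) {N : ℕ} (ψ : ℕ → ℝ) {I J : Finset ℕ}
    (hI : I ⊆ Finset.range N) (hJ : J ⊆ Finset.range N) (hI0 : I.Nonempty) (hJ0 : J.Nonempty) {D : ℝ}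
    (hD : ∀ i ∈ I, ∀ j ∈ J, |(i : ℝ) - j| ≤ D) :
    ((∑ i ∈ I, ψ i) / I.card - (∑ j ∈ J, ψ j) / J.card) ^ 2 ≤
      16 / (p * (1 - p)) * D ^ (2 - p) / (I.card * J.card) * Qf p N ψ := by
  have hIc : (0 : ℝ) < I.card := by exact_mod_cast hI0.card_pos
  have hJc : (0 : ℝ) < J.card := by exact_mod_cast hJ0.card_pos
  have hpp : 0 < p * (1 - p) := mul_pos hp (by linarith)
  have e1 : (∑ i ∈ I, ψ i) / I.card - (∑ j ∈ J, ψ j) / J.card =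
      (∑ q ∈ I ×ˢ J, (ψ q.1 - ψ q.2)) / (I.card * J.card) := by
    rw [Finset.sum_product]
    simp only [Finset.sum_sub_distrib, Finset.sum_const, nsmul_eq_mul]
    rw [← Finset.mul_sum]
    field_simp
  have e2 : (∑ q ∈ I ×ˢ J, (ψ q.1 - ψ q.2)) ^ 2 ≤ (I.card * J.card) * ∑ q ∈ I ×ˢ J, (ψ q.1 - ψ q.2) ^ 2 := by
    have := sq_sum_le_card_mul_sum_sq (s := I ×ˢ J) (f := fun q => ψ q.1 - ψ q.2)
    rw [Finset.card_product] at this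
    exact_mod_cast this
  have e3 : ∀ i ∈ I, ∀ j ∈ J, (ψ i - ψ j) ^ 2 ≤
      8 / (p * (1 - p)) * D ^ (2 - p) * (-rk p ((i : ℝ) - j) * (ψ i - ψ j) ^ 2) := by
    intro i hi j hj
    by_cases h : i = j
    · subst h; simp
    have hd1 : 1 ≤ |(i : ℝ) - j| := by
      have : (1 : ℤ) ≤ |(i : ℤ) - j| := Int.one_le_abs (sub_ne_zero.2 (by exact_mod_cast h))
      exact_mod_cast this
    have hrk : rk p ((i : ℝ) - j) = rk p |(i : ℝ) - j| := by
      rcases abs_cases ((i : ℝ) - j) with ⟨h, _⟩ | ⟨h, _⟩ <;> rw [h]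
      rw [rk_neg]
    have h1 := rk_lower hp hp1 hd1
    rw [← hrk] at h1
    have h2 := Real.rpow_le_rpow_of_nonpos (by linarith) (hD i hi j hj) (show p - 2 ≤ 0 by linarith)
    have hD0 : 0 < D := lt_of_lt_of_le (by linarith) (hD i hi j hj)
    have h3 : D ^ (2 - p) * D ^ (p - 2) = 1 := by
      rw [← Real.rpow_add hD0]; simp
    have h4 : 1 ≤ 8 / (p * (1 - p)) * D ^ (2 - p) * (-rk p ((i : ℝ) - j)) := by
      calc 1 = 8 / (p * (1 - p)) * D ^ (2 - p) * (p * (1 - p) / 8 * D ^ (p - 2)) := by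
            have h5 : 8 / (p * (1 - p)) * (p * (1 - p) / 8) = 1 := by
              generalize p * (1 - p) = c at hpp; field_simp
            linear_combination -h5 - 8 / (p * (1 - p)) * (p * (1 - p) / 8) * h3
        _ ≤ 8 / (p * (1 - p)) * D ^ (2 - p) * (-rk p ((i : ℝ) - j)) := by
            gcongr
            exact le_trans (by gcongr) h1
    calc (ψ i - ψ j) ^ 2 = 1 * (ψ i - ψ j) ^ 2 := by ring
      _ ≤ (8 / (p * (1 - p)) * D ^ (2 - p) * (-rk p ((i : ℝ) - j))) * (ψ i - ψ j) ^ 2 := by gcongr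
      _ = _ := by ring
  have hD0 : 0 ≤ D := by
    obtain ⟨i, hi⟩ := hI0; obtain ⟨j, hj⟩ := hJ0
    exact (abs_nonneg _).trans (hD i hi j hj)
  have e4 : ∑ q ∈ I ×ˢ J, (ψ q.1 - ψ q.2) ^ 2 ≤ 8 / (p * (1 - p)) * D ^ (2 - p) * (2 * Qf p N ψ) := by
    calc ∑ q ∈ I ×ˢ J, (ψ q.1 - ψ q.2) ^ 2
        ≤ ∑ q ∈ I ×ˢ J, 8 / (p * (1 - p)) * D ^ (2 - p) * (-rk p ((q.1 : ℝ) - q.2) * (ψ q.1 - ψ q.2) ^ 2) :=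
          Finset.sum_le_sum fun q hq => e3 q.1 (Finset.mem_product.1 hq).1 q.2 (Finset.mem_product.1 hq).2
      _ = 8 / (p * (1 - p)) * D ^ (2 - p) * ∑ q ∈ I ×ˢ J, (-rk p ((q.1 : ℝ) - q.2) * (ψ q.1 - ψ q.2) ^ 2) := by
          rw [Finset.mul_sum]
      _ ≤ 8 / (p * (1 - p)) * D ^ (2 - p) * ∑ q ∈ Finset.range N ×ˢ Finset.range N,
            (-rk p ((q.1 : ℝ) - q.2) * (ψ q.1 - ψ q.2) ^ 2) := by
          refine mul_le_mul_of_nonneg_left (Finset.sum_le_sum_of_subset_of_nonneg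
            (Finset.product_subset_product hI hJ) ?_) (by positivity)
          intro q _ _; exact dir_nonneg hp hp1 ψ q.1 q.2
      _ ≤ _ := by
          rw [Finset.sum_product]
          gcongr
          exact Qf_ge_dir hp hp1 N ψ
  rw [e1, div_pow, div_le_iff₀ (by positivity)]
  calc _ ≤ (I.card * J.card) * ∑ q ∈ I ×ˢ J, (ψ q.1 - ψ q.2) ^ 2 := e2
    _ ≤ (I.card * J.card) * (8 / (p * (1 - p)) * D ^ (2 - p) * (2 * Qf p N ψ)) := by gcongr
    _ = _ := by field_simp; ring

/-- local nondeterminism in discrete form -/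
lemma lnd {p : ℝ} (hp : 0 < p) (hp1 : p < 1) : ∃ C : ℝ, 0 < C ∧ ∀ (R : ℕ) (ψ : ℕ → ℝ),
    (∀ i, R ≤ i → ψ i = 0) → ∀ s L : ℕ, 0 < L →
    ((∑ i ∈ Finset.Ico s (s + L), ψ i) / L) ^ 2 ≤ C * (L : ℝ) ^ (-p) * Qf p R ψ := by
  set A : ℝ := Real.sqrt (32 / (p * (1 - p))) with hA
  set q : ℝ := 2 ^ (-(p / 2)) with hq
  have hpp : 0 < p * (1 - p) := mul_pos hp (by linarith)
  have hA0 : 0 < A := Real.sqrt_pos.2 (by positivity)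
  have hq0 : 0 < q := by positivity
  have hq1 : q < 1 := Real.rpow_lt_one_of_one_lt_of_neg (by norm_num) (by linarith)
  refine ⟨(A / (1 - q)) ^ 2, pow_pos (div_pos hA0 (by linarith)) 2, ?_⟩
  intro R ψ hψ s L hL
  have hL0 : (0 : ℝ) < L := by exact_mod_cast hL
  set a : ℕ → ℝ := fun k => (∑ i ∈ Finset.Ico s (s + 2 ^ k * L), ψ i) / ((2 ^ k * L : ℕ) : ℝ) with ha
  set Q := Qf p R ψ with hQ
  have hQ0 : 0 ≤ Q := Qf_nonneg hp hp1 R ψ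
  set E : ℝ := A * (L : ℝ) ^ (-(p / 2)) * Real.sqrt Q with hE
  have hE0 : 0 ≤ E := by positivity
  have step : ∀ k, |a k - a (k + 1)| ≤ E * q ^ k := by
    intro k
    set M : ℕ := 2 ^ k * L with hM
    have hM0 : 0 < M := by positivity
    have hMr : (0 : ℝ) < M := by exact_mod_cast hM0
    have hM2 : 2 ^ (k + 1) * L = 2 * M := by rw [hM, pow_succ]; ring
    set N := max R (s + 2 * M) with hN
    have := avg_diff hp hp1 (N := N) ψ (I := Finset.Ico s (s + M)) (J := Finset.Ico s (s + 2 * M)) (D := 2 * M)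
      (fun i hi => by
        rw [Finset.mem_Ico] at hi; rw [Finset.mem_range]
        have := le_max_right R (s + 2 * M); omega)
      (fun i hi => by
        rw [Finset.mem_Ico] at hi; rw [Finset.mem_range]
        have := le_max_right R (s + 2 * M); omega)
      (Finset.nonempty_Ico.2 (by omega)) (Finset.nonempty_Ico.2 (by omega))
      (fun i hi j hj => by
        rw [Finset.mem_Ico] at hi hj
        rw [abs_le]
        have h1 : (i : ℝ) ≤ s + 2 * M := by exact_mod_cast (by omega : i ≤ s + 2 * M)
        have h2 : (j : ℝ) ≤ s + 2 * M := by exact_mod_cast (by omega : j ≤ s + 2 * M)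
        have h3 : (s : ℝ) ≤ i := by exact_mod_cast hi.1
        have h4 : (s : ℝ) ≤ j := by exact_mod_cast hj.1
        constructor <;> linarith)
    rw [Nat.card_Ico, Nat.card_Ico, Nat.add_sub_cancel_left, Nat.add_sub_cancel_left,
      Qf_ext (le_max_left _ _) hψ] at this
    have hak : a k - a (k + 1) = (∑ i ∈ Finset.Ico s (s + M), ψ i) / M -
        (∑ i ∈ Finset.Ico s (s + 2 * M), ψ i) / ((2 * M : ℕ) : ℝ) := by
      simp only [ha, hM2]; rfl
    refine abs_le_of_sq_le_sq ?_ (by positivity)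
    rw [hak]
    refine this.trans ?_
    have e1 : (2 * (M : ℝ)) ^ (2 - p) / (M * ((2 * M : ℕ) : ℝ)) ≤ 2 * (M : ℝ) ^ (-p) := by
      rw [Real.mul_rpow (by norm_num) hMr.le, Real.rpow_sub hMr, Real.rpow_neg hMr.le]
      have : (2 : ℝ) ^ (2 - p) ≤ 4 := by
        calc (2 : ℝ) ^ (2 - p) ≤ 2 ^ (2 : ℝ) := Real.rpow_le_rpow_of_exponent_le (by norm_num) (by linarith)
          _ = 4 := by norm_num
      push_cast
      rw [Real.rpow_two]
      have h0 : 0 < (M : ℝ) ^ p := by positivity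
      rw [div_le_iff₀ (by positivity)]
      field_simp
      linarith
    have e2 : (E * q ^ k) ^ 2 = 32 / (p * (1 - p)) * (M : ℝ) ^ (-p) * Q := by
      have hq2 : (q ^ k) ^ 2 = ((2 : ℝ) ^ k) ^ (-p) := by
        rw [hq, ← Real.rpow_natCast, ← Real.rpow_natCast, ← Real.rpow_natCast, ← Real.rpow_mul (by positivity),
          ← Real.rpow_mul (by positivity), ← Real.rpow_mul (by positivity)]
        congr 1; push_cast; ring
      have hL2 : ((L : ℝ) ^ (-(p / 2))) ^ 2 = (L : ℝ) ^ (-p) := by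
        rw [← Real.rpow_natCast, ← Real.rpow_mul hL0.le]; congr 1; push_cast; ring
      rw [mul_pow, hE, mul_pow, mul_pow, hq2, hL2, Real.sq_sqrt hQ0, hA, Real.sq_sqrt (by positivity), hM]
      push_cast
      rw [Real.mul_rpow (by positivity) hL0.le]
      ring
    rw [e2]
    calc _ = 16 / (p * (1 - p)) * ((2 * (M : ℝ)) ^ (2 - p) / (M * ((2 * M : ℕ) : ℝ))) * Q := by ring
      _ ≤ 16 / (p * (1 - p)) * (2 * (M : ℝ) ^ (-p)) * Q := by gcongr
      _ = _ := by ring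
  have hlim : Tendsto a atTop (𝓝 0) := by
    have hb : ∀ k, |a k| ≤ (∑ i ∈ Finset.range R, |ψ i|) * (1 / 2) ^ k := by
      intro k
      simp only [ha]
      rw [abs_div, div_le_iff₀ (by positivity)]
      have h1 : |∑ i ∈ Finset.Ico s (s + 2 ^ k * L), ψ i| ≤ ∑ i ∈ Finset.range R, |ψ i| := by
        refine (Finset.abs_sum_le_sum_abs _ _).trans ?_
        have : ∑ i ∈ Finset.Ico s (s + 2 ^ k * L), |ψ i| =
            ∑ i ∈ (Finset.Ico s (s + 2 ^ k * L)).filter (fun i => i < R), |ψ i| := by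
          rw [Finset.sum_filter]
          refine Finset.sum_congr rfl fun i _ => ?_
          split_ifs with h
          · rfl
          · rw [hψ i (not_lt.1 h), abs_zero]
        rw [this]
        refine Finset.sum_le_sum_of_subset_of_nonneg ?_ (fun _ _ _ => abs_nonneg _)
        intro i hi; rw [Finset.mem_filter] at hi; exact Finset.mem_range.2 hi.2
      have h2 : 0 ≤ ∑ i ∈ Finset.range R, |ψ i| := Finset.sum_nonneg fun _ _ => abs_nonneg _
      have h3 : (1 : ℝ) ≤ L := by exact_mod_cast hL
      rw [Nat.abs_cast]
      push_cast
      calc _ ≤ ∑ i ∈ Finset.range R, |ψ i| := h1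
        _ ≤ (∑ i ∈ Finset.range R, |ψ i|) * L := by nlinarith
        _ = (∑ i ∈ Finset.range R, |ψ i|) * (1 / 2) ^ k * (2 ^ k * L) := by
            rw [one_div, inv_pow]; field_simp
    refine squeeze_zero_norm hb ?_
    have := (tendsto_pow_atTop_nhds_zero_of_lt_one (show (0 : ℝ) ≤ 1 / 2 by norm_num) (by norm_num)).const_mul
      (∑ i ∈ Finset.range R, |ψ i|)
    simpa using this
  have hbd : ∀ K, |a 0 - a K| ≤ E / (1 - q) := by
    intro K
    have h1 : |a 0 - a K| ≤ ∑ k ∈ Finset.range K, E * q ^ k := by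
      have := Finset.sum_range_sub' a K
      rw [← this]
      exact (Finset.abs_sum_le_sum_abs _ _).trans (Finset.sum_le_sum fun k _ => step k)
    refine h1.trans ?_
    rw [← Finset.mul_sum, div_eq_mul_inv]
    gcongr
    have hg := geom_sum_eq hq1.ne K
    rw [hg, ← one_div, ← neg_div_neg_eq]
    have : 0 < 1 - q := by linarith
    rw [neg_sub, neg_sub]
    gcongr
    linarith [pow_pos hq0 K]
  have hfin : |a 0| ≤ E / (1 - q) := by
    have h1 : Tendsto (fun K => |a 0 - a K|) atTop (𝓝 |a 0 - 0|) := (tendsto_const_nhds.sub hlim).abs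
    rw [sub_zero] at h1
    exact le_of_tendsto' h1 hbd
  have ha0 : a 0 = (∑ i ∈ Finset.Ico s (s + L), ψ i) / L := by simp [ha]
  rw [← ha0, ← sq_abs]
  calc |a 0| ^ 2 ≤ (E / (1 - q)) ^ 2 := by gcongr
    _ = _ := by
      have hL2 : ((L : ℝ) ^ (-(p / 2))) ^ 2 = (L : ℝ) ^ (-p) := by
        rw [← Real.rpow_natCast, ← Real.rpow_mul hL0.le]; congr 1; push_cast; ring
      rw [hE, div_pow, div_pow, mul_pow, mul_pow, hL2, Real.sq_sqrt hQ0]; ring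

/-- decorrelation of distant blocks -/
lemma decor {p : ℝ} (hp : 0 < p) (hp1 : p < 1) {l M m : ℕ} (hl : 0 < l) (hm : 0 < m) (hM : (m + 1) * l ≤ M)
    (x y : ℕ → ℝ) :
    |∑ i ∈ Finset.range l, ∑ j ∈ Finset.range l, x i * y j * rk p ((M : ℝ) + j - i)| ≤
      1 / (p * m) * (Real.sqrt (Qf p l x) * Real.sqrt (Qf p l y)) := by
  have hl0 : (0 : ℝ) < l := by exact_mod_cast hl
  have hm0 : (0 : ℝ) < m := by exact_mod_cast hm
  have hm1 : (1 : ℝ) ≤ m := by exact_mod_cast hm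
  have hb : ∀ i ∈ Finset.range l, ∀ j ∈ Finset.range l, |rk p ((M : ℝ) + j - i)| ≤ (l : ℝ) ^ (p - 2) / m := by
    intro i hi j _
    have hi' : (i : ℝ) + 1 ≤ l := by exact_mod_cast Finset.mem_range.1 hi
    have hM' : ((m : ℝ) + 1) * l ≤ M := by exact_mod_cast hM
    have hj0 : (0 : ℝ) ≤ j := j.cast_nonneg
    have hml : 0 < (m : ℝ) * l := by positivity
    have h1 := rk_upper hp hp1 (d := (M : ℝ) + j - i) (by nlinarith)
    refine h1.trans ?_
    have h2 := Real.rpow_le_rpow_of_nonpos hml (show (m : ℝ) * l ≤ (M : ℝ) + j - i - 1 by nlinarith)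
      (show p - 2 ≤ 0 by linarith)
    refine h2.trans ?_
    rw [Real.mul_rpow hm0.le hl0.le, div_eq_inv_mul]
    gcongr
    rw [← Real.rpow_neg_one]
    exact Real.rpow_le_rpow_of_exponent_le hm1 (by linarith)
  have hcs : ∀ z : ℕ → ℝ, ∑ i ∈ Finset.range l, |z i| ≤
      Real.sqrt ((l : ℝ) * ((l : ℝ) ^ (1 - p) / p * Qf p l z)) := by
    intro z
    refine Real.le_sqrt_of_sq_le ?_
    have h1 := sq_sum_le_card_mul_sum_sq (s := Finset.range l) (f := fun i => |z i|)
    simp only [sq_abs, Finset.card_range] at h1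
    refine h1.trans ?_
    gcongr
    have h2 := Qf_ge_sq hp hp1 l z
    have h3 : (l : ℝ) ^ (1 - p) * (l : ℝ) ^ (p - 1) = 1 := by rw [← Real.rpow_add hl0]; simp
    have h4 : (l : ℝ) ^ (1 - p) / p * (p * (l : ℝ) ^ (p - 1) * ∑ i ∈ Finset.range l, z i ^ 2) =
        ∑ i ∈ Finset.range l, z i ^ 2 := by
      have : (l : ℝ) ^ (1 - p) / p * (p * (l : ℝ) ^ (p - 1) * ∑ i ∈ Finset.range l, z i ^ 2) =
        ((l : ℝ) ^ (1 - p) * (l : ℝ) ^ (p - 1)) * ∑ i ∈ Finset.range l, z i ^ 2 := by field_simp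
      rw [this, h3, one_mul]
    rw [← h4]
    gcongr
  have hmain : |∑ i ∈ Finset.range l, ∑ j ∈ Finset.range l, x i * y j * rk p ((M : ℝ) + j - i)| ≤
      (l : ℝ) ^ (p - 2) / m * ((∑ i ∈ Finset.range l, |x i|) * ∑ j ∈ Finset.range l, |y j|) := by
    rw [Finset.sum_mul_sum, Finset.mul_sum]
    refine (Finset.abs_sum_le_sum_abs _ _).trans (Finset.sum_le_sum fun i hi => ?_)
    rw [Finset.mul_sum]
    refine (Finset.abs_sum_le_sum_abs _ _).trans (Finset.sum_le_sum fun j hj => ?_)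
    rw [abs_mul, abs_mul, mul_comm]
    gcongr
    exact hb i hi j hj
  refine hmain.trans ?_
  have hQx := Qf_nonneg hp hp1 l x
  have hQy := Qf_nonneg hp hp1 l y
  calc _ ≤ (l : ℝ) ^ (p - 2) / m * (Real.sqrt ((l : ℝ) * ((l : ℝ) ^ (1 - p) / p * Qf p l x)) *
        Real.sqrt ((l : ℝ) * ((l : ℝ) ^ (1 - p) / p * Qf p l y))) := by
        gcongr
        exacts [hcs x, hcs y]
    _ = (l : ℝ) ^ (p - 2) / m * ((l : ℝ) * ((l : ℝ) ^ (1 - p) / p)) *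
        (Real.sqrt (Qf p l x) * Real.sqrt (Qf p l y)) := by
        rw [← mul_assoc (l : ℝ) _ (Qf p l x), ← mul_assoc (l : ℝ) _ (Qf p l y), Real.sqrt_mul (x := (l : ℝ) * ((l : ℝ) ^ (1 - p) / p)) (by positivity) (Qf p l x),
          Real.sqrt_mul (x := (l : ℝ) * ((l : ℝ) ^ (1 - p) / p)) (by positivity) (Qf p l y)]
        have : Real.sqrt ((l : ℝ) * ((l : ℝ) ^ (1 - p) / p)) * Real.sqrt ((l : ℝ) * ((l : ℝ) ^ (1 - p) / p))
          = (l : ℝ) * ((l : ℝ) ^ (1 - p) / p) := Real.mul_self_sqrt (by positivity)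
        calc _ = (l : ℝ) ^ (p - 2) / m * (Real.sqrt ((l : ℝ) * ((l : ℝ) ^ (1 - p) / p)) *
            Real.sqrt ((l : ℝ) * ((l : ℝ) ^ (1 - p) / p))) * (Real.sqrt (Qf p l x) * Real.sqrt (Qf p l y)) := by ring
          _ = _ := by rw [this]
    _ = _ := by
        congr 1
        have h3 : (l : ℝ) ^ (p - 2) * ((l : ℝ) * (l : ℝ) ^ (1 - p)) = 1 := by
          nth_rewrite 2 [← Real.rpow_one (l : ℝ)]
          rw [← Real.rpow_add hl0, ← Real.rpow_add hl0]
          rw [show p - 2 + (1 + (1 - p)) = 0 by ring, Real.rpow_zero]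
        have : (l : ℝ) ^ (p - 2) / m * ((l : ℝ) * ((l : ℝ) ^ (1 - p) / p)) =
          ((l : ℝ) ^ (p - 2) * ((l : ℝ) * (l : ℝ) ^ (1 - p))) / (p * m) := by field_simp
        rw [this, h3]
end

section
open Matrix in
/-- centred Gaussian law on `ι → ℝ` with covariance matrix `S` -/
def IsG {ι : Type*} [Fintype ι] (ν : Measure (ι → ℝ)) (S : Matrix ι ι ℝ) : Prop :=
  ∀ c : ι → ℝ, ν.map (fun x => c ⬝ᵥ x) = gaussianReal 0 (c ⬝ᵥ S *ᵥ c).toNNReal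

open Matrix in
lemma meas_dot {ι : Type*} [Fintype ι] (c : ι → ℝ) : Measurable (fun x : ι → ℝ => c ⬝ᵥ x) := by
  unfold dotProduct; fun_prop

open Matrix in
lemma pi_ext {ι : Type*} [Fintype ι] {μ ν : Measure (ι → ℝ)} [IsFiniteMeasure μ] [IsFiniteMeasure ν]
    (h : ∀ c : ι → ℝ, μ.map (fun x => c ⬝ᵥ x) = ν.map (fun x => c ⬝ᵥ x)) : μ = ν := by
  refine Measure.ext_of_charFunDual ?_
  ext Λ
  rw [charFunDual_eq_charFun_map_one, charFunDual_eq_charFun_map_one]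
  have : (Λ : (ι → ℝ) → ℝ) = fun x => (fun i => Λ (Pi.single i 1)) ⬝ᵥ x := by
    ext x
    conv_lhs => rw [← Finset.univ_sum_single x]
    rw [map_sum]
    refine Finset.sum_congr rfl fun i _ => ?_
    have : Pi.single i (x i) = x i • (Pi.single i (1 : ℝ) : ι → ℝ) := by
      rw [← Pi.single_smul, smul_eq_mul, mul_one]
    rw [this, map_smul, smul_eq_mul, mul_comm]
  rw [this, h]

open Matrix in
lemma IsG.prob {ι : Type*} [Fintype ι] {ν : Measure (ι → ℝ)} {S : Matrix ι ι ℝ} (h : IsG ν S) :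
    IsProbabilityMeasure ν := by
  have := h 0
  have h2 : IsProbabilityMeasure (ν.map (fun x => (0 : ι → ℝ) ⬝ᵥ x)) := by rw [this]; infer_instance
  exact (Measure.isProbabilityMeasure_map_iff (meas_dot 0).aemeasurable).1 h2

lemma IsG.unique {ι : Type*} [Fintype ι] {ν ν' : Measure (ι → ℝ)} {S : Matrix ι ι ℝ} (h : IsG ν S)
    (h' : IsG ν' S) : ν = ν' := by
  have := h.prob
  have := h'.prob
  exact pi_ext fun c => (h c).trans (h' c).symm

open Matrix in
lemma exists_IsG {ι : Type*} [Fintype ι] {S : Matrix ι ι ℝ} (hS : S.PosSemidef) :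
    ∃ ν : Measure (ι → ℝ), IsG ν S := by
  refine ⟨(multivariateGaussian 0 S).map (WithLp.ofLp), fun c => ?_⟩
  rw [Measure.map_map (meas_dot c) (by fun_prop)]
  have : IsProbabilityMeasure ((multivariateGaussian 0 S).map
      ((fun x => c ⬝ᵥ x) ∘ (WithLp.ofLp : EuclideanSpace ℝ ι → ι → ℝ))) :=
    Measure.isProbabilityMeasure_map ((meas_dot c).comp (by fun_prop)).aemeasurable
  refine Measure.ext_of_charFun ?_
  ext t
  rw [charFun_gaussianReal, charFun_apply, integral_map ((meas_dot c).comp (by fun_prop)).aemeasurable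
    (by fun_prop)]
  have := charFun_multivariateGaussian (μ := 0) hS (WithLp.toLp 2 (t • c))
  rw [charFun_apply] at this
  have e : ∀ x : EuclideanSpace ℝ ι, inner ℝ (((fun x => c ⬝ᵥ x) ∘ WithLp.ofLp) x) t =
      inner ℝ x (WithLp.toLp 2 (t • c)) := by
    intro x
    simp only [Function.comp, PiLp.inner_apply, dotProduct, RCLike.inner_apply, conj_trivial,
      Pi.smul_apply, smul_eq_mul, Finset.mul_sum]
    refine Finset.sum_congr rfl fun i _ => by ring
  simp only [e]
  rw [this]
  have h0 : 0 ≤ c ⬝ᵥ S *ᵥ c := by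
    have := hS.dotProduct_mulVec_nonneg c
    simpa using this
  rw [Real.coe_toNNReal _ h0]
  congr 1
  simp only [inner_zero_right, Matrix.mulVec_smul, dotProduct_smul, smul_dotProduct, smul_eq_mul]
  push_cast
  ring

open Matrix in
lemma IsG.mgf {ι : Type*} [Fintype ι] {ν : Measure (ι → ℝ)} {S : Matrix ι ι ℝ} (h : IsG ν S)
    (hS : ∀ c : ι → ℝ, 0 ≤ c ⬝ᵥ S *ᵥ c) (c : ι → ℝ) :
    Integrable (fun x => Real.exp (c ⬝ᵥ x)) ν ∧
    ∫ x, Real.exp (c ⬝ᵥ x) ∂ν = Real.exp ((c ⬝ᵥ S *ᵥ c) / 2) := by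
  have h1 := mgf_gaussianReal (h c) 1
  have h2 : Integrable (fun x => Real.exp (1 * x)) (ν.map (fun x => c ⬝ᵥ x)) := by
    rw [h c]; exact integrable_exp_mul_gaussianReal 1
  rw [integrable_map_measure (by fun_prop) (meas_dot c).aemeasurable] at h2
  constructor
  · refine h2.congr (ae_of_all _ fun x => ?_)
    simp [Function.comp]
  · unfold ProbabilityTheory.mgf at h1
    simp only [one_mul, mul_one, one_pow, zero_add, Real.coe_toNNReal _ (hS c)] at h1
    exact h1

/-- measures on the line with the same, everywhere finite, mgf coincide -/
lemma ext_of_mgf {μ ν : Measure ℝ} [IsProbabilityMeasure μ] [IsProbabilityMeasure ν]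
    (hi : ∀ t, Integrable (fun x => Real.exp (t * x)) μ)
    (h : ∀ t, ∫ x, Real.exp (t * x) ∂μ = ∫ x, Real.exp (t * x) ∂ν) : μ = ν := by
  refine Measure.ext_of_complexMGF_id_eq ?_
  ext z
  have hm : ProbabilityTheory.mgf id μ = ProbabilityTheory.mgf id ν := by
    ext t; exact h t
  refine eqOn_complexMGF_of_mgf hm ?_
  have : integrableExpSet id μ = univ := by
    ext t; simpa [integrableExpSet] using hi t
  simp [this]

open Matrix in
/-- finite dimensional Cameron–Martin -/
lemma IsG.cm {ι : Type*} [Fintype ι] {ν : Measure (ι → ℝ)} {S : Matrix ι ι ℝ} (h : IsG ν S)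
    (hS : ∀ c : ι → ℝ, 0 ≤ c ⬝ᵥ S *ᵥ c) (hsym : Sᵀ = S) (e : ι → ℝ) {Φ : (ι → ℝ) → ℝ≥0∞}
    (hΦ : Measurable Φ) :
    ∫⁻ x, Φ (x + S *ᵥ e) ∂ν =
      ∫⁻ x, ENNReal.ofReal (Real.exp (e ⬝ᵥ x - (e ⬝ᵥ S *ᵥ e) / 2)) * Φ x ∂ν := by
  have hp := h.prob
  have key : ν.map (fun x => x + S *ᵥ e) = ν.tilted (fun x => e ⬝ᵥ x) := by
    have p1 : IsProbabilityMeasure (ν.tilted (fun x => e ⬝ᵥ x)) :=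
      isProbabilityMeasure_tilted (h.mgf hS e).1
    have p2 : IsProbabilityMeasure (ν.map (fun x => x + S *ᵥ e)) :=
      Measure.isProbabilityMeasure_map (by fun_prop)
    refine pi_ext fun d => ?_
    have p3 : IsProbabilityMeasure ((ν.tilted (fun x => e ⬝ᵥ x)).map fun x => d ⬝ᵥ x) :=
      Measure.isProbabilityMeasure_map (meas_dot d).aemeasurable
    have p4 : IsProbabilityMeasure ((ν.map (fun x => x + S *ᵥ e)).map fun x => d ⬝ᵥ x) :=
      Measure.isProbabilityMeasure_map (meas_dot d).aemeasurable
    refine ext_of_mgf (fun t => ?_) (fun t => ?_)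
    · rw [Measure.map_map (meas_dot d) (by fun_prop), integrable_map_measure (by fun_prop)
        ((meas_dot d).comp (by fun_prop)).aemeasurable]
      refine ((h.mgf hS (t • d)).1.const_mul (Real.exp (t * (d ⬝ᵥ S *ᵥ e)))).congr
        (ae_of_all _ fun x => ?_)
      simp only [Function.comp, ← Real.exp_add, dotProduct_add, smul_dotProduct, smul_eq_mul]
      congr 1; ring
    · rw [Measure.map_map (meas_dot d) (by fun_prop), integral_map
        ((meas_dot d).comp (by fun_prop)).aemeasurable (by fun_prop), integral_map
        (meas_dot d).aemeasurable (by fun_prop), integral_exp_tilted]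
      have e1 : ∫ x, Real.exp (t * ((fun x => d ⬝ᵥ x) ∘ fun x => x + S *ᵥ e) x) ∂ν =
          Real.exp (t * (d ⬝ᵥ S *ᵥ e)) * ∫ x, Real.exp ((t • d) ⬝ᵥ x) ∂ν := by
        rw [← integral_const_mul]
        refine integral_congr_ae (ae_of_all _ fun x => ?_)
        simp only [Function.comp, ← Real.exp_add, dotProduct_add, smul_dotProduct, smul_eq_mul]
        congr 1; ring
      have e2 : ∫ x, Real.exp (((fun x => e ⬝ᵥ x) + fun x => t * d ⬝ᵥ x) x) ∂ν =
          ∫ x, Real.exp ((e + t • d) ⬝ᵥ x) ∂ν := by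
        refine integral_congr_ae (ae_of_all _ fun x => ?_)
        simp only [Pi.add_apply, add_dotProduct, smul_dotProduct, smul_eq_mul]
      rw [e1, e2, (h.mgf hS _).2, (h.mgf hS _).2, (h.mgf hS _).2, ← Real.exp_add, ← Real.exp_sub]
      congr 1
      have hs : e ⬝ᵥ S *ᵥ d = d ⬝ᵥ S *ᵥ e := by
        rw [dotProduct_mulVec, ← mulVec_transpose, hsym, dotProduct_comm]
      simp only [Matrix.mulVec_add, Matrix.mulVec_smul, dotProduct_add, add_dotProduct, dotProduct_smul,
        smul_dotProduct, smul_eq_mul, hs]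
      ring
  rw [← lintegral_map (f := Φ) (g := fun x => x + S *ᵥ e) hΦ (by fun_prop), key, lintegral_tilted]
  refine lintegral_congr fun x => ?_
  rw [(h.mgf hS e).2, ← Real.exp_sub]

open Matrix in
/-- the basic comparison estimate -/
lemma IsG.compare {ι : Type*} [Fintype ι] {ν : Measure (ι → ℝ)} {S : Matrix ι ι ℝ} (h : IsG ν S)
    (hS : ∀ c : ι → ℝ, 0 ≤ c ⬝ᵥ S *ᵥ c) (hsym : Sᵀ = S) (e : ι → ℝ) {Φ Y : (ι → ℝ) → ℝ≥0∞}
    (hΦ : Measurable Φ) (hY : Measurable Y) {K : ℝ≥0∞} (hK : ∀ x, Φ x ≤ K)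
    (hinv : ∀ (s : ℝ) x, Y (x + s • S *ᵥ e) = Y x) {η M : ℝ} (hη : 0 < η) (hM : 0 ≤ M) :
    ∫⁻ x, Y x * Φ (x + S *ᵥ e) ∂ν ≤ ENNReal.ofReal (1 + η) * ∫⁻ x, Y x * Φ x ∂ν
      + K * ENNReal.ofReal (Real.exp ((1 + M) ^ 2 * (e ⬝ᵥ S *ᵥ e) / 2 - M * Real.log (1 + η))) * ∫⁻ x, Y x ∂ν := by
  set q := e ⬝ᵥ S *ᵥ e with hq
  set l := Real.log (1 + η) with hl
  have hYΦ : Measurable fun x => Y x * Φ x := hY.mul hΦ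
  have h1 : ∫⁻ x, Y x * Φ (x + S *ᵥ e) ∂ν = ∫⁻ x, ENNReal.ofReal (Real.exp (e ⬝ᵥ x - q / 2)) * (Y x * Φ x) ∂ν := by
    rw [hq, ← h.cm hS hsym e hYΦ]
    refine lintegral_congr fun x => ?_
    have := hinv 1 x
    rw [one_smul] at this
    simp only [this]
  have h2 : ∫⁻ x, Y x ∂ν = ∫⁻ x, ENNReal.ofReal (Real.exp ((1 + M) * (e ⬝ᵥ x) - (1 + M) ^ 2 * q / 2)) * Y x ∂ν := by
    have := h.cm hS hsym ((1 + M) • e) hY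
    simp only [mulVec_smul, hinv, smul_dotProduct, dotProduct_smul, smul_eq_mul] at this
    rw [this]
    refine lintegral_congr fun x => ?_
    congr 4; rw [← hq]; ring
  have hpt : ∀ x : ι → ℝ, ENNReal.ofReal (Real.exp (e ⬝ᵥ x - q / 2)) ≤ ENNReal.ofReal (1 + η) +
      ENNReal.ofReal (Real.exp ((1 + M) ^ 2 * q / 2 - M * l)) *
        ENNReal.ofReal (Real.exp ((1 + M) * (e ⬝ᵥ x) - (1 + M) ^ 2 * q / 2)) := by
    intro x
    rw [← ENNReal.ofReal_mul (Real.exp_pos _).le, ← Real.exp_add, ← ENNReal.ofReal_add (by linarith) (Real.exp_pos _).le]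
    refine ENNReal.ofReal_le_ofReal ?_
    have hq0 : 0 ≤ q := hS e
    by_cases hc : Real.exp (e ⬝ᵥ x - q / 2) ≤ 1 + η
    · linarith [Real.exp_pos ((1 + M) ^ 2 * q / 2 - M * l + ((1 + M) * e ⬝ᵥ x - (1 + M) ^ 2 * q / 2))]
    · push Not at hc
      have h3 : l < e ⬝ᵥ x - q / 2 := by
        rw [hl, Real.log_lt_iff_lt_exp (by linarith)]; exact hc
      have : Real.exp (e ⬝ᵥ x - q / 2) ≤ Real.exp ((1 + M) ^ 2 * q / 2 - M * l + ((1 + M) * e ⬝ᵥ x - (1 + M) ^ 2 * q / 2)) := by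
        refine Real.exp_le_exp.2 ?_
        have : 0 ≤ M * (e ⬝ᵥ x - l) := mul_nonneg hM (by linarith)
        linarith
      linarith
  rw [h1, h2]
  have hm1 : Measurable fun x : ι → ℝ => ENNReal.ofReal (Real.exp ((1 + M) * (e ⬝ᵥ x) - (1 + M) ^ 2 * q / 2)) := by
    have := meas_dot e
    fun_prop
  calc ∫⁻ x, ENNReal.ofReal (Real.exp (e ⬝ᵥ x - q / 2)) * (Y x * Φ x) ∂ν
      ≤ ∫⁻ x, (ENNReal.ofReal (1 + η) * (Y x * Φ x) + K * ENNReal.ofReal (Real.exp ((1 + M) ^ 2 * q / 2 - M * l)) *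
        (ENNReal.ofReal (Real.exp ((1 + M) * (e ⬝ᵥ x) - (1 + M) ^ 2 * q / 2)) * Y x)) ∂ν := by
        refine lintegral_mono fun x => ?_
        calc _ ≤ (ENNReal.ofReal (1 + η) +
      ENNReal.ofReal (Real.exp ((1 + M) ^ 2 * q / 2 - M * l)) *
        ENNReal.ofReal (Real.exp ((1 + M) * (e ⬝ᵥ x) - (1 + M) ^ 2 * q / 2))) * (Y x * Φ x) := by
              gcongr; exact hpt x
          _ = ENNReal.ofReal (1 + η) * (Y x * Φ x) + Φ x * ENNReal.ofReal (Real.exp ((1 + M) ^ 2 * q / 2 - M * l)) *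
        (ENNReal.ofReal (Real.exp ((1 + M) * (e ⬝ᵥ x) - (1 + M) ^ 2 * q / 2)) * Y x) := by ring
          _ ≤ _ := by gcongr; exact hK x
    _ = _ := by
        rw [lintegral_add_left (hYΦ.const_mul _), lintegral_const_mul _ hYΦ,
          lintegral_const_mul _ (show Measurable fun x => _ * Y x from hm1.mul hY)]
end

section
open Matrix in
lemma IsG.of_mgf {ι : Type*} [Fintype ι] {ν : Measure (ι → ℝ)} [IsProbabilityMeasure ν] {S : Matrix ι ι ℝ}
    (hS : ∀ c : ι → ℝ, 0 ≤ c ⬝ᵥ S *ᵥ c)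
    (h : ∀ c : ι → ℝ, Integrable (fun x => Real.exp (c ⬝ᵥ x)) ν ∧
      ∫ x, Real.exp (c ⬝ᵥ x) ∂ν = Real.exp ((c ⬝ᵥ S *ᵥ c) / 2)) : IsG ν S := by
  intro c
  have p3 : IsProbabilityMeasure (ν.map fun x => c ⬝ᵥ x) :=
    Measure.isProbabilityMeasure_map (meas_dot c).aemeasurable
  refine ext_of_mgf (fun t => ?_) (fun t => ?_)
  · rw [integrable_map_measure (by fun_prop) (meas_dot c).aemeasurable]
    refine (h (t • c)).1.congr (ae_of_all _ fun x => ?_)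
    simp [Function.comp]
  · rw [integral_map (meas_dot c).aemeasurable (by fun_prop)]
    have e1 : ∫ x, Real.exp (t * c ⬝ᵥ x) ∂ν = ∫ x, Real.exp ((t • c) ⬝ᵥ x) ∂ν := by
      refine integral_congr_ae (ae_of_all _ fun x => ?_)
      simp
    have h1 := mgf_gaussianReal (μ := 0) (v := (c ⬝ᵥ S *ᵥ c).toNNReal) (X := id) (Measure.map_id) t
    unfold ProbabilityTheory.mgf at h1
    simp only [id] at h1
    rw [e1, (h _).2, h1, Real.coe_toNNReal _ (hS c)]
    simp only [Matrix.mulVec_smul, dotProduct_smul, smul_dotProduct, smul_eq_mul]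
    congr 1; ring

lemma r2 : ((Real.sqrt 2)⁻¹ : ℝ) * (Real.sqrt 2)⁻¹ = 1 / 2 := by
  rw [← mul_inv, Real.mul_self_sqrt (by norm_num)]; norm_num

lemma bint {α : Type*} [MeasurableSpace α] {μ : Measure α} [IsProbabilityMeasure μ] {f : α → ℝ}
    (hf : Measurable f) {C : ℝ} (h : ∀ x, |f x| ≤ C) : Integrable f μ :=
  Integrable.of_bound hf.aestronglyMeasurable C (ae_of_all _ fun x => by rw [Real.norm_eq_abs]; exact h x)

lemma bintm {α : Type*} [MeasurableSpace α] {μ : Measure α} [IsProbabilityMeasure μ] {f g : α → ℝ}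
    (hf : Measurable f) (hg : Measurable g) {C D : ℝ} (h : ∀ x, |f x| ≤ C) (h' : ∀ x, |g x| ≤ D) :
    Integrable (fun x => f x * g x) μ :=
  bint (hf.mul hg) (C := C * D) fun x => by
    rw [abs_mul]; exact mul_le_mul (h x) (h' x) (abs_nonneg _) ((abs_nonneg _).trans (h x))

lemma int6 {α : Type*} [MeasurableSpace α] {μ : Measure α} {f1 f2 f3 f4 f5 f6 : α → ℝ}
    (h1 : Integrable f1 μ) (h2 : Integrable f2 μ) (h3 : Integrable f3 μ) (h4 : Integrable f4 μ)
    (h5 : Integrable f5 μ) (h6 : Integrable f6 μ) :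
    ∫ x, (f1 x + f2 x + f3 x + f4 x - f5 x - f6 x) ∂μ =
      ∫ x, f1 x ∂μ + ∫ x, f2 x ∂μ + ∫ x, f3 x ∂μ + ∫ x, f4 x ∂μ - ∫ x, f5 x ∂μ - ∫ x, f6 x ∂μ := by
  have : ∫ x, (f1 + f2 + f3 + f4 - f5 - f6) x ∂μ =
      ∫ x, f1 x ∂μ + ∫ x, f2 x ∂μ + ∫ x, f3 x ∂μ + ∫ x, f4 x ∂μ - ∫ x, f5 x ∂μ - ∫ x, f6 x ∂μ := by
    rw [integral_sub' ((((h1.add h2).add h3).add h4).sub h5) h6, integral_sub' (((h1.add h2).add h3).add h4) h5,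
      integral_add' ((h1.add h2).add h3) h4, integral_add' (h1.add h2) h3, integral_add' h1 h2]
  exact this

open Matrix in
lemma IsG.half {ι : Type*} [Fintype ι] {ν : Measure (ι → ℝ)} {A : Matrix ι ι ℝ} (h : IsG ν A)
    (hA : ∀ c : ι → ℝ, 0 ≤ c ⬝ᵥ A *ᵥ c) :
    (ν.prod ν).map (fun p => (Real.sqrt 2)⁻¹ • (p.1 + p.2)) = ν := by
  have := h.prob
  have p2 : IsProbabilityMeasure ((ν.prod ν).map (fun p => (Real.sqrt 2)⁻¹ • (p.1 + p.2))) :=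
    Measure.isProbabilityMeasure_map (by fun_prop)
  refine IsG.unique (S := A) (IsG.of_mgf hA fun c => ?_) h
  set r := (Real.sqrt 2)⁻¹ with hr
  have e : ∀ p : (ι → ℝ) × (ι → ℝ), Real.exp (c ⬝ᵥ r • (p.1 + p.2)) =
      Real.exp ((r • c) ⬝ᵥ p.1) * Real.exp ((r • c) ⬝ᵥ p.2) := by
    intro p
    rw [← Real.exp_add]; simp only [dotProduct_smul, dotProduct_add, smul_dotProduct, smul_eq_mul]; congr 1; ring
  have hm := h.mgf hA (r • c)
  have md := meas_dot c
  constructor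
  · rw [integrable_map_measure (by fun_prop) (by fun_prop)]
    refine (hm.1.mul_prod hm.1).congr (ae_of_all _ fun p => (e p).symm)
  · rw [integral_map (by fun_prop) (by fun_prop), integral_congr_ae (ae_of_all _ e),
      integral_prod_mul (fun x => Real.exp ((r • c) ⬝ᵥ x)) (fun x => Real.exp ((r • c) ⬝ᵥ x)), hm.2, ← Real.exp_add]
    simp only [Matrix.mulVec_smul, dotProduct_smul, smul_dotProduct, smul_eq_mul]
    congr 1
    linear_combination (c ⬝ᵥ A *ᵥ c) * r2

/-- half Mehler step -/
def PP {ι : Type*} [Fintype ι] (ν : Measure (ι → ℝ)) (F : (ι → ℝ) → ℝ) (x : ι → ℝ) : ℝ :=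
  ∫ y, F ((Real.sqrt 2)⁻¹ • (x + y)) ∂ν

lemma PP_meas {ι : Type*} [Fintype ι] {ν : Measure (ι → ℝ)} [IsProbabilityMeasure ν] {F : (ι → ℝ) → ℝ}
    (hF : Measurable F) : Measurable (PP ν F) := by
  unfold PP
  refine (StronglyMeasurable.integral_prod_right (f := fun x y => F ((Real.sqrt 2)⁻¹ • (x + y))) ?_).measurable
  exact (hF.comp (by fun_prop : Measurable fun p : (ι → ℝ) × (ι → ℝ) => (Real.sqrt 2)⁻¹ • (p.1 + p.2))).stronglyMeasurable

lemma PP_bd {ι : Type*} [Fintype ι] {ν : Measure (ι → ℝ)} [IsProbabilityMeasure ν] {F : (ι → ℝ) → ℝ}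
    {C : ℝ} (h : ∀ x, |F x| ≤ C) (x : ι → ℝ) : |PP ν F x| ≤ C := by
  unfold PP
  rw [← Real.norm_eq_abs]
  have := norm_integral_le_of_norm_le_const (μ := ν) (f := fun y => F ((Real.sqrt 2)⁻¹ • (x + y))) (C := C)
    (ae_of_all _ fun y => by rw [Real.norm_eq_abs]; exact h _)
  simpa using this

lemma PP_int {ι : Type*} [Fintype ι] {ν : Measure (ι → ℝ)} {A : Matrix ι ι ℝ} (h : IsG ν A)
    (hA : ∀ c : ι → ℝ, 0 ≤ c ⬝ᵥ A.mulVec c) {F : (ι → ℝ) → ℝ} (hF : Measurable F)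
    {C : ℝ} (hb : ∀ x, |F x| ≤ C) : ∫ x, PP ν F x ∂ν = ∫ x, F x ∂ν := by
  have := h.prob
  have h1 : ∫ x, F x ∂ν = ∫ p, F ((Real.sqrt 2)⁻¹ • (p.1 + p.2)) ∂(ν.prod ν) := by
    conv_lhs => rw [← h.half hA]
    rw [integral_map (by fun_prop) hF.aestronglyMeasurable]
  rw [h1, integral_prod]
  · rfl
  · exact bint (hF.comp (by fun_prop)) fun _ => hb _

lemma PP_bessel {ι : Type*} [Fintype ι] {ν : Measure (ι → ℝ)} {A : Matrix ι ι ℝ} (h : IsG ν A)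
    (hA : ∀ c : ι → ℝ, 0 ≤ c ⬝ᵥ A.mulVec c) {F : (ι → ℝ) → ℝ} (hF : Measurable F)
    {C : ℝ} (hb : ∀ x, |F x| ≤ C) (h0 : ∫ x, F x ∂ν = 0) :
    2 * ∫ x, PP ν F x ^ 2 ∂ν ≤ ∫ x, F x ^ 2 ∂ν := by
  have := h.prob
  set r := (Real.sqrt 2)⁻¹ with hr
  have hC : 0 ≤ C := (abs_nonneg _).trans (hb 0)
  have hPm := PP_meas (ν := ν) hF
  have hPb := PP_bd (ν := ν) hb
  have hP0 := (PP_int h hA hF hb).trans h0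
  have sqb : ∀ {a b : ℝ}, |a| ≤ C → |b| ≤ C → |a * b| ≤ C * C := fun ha hb => by
    rw [abs_mul]; exact mul_le_mul ha hb (abs_nonneg _) hC
  have mF : Measurable fun p : (ι → ℝ) × (ι → ℝ) => F (r • (p.1 + p.2)) := hF.comp (by fun_prop)
  have m1 : Measurable fun p : (ι → ℝ) × (ι → ℝ) => PP ν F p.1 := hPm.comp measurable_fst
  have m2 : Measurable fun p : (ι → ℝ) × (ι → ℝ) => PP ν F p.2 := hPm.comp measurable_snd
  have i1 : ∫ p, F (r • (p.1 + p.2)) * F (r • (p.1 + p.2)) ∂(ν.prod ν) = ∫ x, F x ^ 2 ∂ν := by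
    conv_rhs => rw [← h.half hA]
    rw [integral_map (by fun_prop) (hF.pow_const 2).aestronglyMeasurable]
    simp only [sq]; rfl
  have i2 : ∫ p : (ι → ℝ) × (ι → ℝ), PP ν F p.1 * PP ν F p.1 ∂(ν.prod ν) = ∫ x, PP ν F x ^ 2 ∂ν := by
    rw [integral_prod _ (bintm m1 m1 (fun _ => hPb _) (fun _ => hPb _))]
    simp [sq]
  have i3 : ∫ p : (ι → ℝ) × (ι → ℝ), PP ν F p.2 * PP ν F p.2 ∂(ν.prod ν) = ∫ x, PP ν F x ^ 2 ∂ν := by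
    rw [integral_prod _ (bintm m2 m2 (fun _ => hPb _) (fun _ => hPb _))]
    simp [sq]
  have i4 : ∫ p : (ι → ℝ) × (ι → ℝ), PP ν F p.1 * PP ν F p.2 ∂(ν.prod ν) = 0 := by
    rw [integral_prod_mul (PP ν F) (PP ν F), hP0, zero_mul]
  have i5 : ∫ p : (ι → ℝ) × (ι → ℝ), PP ν F p.1 * F (r • (p.1 + p.2)) ∂(ν.prod ν) = ∫ x, PP ν F x ^ 2 ∂ν := by
    rw [integral_prod _ (bintm m1 mF (fun _ => hPb _) (fun _ => hb _))]
    refine integral_congr_ae (ae_of_all _ fun x => ?_)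
    simp only [integral_const_mul, sq]; rfl
  have i6 : ∫ p : (ι → ℝ) × (ι → ℝ), PP ν F p.2 * F (r • (p.1 + p.2)) ∂(ν.prod ν) = ∫ x, PP ν F x ^ 2 ∂ν := by
    rw [integral_prod_symm _ (bintm m2 mF (fun _ => hPb _) (fun _ => hb _))]
    refine integral_congr_ae (ae_of_all _ fun x => ?_)
    simp only [integral_const_mul, sq, add_comm _ x]; rfl
  have hpos : 0 ≤ ∫ p : (ι → ℝ) × (ι → ℝ), (F (r • (p.1 + p.2)) - PP ν F p.1 - PP ν F p.2) ^ 2 ∂(ν.prod ν) :=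
    integral_nonneg fun _ => sq_nonneg _
  have I1 := bintm (μ := ν.prod ν) mF mF (fun _ => hb _) (fun _ => hb _)
  have I2 := bintm (μ := ν.prod ν) m1 m1 (fun _ => hPb _) (fun _ => hPb _)
  have I3 := bintm (μ := ν.prod ν) m2 m2 (fun _ => hPb _) (fun _ => hPb _)
  have I4 := (bintm (μ := ν.prod ν) m1 m2 (fun _ => hPb _) (fun _ => hPb _)).const_mul 2
  have I5 := (bintm (μ := ν.prod ν) m1 mF (fun _ => hPb _) (fun _ => hb _)).const_mul 2
  have I6 := (bintm (μ := ν.prod ν) m2 mF (fun _ => hPb _) (fun _ => hb _)).const_mul 2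
  have e : ∫ p : (ι → ℝ) × (ι → ℝ), (F (r • (p.1 + p.2)) - PP ν F p.1 - PP ν F p.2) ^ 2 ∂(ν.prod ν) =
    ∫ p : (ι → ℝ) × (ι → ℝ), (((((F (r • (p.1 + p.2)) * F (r • (p.1 + p.2)) + PP ν F p.1 * PP ν F p.1)
      + PP ν F p.2 * PP ν F p.2) + 2 * (PP ν F p.1 * PP ν F p.2)) - 2 * (PP ν F p.1 * F (r • (p.1 + p.2))))
      - 2 * (PP ν F p.2 * F (r • (p.1 + p.2)))) ∂(ν.prod ν) :=
    integral_congr_ae (ae_of_all _ fun p => by ring)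
  rw [e, int6 I1 I2 I3 I4 I5 I6,
    integral_const_mul, integral_const_mul, integral_const_mul, i1, i2, i3, i4, i5, i6] at hpos
  linarith

open Matrix in
lemma blk_q {ι : Type*} [Fintype ι] (A C : Matrix ι ι ℝ) (c : ι ⊕ ι → ℝ) :
    c ⬝ᵥ (fromBlocks A C Cᵀ A) *ᵥ c = (c ∘ Sum.inl) ⬝ᵥ A *ᵥ (c ∘ Sum.inl) + (c ∘ Sum.inr) ⬝ᵥ A *ᵥ (c ∘ Sum.inr)
      + 2 * ((c ∘ Sum.inl) ⬝ᵥ C *ᵥ (c ∘ Sum.inr)) := by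
  have hs : (c ∘ Sum.inr) ⬝ᵥ Cᵀ *ᵥ (c ∘ Sum.inl) = (c ∘ Sum.inl) ⬝ᵥ C *ᵥ (c ∘ Sum.inr) := by
    rw [dotProduct_mulVec, vecMul_transpose, dotProduct_comm]
  rw [fromBlocks_mulVec]
  have : ∀ u v : ι → ℝ, c ⬝ᵥ Sum.elim u v = (c ∘ Sum.inl) ⬝ᵥ u + (c ∘ Sum.inr) ⬝ᵥ v := by
    intro u v; simp [dotProduct, Fintype.sum_sum_type]
  rw [this, dotProduct_add, dotProduct_add, hs]
  ring

open Matrix in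
/-- Gebelein type inequality for bounded centred functions -/
lemma geb {ι : Type*} [Fintype ι] {ν : Measure (ι → ℝ)} {A : Matrix ι ι ℝ} (h : IsG ν A)
    (hAs : Aᵀ = A) (hA : ∀ c : ι → ℝ, 0 ≤ c ⬝ᵥ A *ᵥ c) (j : ℕ) :
    ∀ (C : Matrix ι ι ℝ) (_ : ∀ c d : ι → ℝ, |c ⬝ᵥ C *ᵥ d| ≤ (1 / 2) ^ j * ((c ⬝ᵥ A *ᵥ c + d ⬝ᵥ A *ᵥ d) / 2))
    (ρ : Measure (ι ⊕ ι → ℝ)) (_ : IsG ρ (fromBlocks A C Cᵀ A)) (F G : (ι → ℝ) → ℝ) (_ : Measurable F)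
    (_ : Measurable G) (_ : ∃ M, ∀ x, |F x| ≤ M) (_ : ∃ M, ∀ x, |G x| ≤ M) (_ : ∫ x, F x ∂ν = 0)
    (_ : ∫ x, G x ∂ν = 0),
    ∫ z, F (z ∘ Sum.inl) * G (z ∘ Sum.inr) ∂ρ ≤ (1 / 2) ^ j * ((∫ x, F x ^ 2 ∂ν + ∫ x, G x ^ 2 ∂ν) / 2) := by
  have hp := h.prob
  have hblk : ∀ (C : Matrix ι ι ℝ) (j : ℕ) (_ : ∀ c d : ι → ℝ, |c ⬝ᵥ C *ᵥ d| ≤ (1 / 2) ^ j * ((c ⬝ᵥ A *ᵥ c + d ⬝ᵥ A *ᵥ d) / 2)),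
      ∀ c : ι ⊕ ι → ℝ, 0 ≤ c ⬝ᵥ (fromBlocks A C Cᵀ A) *ᵥ c := by
    intro C j hC c
    rw [blk_q]
    have h1 := abs_le.1 (hC (c ∘ Sum.inl) (c ∘ Sum.inr))
    have h2 : ((1 : ℝ) / 2) ^ j ≤ 1 := pow_le_one₀ (by norm_num) (by norm_num)
    have h3 := hA (c ∘ Sum.inl)
    have h4 := hA (c ∘ Sum.inr)
    have h5 := mul_le_of_le_one_left (by linarith : 0 ≤ ((c ∘ Sum.inl) ⬝ᵥ A *ᵥ (c ∘ Sum.inl) + (c ∘ Sum.inr) ⬝ᵥ A *ᵥ (c ∘ Sum.inr)) / 2) h2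
    linarith [h1.1]
  induction j with
  | zero =>
    intro C hC ρ hρ F G hF hG hFb hGb hF0 hG0
    have hρp := hρ.prob
    obtain ⟨MF, hMF⟩ := hFb
    obtain ⟨MG, hMG⟩ := hGb
    have hb := hblk C 0 hC
    have mi : Measurable fun z : ι ⊕ ι → ℝ => z ∘ Sum.inl := by
      refine measurable_pi_lambda _ fun i => ?_
      exact measurable_pi_apply _
    have mr : Measurable fun z : ι ⊕ ι → ℝ => z ∘ Sum.inr := by
      refine measurable_pi_lambda _ fun i => ?_
      exact measurable_pi_apply _
    have l1 : ρ.map (fun z => z ∘ Sum.inl) = ν := by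
      have : IsProbabilityMeasure (ρ.map (fun z => z ∘ Sum.inl)) := Measure.isProbabilityMeasure_map mi.aemeasurable
      refine IsG.unique (S := A) (fun c => ?_) h
      rw [Measure.map_map (meas_dot c) mi]
      have := hρ (Sum.elim c 0)
      rw [blk_q] at this
      simp only [Sum.elim_comp_inl, Sum.elim_comp_inr, mulVec_zero, dotProduct_zero, mul_zero, add_zero] at this
      rw [← this]
      congr 1; ext z
      simp [dotProduct, Fintype.sum_sum_type]
    have l2 : ρ.map (fun z => z ∘ Sum.inr) = ν := by
      have : IsProbabilityMeasure (ρ.map (fun z => z ∘ Sum.inr)) := Measure.isProbabilityMeasure_map mr.aemeasurable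
      refine IsG.unique (S := A) (fun c => ?_) h
      rw [Measure.map_map (meas_dot c) mr]
      have := hρ (Sum.elim 0 c)
      rw [blk_q] at this
      simp only [Sum.elim_comp_inl, Sum.elim_comp_inr, zero_dotProduct, mul_zero, add_zero, zero_add] at this
      rw [← this]
      congr 1; ext z
      simp [dotProduct, Fintype.sum_sum_type]
    have i1 : ∫ x, F x ^ 2 ∂ν = ∫ z, F (z ∘ Sum.inl) ^ 2 ∂ρ := by
      rw [← l1, integral_map mi.aemeasurable (hF.pow_const 2).aestronglyMeasurable]
    have i2 : ∫ x, G x ^ 2 ∂ν = ∫ z, G (z ∘ Sum.inr) ^ 2 ∂ρ := by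
      rw [← l2, integral_map mr.aemeasurable (hG.pow_const 2).aestronglyMeasurable]
    have j1 : Integrable (fun z => F (z ∘ Sum.inl) ^ 2) ρ := bint ((hF.comp mi).pow_const 2) (C := MF ^ 2)
      fun z => by rw [abs_pow]; exact pow_le_pow_left₀ (abs_nonneg _) (hMF _) 2
    have j2 : Integrable (fun z => G (z ∘ Sum.inr) ^ 2) ρ := bint ((hG.comp mr).pow_const 2) (C := MG ^ 2)
      fun z => by rw [abs_pow]; exact pow_le_pow_left₀ (abs_nonneg _) (hMG _) 2
    have j3 : Integrable (fun z => F (z ∘ Sum.inl) * G (z ∘ Sum.inr)) ρ := bint ((hF.comp mi).mul (hG.comp mr)) (C := MF * MG)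
      fun z => by
        rw [abs_mul]; exact mul_le_mul (hMF _) (hMG _) (abs_nonneg _) ((abs_nonneg _).trans (hMF 0))
    rw [pow_zero, one_mul, i1, i2, ← integral_add j1 j2, ← integral_div]
    refine integral_mono j3 ((j1.add j2).div_const 2) fun z => ?_
    have := sq_nonneg (F (z ∘ Sum.inl) - G (z ∘ Sum.inr))
    simp only [Pi.add_apply]
    linarith
  | succ j ih =>
    intro C hC ρ hρ F G hF hG hFb hGb hF0 hG0
    obtain ⟨MF, hMF⟩ := hFb
    obtain ⟨MG, hMG⟩ := hGb
    have hC2 : ∀ c d : ι → ℝ, |c ⬝ᵥ ((2 : ℝ) • C) *ᵥ d| ≤ (1 / 2) ^ j * ((c ⬝ᵥ A *ᵥ c + d ⬝ᵥ A *ᵥ d) / 2) := by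
      intro c d
      rw [smul_mulVec, dotProduct_smul, smul_eq_mul, abs_mul, abs_two]
      have := hC c d
      rw [pow_succ] at this
      linarith
    have hpos2 := hblk _ _ hC2
    have hpos1 := hblk _ _ hC
    obtain ⟨ρ', hρ'⟩ := exists_IsG (S := fromBlocks A ((2 : ℝ) • C) ((2 : ℝ) • C)ᵀ A) (by
      refine PosSemidef.of_dotProduct_mulVec_nonneg ?_ (fun c => by simpa using hpos2 c)
      rw [IsHermitian, conjTranspose_eq_transpose_of_trivial, fromBlocks_transpose, hAs, transpose_transpose])
    have hρp := hρ'.prob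
    set r := (Real.sqrt 2)⁻¹ with hr
    let g : (ι ⊕ ι → ℝ) × ((ι → ℝ) × (ι → ℝ)) → (ι ⊕ ι → ℝ) := fun p => r • (p.1 + Sum.elim p.2.1 p.2.2)
    have hg : Measurable g := by
      refine measurable_pi_lambda _ fun i => ?_
      rcases i with i | i
      · exact (by fun_prop : Measurable fun p : (ι ⊕ ι → ℝ) × ((ι → ℝ) × (ι → ℝ)) => r • (p.1 (Sum.inl i) + p.2.1 i))
      · exact (by fun_prop : Measurable fun p : (ι ⊕ ι → ℝ) × ((ι → ℝ) × (ι → ℝ)) => r • (p.1 (Sum.inr i) + p.2.2 i))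
    have hlaw : (ρ'.prod (ν.prod ν)).map g = ρ := by
      have p2 : IsProbabilityMeasure ((ρ'.prod (ν.prod ν)).map g) := Measure.isProbabilityMeasure_map hg.aemeasurable
      refine IsG.unique (IsG.of_mgf hpos1 fun c => ?_) hρ
      have e : ∀ p : (ι ⊕ ι → ℝ) × ((ι → ℝ) × (ι → ℝ)), Real.exp (c ⬝ᵥ g p) =
          Real.exp ((r • c) ⬝ᵥ p.1) * (Real.exp ((r • (c ∘ Sum.inl)) ⬝ᵥ p.2.1) * Real.exp ((r • (c ∘ Sum.inr)) ⬝ᵥ p.2.2)) := by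
        intro p
        rw [← Real.exp_add, ← Real.exp_add]
        have : c ⬝ᵥ Sum.elim p.2.1 p.2.2 = (c ∘ Sum.inl) ⬝ᵥ p.2.1 + (c ∘ Sum.inr) ⬝ᵥ p.2.2 := by
          simp [dotProduct, Fintype.sum_sum_type]
        simp only [g, dotProduct_smul, dotProduct_add, smul_dotProduct, smul_eq_mul, this]; congr 1; ring
      have k1 := hρ'.mgf hpos2 (r • c)
      have k2 := h.mgf hA (r • (c ∘ Sum.inl))
      have k3 := h.mgf hA (r • (c ∘ Sum.inr))
      have md := meas_dot c
      constructor
      · rw [integrable_map_measure (by fun_prop) hg.aemeasurable]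
        exact (k1.1.mul_prod (k2.1.mul_prod k3.1)).congr (ae_of_all _ fun p => (e p).symm)
      · rw [integral_map hg.aemeasurable (by fun_prop), integral_congr_ae (ae_of_all _ e),
          integral_prod_mul (fun x => Real.exp ((r • c) ⬝ᵥ x))
            (fun q : (ι → ℝ) × (ι → ℝ) => Real.exp ((r • (c ∘ Sum.inl)) ⬝ᵥ q.1) * Real.exp ((r • (c ∘ Sum.inr)) ⬝ᵥ q.2)),
          integral_prod_mul (fun x => Real.exp ((r • (c ∘ Sum.inl)) ⬝ᵥ x)) (fun x => Real.exp ((r • (c ∘ Sum.inr)) ⬝ᵥ x)),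
          k1.2, k2.2, k3.2, ← Real.exp_add, ← Real.exp_add]
        congr 1
        simp only [Matrix.mulVec_smul, dotProduct_smul, smul_dotProduct, smul_eq_mul, blk_q, smul_mulVec]
        linear_combination (2 * ((c ∘ Sum.inl) ⬝ᵥ A *ᵥ (c ∘ Sum.inl) + (c ∘ Sum.inr) ⬝ᵥ A *ᵥ (c ∘ Sum.inr)
          + 2 * ((c ∘ Sum.inl) ⬝ᵥ C *ᵥ (c ∘ Sum.inr))) / 2) * r2
    have mi : Measurable fun z : ι ⊕ ι → ℝ => z ∘ Sum.inl := by
      refine measurable_pi_lambda _ fun i => ?_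
      exact measurable_pi_apply _
    have mr : Measurable fun z : ι ⊕ ι → ℝ => z ∘ Sum.inr := by
      refine measurable_pi_lambda _ fun i => ?_
      exact measurable_pi_apply _
    have hFG : Measurable fun z : ι ⊕ ι → ℝ => F (z ∘ Sum.inl) * G (z ∘ Sum.inr) := (hF.comp mi).mul (hG.comp mr)
    have hbd : ∀ z : ι ⊕ ι → ℝ, |F (z ∘ Sum.inl) * G (z ∘ Sum.inr)| ≤ MF * MG := fun z => by
        rw [abs_mul]; exact mul_le_mul (hMF _) (hMG _) (abs_nonneg _) ((abs_nonneg _).trans (hMF 0))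
    have step : ∫ z, F (z ∘ Sum.inl) * G (z ∘ Sum.inr) ∂ρ =
        ∫ z, PP ν F (z ∘ Sum.inl) * PP ν G (z ∘ Sum.inr) ∂ρ' := by
      have hI : Integrable (fun p => F (g p ∘ Sum.inl) * G (g p ∘ Sum.inr)) (ρ'.prod (ν.prod ν)) :=
        bint (hFG.comp hg) fun _ => hbd _
      rw [← hlaw, integral_map hg.aemeasurable hFG.aestronglyMeasurable, integral_prod _ hI]
      refine integral_congr_ae (ae_of_all _ fun z => ?_)
      exact integral_prod_mul (fun x => F (r • (z ∘ Sum.inl + x))) (fun y => G (r • (z ∘ Sum.inr + y)))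
    rw [step]
    refine (ih _ hC2 ρ' hρ' (PP ν F) (PP ν G) (PP_meas hF) (PP_meas hG) ⟨MF, PP_bd hMF⟩ ⟨MG, PP_bd hMG⟩
      ((PP_int h hA hF hMF).trans hF0) ((PP_int h hA hG hMG).trans hG0)).trans ?_
    have b1 := PP_bessel h hA hF hMF hF0
    have b2 := PP_bessel h hA hG hMG hG0
    rw [pow_succ, mul_assoc]
    refine mul_le_mul_of_nonneg_left ?_ (by positivity)
    linarith
end

section
/-! ### Framework: increments of fractional Brownian motion -/
section M7
set_option linter.unusedSectionVars false
open Matrix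
variable {Ω : Type*} [MeasurableSpace Ω] {P : Measure Ω} [IsProbabilityMeasure P] {H : ℝ} {B : ℝ → Ω → ℝ} {aH : ℝ}

lemma fb_comb (hB : IsFBM H P B) {κ : Type*} [Fintype κ] (t c : κ → ℝ) :
    ∃ v : ℝ≥0, Measure.map (fun ω => ∑ i, c i * B (t i) ω) P = gaussianReal 0 v := by
  obtain ⟨v, hv⟩ := hB.2.2.2.1 (Fintype.card κ) (t ∘ (Fintype.equivFin κ).symm) (c ∘ (Fintype.equivFin κ).symm)
  refine ⟨v, ?_⟩
  rw [← hv]; congr 1; funext ω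
  exact (Equiv.sum_comp (Fintype.equivFin κ).symm (fun i => c i * B (t i) ω)).symm

lemma fb_memLp (hB : IsFBM H P B) (t : ℝ) (p : ℝ≥0) : MemLp (B t) p P := by
  obtain ⟨v, hv⟩ := fb_comb hB (fun _ : Unit => t) (fun _ => 1)
  simp only [Finset.univ_unique, Finset.sum_singleton, one_mul] at hv
  have h := memLp_id_gaussianReal (μ := 0) (v := v) p
  rw [← hv, memLp_map_measure_iff (by fun_prop) (hB.2.2.1 t).aemeasurable] at h
  exact h

/-- the covariance of increments -/
def cv (aH H a b c d : ℝ) : ℝ :=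
  aH / 2 * (|a - d| ^ (2 * H) + |b - c| ^ (2 * H) - |a - c| ^ (2 * H) - |b - d| ^ (2 * H))

lemma fb_int2 (hB : IsFBM H P B) (a b c d : ℝ) : Integrable (fun ω => (B a ω - B b ω) * (B c ω - B d ω)) P := by
  have m2 : ∀ t, MemLp (B t) 2 P := fun t => by simpa using fb_memLp hB t 2
  exact ((m2 a).sub (m2 b)).integrable_mul ((m2 c).sub (m2 d))

lemma fb_cov (hB : IsFBM H P B) (ha : ∀ s t : ℝ, ∫ ω, (B t ω - B s ω) ^ 2 ∂P = aH * |t - s| ^ (2 * H)) (a b c d : ℝ) :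
    ∫ ω, (B a ω - B b ω) * (B c ω - B d ω) ∂P = cv aH H a b c d := by
  have I := fb_int2 hB
  have e : ∀ ω, (B a ω - B b ω) * (B c ω - B d ω) = 1 / 2 * ((B a ω - B d ω) * (B a ω - B d ω))
      + 1 / 2 * ((B b ω - B c ω) * (B b ω - B c ω)) - 1 / 2 * ((B a ω - B c ω) * (B a ω - B c ω))
      - 1 / 2 * ((B b ω - B d ω) * (B b ω - B d ω)) := fun ω => by ring
  have i1 := (I a d a d).const_mul (1 / 2)
  have i2 := (I b c b c).const_mul (1 / 2)
  have i3 := (I a c a c).const_mul (1 / 2)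
  have i4 := (I b d b d).const_mul (1 / 2)
  have q : ∀ s t : ℝ, ∫ ω, (B t ω - B s ω) * (B t ω - B s ω) ∂P = aH * |t - s| ^ (2 * H) := fun s t => by
    rw [← ha]; simp only [sq]
  rw [integral_congr_ae (ae_of_all _ e)]
  refine (integral_sub ((i1.add i2).sub i3) i4).trans ?_
  rw [integral_sub' (i1.add i2) i3, integral_add' i1 i2]
  simp only [integral_const_mul, q, cv]
  ring

lemma fb_IsG (hB : IsFBM H P B) (ha : ∀ s t : ℝ, ∫ ω, (B t ω - B s ω) ^ 2 ∂P = aH * |t - s| ^ (2 * H))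
    {κ : Type*} [Fintype κ] (a b : κ → ℝ) (S : Matrix κ κ ℝ) (hS : ∀ i j, S i j = cv aH H (a i) (b i) (a j) (b j)) :
    IsG (P.map fun ω i => B (a i) ω - B (b i) ω) S := by
  intro c
  have mD : Measurable fun ω (i : κ) => B (a i) ω - B (b i) ω :=
    measurable_pi_lambda _ fun i => (hB.2.2.1 _).sub (hB.2.2.1 _)
  rw [Measure.map_map (meas_dot c) mD]
  obtain ⟨v, hv⟩ := fb_comb hB (Sum.elim a b) (Sum.elim c (fun i => - c i))
  have e : (fun x : κ → ℝ => c ⬝ᵥ x) ∘ (fun ω (i : κ) => B (a i) ω - B (b i) ω) =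
      fun ω => ∑ i, (Sum.elim c (fun i => - c i)) i * B (Sum.elim a b i) ω := by
    funext ω
    simp only [Function.comp, dotProduct, Fintype.sum_sum_type, Sum.elim_inl, Sum.elim_inr, ← Finset.sum_add_distrib]
    exact Finset.sum_congr rfl fun i _ => by ring
  rw [e, hv]
  congr 1
  have h1 : ∫ x, x ^ 2 ∂(gaussianReal 0 v) = v := by
    have := variance_id_gaussianReal (μ := 0) (v := v)
    rw [variance_eq_integral (by fun_prop)] at this
    simpa using this
  have hm : Measurable fun ω => ∑ i, (Sum.elim c (fun i => - c i)) i * B (Sum.elim a b i) ω := by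
    rw [← e]; exact (meas_dot c).comp mD
  rw [← hv, integral_map hm.aemeasurable (by fun_prop)] at h1
  have h2 : ∫ ω, ((fun x : κ → ℝ => c ⬝ᵥ x) ∘ (fun ω (i : κ) => B (a i) ω - B (b i) ω)) ω ^ 2 ∂P = c ⬝ᵥ S *ᵥ c := by
    have key : ∀ ω, ((fun x : κ → ℝ => c ⬝ᵥ x) ∘ (fun ω (i : κ) => B (a i) ω - B (b i) ω)) ω ^ 2 =
        ∑ i, ∑ j, c i * c j * ((B (a i) ω - B (b i) ω) * (B (a j) ω - B (b j) ω)) := fun ω => by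
      simp only [Function.comp, dotProduct, sq, Finset.sum_mul_sum]
      exact Finset.sum_congr rfl fun i _ => Finset.sum_congr rfl fun j _ => by ring
    rw [integral_congr_ae (ae_of_all _ key), integral_finsetSum]
    · simp only [dotProduct, mulVec, Finset.mul_sum]
      refine Finset.sum_congr rfl fun i _ => ?_
      rw [integral_finsetSum _ fun j _ => (fb_int2 hB _ _ _ _).const_mul _]
      refine Finset.sum_congr rfl fun j _ => ?_
      rw [integral_const_mul, fb_cov hB ha, hS]; ring
    · exact fun i _ => integrable_finsetSum _ fun j _ => (fb_int2 hB _ _ _ _).const_mul _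
  have h3 : (v : ℝ) = c ⬝ᵥ S *ᵥ c := by rw [← h1, ← h2, e]
  rw [← h3, Real.toNNReal_coe]

/-- grid increments -/
def incr (B : ℝ → Ω → ℝ) (s τ : ℝ) (R : ℕ) (ω : Ω) : Fin R → ℝ :=
  fun i => B (s + ((i : ℝ) + 1) * τ) ω - B (s + (i : ℝ) * τ) ω

/-- covariance matrix of grid increments -/
def Sm (aH H τ : ℝ) (R : ℕ) : Matrix (Fin R) (Fin R) ℝ :=
  fun i j => aH * τ ^ (2 * H) * rk (2 * H) ((i : ℝ) - j)

/-- cross covariance matrix of grid increments -/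
def Cm (aH H τ : ℝ) (R : ℕ) (M : ℝ) : Matrix (Fin R) (Fin R) ℝ :=
  fun i j => aH * τ ^ (2 * H) * rk (2 * H) (M + j - i)

lemma cv_grid {τ : ℝ} (hτ : 0 < τ) (s x y : ℝ) :
    cv aH H (s + (x + 1) * τ) (s + x * τ) (s + (y + 1) * τ) (s + y * τ) = aH * τ ^ (2 * H) * rk (2 * H) (x - y) := by
  have e : ∀ u v : ℝ, |s + u * τ - (s + v * τ)| ^ (2 * H) = τ ^ (2 * H) * |u - v| ^ (2 * H) := fun u v => by
    rw [show s + u * τ - (s + v * τ) = τ * (u - v) by ring, abs_mul, abs_of_pos hτ, Real.mul_rpow hτ.le (abs_nonneg _)]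
  rw [cv, e, e, e, e, rk, show x + 1 - y = x - y + 1 by ring, show x - (y + 1) = x - y - 1 by ring,
    show x + 1 - (y + 1) = x - y by ring]
  ring

lemma incr_meas (hB : IsFBM H P B) (s τ : ℝ) (R : ℕ) : Measurable (incr B s τ R) :=
  measurable_pi_lambda _ fun i => (hB.2.2.1 _).sub (hB.2.2.1 _)

lemma incr_IsG (hB : IsFBM H P B) (ha : ∀ s t : ℝ, ∫ ω, (B t ω - B s ω) ^ 2 ∂P = aH * |t - s| ^ (2 * H))
    {τ : ℝ} (hτ : 0 < τ) (s : ℝ) (R : ℕ) : IsG (P.map (incr B s τ R)) (Sm aH H τ R) :=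
  fb_IsG hB ha (fun i : Fin R => s + ((i : ℝ) + 1) * τ) (fun i => s + (i : ℝ) * τ) _ fun i j =>
    (cv_grid hτ s _ _).symm

lemma incr2_IsG (hB : IsFBM H P B) (ha : ∀ s t : ℝ, ∫ ω, (B t ω - B s ω) ^ 2 ∂P = aH * |t - s| ^ (2 * H))
    {τ : ℝ} (hτ : 0 < τ) (s : ℝ) (R M : ℕ) :
    IsG (P.map fun ω => Sum.elim (incr B s τ R ω) (incr B (s + M * τ) τ R ω))
      (fromBlocks (Sm aH H τ R) (Cm aH H τ R M) (Cm aH H τ R M)ᵀ (Sm aH H τ R)) := by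
  have := fb_IsG hB ha (Sum.elim (fun i : Fin R => s + ((i : ℝ) + 1) * τ) (fun i : Fin R => s + ((M + i : ℝ) + 1) * τ))
    (Sum.elim (fun i : Fin R => s + (i : ℝ) * τ) (fun i : Fin R => s + (M + i : ℝ) * τ))
    (fromBlocks (Sm aH H τ R) (Cm aH H τ R M) (Cm aH H τ R M)ᵀ (Sm aH H τ R)) ?_
  · convert this using 3 with ω
    funext i
    rcases i with i | i
    · simp [incr]
    · simp only [Sum.elim_inr, incr]; congr 2 <;> ring
  · rintro (i | i) (j | j)
    · simp only [fromBlocks_apply₁₁, Sum.elim_inl, cv_grid hτ, Sm]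
    · simp only [fromBlocks_apply₁₂, Sum.elim_inl, Sum.elim_inr, cv_grid hτ, Cm]
      rw [← rk_neg]; congr 2; ring
    · simp only [fromBlocks_apply₂₁, Sum.elim_inl, Sum.elim_inr, cv_grid hτ, Cm, transpose_apply]
    · simp only [fromBlocks_apply₂₂, Sum.elim_inr, cv_grid hτ, Sm]; congr 2; ring

/-- extension by zero -/
def ex0 {R : ℕ} (c : Fin R → ℝ) : ℕ → ℝ := fun i => if h : i < R then c ⟨i, h⟩ else 0

lemma ex0_val {R : ℕ} (c : Fin R → ℝ) (i : Fin R) : ex0 c i = c i := by simp [ex0]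

lemma Sm_sym (τ : ℝ) (R : ℕ) : (Sm aH H τ R)ᵀ = Sm aH H τ R := by
  ext i j; simp only [transpose_apply, Sm]; rw [← rk_neg]; congr 2; ring

lemma Sm_q (τ : ℝ) (R : ℕ) (c : Fin R → ℝ) :
    c ⬝ᵥ Sm aH H τ R *ᵥ c = aH * τ ^ (2 * H) * Qf (2 * H) R (ex0 c) := by
  simp only [dotProduct, mulVec, Qf, Finset.mul_sum, Finset.sum_range, ex0_val, Sm]
  exact Finset.sum_congr rfl fun i _ => Finset.sum_congr rfl fun j _ => by ring

lemma Cm_q (τ : ℝ) (R : ℕ) (M : ℝ) (c d : Fin R → ℝ) :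
    c ⬝ᵥ Cm aH H τ R M *ᵥ d = aH * τ ^ (2 * H) *
      ∑ i ∈ Finset.range R, ∑ j ∈ Finset.range R, ex0 c i * ex0 d j * rk (2 * H) (M + j - i) := by
  simp only [dotProduct, mulVec, Finset.mul_sum, Finset.sum_range, ex0_val, Cm]
  exact Finset.sum_congr rfl fun i _ => Finset.sum_congr rfl fun j _ => by ring
end M7
end

section
section M8
open Matrix
lemma iSup_mul_mono {f g : ℕ → ℝ≥0∞} (hf : Monotone f) (hg : Monotone g) : (⨆ n, f n) * (⨆ n, g n) = ⨆ n, f n * g n := by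
  refine le_antisymm ?_ (iSup_le fun n => mul_le_mul' (le_iSup f n) (le_iSup g n))
  rw [ENNReal.iSup_mul]
  refine iSup_le fun m => ?_
  rw [ENNReal.mul_iSup]
  exact iSup_le fun n => le_trans (mul_le_mul' (hf (le_max_left m n)) (hg (le_max_right m n)))
    (le_iSup (fun n => f n * g n) (max m n))

lemma marg_inl {ι : Type*} [Fintype ι] {A C D : Matrix ι ι ℝ} {ρ : Measure (ι ⊕ ι → ℝ)}
    (hρ : IsG ρ (fromBlocks A C D A)) : IsG (ρ.map fun z => z ∘ Sum.inl) A := by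
  intro c
  have m : Measurable fun z : ι ⊕ ι → ℝ => z ∘ Sum.inl := measurable_pi_lambda _ fun i => measurable_pi_apply _
  rw [Measure.map_map (meas_dot c) m]
  have := hρ (Sum.elim c 0)
  convert this using 2
  · funext z; simp [dotProduct, Fintype.sum_sum_type]
  · congr 1; simp [dotProduct, mulVec, Fintype.sum_sum_type]

lemma marg_inr {ι : Type*} [Fintype ι] {A C D : Matrix ι ι ℝ} {ρ : Measure (ι ⊕ ι → ℝ)}
    (hρ : IsG ρ (fromBlocks A C D A)) : IsG (ρ.map fun z => z ∘ Sum.inr) A := by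
  intro c
  have m : Measurable fun z : ι ⊕ ι → ℝ => z ∘ Sum.inr := measurable_pi_lambda _ fun i => measurable_pi_apply _
  rw [Measure.map_map (meas_dot c) m]
  have := hρ (Sum.elim 0 c)
  convert this using 2
  · funext z; simp [dotProduct, Fintype.sum_sum_type]
  · congr 1; simp [dotProduct, mulVec, Fintype.sum_sum_type]

lemma geb_real {ι : Type*} [Fintype ι] {ν : Measure (ι → ℝ)} {A : Matrix ι ι ℝ} (h : IsG ν A)
    (hAs : Aᵀ = A) (hA : ∀ c : ι → ℝ, 0 ≤ c ⬝ᵥ A *ᵥ c) (j : ℕ)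
    (C : Matrix ι ι ℝ) (hC : ∀ c d : ι → ℝ, |c ⬝ᵥ C *ᵥ d| ≤ (1 / 2) ^ j * ((c ⬝ᵥ A *ᵥ c + d ⬝ᵥ A *ᵥ d) / 2))
    (ρ : Measure (ι ⊕ ι → ℝ)) (hρ : IsG ρ (fromBlocks A C Cᵀ A)) (F G : (ι → ℝ) → ℝ) (hF : Measurable F)
    (hG : Measurable G) (bF : ∃ M, ∀ x, |F x| ≤ M) (bG : ∃ M, ∀ x, |G x| ≤ M) :
    ∫ z, F (z ∘ Sum.inl) * G (z ∘ Sum.inr) ∂ρ ≤ (∫ x, F x ∂ν) * (∫ x, G x ∂ν) +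
      (1 / 2) ^ j * ((∫ x, F x ^ 2 ∂ν + ∫ x, G x ^ 2 ∂ν) / 2) := by
  have hp := h.prob
  have hp' := hρ.prob
  obtain ⟨MF, hMF⟩ := bF
  obtain ⟨MG, hMG⟩ := bG
  set mF := ∫ x, F x ∂ν
  set mG := ∫ x, G x ∂ν
  have iF : Integrable F ν := bint hF hMF
  have iG : Integrable G ν := bint hG hMG
  have iF2 : Integrable (fun x => F x ^ 2) ν := bint (hF.pow_const 2) (C := MF ^ 2) fun x => by
    rw [abs_pow]; exact pow_le_pow_left₀ (abs_nonneg _) (hMF x) 2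
  have iG2 : Integrable (fun x => G x ^ 2) ν := bint (hG.pow_const 2) (C := MG ^ 2) fun x => by
    rw [abs_pow]; exact pow_le_pow_left₀ (abs_nonneg _) (hMG x) 2
  have mi : Measurable fun z : ι ⊕ ι → ℝ => z ∘ Sum.inl := measurable_pi_lambda _ fun i => measurable_pi_apply _
  have mr : Measurable fun z : ι ⊕ ι → ℝ => z ∘ Sum.inr := measurable_pi_lambda _ fun i => measurable_pi_apply _
  have e1 : ρ.map (fun z => z ∘ Sum.inl) = ν := (marg_inl hρ).unique h
  have e2 : ρ.map (fun z => z ∘ Sum.inr) = ν := (marg_inr hρ).unique h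
  have c : ∀ f : (ι → ℝ) → ℝ, Integrable f ν → ∫ x, (f x - ∫ y, f y ∂ν) ∂ν = 0 := fun f hf => by
    rw [integral_sub hf (integrable_const _)]; simp
  have key := geb h hAs hA j C hC ρ hρ (fun x => F x - mF) (fun x => G x - mG) (hF.sub_const _) (hG.sub_const _)
    ⟨MF + |mF|, fun x => (abs_sub _ _).trans (by gcongr; exact hMF x)⟩
    ⟨MG + |mG|, fun x => (abs_sub _ _).trans (by gcongr; exact hMG x)⟩ (c F iF) (c G iG)
  have v : ∀ f : (ι → ℝ) → ℝ, Integrable f ν → Integrable (fun x => f x ^ 2) ν →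
      ∫ x, (f x - ∫ y, f y ∂ν) ^ 2 ∂ν ≤ ∫ x, f x ^ 2 ∂ν := fun f hf hf2 => by
    set m := ∫ y, f y ∂ν with hm
    have : ∀ x, (f x - m) ^ 2 = f x ^ 2 - (2 * m * f x - m ^ 2) := fun x => by ring
    have i1 : Integrable (fun x => 2 * m * f x - m ^ 2) ν := (hf.const_mul _).sub (integrable_const _)
    rw [integral_congr_ae (ae_of_all _ this), integral_sub hf2 i1,
      integral_sub (hf.const_mul _) (integrable_const _), integral_const_mul, ← hm]
    simp only [integral_const, probReal_univ, smul_eq_mul, one_mul]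
    nlinarith [sq_nonneg m]
  have jF : Integrable (fun z : ι ⊕ ι → ℝ => F (z ∘ Sum.inl)) ρ := bint (hF.comp mi) fun z => hMF _
  have jG : Integrable (fun z : ι ⊕ ι → ℝ => G (z ∘ Sum.inr)) ρ := bint (hG.comp mr) fun z => hMG _
  have jFG : Integrable (fun z : ι ⊕ ι → ℝ => F (z ∘ Sum.inl) * G (z ∘ Sum.inr)) ρ :=
    bint ((hF.comp mi).mul (hG.comp mr)) (C := MF * MG) fun z => by
      simp only [abs_mul, Pi.mul_apply, Function.comp]
      exact mul_le_mul (hMF _) (hMG _) (abs_nonneg _) ((abs_nonneg _).trans (hMF 0))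
  have k1 : ∫ z, F (z ∘ Sum.inl) ∂ρ = mF := by
    simp only [mF]
    rw [← e1, integral_map mi.aemeasurable hF.aestronglyMeasurable]
  have k2 : ∫ z, G (z ∘ Sum.inr) ∂ρ = mG := by
    simp only [mG]
    rw [← e2, integral_map mr.aemeasurable hG.aestronglyMeasurable]
  have ex : ∫ z, (F (z ∘ Sum.inl) - mF) * (G (z ∘ Sum.inr) - mG) ∂ρ =
      ∫ z, F (z ∘ Sum.inl) * G (z ∘ Sum.inr) ∂ρ - mF * mG := by
    have : ∀ z : ι ⊕ ι → ℝ, (F (z ∘ Sum.inl) - mF) * (G (z ∘ Sum.inr) - mG) =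
      F (z ∘ Sum.inl) * G (z ∘ Sum.inr) - (mG * F (z ∘ Sum.inl) + (mF * G (z ∘ Sum.inr) - mF * mG)) := fun z => by ring
    have i2 : Integrable (fun z : ι ⊕ ι → ℝ => mF * G (z ∘ Sum.inr) - mF * mG) ρ :=
      (jG.const_mul _).sub (integrable_const _)
    have i1 : Integrable (fun z : ι ⊕ ι → ℝ => mG * F (z ∘ Sum.inl) + (mF * G (z ∘ Sum.inr) - mF * mG)) ρ :=
      (jF.const_mul _).add i2
    rw [integral_congr_ae (ae_of_all _ this), integral_sub jFG i1, integral_add (jF.const_mul _) i2,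
      integral_sub (jG.const_mul _) (integrable_const _), integral_const_mul, integral_const_mul, k1, k2]
    simp only [integral_const, probReal_univ, smul_eq_mul, one_mul]
    ring
  have hv : (1 / 2 : ℝ) ^ j * ((∫ x, (F x - mF) ^ 2 ∂ν + ∫ x, (G x - mG) ^ 2 ∂ν) / 2) ≤
      (1 / 2) ^ j * ((∫ x, F x ^ 2 ∂ν + ∫ x, G x ^ 2 ∂ν) / 2) := by
    have := v F iF iF2
    have := v G iG iG2
    gcongr
  rw [ex] at key
  linarith

lemma geb_lint {ι : Type*} [Fintype ι] {ν : Measure (ι → ℝ)} {A : Matrix ι ι ℝ} (h : IsG ν A)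
    (hAs : Aᵀ = A) (hA : ∀ c : ι → ℝ, 0 ≤ c ⬝ᵥ A *ᵥ c) (j : ℕ)
    (C : Matrix ι ι ℝ) (hC : ∀ c d : ι → ℝ, |c ⬝ᵥ C *ᵥ d| ≤ (1 / 2) ^ j * ((c ⬝ᵥ A *ᵥ c + d ⬝ᵥ A *ᵥ d) / 2))
    (ρ : Measure (ι ⊕ ι → ℝ)) (hρ : IsG ρ (fromBlocks A C Cᵀ A)) (F G : (ι → ℝ) → ℝ≥0∞) (hF : Measurable F)
    (hG : Measurable G) :
    ∫⁻ z, F (z ∘ Sum.inl) * G (z ∘ Sum.inr) ∂ρ ≤ (∫⁻ x, F x ∂ν) * (∫⁻ x, G x ∂ν) +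
      ENNReal.ofReal ((1 / 2) ^ j) * (∫⁻ x, F x ^ 2 ∂ν + ∫⁻ x, G x ^ 2 ∂ν) := by
  have hp := h.prob
  have hp' := hρ.prob
  have mi : Measurable fun z : ι ⊕ ι → ℝ => z ∘ Sum.inl := measurable_pi_lambda _ fun i => measurable_pi_apply _
  have mr : Measurable fun z : ι ⊕ ι → ℝ => z ∘ Sum.inr := measurable_pi_lambda _ fun i => measurable_pi_apply _
  have sup : ∀ y : ℝ≥0∞, (⨆ n : ℕ, min y (n : ℝ≥0∞)) = y := fun y => by
    rw [← inf_iSup_eq, ENNReal.iSup_natCast, inf_top_eq]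
  have mono : ∀ y : ℝ≥0∞, Monotone fun n : ℕ => min y (n : ℝ≥0∞) := fun y m n hmn =>
    min_le_min le_rfl (by exact_mod_cast hmn)
  have e : ∀ z : ι ⊕ ι → ℝ, F (z ∘ Sum.inl) * G (z ∘ Sum.inr) =
      ⨆ n : ℕ, min (F (z ∘ Sum.inl)) n * min (G (z ∘ Sum.inr)) n := fun z => by
    conv_lhs => rw [← sup (F _), ← sup (G _)]
    exact iSup_mul_mono (mono _) (mono _)
  have me : ∀ n : ℕ, Measurable fun z : ι ⊕ ι → ℝ => min (F (z ∘ Sum.inl)) (n : ℝ≥0∞) * min (G (z ∘ Sum.inr)) n :=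
    fun n => ((hF.comp mi).min measurable_const).mul ((hG.comp mr).min measurable_const)
  rw [lintegral_congr e, lintegral_iSup me
    (fun m n hmn z => mul_le_mul' (mono _ hmn) (mono _ hmn))]
  refine iSup_le fun n => ?_
  have fin : ∀ y : ℝ≥0∞, min y (n : ℝ≥0∞) ≠ ⊤ := fun y => (min_lt_of_right_lt (ENNReal.natCast_lt_top n)).ne
  have bd : ∀ y : ℝ≥0∞, |(min y (n : ℝ≥0∞)).toReal| ≤ n := fun y => by
    rw [abs_of_nonneg ENNReal.toReal_nonneg]
    exact ENNReal.toReal_le_of_le_ofReal (by positivity) (by simp)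
  have mF : Measurable fun x => (min (F x) (n : ℝ≥0∞)).toReal := (hF.min measurable_const).ennreal_toReal
  have mG : Measurable fun x => (min (G x) (n : ℝ≥0∞)).toReal := (hG.min measurable_const).ennreal_toReal
  have key := geb_real h hAs hA j C hC ρ hρ _ _ mF mG ⟨n, fun x => bd _⟩ ⟨n, fun x => bd _⟩
  have o1 : ∀ f : (ι → ℝ) → ℝ≥0∞, Measurable f → ENNReal.ofReal (∫ x, (min (f x) (n : ℝ≥0∞)).toReal ∂ν) ≤ ∫⁻ x, f x ∂ν := fun f hf => by
    rw [ofReal_integral_eq_lintegral_ofReal (bint ((hf.min measurable_const).ennreal_toReal) fun x => bd _)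
      (ae_of_all _ fun x => ENNReal.toReal_nonneg)]
    exact lintegral_mono fun x => by rw [ENNReal.ofReal_toReal (fin _)]; exact min_le_left _ _
  have o2 : ∀ f : (ι → ℝ) → ℝ≥0∞, Measurable f → ENNReal.ofReal (∫ x, (min (f x) (n : ℝ≥0∞)).toReal ^ 2 ∂ν) ≤ ∫⁻ x, f x ^ 2 ∂ν := fun f hf => by
    have mf : Measurable fun x => (min (f x) (n : ℝ≥0∞)).toReal := (hf.min measurable_const).ennreal_toReal
    rw [ofReal_integral_eq_lintegral_ofReal (bint (mf.pow_const 2) (C := n ^ 2) fun x => by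
      rw [abs_pow]; exact pow_le_pow_left₀ (abs_nonneg _) (bd _) 2)
      (ae_of_all _ fun x => sq_nonneg _)]
    refine lintegral_mono fun x => ?_
    rw [ENNReal.ofReal_pow ENNReal.toReal_nonneg, ENNReal.ofReal_toReal (fin _)]
    exact pow_le_pow_left' (min_le_left _ _) 2
  have hI : Integrable (fun z : ι ⊕ ι → ℝ => (min (F (z ∘ Sum.inl)) (n : ℝ≥0∞)).toReal * (min (G (z ∘ Sum.inr)) (n : ℝ≥0∞)).toReal) ρ :=
    bint ((mF.comp mi).mul (mG.comp mr)) (C := n * n) fun z => by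
      simp only [abs_mul, Pi.mul_apply, Function.comp]
      exact mul_le_mul (bd _) (bd _) (abs_nonneg _) (by positivity)
  have lhs : ∫⁻ z, min (F (z ∘ Sum.inl)) (n : ℝ≥0∞) * min (G (z ∘ Sum.inr)) (n : ℝ≥0∞) ∂ρ =
      ENNReal.ofReal (∫ z, (min (F (z ∘ Sum.inl)) (n : ℝ≥0∞)).toReal * (min (G (z ∘ Sum.inr)) (n : ℝ≥0∞)).toReal ∂ρ) := by
    rw [ofReal_integral_eq_lintegral_ofReal hI (ae_of_all _ fun z => mul_nonneg ENNReal.toReal_nonneg ENNReal.toReal_nonneg)]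
    refine lintegral_congr fun z => ?_
    rw [ENNReal.ofReal_mul ENNReal.toReal_nonneg, ENNReal.ofReal_toReal (fin _), ENNReal.ofReal_toReal (fin _)]
  rw [lhs]
  refine (ENNReal.ofReal_le_ofReal key).trans ?_
  have n1 : ∀ f : (ι → ℝ) → ℝ≥0∞, 0 ≤ ∫ x, (min (f x) (n : ℝ≥0∞)).toReal ∂ν := fun f => integral_nonneg fun x => ENNReal.toReal_nonneg
  have n2 : ∀ f : (ι → ℝ) → ℝ≥0∞, 0 ≤ ∫ x, (min (f x) (n : ℝ≥0∞)).toReal ^ 2 ∂ν := fun f => integral_nonneg fun x => sq_nonneg _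
  refine ENNReal.ofReal_add_le.trans (add_le_add ?_ ?_)
  · rw [ENNReal.ofReal_mul (n1 F)]
    exact mul_le_mul' (o1 F hF) (o1 G hG)
  · rw [ENNReal.ofReal_mul (by positivity)]
    refine mul_le_mul' le_rfl ?_
    refine (ENNReal.ofReal_le_ofReal (half_le_self (add_nonneg (n2 F) (n2 G)))).trans ?_
    exact ENNReal.ofReal_add_le.trans (add_le_add (o2 F hF) (o2 G hG))
end M8
end

section
section M9
set_option linter.unusedSectionVars false
/-- window integral of the crossing number -/
def J {α : Type*} [LinearOrder α] (w : α → ℝ) (S : Set α) (A : Set ℝ) (ε : ℝ) : ℝ≥0∞ := ∫⁻ b in A, V w S b (b + ε)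

/-- path with given increments -/
def pth {R : ℕ} (x : Fin R → ℝ) (i : ℕ) : ℝ := ∑ l : Fin R, if (l : ℕ) < i then x l else 0

lemma Wt_J (w : ℝ → ℝ) (s t ε : ℝ) : Wt w s t ε = J w (Icc s t) univ ε := by simp [Wt, J]

lemma J_congr {α : Type*} [LinearOrder α] {w w' : α → ℝ} {S : Set α} (h : ∀ u ∈ S, w u = w' u) (A : Set ℝ) (ε : ℝ) :
    J w S A ε = J w' S A ε := by
  unfold J; exact lintegral_congr fun b => V_congr h

lemma pth_meas {R : ℕ} (i : ℕ) : Measurable fun x : Fin R → ℝ => pth x i := by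
  unfold pth
  refine Finset.measurable_sum _ fun l _ => ?_
  split_ifs
  · exact measurable_pi_apply _
  · exact measurable_const

lemma J_meas {Ω' : Type*} [MeasurableSpace Ω'] {w : Ω' → ℕ → ℝ} (hw : ∀ i, Measurable fun x => w x i)
    (S : Set ℕ) (A : Set ℝ) (ε : ℝ) : Measurable fun x => J (w x) S A ε := by
  unfold J
  have : Measurable fun p : Ω' × ℝ => V (w p.1) S p.2 (p.2 + ε) :=
    measurable_V (fun i => (hw i).comp measurable_fst) measurable_snd (measurable_snd.add_const ε) S
  exact this.lintegral_prod_right'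

lemma J_pth_meas {R : ℕ} (S : Set ℕ) (A : Set ℝ) (ε : ℝ) : Measurable fun x : Fin R → ℝ => J (pth x) S A ε :=
  J_meas (fun i => pth_meas i) S A ε

lemma V_block_nat (w : ℝ → ℝ) (s : ℝ) {h : ℝ} (hh : 0 < h) (j k : ℕ) (x y : ℝ) :
    V w (grd (s + j * h) (s + (j + 1) * h) k) x y =
      V (fun i : ℕ => w (s + i * (h / 2 ^ k))) (Icc (j * 2 ^ k) ((j + 1) * 2 ^ k)) x y := by
  rw [V_comp (w := w) (τ := fun i : ℕ => s + i * (h / 2 ^ k))]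
  · congr 1
    ext z; simp only [grd, mem_ofPred_eq, mem_image, mem_Icc]
    constructor
    · rintro ⟨i, hi, rfl⟩
      refine ⟨j * 2 ^ k + i, ⟨by omega, by rw [add_mul, one_mul]; omega⟩, ?_⟩
      push_cast; field_simp; ring
    · rintro ⟨i, ⟨h1, h2⟩, rfl⟩
      refine ⟨i - j * 2 ^ k, by rw [add_mul, one_mul] at h2; omega, ?_⟩
      rw [Nat.cast_sub h1]; push_cast; field_simp; ring
  · intro i j hij
    have : (i : ℝ) < j := by exact_mod_cast hij
    dsimp only; gcongr

lemma J_block {w : ℝ → ℝ} (hw : Continuous w) (s : ℝ) {h ε : ℝ} (hh : 0 < h) (hε : 0 ≤ ε) (j : ℕ) (A : Set ℝ) :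
    J w (Icc (s + j * h) (s + (j + 1) * h)) A ε =
      ⨆ k, J (fun i : ℕ => w (s + i * (h / 2 ^ k))) (Icc (j * 2 ^ k) ((j + 1) * 2 ^ k)) A ε := by
  have hlt : s + j * h < s + (j + 1) * h := by nlinarith
  unfold J
  simp only [← V_block_nat w s hh j]
  rw [← lintegral_iSup]
  · exact lintegral_congr fun b => V_grid hlt (by linarith) hw
  · intro k
    simp only [V_block_nat w s hh j]
    exact measurable_V (w := fun _ => fun i : ℕ => w (s + i * (h / 2 ^ k)))
      (fun i => measurable_const) measurable_id (measurable_id.add_const ε) _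
  · intro k k' hk b
    exact V_grd_mono _ _ _ _ _ hk

lemma J_block_mono (w : ℝ → ℝ) (s : ℝ) {h ε : ℝ} (hh : 0 < h) (j : ℕ) (A : Set ℝ) :
    Monotone fun k => J (fun i : ℕ => w (s + i * (h / 2 ^ k))) (Icc (j * 2 ^ k) ((j + 1) * 2 ^ k)) A ε := by
  intro k k' hk
  dsimp only [J]
  simp only [← V_block_nat w s hh j]
  exact lintegral_mono fun b => V_grd_mono _ _ _ _ _ hk

lemma J_shift {α : Type*} [LinearOrder α] (w : α → ℝ) (S : Set α) (a δ ε c : ℝ) :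
    J (fun i => w i + c) S (Ioc a (a + δ)) ε = J w S (Ioc (a - c) (a - c + δ)) ε := by
  unfold J
  simp only [V_shift]
  have e : ∀ b, V w S (b - c) (b + ε - c) = (fun b => V w S b (b + ε)) (b - c) := fun b => by
    dsimp only; congr 1; ring
  have p := (measurePreserving_sub_right volume c).setLIntegral_comp_preimage_emb
    (MeasurableEquiv.subRight c).measurableEmbedding (fun b => V w S b (b + ε)) (Ioc (a - c) (a - c + δ))
  rw [← p]
  have hs : (fun x => x - c) ⁻¹' Ioc (a - c) (a - c + δ) = Ioc a (a + δ) := by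
    ext x; simp only [mem_preimage, mem_Ioc]; constructor <;> rintro ⟨h1, h2⟩ <;> constructor <;> linarith
  rw [hs]
  exact lintegral_congr fun b => e b

lemma J_shift_univ {α : Type*} [LinearOrder α] (w : α → ℝ) (S : Set α) (ε c : ℝ) :
    J (fun i => w i + c) S univ ε = J w S univ ε := by
  unfold J
  simp only [V_shift, Measure.restrict_univ]
  rw [← lintegral_sub_right_eq_self (fun b => V w S b (b + ε)) c]
  exact lintegral_congr fun b => by congr 1; ring

lemma J_scale {α : Type*} [LinearOrder α] (w : α → ℝ) (S : Set α) (ε : ℝ) {c : ℝ} (hc : 0 < c) :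
    J (fun i => c * w i) S univ (c * ε) = ENNReal.ofReal c * J w S univ ε := by
  unfold J
  simp only [Measure.restrict_univ]
  have h := Real.smul_map_volume_mul_left hc.ne'
  rw [abs_of_pos hc] at h
  conv_lhs => rw [← h]
  have emb : MeasurableEmbedding (fun x : ℝ => c * x) := (MeasurableEquiv.mulLeft₀ c hc.ne').measurableEmbedding
  rw [lintegral_smul_measure, emb.lintegral_map, smul_eq_mul]
  congr 1
  refine lintegral_congr fun b => ?_
  change V _ S (c * b) (c * b + c * ε) = _
  rw [← mul_add, V_scale hc]

variable {Ω : Type*} [MeasurableSpace Ω] {P : Measure Ω} [IsProbabilityMeasure P] {H : ℝ} {B : ℝ → Ω → ℝ} {aH : ℝ}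

lemma pth_incr (B : ℝ → Ω → ℝ) (s τ : ℝ) (R : ℕ) (ω : Ω) (i : ℕ) (hi : i ≤ R) :
    pth (incr B s τ R ω) i = B (s + i * τ) ω - B s ω := by
  unfold pth incr
  induction i with
  | zero => simp
  | succ n ih =>
    have : ∀ l : Fin R, (if (l : ℕ) < n + 1 then B (s + ((l : ℝ) + 1) * τ) ω - B (s + l * τ) ω else 0) =
        (if (l : ℕ) < n then B (s + ((l : ℝ) + 1) * τ) ω - B (s + l * τ) ω else 0) +
        if l = ⟨n, hi⟩ then B (s + ((l : ℝ) + 1) * τ) ω - B (s + l * τ) ω else 0 := fun l => by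
      rcases lt_trichotomy (l : ℕ) n with h | h | h
      · simp [h, Nat.lt_succ_of_lt h, Fin.ext_iff, h.ne]
      · simp [h, Fin.ext_iff]
      · simp [not_lt.2 h.le, Fin.ext_iff, h.ne', not_lt.2 (show n + 1 ≤ l from h)]
    rw [Finset.sum_congr rfl fun l _ => this l, Finset.sum_add_distrib, ih (by omega)]
    simp

lemma J_pth_incr (B : ℝ → Ω → ℝ) (s τ : ℝ) (R : ℕ) (ω : Ω) (S : Set ℕ) (hS : ∀ i ∈ S, i ≤ R) (ε : ℝ) :
    J (fun i : ℕ => B (s + i * τ) ω) S univ ε = J (pth (incr B s τ R ω)) S univ ε := by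
  rw [J_congr (w := pth _) (w' := fun i : ℕ => B (s + i * τ) ω + - B s ω), J_shift_univ]
  intro i hi
  rw [pth_incr _ _ _ _ _ _ (hS i hi), sub_eq_add_neg]

lemma Wt_incr (hB : IsFBM H P B) (s : ℝ) {h ε : ℝ} (hh : 0 < h) (hε : 0 ≤ ε) (ω : Ω) :
    Wt (fun r => B r ω) s (s + h) ε = ⨆ k, J (pth (incr B s (h / 2 ^ k) (2 ^ k) ω)) (Icc 0 (2 ^ k)) univ ε := by
  have := J_block (hB.1 ω) s hh hε 0 univ
  simp only [Nat.cast_zero, zero_mul, add_zero, zero_add, one_mul] at this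
  rw [Wt_J, this]
  congr 1; funext k
  rw [J_pth_incr B s (h / 2 ^ k) (2 ^ k) ω _ fun i hi => hi.2]

lemma Wt_incr_mono (B : ℝ → Ω → ℝ) (s : ℝ) {h : ℝ} (ε : ℝ) (hh : 0 < h) (ω : Ω) :
    Monotone fun k => J (pth (incr B s (h / 2 ^ k) (2 ^ k) ω)) (Icc 0 (2 ^ k)) univ ε := by
  have := J_block_mono (ε := ε) (fun r => B r ω) s hh 0 univ
  simp only [zero_mul, zero_add, one_mul] at this
  convert this using 2 with k
  rw [J_pth_incr B s (h / 2 ^ k) (2 ^ k) ω _ fun i hi => hi.2]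

lemma Wt_meas (hB : IsFBM H P B) (s : ℝ) {h ε : ℝ} (hh : 0 < h) (hε : 0 ≤ ε) :
    Measurable fun ω => Wt (fun r => B r ω) s (s + h) ε := by
  simp only [Wt_incr hB s hh hε]
  exact Measurable.iSup fun k => (J_pth_meas _ _ _).comp (incr_meas hB _ _ _)

lemma incr_law {Ω' : Type*} [MeasurableSpace Ω'] {P' : Measure Ω'} [IsProbabilityMeasure P'] {B' : ℝ → Ω' → ℝ}
    (hB : IsFBM H P B) (ha : ∀ s t : ℝ, ∫ ω, (B t ω - B s ω) ^ 2 ∂P = aH * |t - s| ^ (2 * H))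
    (hB' : IsFBM H P' B') (ha' : ∀ s t : ℝ, ∫ ω, (B' t ω - B' s ω) ^ 2 ∂P' = aH * |t - s| ^ (2 * H))
    (s s' : ℝ) {τ : ℝ} (hτ : 0 < τ) (R : ℕ) : P.map (incr B s τ R) = P'.map (incr B' s' τ R) :=
  (incr_IsG hB ha hτ s R).unique (incr_IsG hB' ha' hτ s' R)

lemma Wt_law {Ω' : Type*} [MeasurableSpace Ω'] {P' : Measure Ω'} [IsProbabilityMeasure P'] {B' : ℝ → Ω' → ℝ}
    (hB : IsFBM H P B) (ha : ∀ s t : ℝ, ∫ ω, (B t ω - B s ω) ^ 2 ∂P = aH * |t - s| ^ (2 * H))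
    (hB' : IsFBM H P' B') (ha' : ∀ s t : ℝ, ∫ ω, (B' t ω - B' s ω) ^ 2 ∂P' = aH * |t - s| ^ (2 * H))
    (s s' : ℝ) {h ε : ℝ} (hh : 0 < h) (hε : 0 ≤ ε) (q : ℕ) :
    ∫⁻ ω, Wt (fun r => B r ω) s (s + h) ε ^ q ∂P = ∫⁻ ω, Wt (fun r => B' r ω) s' (s' + h) ε ^ q ∂P' := by
  have e1 : ∫⁻ ω, Wt (fun r => B r ω) s (s + h) ε ^ q ∂P =
        ⨆ k, ∫⁻ x, J (pth x) (Icc 0 (2 ^ k)) univ ε ^ q ∂(P.map (incr B s (h / 2 ^ k) (2 ^ k))) := by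
    simp only [Wt_incr hB s hh hε, ENNReal.iSup_pow]
    rw [lintegral_iSup]
    · congr 1; funext k
      rw [lintegral_map ((J_pth_meas _ _ _).pow_const q) (incr_meas hB _ _ _)]
    · exact fun k => ((J_pth_meas _ _ _).comp (incr_meas hB _ _ _)).pow_const q
    · exact fun k k' hk ω => pow_le_pow_left' (Wt_incr_mono B s ε hh ω hk) q
  have e2 : ∫⁻ ω, Wt (fun r => B' r ω) s' (s' + h) ε ^ q ∂P' =
        ⨆ k, ∫⁻ x, J (pth x) (Icc 0 (2 ^ k)) univ ε ^ q ∂(P'.map (incr B' s' (h / 2 ^ k) (2 ^ k))) := by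
    simp only [Wt_incr hB' s' hh hε, ENNReal.iSup_pow]
    rw [lintegral_iSup]
    · congr 1; funext k
      rw [lintegral_map ((J_pth_meas _ _ _).pow_const q) (incr_meas hB' _ _ _)]
    · exact fun k => ((J_pth_meas _ _ _).comp (incr_meas hB' _ _ _)).pow_const q
    · exact fun k k' hk ω => pow_le_pow_left' (Wt_incr_mono B' s' ε hh ω hk) q
  rw [e1, e2]
  congr 1; funext k
  rw [incr_law hB ha hB' ha' s s' (by positivity)]

lemma fb_trans (hB : IsFBM H P B) (ha : ∀ s t : ℝ, ∫ ω, (B t ω - B s ω) ^ 2 ∂P = aH * |t - s| ^ (2 * H))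
    (haH : 0 < aH) {d l : ℝ} (hl : 0 < l) (hd : d ^ 2 * l ^ (2 * H) = 1) :
    IsFBM H P (fun t ω => d * B (l * t) ω) ∧
    ∀ s t : ℝ, ∫ ω, (d * B (l * t) ω - d * B (l * s) ω) ^ 2 ∂P = aH * |t - s| ^ (2 * H) := by
  have hv : ∀ s t : ℝ, ∫ ω, (d * B (l * t) ω - d * B (l * s) ω) ^ 2 ∂P = aH * |t - s| ^ (2 * H) := by
    intro s t
    have : ∀ ω, (d * B (l * t) ω - d * B (l * s) ω) ^ 2 = d ^ 2 * (B (l * t) ω - B (l * s) ω) ^ 2 := fun ω => by ring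
    rw [integral_congr_ae (ae_of_all _ this), integral_const_mul, ha, ← mul_sub, abs_mul, abs_of_pos hl,
      Real.mul_rpow hl.le (abs_nonneg _)]
    linear_combination aH * |t - s| ^ (2 * H) * hd
  refine ⟨⟨fun ω => ?_, fun ω => by simp [hB.2.1 ω], fun t => (hB.2.2.1 _).const_mul d, fun n t c => ?_, aH, haH, hv⟩, hv⟩
  · exact continuous_const.mul ((hB.1 ω).comp (continuous_const.mul continuous_id))
  · obtain ⟨v, hv⟩ := hB.2.2.2.1 n (fun i => l * t i) (fun i => c i * d)
    refine ⟨v, ?_⟩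
    rw [← hv]; congr 1; funext ω
    exact Finset.sum_congr rfl fun i _ => by ring

lemma Wt_time {w : ℝ → ℝ} {l : ℝ} (hl : 0 < l) (s t ε : ℝ) :
    Wt (fun r => w (l * r)) s t ε = Wt w (l * s) (l * t) ε := by
  unfold Wt
  refine lintegral_congr fun b => ?_
  rw [V_comp (w := w) (τ := fun r : ℝ => l * r) (strictMono_mul_left_of_pos hl)]
  congr 1
  rw [image_mul_left_Icc' hl]

lemma Wt_mul {w : ℝ → ℝ} {c : ℝ} (hc : 0 < c) (s t ε : ℝ) :
    Wt (fun r => c * w r) s t (c * ε) = ENNReal.ofReal c * Wt w s t ε := by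
  rw [Wt_J, Wt_J, J_scale _ _ _ hc]

/-- moments of the total crossing functional: stationarity and scaling -/
lemma Wt_moment (hB : IsFBM H P B) (ha : ∀ s t : ℝ, ∫ ω, (B t ω - B s ω) ^ 2 ∂P = aH * |t - s| ^ (2 * H))
    (haH : 0 < aH) (hH : 0 < H) (s : ℝ) {h ε : ℝ} (hh : 0 < h) (hε : 0 < ε) (q : ℕ) :
    ∫⁻ ω, Wt (fun r => B r ω) s (s + h) ε ^ q ∂P =
      ENNReal.ofReal ε ^ q * ∫⁻ ω, Wt (fun r => B r ω) 0 (h * ε ^ (-(1 / H))) 1 ^ q ∂P := by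
  set l := ε ^ (1 / H) with hl
  have hl0 : 0 < l := Real.rpow_pos_of_pos hε _
  have hd : (ε⁻¹) ^ 2 * l ^ (2 * H) = 1 := by
    rw [hl, ← Real.rpow_mul hε.le, show 1 / H * (2 * H) = (2 : ℕ) by field_simp; norm_num, Real.rpow_natCast]
    field_simp
  obtain ⟨hB', ha'⟩ := fb_trans hB ha haH hl0 hd
  have hh' : 0 < h * ε ^ (-(1 / H)) := by positivity
  have e0 : l * (h * ε ^ (-(1 / H))) = h := by
    rw [Real.rpow_neg hε.le, hl]; field_simp
  have e := Wt_law hB ha hB ha s 0 hh hε.le q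
  rw [e, zero_add]
  have e2 := Wt_law hB' ha' hB ha 0 0 hh' (zero_le_one) q
  rw [zero_add] at e2
  rw [← e2, ← lintegral_const_mul' _ _ (by finiteness)]
  refine lintegral_congr fun ω => ?_
  rw [← mul_pow, ← Wt_mul hε]
  have := Wt_time (w := fun r => B r ω) hl0 0 (h * ε ^ (-(1 / H))) ε
  rw [e0, mul_zero] at this
  rw [mul_one, ← this]
  congr 2
  funext r
  field_simp

lemma Wt_neg_mean (hB : IsFBM H P B) (ha : ∀ s t : ℝ, ∫ ω, (B t ω - B s ω) ^ 2 ∂P = aH * |t - s| ^ (2 * H))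
    (haH : 0 < aH) {h ε : ℝ} (hh : 0 < h) (hε : 0 < ε) :
    ∫⁻ ω, Wt (fun r => - B r ω) 0 h ε ∂P = ∫⁻ ω, Wt (fun r => B r ω) 0 h ε ∂P := by
  obtain ⟨hB', ha'⟩ := fb_trans hB ha haH (d := -1) (l := 1) one_pos (by simp)
  have e := Wt_law hB' ha' hB ha 0 0 hh hε.le 1
  simpa using e
end M9
end

section
section M10
set_option linter.unusedSectionVars false

lemma chain1 {w : ℝ → ℝ} (hw : Continuous w) {T q A : ℝ} (hT : 0 < T) (hq : 0 < q) (hq1 : q < 1)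
    (hA : 0 ≤ A) (h : ∀ n k : ℕ, k < 2 ^ n → |w (((k : ℝ) + 1) * (T / 2 ^ n)) - w (k * (T / 2 ^ n))| ≤ A * q ^ n)
    (n : ℕ) {u : ℝ} (hu : u ∈ Icc 0 T) :
    |w u - w (⌊u * 2 ^ n / T⌋₊ * (T / 2 ^ n))| ≤ A * q ^ n * (q / (1 - q)) := by
  set U : ℕ → ℝ := fun n => ⌊u * 2 ^ n / T⌋₊ * (T / 2 ^ n) with hU
  have y0 : ∀ n : ℕ, 0 ≤ u * 2 ^ n / T := fun n => by have := hu.1; positivity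
  have yT : ∀ n : ℕ, u * 2 ^ n / T ≤ 2 ^ n := fun n => by
    rw [div_le_iff₀ hT, mul_comm]; exact mul_le_mul_of_nonneg_left hu.2 (by positivity)
  have lim : Tendsto U atTop (𝓝 u) := by
    rw [tendsto_iff_dist_tendsto_zero]
    have l0 : Tendsto (fun n : ℕ => T * (1 / 2 : ℝ) ^ n) atTop (𝓝 0) := by
      simpa using (tendsto_pow_atTop_nhds_zero_of_lt_one (by norm_num : (0:ℝ) ≤ 1/2) (by norm_num)).const_mul T
    refine squeeze_zero (fun _ => dist_nonneg) (fun n => ?_) l0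
    have h1 := Nat.floor_le (y0 n)
    have h2 := Nat.lt_floor_add_one (u * 2 ^ n / T)
    have hp : 0 < T / 2 ^ n := by positivity
    have e : u = u * 2 ^ n / T * (T / 2 ^ n) := by field_simp
    have e2 : T * (1 / 2 : ℝ) ^ n = T / 2 ^ n := by rw [one_div, inv_pow]; rfl
    rw [Real.dist_eq, abs_sub_comm, e2, abs_le]
    constructor <;> simp only [hU] <;> nlinarith
  have step : ∀ m, |w (U (m + 1)) - w (U m)| ≤ A * q ^ (m + 1) := by
    intro m
    set f := ⌊u * 2 ^ m / T⌋₊ with hf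
    have h1 := Nat.floor_le (y0 m)
    have h2 := Nat.lt_floor_add_one (u * 2 ^ m / T)
    have ey : u * 2 ^ (m + 1) / T = 2 * (u * 2 ^ m / T) := by rw [pow_succ]; ring
    have h3 : ⌊u * 2 ^ (m + 1) / T⌋₊ = 2 * f ∨ ⌊u * 2 ^ (m + 1) / T⌋₊ = 2 * f + 1 := by
      have a1 : 2 * f ≤ ⌊u * 2 ^ (m + 1) / T⌋₊ := Nat.le_floor (by rw [ey]; push_cast; linarith)
      have a2 : ⌊u * 2 ^ (m + 1) / T⌋₊ < 2 * f + 2 := (Nat.floor_lt (y0 _)).2 (by rw [ey]; push_cast; linarith)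
      omega
    have e1 : ((2 * f : ℕ) : ℝ) * (T / 2 ^ (m + 1)) = f * (T / 2 ^ m) := by push_cast; rw [pow_succ]; field_simp
    rcases h3 with h3 | h3
    · have : U (m + 1) = U m := by
        change ((⌊u * 2 ^ (m + 1) / T⌋₊ : ℕ) : ℝ) * (T / 2 ^ (m + 1)) = (f : ℝ) * (T / 2 ^ m)
        rw [h3]; exact e1
      rw [this, sub_self, abs_zero]; positivity
    · have a1 : U (m + 1) = (((2 * f : ℕ) : ℝ) + 1) * (T / 2 ^ (m + 1)) := by simp only [hU, h3]; push_cast; ring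
      have a2 : U m = ((2 * f : ℕ) : ℝ) * (T / 2 ^ (m + 1)) := by rw [e1]
      rw [a1, a2]
      refine h (m + 1) (2 * f) ?_
      have b1 := Nat.floor_le (y0 (m + 1))
      rw [h3] at b1
      have b2 := b1.trans (yT (m + 1))
      have b3 : 2 * f + 1 ≤ 2 ^ (m + 1) := by exact_mod_cast b2
      omega
  have tele : ∀ m, |w (U (n + m)) - w (U n)| ≤ A * q ^ n * ((1 - q ^ m) * (q / (1 - q))) := by
    intro m
    induction m with
    | zero => simp
    | succ m ih =>
      have hs := step (n + m)
      have : |w (U (n + (m + 1))) - w (U n)| ≤ |w (U (n + m + 1)) - w (U (n + m))| + |w (U (n + m)) - w (U n)| :=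
        abs_sub_le _ _ _
      refine this.trans ((add_le_add hs ih).trans (le_of_eq ?_))
      have : 1 - q ≠ 0 := by linarith
      field_simp; ring
  have hle : ∀ m, |w (U (n + m)) - w (U n)| ≤ A * q ^ n * (q / (1 - q)) := fun m => by
    refine (tele m).trans ?_
    have : 0 < 1 - q := by linarith
    have : 0 ≤ q / (1 - q) := by positivity
    have : 0 ≤ q ^ m := by positivity
    refine mul_le_mul_of_nonneg_left ?_ (by positivity)
    nlinarith
  have t1 : Tendsto (fun m => |w (U (n + m)) - w (U n)|) atTop (𝓝 |w u - w (U n)|) := by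
    have : Tendsto (fun m => U (n + m)) atTop (𝓝 u) := lim.comp (tendsto_atTop_mono (fun m => Nat.le_add_left m n) tendsto_id)
    exact (((hw.tendsto u).comp this).sub_const _).abs
  exact le_of_tendsto t1 (Eventually.of_forall hle)

lemma chain2 {w : ℝ → ℝ} (hw : Continuous w) {T q A : ℝ} (hT : 0 < T) (hq : 0 < q) (hq1 : q < 1)
    (hA : 0 ≤ A) (h : ∀ n k : ℕ, k < 2 ^ n → |w (((k : ℝ) + 1) * (T / 2 ^ n)) - w (k * (T / 2 ^ n))| ≤ A * q ^ n)
    (n : ℕ) {u v : ℝ} (hu : u ∈ Icc 0 T) (hv : v ∈ Icc 0 T) (huv : |u - v| ≤ T / 2 ^ n) :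
    |w u - w v| ≤ (2 * (q / (1 - q)) + 1) * A * q ^ n := by
  wlog hle : u ≤ v generalizing u v
  · rw [abs_sub_comm]; exact this hv hu (by rwa [abs_sub_comm]) (le_of_not_ge hle)
  have c1 := chain1 hw hT hq hq1 hA h n hu
  have c2 := chain1 hw hT hq hq1 hA h n hv
  have y0 : 0 ≤ u * 2 ^ n / T := by have := hu.1; positivity
  have y1 : 0 ≤ v * 2 ^ n / T := by have := hv.1; positivity
  have yT : v * 2 ^ n / T ≤ 2 ^ n := by
    rw [div_le_iff₀ hT, mul_comm]; exact mul_le_mul_of_nonneg_left hv.2 (by positivity)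
  have hd : v * 2 ^ n / T ≤ u * 2 ^ n / T + 1 := by
    rw [abs_sub_comm, abs_of_nonneg (by linarith), le_div_iff₀ (by positivity)] at huv
    rw [div_add_one hT.ne']
    gcongr; nlinarith
  set f := ⌊u * 2 ^ n / T⌋₊
  set g := ⌊v * 2 ^ n / T⌋₊
  have a1 : f ≤ g := Nat.floor_mono (by gcongr)
  have a2 : g ≤ f + 1 := by
    have := (Nat.floor_lt (n := f + 2) y1).2 (by have := Nat.lt_floor_add_one (u * 2 ^ n / T); push_cast; linarith)
    omega
  have mid : |w (f * (T / 2 ^ n)) - w (g * (T / 2 ^ n))| ≤ A * q ^ n := by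
    rcases Nat.eq_or_lt_of_le a1 with e | e
    · rw [e, sub_self, abs_zero]; positivity
    · have e : g = f + 1 := by omega
      rw [abs_sub_comm, e]; push_cast
      refine h n f ?_
      have b1 : ((g : ℕ) : ℝ) ≤ ((2 ^ n : ℕ) : ℝ) := by
        push_cast; exact (Nat.floor_le y1).trans yT
      have b2 : g ≤ 2 ^ n := Nat.cast_le.1 b1
      omega
  have : |w u - w v| ≤ |w u - w (f * (T / 2 ^ n))| + |w (f * (T / 2 ^ n)) - w (g * (T / 2 ^ n))| + |w v - w (g * (T / 2 ^ n))| := by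
    rw [abs_sub_comm (w v)]
    exact (abs_sub_le _ (w (g * (T / 2 ^ n))) _).trans (add_le_add (abs_sub_le _ _ _) le_rfl)
  refine this.trans ((add_le_add (add_le_add c1 mid) c2).trans (le_of_eq ?_))
  ring

variable {Ω : Type*} [MeasurableSpace Ω] {P : Measure Ω} [IsProbabilityMeasure P] {H : ℝ} {B : ℝ → Ω → ℝ} {aH : ℝ}

/-- absolute Gaussian moments -/
def gmom (p : ℕ) : ℝ≥0∞ := ∫⁻ x, ENNReal.ofReal |x| ^ p ∂(gaussianReal 0 1)

lemma gmom_lt (p : ℕ) : gmom p < ⊤ := by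
  rcases Nat.eq_zero_or_pos p with rfl | hp
  · simp [gmom]
  have h := (memLp_id_gaussianReal (μ := 0) (v := 1) (p : ℝ≥0)).eLpNorm_lt_top
  have hp' : ((p : ℝ≥0) : ℝ≥0∞) ≠ 0 := by simp; omega
  rw [eLpNorm_lt_top_iff_lintegral_rpow_enorm_lt_top hp' (by simp)] at h
  simpa [gmom, Real.enorm_eq_ofReal_abs] using h

lemma fb_mom (hB : IsFBM H P B) (ha : ∀ s t : ℝ, ∫ ω, (B t ω - B s ω) ^ 2 ∂P = aH * |t - s| ^ (2 * H))
    (haH : 0 < aH) (s t : ℝ) (p : ℕ) :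
    ∫⁻ ω, ENNReal.ofReal |B t ω - B s ω| ^ p ∂P = ENNReal.ofReal (Real.sqrt aH * |t - s| ^ H) ^ p * gmom p := by
  obtain ⟨v, hv⟩ := fb_comb hB (fun i : Bool => if i then t else s) (fun i => if i then 1 else -1)
  simp only [Fintype.sum_bool, if_true, Bool.false_eq_true, if_false, one_mul, neg_one_mul, ← sub_eq_add_neg] at hv
  have m : Measurable fun ω => B t ω - B s ω := (hB.2.2.1 t).sub (hB.2.2.1 s)
  have h1 : ∫ x, x ^ 2 ∂(gaussianReal 0 v) = v := by
    have := variance_id_gaussianReal (μ := 0) (v := v)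
    rw [variance_eq_integral (by fun_prop)] at this
    simpa using this
  rw [← hv, integral_map m.aemeasurable (by fun_prop), ha] at h1
  set c := Real.sqrt aH * |t - s| ^ H with hc
  have hc0 : 0 ≤ c := by positivity
  have hc2 : c ^ 2 = v := by
    rw [← h1, hc, mul_pow, Real.sq_sqrt haH.le, ← Real.rpow_natCast, ← Real.rpow_mul (abs_nonneg _)]
    congr 2; push_cast; ring
  have e : gaussianReal 0 v = (gaussianReal 0 1).map (c * ·) := by
    rw [gaussianReal_map_const_mul]; congr 1
    · simp
    · ext; simp [hc2]
  have mf : Measurable fun x : ℝ => ENNReal.ofReal |x| ^ p := (measurable_id.abs.ennreal_ofReal).pow_const p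
  have : ∫⁻ ω, ENNReal.ofReal |B t ω - B s ω| ^ p ∂P = ∫⁻ x, ENNReal.ofReal |x| ^ p ∂(gaussianReal 0 v) := by
    rw [← hv, lintegral_map mf m]
  rw [this, e, lintegral_map mf (by fun_prop), gmom, ← lintegral_const_mul _ mf]
  refine lintegral_congr fun x => ?_
  rw [abs_mul, abs_of_nonneg hc0, ENNReal.ofReal_mul hc0, mul_pow]

lemma fb_Z (hB : IsFBM H P B) (ha : ∀ s t : ℝ, ∫ ω, (B t ω - B s ω) ^ 2 ∂P = aH * |t - s| ^ (2 * H))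
    (haH : 0 < aH) {α T : ℝ} (hT : 0 < T) {p : ℕ} (hp : 1 < p * (H - α)) :
    ∃ Z : Ω → ℝ≥0∞, Measurable Z ∧ ∫⁻ ω, Z ω ∂P < ⊤ ∧ ∀ ω, ∀ n k : ℕ, k < 2 ^ n →
      ENNReal.ofReal |B (((k : ℝ) + 1) * (T / 2 ^ n)) ω - B (k * (T / 2 ^ n)) ω| ^ p ≤
        Z ω * ENNReal.ofReal (((2 : ℝ) ^ (-α)) ^ n) ^ p := by
  set q : ℝ := (2 : ℝ) ^ (-α) with hq
  have hq0 : 0 < q := by positivity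
  set D : ℕ → ℕ → Ω → ℝ≥0∞ := fun n k ω =>
    ENNReal.ofReal |B (((k : ℝ) + 1) * (T / 2 ^ n)) ω - B (k * (T / 2 ^ n)) ω| ^ p with hD
  have mD : ∀ n k, Measurable (D n k) := fun n k =>
    (((hB.2.2.1 _).sub (hB.2.2.1 _)).abs.ennreal_ofReal).pow_const p
  set K : ℕ → ℝ≥0∞ := fun n => ENNReal.ofReal (((q ^ n)⁻¹) ^ p) with hK
  refine ⟨fun ω => ∑' n, ∑ k ∈ Finset.range (2 ^ n), K n * D n k ω, ?_, ?_, ?_⟩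
  · exact Measurable.tsum fun n => Finset.measurable_sum _ fun k _ => (mD n k).const_mul _
  · rw [lintegral_tsum fun n => (Finset.measurable_sum _ fun k _ => (mD n k).const_mul _).aemeasurable]
    have e : ∀ n, ∫⁻ ω, ∑ k ∈ Finset.range (2 ^ n), K n * D n k ω ∂P =
        ENNReal.ofReal ((Real.sqrt aH * T ^ H) ^ p) * gmom p * ENNReal.ofReal ((2 : ℝ) ^ (1 - p * (H - α))) ^ n := by
      intro n
      rw [lintegral_finsetSum _ fun k _ => (mD n k).const_mul _]
      have ek : ∀ k ∈ Finset.range (2 ^ n), ∫⁻ ω, K n * D n k ω ∂P =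
          K n * (ENNReal.ofReal (Real.sqrt aH * (T / 2 ^ n) ^ H) ^ p * gmom p) := fun k _ => by
        have ea : |((k : ℝ) + 1) * (T / 2 ^ n) - k * (T / 2 ^ n)| = T / 2 ^ n := by
          rw [show ((k : ℝ) + 1) * (T / 2 ^ n) - k * (T / 2 ^ n) = T / 2 ^ n by ring]
          exact abs_of_pos (by positivity)
        rw [lintegral_const_mul _ (mD n k), hD, fb_mom hB ha haH, ea]
      rw [Finset.sum_congr rfl ek, Finset.sum_const, Finset.card_range, nsmul_eq_mul]
      change _ * (ENNReal.ofReal (((q ^ n)⁻¹) ^ p) * _) = _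
      rw [← ENNReal.ofReal_pow (by positivity), ← ENNReal.ofReal_pow (by positivity)]
      rw [show ((2 ^ n : ℕ) : ℝ≥0∞) = ENNReal.ofReal (2 ^ n) by
        rw [← ENNReal.ofReal_natCast]; push_cast; rfl]
      rw [mul_comm _ (gmom p), mul_left_comm, mul_left_comm _ (gmom p), mul_comm _ (gmom p), mul_assoc (gmom p),
        ← ENNReal.ofReal_mul (by positivity), ← ENNReal.ofReal_mul (by positivity), mul_left_comm, ← ENNReal.ofReal_mul (by positivity)]
      congr 2
      have e2 : ((2 : ℝ) ^ (1 - p * (H - α))) ^ n = (2 : ℝ) ^ n * ((q ^ n)⁻¹) ^ p * (((2 : ℝ) ^ n) ^ H)⁻¹ ^ p := by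
        simp only [hq, ← Real.rpow_natCast, ← Real.rpow_mul (zero_le_two : (0:ℝ) ≤ 2), ← Real.rpow_neg (zero_le_two : (0:ℝ) ≤ 2),
          ← Real.rpow_add (zero_lt_two : (0:ℝ) < 2)]
        congr 1; ring
      rw [e2, Real.div_rpow hT.le (by positivity), div_eq_mul_inv, mul_pow, mul_pow, mul_pow]
      ring
    simp only [e]
    rw [ENNReal.tsum_mul_left, ENNReal.tsum_geometric]
    refine ENNReal.mul_lt_top (ENNReal.mul_lt_top ENNReal.ofReal_lt_top (gmom_lt p)) ?_
    rw [ENNReal.inv_lt_top, tsub_pos_iff_lt, ENNReal.ofReal_lt_one]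
    exact Real.rpow_lt_one_of_one_lt_of_neg one_lt_two (by linarith)
  · intro ω n k hk
    have h1 : K n * D n k ω ≤ ∑' n, ∑ k ∈ Finset.range (2 ^ n), K n * D n k ω :=
      le_trans (Finset.single_le_sum (f := fun k => K n * D n k ω) (fun _ _ => bot_le) (Finset.mem_range.2 hk))
        (ENNReal.le_tsum n)
    calc D n k ω = K n * D n k ω * ENNReal.ofReal (q ^ n) ^ p := by
          change _ = ENNReal.ofReal (((q ^ n)⁻¹) ^ p) * D n k ω * ENNReal.ofReal (q ^ n) ^ p
          rw [mul_right_comm, ← ENNReal.ofReal_pow (by positivity), ← ENNReal.ofReal_mul (by positivity),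
            ← mul_pow, inv_mul_cancel₀ (by positivity)]
          simp
      _ ≤ _ := mul_le_mul' h1 le_rfl

lemma fb_path {α T : ℝ} (hα : 0 < α) (hT : 0 < T) {p : ℕ} (hp : 0 < p) (hB : IsFBM H P B) {z : ℝ≥0∞} (hz : z ≠ ⊤) {ω : Ω}
    (h : ∀ n k : ℕ, k < 2 ^ n →
      ENNReal.ofReal |B (((k : ℝ) + 1) * (T / 2 ^ n)) ω - B (k * (T / 2 ^ n)) ω| ^ p ≤
        z * ENNReal.ofReal (((2 : ℝ) ^ (-α)) ^ n) ^ p) (n : ℕ) {u v : ℝ} (hu : u ∈ Icc 0 T) (hv : v ∈ Icc 0 T)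
    (huv : |u - v| ≤ T / 2 ^ n) :
    |B u ω - B v ω| ≤ (2 * ((2 : ℝ) ^ (-α) / (1 - (2 : ℝ) ^ (-α))) + 1) * z.toReal ^ ((p : ℝ)⁻¹) * ((2 : ℝ) ^ (-α)) ^ n := by
  refine chain2 (w := fun u => B u ω) (hB.1 ω) hT (by positivity) (Real.rpow_lt_one_of_one_lt_of_neg one_lt_two (by linarith)) (by positivity) ?_ n hu hv huv
  intro n k hk
  have h1 := h n k hk
  have hq : 0 ≤ ((2 : ℝ) ^ (-α)) ^ n := by positivity
  have h2 := ENNReal.toReal_mono (ENNReal.mul_ne_top hz (ENNReal.pow_ne_top ENNReal.ofReal_ne_top)) h1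
  rw [ENNReal.toReal_pow, ENNReal.toReal_ofReal (abs_nonneg _), ENNReal.toReal_mul, ENNReal.toReal_pow, ENNReal.toReal_ofReal hq] at h2
  refine le_of_pow_le_pow_left₀ hp.ne' (by positivity) (h2.trans (le_of_eq ?_))
  rw [mul_pow, Real.rpow_inv_natCast_pow ENNReal.toReal_nonneg hp.ne']

lemma fb_holder (hB : IsFBM H P B) (ha : ∀ s t : ℝ, ∫ ω, (B t ω - B s ω) ^ 2 ∂P = aH * |t - s| ^ (2 * H))
    (haH : 0 < aH) {α T : ℝ} (hα : 0 < α) (hαH : α < H) (hT : 0 < T) :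
    ∀ᵐ ω ∂P, ∃ C : ℝ, 0 < C ∧ ∀ u ∈ Icc 0 T, ∀ v ∈ Icc 0 T, |B u ω - B v ω| ≤ C * |u - v| ^ α := by
  obtain ⟨p, hp⟩ := exists_nat_gt (1 / (H - α))
  have hp1 : 1 < p * (H - α) := by rwa [div_lt_iff₀ (by linarith)] at hp
  have hp0 : 0 < p := by
    rcases Nat.eq_zero_or_pos p with rfl | h
    · simp at hp1; linarith
    · exact h
  obtain ⟨Z, mZ, iZ, h⟩ := fb_Z hB ha haH (α := α) hT hp1
  filter_upwards [ae_lt_top mZ iZ.ne] with ω hω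
  have key := fun n => @fb_path _ _ _ _ _ _ _ _ hα hT _ hp0 hB _ hω.ne _ (h ω) n
  set q : ℝ := (2 : ℝ) ^ (-α) with hq
  have hq0 : 0 < q := by positivity
  have hq1 : q < 1 := Real.rpow_lt_one_of_one_lt_of_neg one_lt_two (by linarith)
  have hq2 : 0 < 1 - q := by linarith
  set D := (2 * (q / (1 - q)) + 1) * (Z ω).toReal ^ ((p : ℝ)⁻¹)
  have hD : 0 ≤ D := by positivity
  refine ⟨D * (2 / T) ^ α + 1, by positivity, fun u hu v hv => ?_⟩
  rcases eq_or_ne u v with rfl | huv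
  · simp; positivity
  have hd : 0 < |u - v| := abs_pos.2 (sub_ne_zero.2 huv)
  have hdT : |u - v| ≤ T := by rw [abs_le]; constructor <;> linarith [hu.1, hu.2, hv.1, hv.2]
  obtain ⟨n, hn1, hn2⟩ := exists_nat_pow_near_of_lt_one (x := |u - v| / T) (y := 1 / 2) (by positivity)
    (by rw [div_le_one hT]; exact hdT) (by norm_num) (by norm_num)
  have e2 : (1 / 2 : ℝ) ^ n = 1 / 2 ^ n := by rw [one_div, inv_pow, one_div]
  have h1 := key n hu hv (by rw [div_le_iff₀ hT, e2] at hn2; rw [div_eq_mul_one_div, mul_comm]; exact hn2)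
  have h3 : (1 / 2 : ℝ) ^ n ≤ 2 / T * |u - v| := by
    rw [pow_succ, lt_div_iff₀ hT] at hn1
    rw [div_mul_eq_mul_div, le_div_iff₀ hT]; linarith
  have h4 : q ^ n ≤ (2 / T) ^ α * |u - v| ^ α := by
    rw [← Real.mul_rpow (by positivity) hd.le]
    refine le_trans (le_of_eq ?_) (Real.rpow_le_rpow (by positivity) h3 hα.le)
    rw [e2, one_div, Real.inv_rpow (by positivity), hq, Real.rpow_neg (by norm_num), inv_pow]
    congr 1
    rw [← Real.rpow_natCast, ← Real.rpow_natCast, ← Real.rpow_mul (by norm_num), ← Real.rpow_mul (by norm_num), mul_comm]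
  refine h1.trans ((mul_le_mul_of_nonneg_left h4 hD).trans ?_)
  have : 0 < |u - v| ^ α := by positivity
  nlinarith

lemma Wt_sq_lt (hB : IsFBM H P B) (ha : ∀ s t : ℝ, ∫ ω, (B t ω - B s ω) ^ 2 ∂P = aH * |t - s| ^ (2 * H))
    (haH : 0 < aH) (hH : 0 < H) {T : ℝ} (hT : 0 < T) :
    ∫⁻ ω, Wt (fun r => B r ω) 0 T 1 ^ 2 ∂P < ⊤ := by
  set α := H / 2 with hαd
  have hα : 0 < α := by positivity
  obtain ⟨p, hp⟩ := exists_nat_gt (2 / α)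
  have hp2 : 2 < p * α := by rwa [div_lt_iff₀ hα] at hp
  have hp1 : 1 < p * (H - α) := by rw [show H - α = α by rw [hαd]; ring]; linarith
  have hp0 : 0 < p := by
    rcases Nat.eq_zero_or_pos p with rfl | h
    · simp at hp1; linarith
    · exact h
  obtain ⟨Z, mZ, iZ, h⟩ := fb_Z hB ha haH (α := α) hT hp1
  set q : ℝ := (2 : ℝ) ^ (-α) with hq
  have hq0 : 0 < q := by positivity
  have hq1 : q < 1 := Real.rpow_lt_one_of_one_lt_of_neg one_lt_two (by linarith)
  have hq2 : 0 < 1 - q := by linarith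
  set c := 2 * (q / (1 - q)) + 1
  have hc : 0 < c := by positivity
  have hbd : ∀ᵐ ω ∂P, Wt (fun r => B r ω) 0 T 1 ^ 2 ≤ 1 + ENNReal.ofReal (4 * c ^ p) * Z ω := by
    filter_upwards [ae_lt_top mZ iZ.ne] with ω hω
    have key := fun n => @fb_path _ _ _ _ _ _ _ _ hα hT _ hp0 hB _ hω.ne _ (h ω) n
    set D := c * (Z ω).toReal ^ ((p : ℝ)⁻¹) with hDd
    have hD : 0 ≤ D := by positivity
    have ex : ∃ n : ℕ, D * q ^ n ≤ 1 := by
      have : Tendsto (fun n : ℕ => D * q ^ n) atTop (𝓝 0) := by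
        simpa using (tendsto_pow_atTop_nhds_zero_of_lt_one hq0.le hq1).const_mul D
      obtain ⟨n, hn⟩ := (this.eventually (gt_mem_nhds zero_lt_one)).exists
      exact ⟨n, hn.le⟩
    have hW : ∀ n : ℕ, D * q ^ n ≤ 1 → Wt (fun r => B r ω) 0 T 1 ≤ 2 ^ n := by
      intro n hn
      have e : (0 : ℝ) + ((2 ^ n : ℕ) : ℝ) * (T / 2 ^ n) = T := by push_cast; field_simp; ring
      have := @Wt_osc_blocks (fun r => B r ω) (hB.1 ω) 0 (T / 2 ^ n) 1 zero_le_one (by positivity) (2 ^ n)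
        (by
          rw [e]
          intro u hu v hv huv
          have := key n hv hu (by rwa [abs_sub_comm])
          exact (le_abs_self _).trans (this.trans hn))
      rw [e] at this
      simpa using this
    set n := Nat.find ex with hn
    have hn1 := hW n (Nat.find_spec ex)
    rcases Nat.eq_zero_or_pos n with h0 | h0
    · rw [h0] at hn1
      refine le_trans (pow_le_pow_left' hn1 2) ?_
      simp
    obtain ⟨m, hm⟩ : ∃ m, n = m + 1 := ⟨n - 1, by omega⟩
    have hm2 : 1 < D * q ^ m := by
      have := Nat.find_min ex (m := m) (by omega)
      push Not at this; exact this
    have h4 : ((2 : ℝ) ^ n) ^ 2 ≤ 4 * c ^ p * (Z ω).toReal := by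
      have a1 : (1 : ℝ) ≤ (D * q ^ m) ^ p := one_le_pow₀ hm2.le
      have a2 : (q ^ m) ^ p ≤ ((2 : ℝ) ^ (2 * m))⁻¹ := by
        have b1 : q ^ p ≤ 1 / 4 := by
          rw [hq, ← Real.rpow_natCast, ← Real.rpow_mul (by norm_num), show (1 / 4 : ℝ) = (2 : ℝ) ^ (-2 : ℝ) by
            rw [Real.rpow_neg (by norm_num)]; norm_num]
          exact Real.rpow_le_rpow_of_exponent_le (by norm_num) (by nlinarith)
        have b2 : ((2 : ℝ) ^ (2 * m))⁻¹ = (1 / 4) ^ m := by rw [pow_mul, one_div, inv_pow]; norm_num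
        rw [b2, ← pow_mul, mul_comm m p, pow_mul]
        exact pow_le_pow_left₀ (by positivity) b1 m
      have a3 : D ^ p = c ^ p * (Z ω).toReal := by
        rw [hDd, mul_pow, Real.rpow_inv_natCast_pow ENNReal.toReal_nonneg hp0.ne']
      rw [mul_pow, a3] at a1
      have a4 : 1 ≤ c ^ p * (Z ω).toReal * ((2 : ℝ) ^ (2 * m))⁻¹ :=
        a1.trans (mul_le_mul_of_nonneg_left a2 (by positivity))
      rw [← div_eq_mul_inv, le_div_iff₀ (by positivity), one_mul] at a4
      have : ((2 : ℝ) ^ n) ^ 2 = 4 * 2 ^ (2 * m) := by rw [hm]; ring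
      linarith
    refine le_trans (pow_le_pow_left' hn1 2) (le_trans ?_ le_add_self)
    rw [← ENNReal.ofReal_toReal hω.ne, ← ENNReal.ofReal_mul (by positivity)]
    refine le_trans (le_of_eq ?_) (ENNReal.ofReal_le_ofReal h4)
    rw [ENNReal.ofReal_pow (by positivity), ENNReal.ofReal_pow (by positivity)]; simp
  refine (lintegral_mono_ae hbd).trans_lt ?_
  rw [lintegral_add_left measurable_const, lintegral_const_mul _ mZ]
  simp only [lintegral_const, measure_univ, mul_one]
  exact ENNReal.add_lt_top.2 ⟨ENNReal.one_lt_top, ENNReal.mul_lt_top ENNReal.ofReal_lt_top iZ⟩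
end M10
end

section
section M11
set_option linter.unusedSectionVars false

lemma fekete {G : ℝ → ℝ} (h0 : ∀ t, 0 < t → 0 ≤ G t) (hsup : ∀ s t, 0 < s → 0 < t → G s + G t ≤ G (s + t))
    (hsub : ∀ s t, 0 < s → 0 < t → G (s + t) ≤ G s + G t + 1) :
    ∃ γ : ℝ, 0 ≤ γ ∧ ∀ t, 0 < t → G t ≤ γ * t ∧ γ * t - 1 ≤ G t := by
  have hmono : ∀ s t, 0 < s → s ≤ t → G s ≤ G t := by
    intro s t hs hst
    rcases eq_or_lt_of_le hst with rfl | h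
    · exact le_rfl
    · have := hsup s (t - s) hs (by linarith)
      have := h0 (t - s) (by linarith)
      rw [show s + (t - s) = t by ring] at *
      linarith
  have hS : ∀ s, 0 < s → ∀ n : ℕ, (n + 1) * G s ≤ G ((n + 1) * s) := by
    intro s hs n
    induction n with
    | zero => simp
    | succ n ih =>
      have := hsup ((n + 1) * s) s (by positivity) hs
      push_cast
      rw [show ((n : ℝ) + 1 + 1) * s = (n + 1) * s + s by ring]
      linarith
  have hT : ∀ s, 0 < s → ∀ n : ℕ, G ((n + 1) * s) + 1 ≤ (n + 1) * (G s + 1) := by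
    intro s hs n
    induction n with
    | zero => simp
    | succ n ih =>
      have := hsub ((n + 1) * s) s (by positivity) hs
      push_cast
      rw [show ((n : ℝ) + 1 + 1) * s = (n + 1) * s + s by ring]
      linarith
  have key : ∀ s t, 0 < s → 0 < t → G s / s ≤ (G t + 1) / t := by
    intro s t hs ht
    have h1 : ∀ n : ℕ, G s ≤ (s / t + 1 / (n + 1)) * (G t + 1) := by
      intro n
      set m := ⌊(n + 1) * s / t⌋₊ with hm
      have m1 : (m : ℝ) ≤ (n + 1) * s / t := Nat.floor_le (by positivity)
      have m2 : (n + 1) * s / t < m + 1 := Nat.lt_floor_add_one _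
      have a1 := hS s hs n
      have a2 := hmono ((n + 1) * s) ((m + 1) * t) (by positivity) (by rw [div_lt_iff₀ ht] at m2; exact m2.le)
      have a3 := hT t ht m
      have a4 : ((m : ℝ) + 1) * (G t + 1) ≤ ((n + 1) * s / t + 1) * (G t + 1) :=
        mul_le_mul_of_nonneg_right (by linarith) (by have := h0 t ht; linarith)
      have a5 : ((n : ℝ) + 1) * G s ≤ ((n + 1) * s / t + 1) * (G t + 1) := by linarith
      have hn : (0 : ℝ) < n + 1 := by positivity
      rw [← mul_le_mul_iff_right₀ hn]
      refine a5.trans (le_of_eq ?_)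
      field_simp
    have h2 : Tendsto (fun n : ℕ => (s / t + 1 / ((n : ℝ) + 1)) * (G t + 1)) atTop (𝓝 ((s / t + 0) * (G t + 1))) :=
      (tendsto_const_nhds.add tendsto_one_div_add_atTop_nhds_zero_nat).mul_const _
    have h3 := ge_of_tendsto' h2 h1
    rw [div_le_div_iff₀ hs ht]
    rw [add_zero, div_mul_eq_mul_div, le_div_iff₀ ht] at h3
    linarith
  have bdd : BddAbove (range fun s : Ioi (0:ℝ) => G s / s) :=
    ⟨(G 1 + 1) / 1, by rintro _ ⟨s, rfl⟩; exact key s 1 s.2 one_pos⟩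
  have : Nonempty (Ioi (0:ℝ)) := ⟨⟨1, by simp⟩⟩
  refine ⟨⨆ s : Ioi (0:ℝ), G s / s, Real.iSup_nonneg fun s => div_nonneg (h0 _ s.2) (le_of_lt s.2), fun t ht => ⟨?_, ?_⟩⟩
  · rw [← div_le_iff₀ ht]
    exact le_ciSup bdd (⟨t, ht⟩ : Ioi (0:ℝ))
  · have : (⨆ s : Ioi (0:ℝ), G s / s) ≤ (G t + 1) / t := ciSup_le fun s => key s t s.2 ht
    rw [le_div_iff₀ ht] at this
    linarith

variable {Ω : Type*} [MeasurableSpace Ω] {P : Measure Ω} [IsProbabilityMeasure P] {H : ℝ} {B : ℝ → Ω → ℝ} {aH : ℝ}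

/-- mean total number of upcrossings -/
def gE (P : Measure Ω) (B : ℝ → Ω → ℝ) (t : ℝ) : ℝ≥0∞ := ∫⁻ ω, Wt (fun r => B r ω) 0 t 1 ∂P

lemma gE_lt (hB : IsFBM H P B) (ha : ∀ s t : ℝ, ∫ ω, (B t ω - B s ω) ^ 2 ∂P = aH * |t - s| ^ (2 * H))
    (haH : 0 < aH) (hH : 0 < H) {t : ℝ} (ht : 0 < t) : gE P B t < ⊤ := by
  refine (lintegral_mono (g := fun ω => 1 + Wt (fun r => B r ω) 0 t 1 ^ 2) fun ω => ?_).trans_lt ?_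
  · change Wt (fun r => B r ω) 0 t 1 ≤ 1 + Wt (fun r => B r ω) 0 t 1 ^ 2
    rcases le_total (Wt (fun r => B r ω) 0 t 1) 1 with h | h
    · exact h.trans le_self_add
    · refine le_trans ?_ le_add_self
      rw [sq]; exact le_mul_of_one_le_left' h
  · rw [lintegral_add_left measurable_const]
    simp only [lintegral_const, measure_univ, mul_one]
    exact ENNReal.add_lt_top.2 ⟨ENNReal.one_lt_top, Wt_sq_lt hB ha haH hH ht⟩

lemma Wt_mean (hB : IsFBM H P B) (ha : ∀ s t : ℝ, ∫ ω, (B t ω - B s ω) ^ 2 ∂P = aH * |t - s| ^ (2 * H))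
    (haH : 0 < aH) (hH : 0 < H) (s : ℝ) {h ε : ℝ} (hh : 0 < h) (hε : 0 < ε) :
    ∫⁻ ω, Wt (fun r => B r ω) s (s + h) ε ∂P = ENNReal.ofReal ε * gE P B (h * ε ^ (-(1 / H))) := by
  simpa [gE] using Wt_moment hB ha haH hH s hh hε 1

lemma exists_gamma (hB : IsFBM H P B) (ha : ∀ s t : ℝ, ∫ ω, (B t ω - B s ω) ^ 2 ∂P = aH * |t - s| ^ (2 * H))
    (haH : 0 < aH) (hH : 0 < H) : ∃ γ : ℝ, 0 ≤ γ ∧ cH P B = 2 * γ ∧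
      ∀ t, 0 < t → gE P B t ≤ ENNReal.ofReal (γ * t) ∧ ENNReal.ofReal (γ * t - 1) ≤ gE P B t := by
  have m : ∀ t, 0 < t → Measurable fun ω => Wt (fun r => B r ω) 0 t 1 := fun t ht => by
    simpa using Wt_meas hB 0 ht zero_le_one
  have e1 : ∀ s t, 0 < t → ∫⁻ ω, Wt (fun r => B r ω) s (s + t) 1 ∂P = gE P B t := fun s t ht => by
    simpa using Wt_mean hB ha haH hH s ht one_pos
  have fin : ∀ t, 0 < t → gE P B t ≠ ⊤ := fun t ht => (gE_lt hB ha haH hH ht).ne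
  have hsup : ∀ s t, 0 < s → 0 < t → gE P B s + gE P B t ≤ gE P B (s + t) := by
    intro s t hs ht
    rw [← e1 s t ht]
    unfold gE
    rw [← lintegral_add_left (m s hs)]
    exact lintegral_mono fun ω => Wt_superadd (hB.1 ω) zero_le_one hs.le (by linarith)
  have hsub : ∀ s t, 0 < s → 0 < t → gE P B (s + t) ≤ gE P B s + gE P B t + 1 := by
    intro s t hs ht
    rw [← e1 s t ht]
    unfold gE
    rw [← lintegral_add_left (m s hs)]
    refine le_trans (lintegral_mono fun ω => Wt_subadd (hB.1 ω) zero_le_one hs.le (by linarith)) ?_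
    rw [lintegral_add_right _ measurable_const]
    simp
  obtain ⟨γ, h0, hγ⟩ := fekete (G := fun t => (gE P B t).toReal) (fun _ _ => ENNReal.toReal_nonneg)
    (fun s t hs ht => by
      rw [← ENNReal.toReal_add (fin s hs) (fin t ht)]
      exact ENNReal.toReal_mono (fin _ (by linarith)) (hsup s t hs ht))
    (fun s t hs ht => by
      rw [← ENNReal.toReal_add (fin s hs) (fin t ht), ← ENNReal.toReal_one,
        ← ENNReal.toReal_add (ENNReal.add_ne_top.2 ⟨fin s hs, fin t ht⟩) ENNReal.one_ne_top]
      exact ENNReal.toReal_mono (ENNReal.add_ne_top.2 ⟨ENNReal.add_ne_top.2 ⟨fin s hs, fin t ht⟩, ENNReal.one_ne_top⟩) (hsub s t hs ht))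
  have hγ' : ∀ t, 0 < t → gE P B t ≤ ENNReal.ofReal (γ * t) ∧ ENNReal.ofReal (γ * t - 1) ≤ gE P B t := by
    intro t ht
    refine ⟨(ENNReal.le_ofReal_iff_toReal_le (fin t ht) (by positivity)).2 (hγ t ht).1,
      ENNReal.ofReal_le_of_le_toReal (hγ t ht).2⟩
  refine ⟨γ, h0, ?_, hγ'⟩
  have lo : ∀ t, 0 < t → ENNReal.ofReal (2 * γ - 2 / t) ≤ cHe P B := by
    intro t ht
    have : (ENNReal.ofReal t)⁻¹ * ∫⁻ ω, avgK 1 (fun r => B r ω) 0 t ∂P ≤ cHe P B :=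
      le_iSup₂ (f := fun (t : ℝ) (_ : 0 < t) => (ENNReal.ofReal t)⁻¹ * ∫⁻ ω, avgK 1 (fun r => B r ω) 0 t ∂P) t ht
    refine le_trans ?_ this
    have h1 : gE P B t + gE P B t ≤ ∫⁻ ω, avgK 1 (fun r => B r ω) 0 t ∂P := by
      nth_rewrite 2 [gE]
      rw [← Wt_neg_mean hB ha haH ht one_pos]
      unfold gE
      rw [← lintegral_add_left (m t ht)]
      exact lintegral_mono fun ω => avgK_ge (hB.1 ω) (hB.2.1 ω) t
    refine le_trans ?_ (mul_le_mul_right h1 _)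
    refine le_trans ?_ (mul_le_mul_right (add_le_add (hγ' t ht).2 (hγ' t ht).2) _)
    rw [← ENNReal.ofReal_inv_of_pos ht]
    rcases le_total (γ * t - 1) 0 with h | h
    · rw [ENNReal.ofReal_of_nonpos (p := 2 * γ - 2 / t)]; exact zero_le
      rw [sub_nonpos, le_div_iff₀ ht]; linarith
    · rw [← ENNReal.ofReal_add h h, ← ENNReal.ofReal_mul (by positivity)]
      refine ENNReal.ofReal_le_ofReal (le_of_eq ?_)
      field_simp; ring
  have hi : ∀ η, 0 < η → η < 1 / 2 → cHe P B ≤ ENNReal.ofReal (2 * γ * (1 - 2 * η) ^ (1 - 1 / H)) := by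
    intro η hη hη'
    refine iSup₂_le fun t ht => ?_
    have hε : 0 < 1 - 2 * η := by linarith
    have h1 : ∫⁻ ω, avgK 1 (fun r => B r ω) 0 t ∂P ≤ ENNReal.ofReal (1 - 2 * η) * gE P B (t * (1 - 2 * η) ^ (-(1 / H)))
        + ENNReal.ofReal (1 - 2 * η) * gE P B (t * (1 - 2 * η) ^ (-(1 / H))) := by
      have ew := Wt_mean hB ha haH hH 0 ht hε
      rw [zero_add] at ew
      rw [← ew]
      nth_rewrite 2 [← Wt_neg_mean hB ha haH ht hε]
      rw [← lintegral_add_left (by simpa using Wt_meas hB 0 ht hε.le)]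
      exact lintegral_mono fun ω => avgK_le (hB.1 ω) (hB.2.1 ω) ht.le hη hη'
    have h2 := (hγ' (t * (1 - 2 * η) ^ (-(1 / H))) (by positivity)).1
    have h3 := mul_le_mul_right h2 (ENNReal.ofReal (1 - 2 * η))
    refine le_trans (mul_le_mul_right (h1.trans (add_le_add h3 h3)) _) ?_
    rw [← ENNReal.ofReal_inv_of_pos ht, ← ENNReal.ofReal_mul hε.le, ← ENNReal.ofReal_add (by positivity) (by positivity),
      ← ENNReal.ofReal_mul (by positivity)]
    refine ENNReal.ofReal_le_ofReal (le_of_eq ?_)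
    rw [sub_eq_add_neg 1 (1 / H), Real.rpow_add hε, Real.rpow_one]
    field_simp; ring
  have hne : cHe P B ≠ ⊤ := ((hi (1 / 4) (by norm_num) (by norm_num)).trans_lt ENNReal.ofReal_lt_top).ne
  unfold cH
  refine le_antisymm ?_ ?_
  · have hc : Tendsto (fun η : ℝ => 2 * γ * (1 - 2 * η) ^ (1 - 1 / H)) (𝓝[>] 0) (𝓝 (2 * γ * (1 - 2 * 0) ^ (1 - 1 / H))) := by
      refine tendsto_nhdsWithin_of_tendsto_nhds (ContinuousAt.tendsto (f := fun η : ℝ => 2 * γ * (1 - 2 * η) ^ (1 - 1 / H)) ?_)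
      refine continuousAt_const.mul (ContinuousAt.rpow_const (by fun_prop) (Or.inl (by norm_num)))
    have h2 : ∀ᶠ η in 𝓝[>] (0:ℝ), (cHe P B).toReal ≤ 2 * γ * (1 - 2 * η) ^ (1 - 1 / H) := by
      filter_upwards [Ioo_mem_nhdsGT (show (0:ℝ) < 1 / 2 by norm_num)] with η hη
      have : 0 ≤ 1 - 2 * η := by linarith [hη.2]
      have := ENNReal.toReal_mono ENNReal.ofReal_ne_top (hi η hη.1 hη.2)
      rwa [ENNReal.toReal_ofReal (by positivity)] at this
    have := ge_of_tendsto hc h2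
    simpa using this
  · refine le_of_forall_pos_le_add fun e he => ?_
    have h1 := lo (2 / e) (by positivity)
    have h2 := (ENNReal.ofReal_le_iff_le_toReal hne).1 h1
    rw [div_div_cancel₀ (by norm_num)] at h2
    linarith
end M11
end

section
section M12
open Matrix
set_option linter.unusedSectionVars false
variable {Ω : Type*} [MeasurableSpace Ω] {P : Measure Ω} [IsProbabilityMeasure P] {H : ℝ} {B : ℝ → Ω → ℝ} {aH : ℝ}

/-- second moment of the total number of upcrossings -/
def sE (P : Measure Ω) (B : ℝ → Ω → ℝ) (t : ℝ) : ℝ≥0∞ := ∫⁻ ω, Wt (fun r => B r ω) 0 t 1 ^ 2 ∂P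

lemma Wt_mean1 (hB : IsFBM H P B) (ha : ∀ s t : ℝ, ∫ ω, (B t ω - B s ω) ^ 2 ∂P = aH * |t - s| ^ (2 * H))
    (haH : 0 < aH) (hH : 0 < H) (s : ℝ) {h : ℝ} (hh : 0 < h) :
    ∫⁻ ω, Wt (fun r => B r ω) s (s + h) 1 ∂P = gE P B h := by
  simpa using Wt_mean hB ha haH hH s hh one_pos

lemma Wt_sq1 (hB : IsFBM H P B) (ha : ∀ s t : ℝ, ∫ ω, (B t ω - B s ω) ^ 2 ∂P = aH * |t - s| ^ (2 * H))
    (haH : 0 < aH) (hH : 0 < H) (s : ℝ) {h : ℝ} (hh : 0 < h) :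
    ∫⁻ ω, Wt (fun r => B r ω) s (s + h) 1 ^ 2 ∂P = sE P B h := by
  simpa [sE] using Wt_moment hB ha haH hH s hh one_pos 2

lemma Wt_pair (hB : IsFBM H P B) (ha : ∀ s t : ℝ, ∫ ω, (B t ω - B s ω) ^ 2 ∂P = aH * |t - s| ^ (2 * H))
    (haH : 0 < aH) (hH : 0 < H) (hH2 : H < 1 / 2) (s : ℝ) {h : ℝ} (hh : 0 < h) {D d q : ℕ} (hD : 0 < D)
    (hd : D + 1 ≤ d) (hq : (2 : ℝ) ^ q ≤ 2 * H * D) :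
    ∫⁻ ω, Wt (fun r => B r ω) s (s + h) 1 * Wt (fun r => B r ω) (s + d * h) (s + d * h + h) 1 ∂P ≤
      gE P B h ^ 2 + ENNReal.ofReal ((1 / 2) ^ q) * (sE P B h + sE P B h) := by
  have e : ∀ ω, Wt (fun r => B r ω) s (s + h) 1 * Wt (fun r => B r ω) (s + d * h) (s + d * h + h) 1 =
      ⨆ k : ℕ, J (pth (incr B s (h / 2 ^ k) (2 ^ k) ω)) (Icc 0 (2 ^ k)) univ 1 *
        J (pth (incr B (s + d * h) (h / 2 ^ k) (2 ^ k) ω)) (Icc 0 (2 ^ k)) univ 1 := fun ω => by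
    rw [Wt_incr hB s hh zero_le_one, Wt_incr hB _ hh zero_le_one]
    exact iSup_mul_mono (Wt_incr_mono B s 1 hh ω) (Wt_incr_mono B _ 1 hh ω)
  have mJ : ∀ (s : ℝ) (k : ℕ), Measurable fun ω => J (pth (incr B s (h / 2 ^ k) (2 ^ k) ω)) (Icc 0 (2 ^ k)) univ 1 :=
    fun s k => (J_pth_meas _ _ _).comp (incr_meas hB _ _ _)
  simp only [e]
  have mJ2 : ∀ k : ℕ, Measurable fun ω => J (pth (incr B s (h / 2 ^ k) (2 ^ k) ω)) (Icc 0 (2 ^ k)) univ 1 *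
        J (pth (incr B (s + d * h) (h / 2 ^ k) (2 ^ k) ω)) (Icc 0 (2 ^ k)) univ 1 := fun k => (mJ s k).mul (mJ _ k)
  rw [lintegral_iSup mJ2
    (fun k k' hk ω => mul_le_mul' (Wt_incr_mono B s 1 hh ω hk) (Wt_incr_mono B _ 1 hh ω hk))]
  refine iSup_le fun k => ?_
  have hτ : 0 < h / 2 ^ k := by positivity
  have hG := incr2_IsG hB ha hτ s (2 ^ k) (d * 2 ^ k)
  have es : s + ((d * 2 ^ k : ℕ) : ℝ) * (h / 2 ^ k) = s + d * h := by push_cast; field_simp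
  rw [es] at hG
  have hp : 0 < 2 * H := by linarith
  have hp1 : 2 * H < 1 := by linarith
  have hat : 0 ≤ aH * (h / 2 ^ k) ^ (2 * H) := by positivity
  have mF : Measurable fun x : Fin (2 ^ k) → ℝ => J (pth x) (Icc 0 (2 ^ k)) univ 1 := J_pth_meas _ _ _
  have key := geb_lint (incr_IsG hB ha hτ s (2 ^ k)) (Sm_sym _ _)
    (fun c => by rw [Sm_q]; exact mul_nonneg hat (Qf_nonneg hp hp1 _ _)) q
    (Cm aH H (h / 2 ^ k) (2 ^ k) ((d * 2 ^ k : ℕ) : ℝ)) (fun c c' => by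
      rw [Sm_q, Sm_q, Cm_q, abs_mul, abs_of_nonneg hat]
      have h1 := decor hp hp1 (l := 2 ^ k) (m := D) (M := d * 2 ^ k) (by positivity) hD (Nat.mul_le_mul_right _ hd) (ex0 c) (ex0 c')
      have q1 := Qf_nonneg hp hp1 (2 ^ k) (ex0 c)
      have q2 := Qf_nonneg hp hp1 (2 ^ k) (ex0 c')
      set a := Qf (2 * H) (2 ^ k) (ex0 c)
      set b := Qf (2 * H) (2 ^ k) (ex0 c')
      have hD0 : (0 : ℝ) < D := by exact_mod_cast hD
      have h2 : 1 / (2 * H * D) ≤ (1 / 2 : ℝ) ^ q := by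
        rw [_root_.one_div_pow]; exact one_div_le_one_div_of_le (by positivity) hq
      have h3 : Real.sqrt a * Real.sqrt b ≤ (a + b) / 2 := by
        have := sq_nonneg (Real.sqrt a - Real.sqrt b)
        have := Real.sq_sqrt q1
        have := Real.sq_sqrt q2
        nlinarith
      have h4 := h1.trans (mul_le_mul h2 h3 (by positivity) (by positivity))
      calc _ ≤ _ := mul_le_mul_of_nonneg_left h4 hat
        _ = _ := by ring) _ hG _ _ mF mF
  have mFF : Measurable fun z : Fin (2 ^ k) ⊕ Fin (2 ^ k) → ℝ => J (pth (z ∘ Sum.inl)) (Icc 0 (2 ^ k)) univ 1 *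
      J (pth (z ∘ Sum.inr)) (Icc 0 (2 ^ k)) univ 1 :=
    (mF.comp (measurable_pi_lambda _ fun i => measurable_pi_apply _)).mul
      (mF.comp (measurable_pi_lambda _ fun i => measurable_pi_apply _))
  rw [lintegral_map mFF
      (measurable_pi_lambda _ (by
        rintro (i | i)
        · exact (measurable_pi_apply i).comp (incr_meas hB _ _ _)
        · exact (measurable_pi_apply i).comp (incr_meas hB _ _ _))),
    lintegral_map mF (incr_meas hB _ _ _), lintegral_map (mF.pow_const 2) (incr_meas hB _ _ _)] at key
  have le1 : ∀ ω, J (pth (incr B s (h / 2 ^ k) (2 ^ k) ω)) (Icc 0 (2 ^ k)) univ 1 ≤ Wt (fun r => B r ω) s (s + h) 1 := fun ω => by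
    rw [Wt_incr hB s hh zero_le_one]; exact le_iSup (fun k => J (pth (incr B s (h / 2 ^ k) (2 ^ k) ω)) (Icc 0 (2 ^ k)) univ 1) k
  have g1 : ∫⁻ ω, J (pth (incr B s (h / 2 ^ k) (2 ^ k) ω)) (Icc 0 (2 ^ k)) univ 1 ∂P ≤ gE P B h := by
    rw [← Wt_mean1 hB ha haH hH s hh]; exact lintegral_mono le1
  have s1 : ∫⁻ ω, J (pth (incr B s (h / 2 ^ k) (2 ^ k) ω)) (Icc 0 (2 ^ k)) univ 1 ^ 2 ∂P ≤ sE P B h := by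
    rw [← Wt_sq1 hB ha haH hH s hh]; exact lintegral_mono fun ω => pow_le_pow_left' (le1 ω) 2
  refine le_trans (le_trans (le_of_eq ?_) key) ?_
  · rfl
  · rw [sq]
    gcongr

lemma Wt_sq_blocks (hB : IsFBM H P B) (ha : ∀ s t : ℝ, ∫ ω, (B t ω - B s ω) ^ 2 ∂P = aH * |t - s| ^ (2 * H))
    (haH : 0 < aH) (hH : 0 < H) (hH2 : H < 1 / 2) {h : ℝ} (hh : 0 < h) {D q : ℕ} (hD : 0 < D)
    (hq : (2 : ℝ) ^ q ≤ 2 * H * D) (m : ℕ) :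
    sE P B (m * h) ≤ gE P B (m * h) ^ 2 + m ^ 2 * (ENNReal.ofReal ((1 / 2) ^ q) * (sE P B h + sE P B h)) +
      m * ((2 * D + 1 : ℕ) * (sE P B h + sE P B h)) + (2 * m ^ 2 * gE P B h + m ^ 2) := by
  set W : ℕ → Ω → ℝ≥0∞ := fun j ω => Wt (fun r => B r ω) (j * h) (j * h + h) 1 with hW
  have mW : ∀ j, Measurable (W j) := fun j => Wt_meas hB _ hh zero_le_one
  have EW : ∀ j, ∫⁻ ω, W j ω ∂P = gE P B h := fun j => Wt_mean1 hB ha haH hH _ hh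
  have EW2 : ∀ j, ∫⁻ ω, W j ω ^ 2 ∂P = sE P B h := fun j => Wt_sq1 hB ha haH hH _ hh
  have bl : ∀ j : ℕ, (0 : ℝ) + (j + 1) * h = j * h + h := fun j => by ring
  have up : ∀ ω, Wt (fun r => B r ω) 0 (m * h) 1 ≤ ∑ j ∈ Finset.range m, W j ω + m := fun ω => by
    have := Wt_blocks_ge (hB.1 ω) (s := 0) zero_le_one hh.le m
    simpa [bl, W] using this
  have lo : ∀ ω, ∑ j ∈ Finset.range m, W j ω ≤ Wt (fun r => B r ω) 0 (m * h) 1 := fun ω => by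
    have := Wt_blocks_le (hB.1 ω) (s := 0) zero_le_one hh.le m
    simpa [bl, W] using this
  have gm : m * gE P B h ≤ gE P B (m * h) := by
    have : ∫⁻ ω, ∑ j ∈ Finset.range m, W j ω ∂P ≤ gE P B (m * h) := lintegral_mono lo
    rw [lintegral_finsetSum _ fun j _ => mW j] at this
    simpa [EW] using this
  set s2 := sE P B h + sE P B h with hs2
  set c := ENNReal.ofReal ((1 / 2) ^ q) * s2 with hc
  have pr : ∀ i j, ∫⁻ ω, W i ω * W j ω ∂P ≤ (gE P B h ^ 2 + c) + if i < j + D + 1 ∧ j < i + D + 1 then s2 else 0 := by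
    have far : ∀ i j, i + D + 1 ≤ j → ∫⁻ ω, W i ω * W j ω ∂P ≤ gE P B h ^ 2 + c := by
      intro i j hij
      have := Wt_pair hB ha haH hH hH2 (i * h) hh hD (d := j - i) (by omega) hq
      rw [show (i : ℝ) * h + ((j - i : ℕ) : ℝ) * h = j * h by
        rw [Nat.cast_sub (by omega)]; ring] at this
      exact this
    intro i j
    by_cases hn : i < j + D + 1 ∧ j < i + D + 1
    · rw [if_pos hn]
      refine le_trans ?_ le_add_self
      rw [hs2, ← EW2 i]
      nth_rewrite 1 [EW2 i]
      rw [← EW2 j, ← lintegral_add_left ((mW j).pow_const 2)]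
      refine lintegral_mono fun ω => ?_
      rcases le_total (W i ω) (W j ω) with h | h
      · refine le_trans (mul_le_mul' h le_rfl) ?_
        rw [← sq]; exact le_self_add
      · refine le_trans (mul_le_mul' le_rfl h) ?_
        rw [← sq]; exact le_add_self
    · rw [if_neg hn, add_zero]
      rcases le_or_gt (j + D + 1) i with h1 | h1
      · rw [lintegral_congr fun ω => mul_comm (W i ω) (W j ω)]; exact far j i h1
      · exact far i j (by by_contra h2; exact hn ⟨h1, by omega⟩)
  have mS : Measurable fun ω => ∑ j ∈ Finset.range m, W j ω := Finset.measurable_sum _ fun j _ => mW j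
  have ES : ∫⁻ ω, ∑ j ∈ Finset.range m, W j ω ∂P = m * gE P B h := by
    rw [lintegral_finsetSum _ fun j _ => mW j]; simp [EW]
  have ES2 : ∫⁻ ω, (∑ j ∈ Finset.range m, W j ω) ^ 2 ∂P ≤ m ^ 2 * (gE P B h ^ 2 + c) + m * ((2 * D + 1 : ℕ) * s2) := by
    have e1 : ∀ ω, (∑ j ∈ Finset.range m, W j ω) ^ 2 = ∑ i ∈ Finset.range m, ∑ j ∈ Finset.range m, W i ω * W j ω := fun ω => by
      rw [sq, Finset.sum_mul_sum]
    simp only [e1]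
    have mWW : ∀ i j, Measurable fun ω => W i ω * W j ω := fun i j => (mW i).mul (mW j)
    rw [lintegral_finsetSum _ fun i _ => Finset.measurable_sum _ fun j _ => mWW i j]
    have e2 : ∀ i ∈ Finset.range m, ∫⁻ ω, ∑ j ∈ Finset.range m, W i ω * W j ω ∂P ≤ m * (gE P B h ^ 2 + c) + (2 * D + 1 : ℕ) * s2 := by
      intro i _
      rw [lintegral_finsetSum _ fun j _ => mWW i j]
      refine (Finset.sum_le_sum fun j _ => pr i j).trans ?_
      rw [Finset.sum_add_distrib, Finset.sum_const, Finset.card_range, nsmul_eq_mul, ← Finset.sum_filter, Finset.sum_const, nsmul_eq_mul]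
      gcongr
      have : (Finset.range m).filter (fun j => i < j + D + 1 ∧ j < i + D + 1) ⊆ Finset.Icc (i - D) (i + D) := by
        intro j hj
        rw [Finset.mem_filter] at hj
        rw [Finset.mem_Icc]; omega
      refine (Finset.card_le_card this).trans ?_
      rw [Nat.card_Icc]; omega
    refine (Finset.sum_le_sum e2).trans (le_of_eq ?_)
    rw [Finset.sum_const, Finset.card_range, nsmul_eq_mul]; ring
  have h1 : sE P B (m * h) ≤ ∫⁻ ω, ((∑ j ∈ Finset.range m, W j ω) ^ 2 + (2 * m * ∑ j ∈ Finset.range m, W j ω + m ^ 2)) ∂P :=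
    lintegral_mono fun ω => (pow_le_pow_left' (up ω) 2).trans (le_of_eq (by ring))
  refine h1.trans ?_
  rw [lintegral_add_left (mS.pow_const 2), lintegral_add_right _ measurable_const, lintegral_const_mul _ mS, ES]
  simp only [lintegral_const, measure_univ, mul_one]
  refine (add_le_add ES2 le_rfl).trans ?_
  have : (m : ℝ≥0∞) ^ 2 * (gE P B h ^ 2 + c) ≤ gE P B (m * h) ^ 2 + m ^ 2 * c := by
    rw [mul_add, ← mul_pow]; gcongr
  refine (add_le_add (add_le_add this le_rfl) le_rfl).trans (le_of_eq ?_)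
  ring

lemma sE_crude (hB : IsFBM H P B) (ha : ∀ s t : ℝ, ∫ ω, (B t ω - B s ω) ^ 2 ∂P = aH * |t - s| ^ (2 * H))
    (haH : 0 < aH) (hH : 0 < H) (hH2 : H < 1 / 2) :
    ∃ C : ℝ, 0 < C ∧ ∀ h : ℝ, 1 ≤ h → sE P B h ≤ ENNReal.ofReal (C * h ^ 2) := by
  obtain ⟨γ, hγ0, -, hγ⟩ := exists_gamma hB ha haH hH
  have fin : sE P B 1 < ⊤ := Wt_sq_lt hB ha haH hH one_pos
  refine ⟨4 * (2 * (sE P B 1).toReal + 2), by positivity, fun h hh => ?_⟩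
  set m := ⌈h⌉₊ with hm
  have hm1 : h ≤ m := Nat.le_ceil h
  have hm2 : (m : ℝ) < h + 1 := Nat.ceil_lt_add_one (by linarith)
  set W : ℕ → Ω → ℝ≥0∞ := fun j ω => Wt (fun r => B r ω) j (j + 1) 1 with hW
  have mW : ∀ j, Measurable (W j) := fun j => Wt_meas hB _ one_pos zero_le_one
  have EW2 : ∀ j, ∫⁻ ω, W j ω ^ 2 ∂P = sE P B 1 := fun j => Wt_sq1 hB ha haH hH _ one_pos
  have up : ∀ ω, Wt (fun r => B r ω) 0 h 1 ≤ ∑ j ∈ Finset.range m, (W j ω + 1) := fun ω => by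
    have h1 := Wt_superadd (hB.1 ω) (s := 0) (t := h) (u := m) zero_le_one (by linarith) hm1
    have := Wt_blocks_ge (hB.1 ω) (s := 0) zero_le_one zero_le_one m
    rw [Finset.sum_add_distrib]
    refine le_trans (le_self_add.trans h1) ?_
    simpa [W] using this
  have sqle : ∀ ω, Wt (fun r => B r ω) 0 h 1 ^ 2 ≤ m * ∑ j ∈ Finset.range m, (2 * W j ω ^ 2 + 2) := by
    intro ω
    refine (pow_le_pow_left' (up ω) 2).trans ?_
    have h1 := ENNReal.inner_le_Lp_mul_Lq (Finset.range m) (fun _ => 1) (fun j => W j ω + 1) (p := 2) (q := 2) ⟨by norm_num, by norm_num, by norm_num⟩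
    have h2 := pow_le_pow_left' h1 2
    simp only [one_mul, mul_pow, ENNReal.one_rpow, Finset.sum_const, Finset.card_range, nsmul_eq_mul, mul_one] at h2
    have r : ∀ x : ℝ≥0∞, (x ^ (1 / 2 : ℝ)) ^ 2 = x := fun x => by
      rw [← ENNReal.rpow_natCast, ← ENNReal.rpow_mul]; norm_num
    rw [r, r] at h2
    refine h2.trans ?_
    gcongr with j _
    rw [show (2 : ℝ) = ((2 : ℕ) : ℝ) by norm_num, ENNReal.rpow_natCast]
    rcases le_total (W j ω) 1 with h | h
    · calc (W j ω + 1) ^ 2 = W j ω * W j ω + 2 * W j ω + 1 := by ring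
        _ ≤ W j ω ^ 2 + (W j ω ^ 2 + 1) + 1 := by
          gcongr
          · rw [sq]
          · by_cases ht : W j ω = ⊤
            · simp [ht]
            · rw [← ENNReal.ofReal_toReal ht]
              rw [← ENNReal.ofReal_pow (by positivity), ← ENNReal.ofReal_one, ← ENNReal.ofReal_add (by positivity) (by positivity),
                show (2 : ℝ≥0∞) = ENNReal.ofReal 2 by simp, ← ENNReal.ofReal_mul (by positivity)]
              exact ENNReal.ofReal_le_ofReal (by nlinarith [sq_nonneg ((W j ω).toReal - 1)])
        _ = _ := by ring
    · calc (W j ω + 1) ^ 2 = W j ω * W j ω + 2 * W j ω + 1 := by ring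
        _ ≤ W j ω ^ 2 + (W j ω ^ 2 + 1) + 1 := by
          gcongr
          · rw [sq]
          · by_cases ht : W j ω = ⊤
            · simp [ht]
            · rw [← ENNReal.ofReal_toReal ht]
              rw [← ENNReal.ofReal_pow (by positivity), ← ENNReal.ofReal_one, ← ENNReal.ofReal_add (by positivity) (by positivity),
                show (2 : ℝ≥0∞) = ENNReal.ofReal 2 by simp, ← ENNReal.ofReal_mul (by positivity)]
              exact ENNReal.ofReal_le_ofReal (by nlinarith [sq_nonneg ((W j ω).toReal - 1)])
        _ = _ := by ring
  have : sE P B h ≤ m * (m * (2 * sE P B 1 + 2)) := by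
    refine (lintegral_mono sqle).trans (le_of_eq ?_)
    have mm : ∀ j, Measurable fun ω => 2 * W j ω ^ 2 + 2 := fun j => (((mW j).pow_const 2).const_mul 2).add measurable_const
    rw [lintegral_const_mul _ (Finset.measurable_sum _ fun j _ => mm j), lintegral_finsetSum _ fun j _ => mm j]
    have : ∀ j ∈ Finset.range m, ∫⁻ ω, (2 * W j ω ^ 2 + 2) ∂P = 2 * sE P B 1 + 2 := fun j _ => by
      rw [lintegral_add_right _ measurable_const, lintegral_const_mul _ ((mW j).pow_const 2), EW2]; simp
    rw [Finset.sum_congr rfl this, Finset.sum_const, Finset.card_range, nsmul_eq_mul]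
  refine this.trans ?_
  rw [← ENNReal.ofReal_toReal fin.ne, ← ENNReal.ofReal_natCast, show (2 : ℝ≥0∞) = ENNReal.ofReal 2 by simp,
    ← ENNReal.ofReal_mul (by positivity), ← ENNReal.ofReal_add (by positivity) (by positivity),
    ← ENNReal.ofReal_mul (by positivity), ← ENNReal.ofReal_mul (by positivity)]
  refine ENNReal.ofReal_le_ofReal ?_
  have hx : (0:ℝ) ≤ 2 * (sE P B 1).toReal + 2 := by positivity
  rw [ENNReal.toReal_ofReal ENNReal.toReal_nonneg]
  have : (m : ℝ) * m ≤ 4 * h ^ 2 := by nlinarith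
  nlinarith

lemma Wt_var (hB : IsFBM H P B) (ha : ∀ s t : ℝ, ∫ ω, (B t ω - B s ω) ^ 2 ∂P = aH * |t - s| ^ (2 * H))
    (haH : 0 < aH) (hH : 0 < H) (hH2 : H < 1 / 2) :
    ∃ C : ℝ, 0 < C ∧ ∀ N : ℝ, 1 ≤ N → sE P B N ≤ gE P B N ^ 2 + ENNReal.ofReal (C * N ^ (7 / 4 : ℝ)) := by
  obtain ⟨γ, hγ0, -, hγ⟩ := exists_gamma hB ha haH hH
  obtain ⟨C0, hC0, hs⟩ := sE_crude hB ha haH hH hH2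
  refine ⟨4 * C0 + (1 / H + 3) * (4 * C0) + 2 * γ + 1, by positivity, fun N hN => ?_⟩
  have hN0 : 0 < N := by linarith
  set x := N ^ (1 / 4 : ℝ) with hx
  have x4 : x ^ 4 = N := by rw [hx, ← Real.rpow_natCast, ← Real.rpow_mul hN0.le]; norm_num
  have x7 : N ^ (7 / 4 : ℝ) = x ^ 7 := by rw [hx, ← Real.rpow_natCast, ← Real.rpow_mul hN0.le]; norm_num
  have x1 : 1 ≤ x := Real.one_le_rpow hN (by norm_num)
  obtain ⟨q, hq1, hq2⟩ := exists_nat_pow_near x1 (one_lt_two : (1 : ℝ) < 2)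
  set y := (2 : ℝ) ^ q with hy
  have y1 : 1 ≤ y := one_le_pow₀ (by norm_num)
  have hq2 : x < 2 * y := by rw [pow_succ] at hq2; linarith
  have em : ((4 ^ q : ℕ) : ℝ) = y ^ 2 := by push_cast; rw [hy, ← pow_mul, mul_comm, pow_mul]; norm_num
  set h := N / y ^ 2 with hh
  have hy2 : y ^ 2 ≤ x ^ 2 := by gcongr
  have hh1 : 1 ≤ h := by
    rw [hh, le_div_iff₀ (by positivity), one_mul, ← x4]
    nlinarith
  have hh0 : 0 < h := by linarith
  have mh : ((4 ^ q : ℕ) : ℝ) * h = N := by rw [em, hh]; field_simp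
  set D := ⌈y / (2 * H)⌉₊ with hD
  have D1 : y / (2 * H) ≤ D := Nat.le_ceil _
  have D2 : (D : ℝ) < y / (2 * H) + 1 := Nat.ceil_lt_add_one (by positivity)
  have D0 : 0 < D := Nat.ceil_pos.2 (by positivity)
  have key := Wt_sq_blocks hB ha haH hH hH2 hh0 D0 (q := q) (by rw [div_le_iff₀ (by positivity)] at D1; linarith) (4 ^ q)
  rw [mh] at key
  refine key.trans ?_
  have g1 := (hγ h hh0).1
  have s1 := hs h hh1
  rw [add_assoc, add_assoc]
  refine add_le_add le_rfl ?_
  have e1 : ((4 ^ q : ℕ) : ℝ≥0∞) = ENNReal.ofReal (y ^ 2) := by rw [← em, ENNReal.ofReal_natCast]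
  have e2 : ((2 * D + 1 : ℕ) : ℝ≥0∞) = ENNReal.ofReal (2 * D + 1) := by rw [← ENNReal.ofReal_natCast]; push_cast; rfl
  rw [e1, e2]
  have s2 : sE P B h + sE P B h ≤ ENNReal.ofReal (2 * C0 * h ^ 2) := by
    refine (add_le_add s1 s1).trans (le_of_eq ?_)
    rw [← ENNReal.ofReal_add (by positivity) (by positivity)]; congr 1; ring
  calc _ ≤ ENNReal.ofReal (y ^ 2) ^ 2 * (ENNReal.ofReal ((1 / 2) ^ q) * ENNReal.ofReal (2 * C0 * h ^ 2)) +
      (ENNReal.ofReal (y ^ 2) * (ENNReal.ofReal (2 * D + 1) * ENNReal.ofReal (2 * C0 * h ^ 2)) +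
      (ENNReal.ofReal 2 * ENNReal.ofReal (y ^ 2) ^ 2 * ENNReal.ofReal (γ * h) + ENNReal.ofReal (y ^ 2) ^ 2)) := by
        rw [show ENNReal.ofReal 2 = 2 by simp]
        gcongr
    _ = ENNReal.ofReal ((y ^ 2) ^ 2 * ((1 / 2) ^ q * (2 * C0 * h ^ 2)) +
      (y ^ 2 * ((2 * D + 1) * (2 * C0 * h ^ 2)) + (2 * (y ^ 2) ^ 2 * (γ * h) + (y ^ 2) ^ 2))) := by
        rw [← ENNReal.ofReal_pow (by positivity)]
        repeat rw [← ENNReal.ofReal_mul (by positivity)]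
        repeat rw [← ENNReal.ofReal_add (by positivity) (by positivity)]
    _ ≤ _ := by
        refine ENNReal.ofReal_le_ofReal ?_
        rw [x7]
        have hyi : (1 / 2 : ℝ) ^ q = 1 / y := by rw [_root_.one_div_pow]
        have yh : y ^ 2 * h = x ^ 4 := by rw [x4, hh]; field_simp
        have x8 : x ^ 8 / y ≤ 2 * x ^ 7 := by
          rw [div_le_iff₀ (by linarith)]
          have : 0 < x ^ 7 := by positivity
          nlinarith
        have t1 : (y ^ 2) ^ 2 * ((1 / 2) ^ q * (2 * C0 * h ^ 2)) ≤ 4 * C0 * x ^ 7 := by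
          have : (y ^ 2) ^ 2 * ((1 / 2) ^ q * (2 * C0 * h ^ 2)) = 2 * C0 * (x ^ 8 / y) := by
            rw [hyi, show x ^ 8 = (y ^ 2 * h) ^ 2 by rw [yh]; ring]; field_simp
          rw [this]; nlinarith
        have t2 : y ^ 2 * ((2 * D + 1) * (2 * C0 * h ^ 2)) ≤ (1 / H + 3) * (4 * C0) * x ^ 7 := by
          have hDy : (2 * D + 1 : ℝ) ≤ (1 / H + 3) * y := by
            have : 2 * (y / (2 * H)) = 1 / H * y := by field_simp
            nlinarith
          have e : y ^ 2 * (((1 / H + 3) * y) * (2 * C0 * h ^ 2)) = (1 / H + 3) * (2 * C0) * (x ^ 8 / y) := by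
            rw [show x ^ 8 = (y ^ 2 * h) ^ 2 by rw [yh]; ring]; field_simp
          calc _ ≤ y ^ 2 * (((1 / H + 3) * y) * (2 * C0 * h ^ 2)) := by gcongr
            _ = _ := e
            _ ≤ (1 / H + 3) * (2 * C0) * (2 * x ^ 7) := by gcongr
            _ = _ := by ring
        have x67 : x ^ 6 ≤ x ^ 7 := pow_le_pow_right₀ x1 (by norm_num)
        have x47 : x ^ 4 ≤ x ^ 7 := pow_le_pow_right₀ x1 (by norm_num)
        have t3 : 2 * (y ^ 2) ^ 2 * (γ * h) ≤ 2 * γ * x ^ 7 := by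
          have : 2 * (y ^ 2) ^ 2 * (γ * h) = 2 * γ * (y ^ 2 * x ^ 4) := by rw [← yh]; ring
          rw [this]
          have : y ^ 2 * x ^ 4 ≤ x ^ 7 := le_trans (by rw [show x ^ 6 = x ^ 2 * x ^ 4 by ring]; gcongr) x67
          gcongr
        have t4 : (y ^ 2) ^ 2 ≤ x ^ 7 := le_trans (by rw [show x ^ 4 = (x ^ 2) ^ 2 by ring]; gcongr) x47
        linarith
end M12
end

section
section M13
set_option linter.unusedSectionVars false
open Matrix

/-- truncation -/
def trn (κ z : ℝ≥0∞) : ℝ≥0∞ := min (κ * z) 1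

lemma trn_le (κ z : ℝ≥0∞) : trn κ z ≤ 1 := min_le_right _ _

lemma trn_toReal_le (κ z : ℝ≥0∞) : (trn κ z).toReal ≤ 1 := by
  have := ENNReal.toReal_mono ENNReal.one_ne_top (trn_le κ z)
  simpa using this

/-- the bump direction -/
def fv (R s ℓ : ℕ) : Fin R → ℝ := fun i => if s ≤ (i : ℕ) ∧ (i : ℕ) < s + ℓ then (1 : ℝ) / ℓ else 0

lemma pth_fv_lo {R s ℓ : ℕ} (x : Fin R → ℝ) (c : ℝ) (i : ℕ) (hi : i ≤ s) : pth (x + c • fv R s ℓ) i = pth x i := by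
  unfold pth
  refine Finset.sum_congr rfl fun l _ => ?_
  split_ifs with h
  · simp only [Pi.add_apply, Pi.smul_apply, fv, smul_eq_mul]
    rw [if_neg (by omega)]; ring
  · rfl

lemma sum_fv {R s ℓ : ℕ} (hR : s + ℓ ≤ R) (g : ℕ → ℝ) :
    ∑ l : Fin R, g l * fv R s ℓ l = (∑ i ∈ Finset.Ico s (s + ℓ), g i) / ℓ := by
  have h1 : ∑ l : Fin R, g l * fv R s ℓ l = ∑ l ∈ Finset.range R, if s ≤ l ∧ l < s + ℓ then g l * (1 / ℓ) else 0 := by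
    rw [Finset.sum_range]
    refine Finset.sum_congr rfl fun l _ => ?_
    simp only [fv, mul_ite, mul_zero]
  rw [h1, ← Finset.sum_filter, Finset.sum_div]
  have : Finset.filter (fun l => s ≤ l ∧ l < s + ℓ) (Finset.range R) = Finset.Ico s (s + ℓ) := by
    ext l; simp only [Finset.mem_filter, Finset.mem_range, Finset.mem_Ico]; omega
  rw [this]
  exact Finset.sum_congr rfl fun l _ => by ring

lemma pth_fv_hi {R s ℓ : ℕ} (hℓ : 0 < ℓ) (hR : s + ℓ ≤ R) (x : Fin R → ℝ) (c : ℝ) (i : ℕ) (hi : s + ℓ ≤ i) :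
    pth (x + c • fv R s ℓ) i = pth x i + c := by
  have h1 := sum_fv hR (fun l => if l < i then c else 0)
  have h2 : (∑ l ∈ Finset.Ico s (s + ℓ), if l < i then c else 0) = ℓ * c := by
    rw [Finset.sum_congr rfl (g := fun _ => c)]
    · simp
    · intro l hl; rw [Finset.mem_Ico] at hl; rw [if_pos (by omega)]
  rw [h2, mul_div_cancel_left₀ _ (by positivity)] at h1
  suffices hg : pth (x + c • fv R s ℓ) i = pth x i + ∑ l : Fin R, (if (l : ℕ) < i then c else 0) * fv R s ℓ l by rw [hg, h1]
  unfold pth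
  rw [← Finset.sum_add_distrib]
  refine Finset.sum_congr rfl fun l _ => ?_
  simp only [Pi.add_apply, Pi.smul_apply, smul_eq_mul]
  split_ifs with h <;> simp

variable {aH H : ℝ}

lemma Sm_nonneg (haH : 0 < aH) (hH : 0 < H) (hH2 : H < 1 / 2) {τ : ℝ} (hτ : 0 < τ) (R : ℕ) (c : Fin R → ℝ) :
    0 ≤ c ⬝ᵥ Sm aH H τ R *ᵥ c := by
  rw [Sm_q]
  have := Qf_nonneg (p := 2 * H) (by linarith) (by linarith) R (ex0 c)
  positivity

lemma Sm_surj (haH : 0 < aH) (hH : 0 < H) (hH2 : H < 1 / 2) {τ : ℝ} (hτ : 0 < τ) (R : ℕ) (f : Fin R → ℝ) :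
    ∃ u, Sm aH H τ R *ᵥ u = f := by
  have hinj : Function.Injective (Sm aH H τ R).mulVecLin := by
    rw [injective_iff_map_eq_zero]
    intro u hu
    rw [Matrix.mulVecLin_apply] at hu
    have h1 : u ⬝ᵥ Sm aH H τ R *ᵥ u = 0 := by rw [hu]; simp
    rw [Sm_q] at h1
    have hpos : 0 < aH * τ ^ (2 * H) := by positivity
    have h2 : Qf (2 * H) R (ex0 u) = 0 := by
      rcases mul_eq_zero.1 h1 with h | h
      · exact absurd h hpos.ne'
      · exact h
    have h3 := Qf_ge_sq (p := 2 * H) (by linarith) (by linarith) R (ex0 u)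
    rw [h2] at h3
    funext i
    have hR : 0 < R := i.pos
    have h4 : ∑ i ∈ Finset.range R, ex0 u i ^ 2 ≤ 0 := by
      by_contra hc
      push Not at hc
      have : 0 < 2 * H * (R : ℝ) ^ (2 * H - 1) := by positivity
      nlinarith [mul_pos this hc]
    have h5 : ex0 u i ^ 2 ≤ ∑ i ∈ Finset.range R, ex0 u i ^ 2 :=
      Finset.single_le_sum (f := fun i => ex0 u i ^ 2) (fun i _ => sq_nonneg _) (Finset.mem_range.2 i.2)
    have h6 : ex0 u i ^ 2 = 0 := le_antisymm (h5.trans h4) (sq_nonneg _)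
    rw [ex0_val] at h6
    simpa using h6
  obtain ⟨u, hu⟩ := (LinearMap.injective_iff_surjective.1 hinj) f
  exact ⟨u, hu⟩

lemma lnd_vec (haH : 0 < aH) (hH : 0 < H) (hH2 : H < 1 / 2) : ∃ C : ℝ, 0 < C ∧ ∀ (τ : ℝ), 0 < τ → ∀ R s ℓ : ℕ, 0 < ℓ →
    s + ℓ ≤ R → ∃ u : Fin R → ℝ, Sm aH H τ R *ᵥ u = fv R s ℓ ∧ u ⬝ᵥ Sm aH H τ R *ᵥ u ≤ C * (ℓ * τ) ^ (-(2 * H)) := by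
  obtain ⟨C, hC, hlnd⟩ := lnd (p := 2 * H) (by linarith) (by linarith)
  refine ⟨C / aH, by positivity, fun τ hτ R s ℓ hℓ hR => ?_⟩
  obtain ⟨u, hu⟩ := Sm_surj haH hH hH2 hτ R (fv R s ℓ)
  refine ⟨u, hu, ?_⟩
  have h1 := hlnd R (ex0 u) (fun i hi => by simp [ex0, hi]) s ℓ hℓ
  rw [← sum_fv hR] at h1
  simp only [ex0_val] at h1
  have h2 : ∑ l, u l * fv R s ℓ l = u ⬝ᵥ Sm aH H τ R *ᵥ u := by rw [hu]; rfl
  rw [h2] at h1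
  have h3 := Sm_q (aH := aH) (H := H) τ R u
  have h4 := Sm_nonneg haH hH hH2 hτ R u
  set D := u ⬝ᵥ Sm aH H τ R *ᵥ u with hD
  have hpos : 0 < aH * τ ^ (2 * H) := by positivity
  have hℓ' : (0 : ℝ) < ℓ := by exact_mod_cast hℓ
  have h5 : Qf (2 * H) R (ex0 u) = D / (aH * τ ^ (2 * H)) := by rw [h3]; field_simp
  rw [h5] at h1
  rw [Real.mul_rpow hℓ'.le hτ.le, Real.rpow_neg hτ.le]
  rcases h4.eq_or_lt with h0 | h0
  · rw [← h0]; positivity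
  · have : D ^ 2 ≤ (C / aH * ((ℓ : ℝ) ^ (-(2 * H)) * (τ ^ (2 * H))⁻¹)) * D := by
      calc D ^ 2 ≤ _ := h1
        _ = _ := by field_simp
    nlinarith

lemma exp_pt {l η u v : ℝ} (hl : 0 < l) (hl2 : l ≤ 1 / 2) (hη : 0 < η) (hη1 : η ≤ 1) (hu : 0 ≤ u) (hu1 : u ≤ 1)
    (hv : 0 ≤ v) (hv1 : v ≤ 1) : Real.exp (l * (u - (1 + η) * v)) + l * (1 + η) * v ≤ 1 + 4 * l ^ 2 + l * u := by
  set x := l * (u - (1 + η) * v) with hx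
  have h1 : |u - (1 + η) * v| ≤ 2 := by rw [abs_le]; constructor <;> nlinarith
  have h2 : |x| ≤ 2 * l := by rw [hx, abs_mul, abs_of_pos hl]; nlinarith
  have h3 := Real.abs_exp_sub_one_sub_id_le (x := x) (by linarith)
  have h4 : x ^ 2 ≤ (2 * l) ^ 2 := by rw [← sq_abs]; gcongr
  have h5 := (abs_le.1 h3).2
  have : x = l * u - l * (1 + η) * v := by rw [hx]; ring
  nlinarith

/-- exponential weight -/
def Ew (l η : ℝ) (q : ℕ) (u v : ℕ → ℝ≥0∞) : ℝ≥0∞ :=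
  ENNReal.ofReal (Real.exp (l * ∑ i ∈ Finset.range q, ((u i).toReal - (1 + η) * (v i).toReal)))

lemma Ew_succ (l η : ℝ) (q : ℕ) (u v : ℕ → ℝ≥0∞) :
    Ew l η (q + 1) u v = Ew l η q u v * ENNReal.ofReal (Real.exp (l * ((u q).toReal - (1 + η) * (v q).toReal))) := by
  unfold Ew
  rw [← ENNReal.ofReal_mul (Real.exp_nonneg _), ← Real.exp_add, Finset.sum_range_succ]
  congr 3; ring

/-- truncated block functional on discrete paths -/
def phd {R : ℕ} (κ : ℝ≥0∞) (ℓ : ℕ) (δ ε : ℝ) (j : ℕ) (a : ℝ) (x : Fin R → ℝ) : ℝ≥0∞ :=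
  trn κ (J (pth x) (Icc (j * ℓ) ((j + 1) * ℓ)) (Ioc a (a + δ)) ε)

lemma phd_meas {R : ℕ} (κ : ℝ≥0∞) (ℓ : ℕ) (δ ε : ℝ) (j : ℕ) (a : ℝ) :
    Measurable fun x : Fin R → ℝ => phd κ ℓ δ ε j a x :=
  ((J_pth_meas _ _ _).const_mul κ).min measurable_const

lemma phd_lo {R : ℕ} (κ : ℝ≥0∞) (ℓ : ℕ) (δ ε : ℝ) {j s : ℕ} (a c : ℝ) (x : Fin R → ℝ) (hs : (j + 1) * ℓ ≤ s) :
    phd κ ℓ δ ε j a (x + c • fv R s ℓ) = phd κ ℓ δ ε j a x := by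
  unfold phd
  rw [J_congr fun u hu => pth_fv_lo x c u (hu.2.trans hs)]

lemma phd_hi {R : ℕ} (κ : ℝ≥0∞) {ℓ : ℕ} (hℓ : 0 < ℓ) (δ ε : ℝ) {j s : ℕ} (a a' : ℝ) (x : Fin R → ℝ) (hs : s + ℓ ≤ j * ℓ)
    (hR : s + ℓ ≤ R) : phd κ ℓ δ ε j a' (x + (a' - a) • fv R s ℓ) = phd κ ℓ δ ε j a x := by
  unfold phd
  rw [J_congr fun u hu => pth_fv_hi hℓ hR x (a' - a) u (hs.trans hu.1), J_shift, _root_.sub_sub_cancel]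

lemma disc_step {R : ℕ} {ν : Measure (Fin R → ℝ)} [IsProbabilityMeasure ν] {S : Matrix (Fin R) (Fin R) ℝ} (h : IsG ν S)
    (hS : ∀ c, 0 ≤ c ⬝ᵥ S *ᵥ c) (hsym : Sᵀ = S) (κ : ℝ≥0∞) {ℓ : ℕ} (hℓ : 0 < ℓ) (δ ε : ℝ) (a a' : ℝ)
    {l η M σ2 : ℝ} (hl : 0 < l) (hl2 : l ≤ 1 / 2) (hη : 0 < η) (hη1 : η ≤ 1) (hM : 0 ≤ M)
    {Y : (Fin R → ℝ) → ℝ≥0∞} (hY : Measurable Y) (hYt : ∫⁻ x, Y x ∂ν ≠ ⊤) {j s : ℕ} (hs : s + ℓ = j * ℓ) (hR : s + ℓ ≤ R)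
    (hYi : ∀ (c : ℝ) x, Y (x + c • fv R s ℓ) = Y x) {u : Fin R → ℝ} (hu : S *ᵥ u = fv R s ℓ)
    (hσ : (a' - a) ^ 2 * (u ⬝ᵥ S *ᵥ u) ≤ σ2) :
    ∫⁻ x, Y x * ENNReal.ofReal (Real.exp (l * ((phd κ ℓ δ ε j a x).toReal - (1 + η) * (phd κ ℓ δ ε j a' x).toReal))) ∂ν
      ≤ ENNReal.ofReal (1 + 4 * l ^ 2 + l * Real.exp ((1 + M) ^ 2 * σ2 / 2 - M * Real.log (1 + η))) * ∫⁻ x, Y x ∂ν := by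
  set u' := (a' - a) • u with hu'
  have hSu : S *ᵥ u' = (a' - a) • fv R s ℓ := by rw [hu', mulVec_smul, hu]
  have hq : u' ⬝ᵥ S *ᵥ u' = (a' - a) ^ 2 * (u ⬝ᵥ S *ᵥ u) := by
    rw [hSu, hu', hu, smul_dotProduct, dotProduct_smul, smul_eq_mul, smul_eq_mul]; ring
  have hcmp := h.compare hS hsym u' (Φ := phd κ ℓ δ ε j a') (Y := Y) (phd_meas _ _ _ _ _ _) hY (K := 1)
    (fun x => trn_le _ _) (fun s x => by rw [hSu, smul_smul]; exact hYi _ x) hη hM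
  rw [hq, hSu] at hcmp
  simp only [phd_hi κ hℓ δ ε a a' _ hs.le hR, one_mul] at hcmp
  set τ := Real.exp ((1 + M) ^ 2 * σ2 / 2 - M * Real.log (1 + η)) with hτ
  have hτ' : ENNReal.ofReal (Real.exp ((1 + M) ^ 2 * ((a' - a) ^ 2 * u ⬝ᵥ S *ᵥ u) / 2 - M * Real.log (1 + η))) ≤
      ENNReal.ofReal τ := by
    apply ENNReal.ofReal_le_ofReal; rw [hτ]; gcongr
  have hcmp2 : ∫⁻ x, Y x * phd κ ℓ δ ε j a x ∂ν ≤ ENNReal.ofReal (1 + η) * ∫⁻ x, Y x * phd κ ℓ δ ε j a' x ∂ν +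
      ENNReal.ofReal τ * ∫⁻ x, Y x ∂ν := hcmp.trans (by gcongr)
  have hpt : ∀ x, Y x * ENNReal.ofReal (Real.exp (l * ((phd κ ℓ δ ε j a x).toReal - (1 + η) * (phd κ ℓ δ ε j a' x).toReal)))
      + ENNReal.ofReal (l * (1 + η)) * (Y x * phd κ ℓ δ ε j a' x) ≤
      ENNReal.ofReal (1 + 4 * l ^ 2) * Y x + ENNReal.ofReal l * (Y x * phd κ ℓ δ ε j a x) := by
    intro x
    set p := phd κ ℓ δ ε j a x
    set p' := phd κ ℓ δ ε j a' x
    have hp : p ≠ ⊤ := ((trn_le _ _).trans_lt ENNReal.one_lt_top).ne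
    have hp' : p' ≠ ⊤ := ((trn_le _ _).trans_lt ENNReal.one_lt_top).ne
    have e := exp_pt hl hl2 hη hη1 (u := p.toReal) (v := p'.toReal) ENNReal.toReal_nonneg (trn_toReal_le _ _)
      ENNReal.toReal_nonneg (trn_toReal_le _ _)
    have e2 : ENNReal.ofReal (Real.exp (l * (p.toReal - (1 + η) * p'.toReal))) + ENNReal.ofReal (l * (1 + η)) * p' ≤
        ENNReal.ofReal (1 + 4 * l ^ 2) + ENNReal.ofReal l * p := by
      conv_lhs => rw [← ENNReal.ofReal_toReal hp']
      conv_rhs => rw [← ENNReal.ofReal_toReal hp]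
      rw [ENNReal.toReal_ofReal ENNReal.toReal_nonneg, ← ENNReal.ofReal_mul (by positivity), ← ENNReal.ofReal_mul hl.le,
        ← ENNReal.ofReal_add (Real.exp_nonneg _) (by positivity), ← ENNReal.ofReal_add (by positivity) (by positivity)]
      exact ENNReal.ofReal_le_ofReal e
    calc _ = Y x * (ENNReal.ofReal (Real.exp (l * (p.toReal - (1 + η) * p'.toReal))) + ENNReal.ofReal (l * (1 + η)) * p') := by ring
      _ ≤ Y x * (ENNReal.ofReal (1 + 4 * l ^ 2) + ENNReal.ofReal l * p) := by gcongr
      _ = _ := by ring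
  have hm1 : Measurable fun x => Y x * phd κ ℓ δ ε j a x := hY.mul (phd_meas _ _ _ _ _ _)
  have hm2 : Measurable fun x => Y x * phd κ ℓ δ ε j a' x := hY.mul (phd_meas _ _ _ _ _ _)
  have hntg := lintegral_mono (μ := ν) hpt
  rw [lintegral_add_right _ (hm2.const_mul _), lintegral_const_mul _ hm2, lintegral_add_left (hY.const_mul _),
    lintegral_const_mul _ hY, lintegral_const_mul _ hm1] at hntg
  have hfin : ENNReal.ofReal (l * (1 + η)) * ∫⁻ x, Y x * phd κ ℓ δ ε j a' x ∂ν ≠ ⊤ := by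
    refine ENNReal.mul_ne_top ENNReal.ofReal_ne_top (ne_top_of_le_ne_top hYt (lintegral_mono fun x => ?_))
    calc _ ≤ Y x * 1 := by gcongr; exact trn_le _ _
      _ = _ := mul_one _
  refine (ENNReal.add_le_add_iff_right hfin).1 (hntg.trans ?_)
  calc _ ≤ ENNReal.ofReal (1 + 4 * l ^ 2) * ∫⁻ x, Y x ∂ν + ENNReal.ofReal l * (ENNReal.ofReal (1 + η) * ∫⁻ x, Y x * phd κ ℓ δ ε j a' x ∂ν +
      ENNReal.ofReal τ * ∫⁻ x, Y x ∂ν) := by gcongr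
    _ = _ := by
      rw [ENNReal.ofReal_add (p := 1 + 4 * l ^ 2) (by positivity) (by positivity), ENNReal.ofReal_mul hl.le, ENNReal.ofReal_mul hl.le]
      ring

lemma disc_exp (haH : 0 < aH) (hH : 0 < H) (hH2 : H < 1 / 2) : ∃ C : ℝ, 0 < C ∧ ∀ (τ : ℝ), 0 < τ → ∀ (R : ℕ)
    (ν : Measure (Fin R → ℝ)) [IsProbabilityMeasure ν], IsG ν (Sm aH H τ R) → ∀ (κ : ℝ≥0∞) (ℓ : ℕ), 0 < ℓ → ∀ (δ ε a a' l η M σ2 : ℝ),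
    0 < l → l ≤ 1 / 2 → 0 < η → η ≤ 1 → 0 ≤ M → (a' - a) ^ 2 * (C * (ℓ * τ) ^ (-(2 * H))) ≤ σ2 →
    ∀ b : ℕ, 1 ≤ b → ∀ q : ℕ, (2 * q + b - 1) * ℓ ≤ R →
    ∫⁻ x, Ew l η q (fun i => phd κ ℓ δ ε (2 * i + b) a x) (fun i => phd κ ℓ δ ε (2 * i + b) a' x) ∂ν ≤
      ENNReal.ofReal (1 + 4 * l ^ 2 + l * Real.exp ((1 + M) ^ 2 * σ2 / 2 - M * Real.log (1 + η))) ^ q := by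
  obtain ⟨C, hC, hv⟩ := lnd_vec haH hH hH2
  refine ⟨C, hC, fun τ hτ R ν _ hν κ ℓ hℓ δ ε a a' l η M σ2 hl hl2 hη hη1 hM hσ b hb q => ?_⟩
  induction q with
  | zero => intro _; simp [Ew]
  | succ q ih =>
    intro hR
    have hR' : (2 * q + b - 1) * ℓ ≤ R := le_trans (Nat.mul_le_mul_right _ (by omega)) hR
    have ih := ih hR'
    have hsl : (2 * q + b - 1) * ℓ + ℓ = (2 * q + b) * ℓ := by
      rw [← Nat.succ_mul]; congr 1; omega
    have hRl : (2 * q + b - 1) * ℓ + ℓ ≤ R := by rw [hsl]; exact le_trans (Nat.mul_le_mul_right _ (by omega)) hR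
    obtain ⟨u, hu, hu2⟩ := hv τ hτ R ((2 * q + b - 1) * ℓ) ℓ hℓ hRl
    simp only [Ew_succ]
    have hYm : Measurable fun x : Fin R → ℝ => Ew l η q (fun i => phd κ ℓ δ ε (2 * i + b) a x) (fun i => phd κ ℓ δ ε (2 * i + b) a' x) := by
      unfold Ew
      refine ENNReal.measurable_ofReal.comp (Real.measurable_exp.comp (Measurable.const_mul ?_ _))
      exact Finset.measurable_sum _ fun i _ => (phd_meas _ _ _ _ _ _).ennreal_toReal.sub ((phd_meas _ _ _ _ _ _).ennreal_toReal.const_mul _)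
    have hs := disc_step hν (Sm_nonneg haH hH hH2 hτ R) (Sm_sym τ R) κ hℓ δ ε a a' hl hl2 hη hη1 hM hYm
      (ne_top_of_le_ne_top (ENNReal.pow_ne_top ENNReal.ofReal_ne_top) ih) hsl hRl ?_ hu
      (le_trans (mul_le_mul_of_nonneg_left hu2 (sq_nonneg _)) hσ)
    · refine hs.trans ?_
      rw [pow_succ' _ q]
      exact mul_le_mul_right ih _
    · intro c x
      unfold Ew
      congr 3
      refine Finset.sum_congr rfl fun i hi => ?_
      have hi := Finset.mem_range.1 hi
      have : (2 * i + b + 1) * ℓ ≤ (2 * q + b - 1) * ℓ := Nat.mul_le_mul_right _ (by omega)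
      dsimp only
      rw [phd_lo _ _ _ _ _ _ _ this, phd_lo _ _ _ _ _ _ _ this]

variable {Ω : Type*} [MeasurableSpace Ω] {P : Measure Ω} [IsProbabilityMeasure P] {B : ℝ → Ω → ℝ}

/-- truncated block functional along a continuous path -/
def phc (w : ℝ → ℝ) (κ : ℝ≥0∞) (h δ ε : ℝ) (j : ℕ) (a : ℝ) : ℝ≥0∞ :=
  trn κ (J w (Icc (0 + j * h) (0 + (j + 1) * h)) (Ioc a (a + δ)) ε)

lemma phc_tendsto {w : ℝ → ℝ} (hw : Continuous w) {κ : ℝ≥0∞} (hκ : κ ≠ ⊤) {h ε : ℝ} (hh : 0 < h) (hε : 0 ≤ ε) (δ : ℝ) (j : ℕ) (a : ℝ) :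
    Tendsto (fun k => trn κ (J (fun i : ℕ => w (0 + i * (h / 2 ^ k))) (Icc (j * 2 ^ k) ((j + 1) * 2 ^ k)) (Ioc a (a + δ)) ε)) atTop
      (𝓝 (phc w κ h δ ε j a)) := by
  unfold phc trn
  refine Tendsto.min (ENNReal.Tendsto.const_mul ?_ (Or.inr hκ)) tendsto_const_nhds
  rw [J_block hw 0 hh hε j]
  exact tendsto_atTop_iSup (J_block_mono w 0 hh j _)

lemma exp_est (hB : IsFBM H P B) (ha : ∀ s t : ℝ, ∫ ω, (B t ω - B s ω) ^ 2 ∂P = aH * |t - s| ^ (2 * H))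
    (haH : 0 < aH) (hH : 0 < H) (hH2 : H < 1 / 2) : ∃ C : ℝ, 0 < C ∧ ∀ (κ : ℝ≥0∞), κ ≠ ⊤ → ∀ (h δ ε a a' l η M σ2 : ℝ), 0 < h → 0 ≤ ε →
    0 < l → l ≤ 1 / 2 → 0 < η → η ≤ 1 → 0 ≤ M → (a' - a) ^ 2 * (C * h ^ (-(2 * H))) ≤ σ2 →
    ∀ b : ℕ, 1 ≤ b → ∀ q : ℕ,
    ∫⁻ ω, Ew l η q (fun i => phc (fun r => B r ω) κ h δ ε (2 * i + b) a) (fun i => phc (fun r => B r ω) κ h δ ε (2 * i + b) a') ∂P ≤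
      ENNReal.ofReal (1 + 4 * l ^ 2 + l * Real.exp ((1 + M) ^ 2 * σ2 / 2 - M * Real.log (1 + η))) ^ q := by
  obtain ⟨C, hC, hd⟩ := disc_exp haH hH hH2
  refine ⟨C, hC, fun κ hκ h δ ε a a' l η M σ2 hh hε hl hl2 hη hη1 hM hσ b hb q => ?_⟩
  set Rk : ℕ → ℕ := fun k => (2 * q + b - 1) * 2 ^ k with hRk
  set F : ℕ → (ℕ → Ω → ℝ≥0∞) × (ℕ → Ω → ℝ≥0∞) := fun k =>
    (fun i ω => phd κ (2 ^ k) δ ε (2 * i + b) a (incr B 0 (h / 2 ^ k) (Rk k) ω),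
     fun i ω => phd κ (2 ^ k) δ ε (2 * i + b) a' (incr B 0 (h / 2 ^ k) (Rk k) ω)) with hF
  have hlim : ∀ (a : ℝ) (ω : Ω) (i : ℕ), i < q → Tendsto (fun k => phd κ (2 ^ k) δ ε (2 * i + b) a (incr B 0 (h / 2 ^ k) (Rk k) ω)) atTop
      (𝓝 (phc (fun r => B r ω) κ h δ ε (2 * i + b) a)) := by
    intro a ω i hi
    convert phc_tendsto (hB.1 ω) hκ hh hε δ (2 * i + b) a using 2 with k
    unfold phd
    rw [J_congr]
    intro u hu
    have : u ≤ Rk k := hu.2.trans (Nat.mul_le_mul_right _ (by omega))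
    rw [pth_incr _ _ _ _ _ _ this, hB.2.1, sub_zero]
  have hlim2 : ∀ ω, Tendsto (fun k => Ew l η q (fun i => (F k).1 i ω) (fun i => (F k).2 i ω)) atTop
      (𝓝 (Ew l η q (fun i => phc (fun r => B r ω) κ h δ ε (2 * i + b) a) (fun i => phc (fun r => B r ω) κ h δ ε (2 * i + b) a'))) := by
    intro ω
    unfold Ew
    refine (ENNReal.continuous_ofReal.tendsto _).comp ((Real.continuous_exp.tendsto _).comp (Tendsto.const_mul _ ?_))
    refine tendsto_finsetSum _ fun i hi => ?_
    have hi := Finset.mem_range.1 hi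
    have hf : ∀ a, phc (fun r => B r ω) κ h δ ε (2 * i + b) a ≠ ⊤ := fun a => ((trn_le _ _).trans_lt ENNReal.one_lt_top).ne
    exact ((ENNReal.tendsto_toReal (hf a)).comp (hlim a ω i hi)).sub
      (((ENNReal.tendsto_toReal (hf a')).comp (hlim a' ω i hi)).const_mul _)
  have hmeas : ∀ k, Measurable fun x : Fin (Rk k) → ℝ => Ew l η q (fun i => phd κ (2 ^ k) δ ε (2 * i + b) a x)
      (fun i => phd κ (2 ^ k) δ ε (2 * i + b) a' x) := by
    intro k
    unfold Ew
    refine ENNReal.measurable_ofReal.comp (Real.measurable_exp.comp (Measurable.const_mul ?_ _))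
    exact Finset.measurable_sum _ fun i _ => (phd_meas _ _ _ _ _ _).ennreal_toReal.sub ((phd_meas _ _ _ _ _ _).ennreal_toReal.const_mul _)
  have hbd : ∀ k, ∫⁻ ω, Ew l η q (fun i => (F k).1 i ω) (fun i => (F k).2 i ω) ∂P ≤
      ENNReal.ofReal (1 + 4 * l ^ 2 + l * Real.exp ((1 + M) ^ 2 * σ2 / 2 - M * Real.log (1 + η))) ^ q := by
    intro k
    have hτ : 0 < h / 2 ^ k := by positivity
    haveI : IsProbabilityMeasure (P.map (incr B 0 (h / 2 ^ k) (Rk k))) :=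
      Measure.isProbabilityMeasure_map (incr_meas hB _ _ _).aemeasurable
    have := hd (h / 2 ^ k) hτ (Rk k) (P.map (incr B 0 (h / 2 ^ k) (Rk k))) (incr_IsG hB ha hτ 0 (Rk k)) κ (2 ^ k) (by positivity)
      δ ε a a' l η M σ2 hl hl2 hη hη1 hM (by
        have e : ((2 ^ k : ℕ) : ℝ) * (h / 2 ^ k) = h := by push_cast; field_simp
        rw [e]; exact hσ) b hb q le_rfl
    rw [lintegral_map (hmeas k) (incr_meas hB _ _ _)] at this
    exact this
  calc _ = ∫⁻ ω, liminf (fun k => Ew l η q (fun i => (F k).1 i ω) (fun i => (F k).2 i ω)) atTop ∂P :=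
        lintegral_congr fun ω => (hlim2 ω).liminf_eq.symm
    _ ≤ liminf (fun k => ∫⁻ ω, Ew l η q (fun i => (F k).1 i ω) (fun i => (F k).2 i ω) ∂P) atTop :=
        lintegral_liminf_le fun k => (hmeas k).comp (incr_meas hB _ _ _)
    _ ≤ _ := by
        refine (liminf_le_liminf (Eventually.of_forall hbd)).trans ?_
        simp
end M13
end

section
section M14
set_option linter.unusedSectionVars false

lemma ev_exp (A p : ℝ) {c ρ : ℝ} (hc : 0 < c) (hρ : 0 < ρ) :
    ∀ᶠ ε : ℝ in 𝓝[>] 0, A * ε ^ (-p) * Real.exp (-(c * ε ^ (-ρ))) ≤ 1 := by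
  have h1 : Tendsto (fun ε : ℝ => ε ^ (-ρ)) (𝓝[>] 0) atTop := tendsto_rpow_neg_nhdsGT_zero (by linarith)
  have h2 := ((tendsto_rpow_mul_exp_neg_mul_atTop_nhds_zero (p / ρ) c hc).comp h1).const_mul A
  rw [mul_zero] at h2
  filter_upwards [h2.eventually (gt_mem_nhds one_pos), self_mem_nhdsWithin] with ε hε (hpos : 0 < ε)
  simp only [Function.comp] at hε
  have e : (ε ^ (-ρ)) ^ (p / ρ) = ε ^ (-p) := by
    rw [← Real.rpow_mul hpos.le]; congr 1; field_simp
  rw [e] at hε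
  calc _ = A * (ε ^ (-p) * Real.exp (-c * ε ^ (-ρ))) := by rw [mul_assoc, neg_mul]
    _ ≤ 1 := hε.le

lemma ev_pow (A : ℝ) {p y : ℝ} (hp : 0 < p) (hy : 0 < y) : ∀ᶠ ε : ℝ in 𝓝[>] 0, A * ε ^ p ≤ y := by
  have h1 : Tendsto (fun ε : ℝ => A * ε ^ p) (𝓝[>] 0) (𝓝 (A * 0)) := by
    refine Tendsto.const_mul A ?_
    have := (Real.continuousAt_rpow_const 0 p (Or.inr hp.le)).tendsto
    rw [Real.zero_rpow hp.ne'] at this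
    exact this.mono_left nhdsWithin_le_nhds
  rw [mul_zero] at h1
  exact (h1.eventually (gt_mem_nhds hy)).mono fun ε h => h.le

lemma ev_le_one : ∀ᶠ ε : ℝ in 𝓝[>] 0, 0 < ε ∧ ε ≤ 1 := by
  filter_upwards [Ioo_mem_nhdsGT (one_pos (α := ℝ))] with ε h
  exact ⟨h.1, h.2.le⟩

/-- number of block pairs -/
def qn (β ε : ℝ) : ℕ := ⌈ε ^ (-β)⌉₊
/-- block length -/
def hn (t β ε : ℝ) : ℝ := t / (2 * qn β ε + 1)

lemma qn_bd {β ε : ℝ} (hβ : 0 ≤ β) (hε : 0 < ε) (hε1 : ε ≤ 1) : ε ^ (-β) ≤ qn β ε ∧ (qn β ε : ℝ) ≤ 2 * ε ^ (-β) := by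
  have h1 : 1 ≤ ε ^ (-β) := Real.one_le_rpow_of_pos_of_le_one_of_nonpos hε hε1 (by linarith)
  refine ⟨Nat.le_ceil _, ?_⟩
  have := (Nat.ceil_lt_add_one (a := ε ^ (-β)) (by positivity)).le
  unfold qn; linarith

lemma hn_bd {t β ε : ℝ} (ht : 0 < t) (hβ : 0 ≤ β) (hε : 0 < ε) (hε1 : ε ≤ 1) :
    t / 5 * ε ^ β ≤ hn t β ε ∧ hn t β ε ≤ t / 2 * ε ^ β := by
  have h1 : 1 ≤ ε ^ (-β) := Real.one_le_rpow_of_pos_of_le_one_of_nonpos hε hε1 (by linarith)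
  obtain ⟨h2, h3⟩ := qn_bd hβ hε hε1
  have e : ε ^ β = (ε ^ (-β))⁻¹ := by rw [Real.rpow_neg hε.le, inv_inv]
  unfold hn
  rw [e, ← div_eq_mul_inv, ← div_eq_mul_inv, div_div, div_div]
  constructor <;> gcongr <;> linarith

lemma hn_pos {t : ℝ} (ht : 0 < t) (β ε : ℝ) : 0 < hn t β ε := by unfold hn; positivity

lemma asy {H θ κ c C C1 t η : ℝ} (hH : 0 < H) (hθ : 0 < θ) (hκ : 0 < κ) (hc : 0 < c) (hC : 0 < C) (hC1 : 0 < C1)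
    (ht : 0 < t) (hη : 0 < η) : ∀ᶠ ε : ℝ in 𝓝[>] 0, ∀ δ δ' : ℝ, c * ε ^ θ ≤ δ → 0 ≤ δ' → δ' ≤ C * ε ^ (2 * H * θ * (1 + 2 * κ)) →
    ∀ h K l, h = hn t (2 * θ * (1 + κ)) ε → K = h * ε ^ (-(θ * κ / 2)) / δ → l = K * ε ^ (-(θ * κ / 2)) →
    0 < l ∧ l ≤ 1 / 2 ∧ Real.exp (-(l * (η / K))) * (1 + 4 * l ^ 2 + l * Real.exp ((1 + ε ^ (-(2 * H * θ * κ))) ^ 2 *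
      (δ' ^ 2 * (C1 * h ^ (-(2 * H)))) / 2 - ε ^ (-(2 * H * θ * κ)) * Real.log (1 + η))) ^ (qn (2 * θ * (1 + κ)) ε) ≤ ε ^ 5 / 50 := by
  set D := C ^ 2 * C1 * (t / 5) ^ (-(2 * H)) with hD
  have hDpos : 0 < D := by positivity
  set β := 2 * θ * (1 + κ) with hβ
  have hβpos : 0 < β := by positivity
  have hlog : 0 < Real.log (1 + η) := Real.log_pos (by linarith)
  filter_upwards [ev_le_one, ev_pow (t / (2 * c)) (p := θ + θ * κ) (by positivity) (y := 1 / 2) (by norm_num),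
    ev_exp (Real.exp (2 * D)) β hlog (ρ := 2 * H * θ * κ) (by positivity),
    ev_exp (50 * Real.exp (8 * (t / (2 * c)) ^ 2 + 1)) 5 hη (ρ := θ * κ / 2) (by positivity)]
  intro ε ⟨hε, hε1⟩ e1 e2 e3 δ δ' hδ hδ0 hδ' h K l rfl rfl rfl
  set h := hn t β ε with hh
  have hhpos : 0 < h := hn_pos ht _ _
  obtain ⟨hb1, hb2⟩ := hn_bd ht hβpos.le hε hε1
  have hδpos : 0 < δ := lt_of_lt_of_le (by positivity) hδ
  set K := h * ε ^ (-(θ * κ / 2)) / δ with hK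
  have hKpos : 0 < K := by positivity
  set l := K * ε ^ (-(θ * κ / 2)) with hl
  have hlpos : 0 < l := by positivity
  have hl1 : l ≤ t / (2 * c) * ε ^ (θ + θ * κ) := by
    calc l = h * (ε ^ (-(θ * κ / 2)) * ε ^ (-(θ * κ / 2))) / δ := by rw [hl, hK]; ring
      _ ≤ (t / 2 * ε ^ β) * (ε ^ (-(θ * κ / 2)) * ε ^ (-(θ * κ / 2))) / (c * ε ^ θ) := by gcongr
      _ = t / (2 * c) * (ε ^ β * (ε ^ (-(θ * κ / 2)) * ε ^ (-(θ * κ / 2))) / ε ^ θ) := by field_simp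
      _ = _ := by
        rw [← Real.rpow_add hε, ← Real.rpow_add hε, ← Real.rpow_sub hε]; congr 2; rw [hβ]; ring
  have hl2 : l ≤ 1 / 2 := hl1.trans e1
  refine ⟨hlpos, hl2, ?_⟩
  have hlx : l * (η / K) = η * ε ^ (-(θ * κ / 2)) := by rw [hl]; field_simp
  rw [hlx]
  set M := ε ^ (-(2 * H * θ * κ)) with hM
  have hM1 : 1 ≤ M := Real.one_le_rpow_of_pos_of_le_one_of_nonpos hε hε1 (by simp; positivity)
  have hs : (1 + M) ^ 2 * (δ' ^ 2 * (C1 * h ^ (-(2 * H)))) / 2 ≤ 2 * D := by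
    have a1 : h ^ (-(2 * H)) ≤ (t / 5 * ε ^ β) ^ (-(2 * H)) :=
      Real.rpow_le_rpow_of_nonpos (by positivity) hb1 (by linarith)
    rw [Real.mul_rpow (by positivity) (by positivity), ← Real.rpow_mul hε.le] at a1
    calc (1 + M) ^ 2 * (δ' ^ 2 * (C1 * h ^ (-(2 * H)))) / 2 ≤ (M + M) ^ 2 * ((C * ε ^ (2 * H * θ * (1 + 2 * κ))) ^ 2 *
          (C1 * ((t / 5) ^ (-(2 * H)) * ε ^ (β * -(2 * H))))) / 2 := by gcongr
      _ = 2 * D * (M * M * (ε ^ (2 * H * θ * (1 + 2 * κ)) * ε ^ (2 * H * θ * (1 + 2 * κ))) * ε ^ (β * -(2 * H))) := by rw [hD]; ring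
      _ = 2 * D := by
        rw [hM, ← Real.rpow_add hε, ← Real.rpow_add hε, ← Real.rpow_add hε, ← Real.rpow_add hε]
        have : -(2 * H * θ * κ) + -(2 * H * θ * κ) + (2 * H * θ * (1 + 2 * κ) + 2 * H * θ * (1 + 2 * κ)) + β * -(2 * H) = 0 := by
          rw [hβ]; ring
        rw [this, Real.rpow_zero, mul_one]
  set τ := Real.exp ((1 + M) ^ 2 * (δ' ^ 2 * (C1 * h ^ (-(2 * H)))) / 2 - M * Real.log (1 + η)) with hτ
  have hτ1 : ε ^ (-β) * τ ≤ 1 := by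
    refine le_trans ?_ e2
    have : τ ≤ Real.exp (2 * D) * Real.exp (-(Real.log (1 + η) * M)) := by
      rw [hτ, ← Real.exp_add]; apply Real.exp_le_exp.2; linarith
    calc ε ^ (-β) * τ ≤ ε ^ (-β) * (Real.exp (2 * D) * Real.exp (-(Real.log (1 + η) * M))) := by gcongr
      _ = _ := by ring
  obtain ⟨_, hq⟩ := qn_bd hβpos.le hε hε1
  set q := qn β ε with hqd
  have hτpos : 0 < τ := Real.exp_pos _
  have hpw : (1 + 4 * l ^ 2 + l * τ) ^ q ≤ Real.exp (8 * (t / (2 * c)) ^ 2 + 1) := by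
    calc (1 + 4 * l ^ 2 + l * τ) ^ q ≤ (Real.exp (4 * l ^ 2 + l * τ)) ^ q := by
          gcongr; have := Real.add_one_le_exp (4 * l ^ 2 + l * τ); linarith
      _ = Real.exp (q * (4 * l ^ 2 + l * τ)) := by rw [← Real.exp_nat_mul]
      _ ≤ _ := by
        apply Real.exp_le_exp.2
        have b1 : ε ^ (-β) * l ^ 2 ≤ (t / (2 * c)) ^ 2 := by
          calc ε ^ (-β) * l ^ 2 ≤ ε ^ (-β) * (t / (2 * c) * ε ^ (θ + θ * κ)) ^ 2 := by gcongr
            _ = (t / (2 * c)) ^ 2 * (ε ^ (-β) * (ε ^ (θ + θ * κ) * ε ^ (θ + θ * κ))) := by ring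
            _ = _ := by
              rw [← Real.rpow_add hε, ← Real.rpow_add hε]
              have : -β + (θ + θ * κ + (θ + θ * κ)) = 0 := by rw [hβ]; ring
              rw [this, Real.rpow_zero, mul_one]
        calc q * (4 * l ^ 2 + l * τ) ≤ (2 * ε ^ (-β)) * (4 * l ^ 2 + 1 / 2 * τ) := by gcongr
          _ = 8 * (ε ^ (-β) * l ^ 2) + ε ^ (-β) * τ := by ring
          _ ≤ _ := by gcongr
  calc _ ≤ Real.exp (-(η * ε ^ (-(θ * κ / 2)))) * Real.exp (8 * (t / (2 * c)) ^ 2 + 1) := by gcongr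
    _ = ε ^ 5 / 50 * (50 * Real.exp (8 * (t / (2 * c)) ^ 2 + 1) * ε ^ (-(5:ℝ)) * Real.exp (-(η * ε ^ (-(θ * κ / 2))))) := by
      have e5 : ε ^ (-(5:ℝ)) = (ε ^ 5)⁻¹ := by
        rw [Real.rpow_neg hε.le, show (5:ℝ) = ((5:ℕ):ℝ) by norm_num, Real.rpow_natCast]
      rw [e5]
      field_simp
    _ ≤ ε ^ 5 / 50 * 1 := by gcongr
    _ = _ := mul_one _

variable {Ω : Type*} [MeasurableSpace Ω] {P : Measure Ω} [IsProbabilityMeasure P] {H : ℝ} {B : ℝ → Ω → ℝ} {aH : ℝ}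

lemma phc_meas (hB : IsFBM H P B) (κ : ℝ≥0∞) {h ε : ℝ} (hh : 0 < h) (hε : 0 ≤ ε) (δ : ℝ) (j : ℕ) (a : ℝ) :
    Measurable fun ω => phc (fun r => B r ω) κ h δ ε j a := by
  unfold phc trn
  have e : ∀ ω, J (fun r => B r ω) (Icc (0 + j * h) (0 + (j + 1) * h)) (Ioc a (a + δ)) ε = _ := fun ω => J_block (hB.1 ω) 0 hh hε j _
  simp only [e]
  exact ((Measurable.iSup fun k => J_meas (fun i => hB.2.2.1 _) _ _ _).const_mul κ).min measurable_const

lemma bad_prob (hB : IsFBM H P B) (ha : ∀ s t : ℝ, ∫ ω, (B t ω - B s ω) ^ 2 ∂P = aH * |t - s| ^ (2 * H))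
    (haH : 0 < aH) (hH : 0 < H) (hH2 : H < 1 / 2) {θ κ c C t η : ℝ} (hθ : 0 < θ) (hκ : 0 < κ) (hc : 0 < c) (hC : 0 < C)
    (ht : 0 < t) (hη : 0 < η) (hη1 : η ≤ 1) :
    ∀ᶠ ε : ℝ in 𝓝[>] 0, ∀ δ δ' : ℝ, c * ε ^ θ ≤ δ → 0 ≤ δ' → δ' ≤ C * ε ^ (2 * H * θ * (1 + 2 * κ)) →
    ∀ kk : ℝ≥0∞, kk ≠ ⊤ → ∀ a a' : ℝ, |a' - a| ≤ δ' → ∀ b, 1 ≤ b →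
    P {ω | η / (hn t (2 * θ * (1 + κ)) ε * ε ^ (-(θ * κ / 2)) / δ) ≤ ∑ i ∈ Finset.range (qn (2 * θ * (1 + κ)) ε),
      ((phc (fun r => B r ω) kk (hn t (2 * θ * (1 + κ)) ε) δ ε (2 * i + b) a).toReal -
        (1 + η) * (phc (fun r => B r ω) kk (hn t (2 * θ * (1 + κ)) ε) δ ε (2 * i + b) a').toReal)} ≤ ENNReal.ofReal (ε ^ 5 / 50) := by
  obtain ⟨C1, hC1, hexp⟩ := exp_est hB ha haH hH hH2
  filter_upwards [asy hH hθ hκ hc hC hC1 ht hη, ev_le_one]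
  intro ε hasy ⟨hε, hε1⟩ δ δ' hδ hδ0 hδ' kk hkk a a' haa b hb
  set h := hn t (2 * θ * (1 + κ)) ε with hh
  have hhpos : 0 < h := hn_pos ht _ _
  set K := h * ε ^ (-(θ * κ / 2)) / δ with hK
  set l := K * ε ^ (-(θ * κ / 2)) with hl
  obtain ⟨hl0, hl1, hfin⟩ := hasy δ δ' hδ hδ0 hδ' h K l hh hK hl
  set q := qn (2 * θ * (1 + κ)) ε with hq
  set M := ε ^ (-(2 * H * θ * κ)) with hM
  have hM0 : 0 ≤ M := by positivity
  have hE := hexp kk hkk h δ ε a a' l η M (δ' ^ 2 * (C1 * h ^ (-(2 * H)))) hhpos hε.le hl0 hl1 hη hη1 hM0 (by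
    have : (a' - a) ^ 2 ≤ δ' ^ 2 := by rw [← sq_abs]; gcongr
    gcongr) b hb q
  set x := η / K with hx
  set G : Ω → ℝ≥0∞ := fun ω => Ew l η q (fun i => phc (fun r => B r ω) kk h δ ε (2 * i + b) a) (fun i => phc (fun r => B r ω) kk h δ ε (2 * i + b) a') with hG
  have hGm : Measurable G := by
    rw [hG]; unfold Ew
    refine ENNReal.measurable_ofReal.comp (Real.measurable_exp.comp (Measurable.const_mul ?_ _))
    exact Finset.measurable_sum _ fun i _ => (phc_meas hB kk hhpos hε.le _ _ _).ennreal_toReal.sub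
      ((phc_meas hB kk hhpos hε.le _ _ _).ennreal_toReal.const_mul _)
  have hmk := mul_meas_ge_le_lintegral (μ := P) hGm (ENNReal.ofReal (Real.exp (l * x)))
  have hsub : {ω | x ≤ ∑ i ∈ Finset.range q, ((phc (fun r => B r ω) kk h δ ε (2 * i + b) a).toReal -
        (1 + η) * (phc (fun r => B r ω) kk h δ ε (2 * i + b) a').toReal)} ⊆ {ω | ENNReal.ofReal (Real.exp (l * x)) ≤ G ω} := by
    intro ω hω
    apply ENNReal.ofReal_le_ofReal
    apply Real.exp_le_exp.2
    exact mul_le_mul_of_nonneg_left hω hl0.le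
  have hcan : ENNReal.ofReal (Real.exp (-(l * x))) * ENNReal.ofReal (Real.exp (l * x)) = 1 := by
    rw [← ENNReal.ofReal_mul (Real.exp_nonneg _), ← Real.exp_add]; simp
  calc _ ≤ P {ω | ENNReal.ofReal (Real.exp (l * x)) ≤ G ω} := measure_mono hsub
    _ = ENNReal.ofReal (Real.exp (-(l * x))) * (ENNReal.ofReal (Real.exp (l * x)) * P {ω | ENNReal.ofReal (Real.exp (l * x)) ≤ G ω}) := by
        rw [← mul_assoc, hcan, one_mul]
    _ ≤ ENNReal.ofReal (Real.exp (-(l * x))) * ENNReal.ofReal (1 + 4 * l ^ 2 + l * Real.exp ((1 + M) ^ 2 * (δ' ^ 2 * (C1 * h ^ (-(2 * H)))) / 2 - M * Real.log (1 + η))) ^ q := by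
        gcongr; exact hmk.trans hE
    _ ≤ _ := by
        rw [← ENNReal.ofReal_pow (by positivity), ← ENNReal.ofReal_mul (Real.exp_nonneg _)]
        exact ENNReal.ofReal_le_ofReal hfin

/-- Borel-Cantelli along a geometric sequence, from bounds valid for small scales -/
lemma bc_geom {r : ℝ} (hr0 : 0 < r) (hr1 : r < 1) {S : ℝ → Set Ω} (h : ∀ᶠ ε : ℝ in 𝓝[>] 0, P (S ε) ≤ ENNReal.ofReal ε) :
    ∀ᵐ ω ∂P, ∀ᶠ n : ℕ in atTop, ω ∉ S (r ^ n) := by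
  have hlim : Tendsto (fun n : ℕ => r ^ n) atTop (𝓝[>] 0) := by
    rw [tendsto_nhdsWithin_iff]
    exact ⟨tendsto_pow_atTop_nhds_zero_of_lt_one hr0.le hr1, Eventually.of_forall fun n => pow_pos hr0 n⟩
  obtain ⟨n0, hn0⟩ := eventually_atTop.1 (hlim.eventually h)
  have hsum : ∑' n, P (S (r ^ (n + n0))) ≠ ⊤ := by
    have hle : ∑' n, P (S (r ^ (n + n0))) ≤ ∑' n : ℕ, ENNReal.ofReal (r ^ n) :=
      ENNReal.tsum_le_tsum fun n => (hn0 _ (by omega)).trans (ENNReal.ofReal_le_ofReal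
        (pow_le_pow_of_le_one hr0.le hr1.le (by omega)))
    refine ne_top_of_le_ne_top ?_ hle
    rw [← ENNReal.ofReal_tsum_of_nonneg (fun n => by positivity) (summable_geometric_of_lt_one hr0.le hr1)]
    exact ENNReal.ofReal_ne_top
  filter_upwards [ae_eventually_notMem hsum] with ω hω
  obtain ⟨n1, hn1⟩ := eventually_atTop.1 hω
  refine eventually_atTop.2 ⟨n1 + n0, fun n hn => ?_⟩
  have := hn1 (n - n0) (by omega)
  rwa [Nat.sub_add_cancel (by omega)] at this

lemma bad_bc (hB : IsFBM H P B) (ha : ∀ s t : ℝ, ∫ ω, (B t ω - B s ω) ^ 2 ∂P = aH * |t - s| ^ (2 * H))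
    (haH : 0 < aH) (hH : 0 < H) (hH2 : H < 1 / 2) {θ κ c C t η : ℝ} (hθ : 0 < θ) (hκ : 0 < κ) (hc : 0 < c) (hC : 0 < C)
    (ht : 0 < t) (hη : 0 < η) (hη1 : η ≤ 1) {r : ℝ} (hr0 : 0 < r) (hr1 : r < 1) (μ : ℝ → ℝ) (δ δ' : ℝ → ℝ)
    (hδ : ∀ ε, 0 < ε → ε ≤ 1 → c * ε ^ θ ≤ δ ε) (hδ0 : ∀ ε, 0 < ε → ε ≤ 1 → 0 ≤ δ' ε)
    (hδ' : ∀ ε, 0 < ε → ε ≤ 1 → δ' ε ≤ C * ε ^ (2 * H * θ * (1 + 2 * κ))) (kk : ℝ → ℝ≥0∞) (hkk : ∀ ε, kk ε ≠ ⊤) :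
    ∀ᵐ ω ∂P, ∀ᶠ n : ℕ in atTop, ∀ ε, ε = r ^ n → ∀ k k' : ℤ, |k| ≤ qn 2 ε → |k'| ≤ qn 2 ε → |k' * μ ε - k * μ ε| ≤ δ' ε → ∀ b, b = 1 ∨ b = 2 →
    ∑ i ∈ Finset.range (qn (2 * θ * (1 + κ)) ε),
      ((phc (fun r => B r ω) (kk ε) (hn t (2 * θ * (1 + κ)) ε) (δ ε) ε (2 * i + b) (k * μ ε)).toReal -
        (1 + η) * (phc (fun r => B r ω) (kk ε) (hn t (2 * θ * (1 + κ)) ε) (δ ε) ε (2 * i + b) (k' * μ ε)).toReal) ≤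
      η / (hn t (2 * θ * (1 + κ)) ε * ε ^ (-(θ * κ / 2)) / δ ε) := by
  set Bd : ℝ → ℤ → ℤ → ℕ → Set Ω := fun ε k k' b => {ω | η / (hn t (2 * θ * (1 + κ)) ε * ε ^ (-(θ * κ / 2)) / δ ε) ≤ ∑ i ∈ Finset.range (qn (2 * θ * (1 + κ)) ε),
      ((phc (fun r => B r ω) (kk ε) (hn t (2 * θ * (1 + κ)) ε) (δ ε) ε (2 * i + b) (k * μ ε)).toReal -
        (1 + η) * (phc (fun r => B r ω) (kk ε) (hn t (2 * θ * (1 + κ)) ε) (δ ε) ε (2 * i + b) (k' * μ ε)).toReal)} with hBd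
  set I : ℝ → Finset ((ℤ × ℤ) × ℕ) := fun ε => ((Finset.Icc (-(qn 2 ε : ℤ)) (qn 2 ε) ×ˢ Finset.Icc (-(qn 2 ε : ℤ)) (qn 2 ε)) ×ˢ Finset.Icc 1 2).filter
    (fun p => |p.1.2 * μ ε - p.1.1 * μ ε| ≤ δ' ε) with hI
  have key := bc_geom (P := P) hr0 hr1 (S := fun ε => ⋃ p ∈ I ε, Bd ε p.1.1 p.1.2 p.2) ?_
  · filter_upwards [key] with ω hω
    filter_upwards [hω] with n hn ε hεn k k' hk hk' hkk' b hb
    rw [← hεn] at hn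
    by_contra hcon
    push Not at hcon
    apply hn
    simp only [mem_iUnion]
    refine ⟨((k, k'), b), ?_, hcon.le⟩
    simp only [hI, Finset.mem_filter, Finset.mem_product, Finset.mem_Icc]
    refine ⟨⟨⟨abs_le.1 hk, abs_le.1 hk'⟩, by omega⟩, hkk'⟩
  · filter_upwards [bad_prob hB ha haH hH hH2 hθ hκ hc hC ht hη hη1, ev_le_one]
    intro ε hp ⟨hε, hε1⟩
    refine (measure_biUnion_finset_le _ _).trans ?_
    have h1 : ∀ p ∈ I ε, P (Bd ε p.1.1 p.1.2 p.2) ≤ ENNReal.ofReal (ε ^ 5 / 50) := by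
      intro p hpI
      simp only [hI, Finset.mem_filter, Finset.mem_product, Finset.mem_Icc] at hpI
      exact hp (δ ε) (δ' ε) (hδ ε hε hε1) (hδ0 ε hε hε1) (hδ' ε hε hε1) (kk ε) (hkk ε) _ _ hpI.2 p.2 hpI.1.2.1
    refine (Finset.sum_le_card_nsmul _ _ _ h1).trans ?_
    have hcard : ((I ε).card : ℝ) ≤ 50 * ε ^ (-(4:ℝ)) := by
      have c1 : (I ε).card ≤ (2 * qn 2 ε + 1) * (2 * qn 2 ε + 1) * 2 := by
        refine (Finset.card_filter_le _ _).trans ?_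
        rw [Finset.card_product, Finset.card_product, Int.card_Icc]
        simp only [Nat.card_Icc]
        have : ((qn 2 ε : ℤ) + 1 - -(qn 2 ε : ℤ)).toNat = 2 * qn 2 ε + 1 := by omega
        rw [this]
      have c2 := (qn_bd (β := 2) (by norm_num) hε hε1).2
      have c3 : 1 ≤ ε ^ (-(2:ℝ)) := Real.one_le_rpow_of_pos_of_le_one_of_nonpos hε hε1 (by norm_num)
      calc ((I ε).card : ℝ) ≤ ((2 * qn 2 ε + 1) * (2 * qn 2 ε + 1) * 2 : ℕ) := by exact_mod_cast c1
        _ = (2 * (qn 2 ε : ℝ) + 1) * (2 * qn 2 ε + 1) * 2 := by push_cast; ring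
        _ ≤ (5 * ε ^ (-(2:ℝ))) * (5 * ε ^ (-(2:ℝ))) * 2 := by gcongr <;> linarith
        _ = 50 * (ε ^ (-(2:ℝ)) * ε ^ (-(2:ℝ))) := by ring
        _ = _ := by rw [← Real.rpow_add hε]; norm_num
    rw [nsmul_eq_mul, ← ENNReal.ofReal_natCast, ← ENNReal.ofReal_mul (by positivity)]
    apply ENNReal.ofReal_le_ofReal
    calc ((I ε).card : ℝ) * (ε ^ 5 / 50) ≤ 50 * ε ^ (-(4:ℝ)) * (ε ^ 5 / 50) := by gcongr
      _ = ε := by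
        have e5 : ε ^ (-(4:ℝ)) = (ε ^ 4)⁻¹ := by
          rw [Real.rpow_neg hε.le, show (4:ℝ) = ((4:ℕ):ℝ) by norm_num, Real.rpow_natCast]
        rw [e5]
        field_simp
end M14
end

section
section M15
set_option linter.unusedSectionVars false

/-- tent function -/
def tent (m d z : ℝ) : ℝ := max 0 (d - |z - m|)

lemma tent_cont (m d : ℝ) : Continuous (tent m d) := by unfold tent; fun_prop
lemma tent_nonneg (m d z : ℝ) : 0 ≤ tent m d z := le_max_left _ _
lemma tent_le {m d : ℝ} (hd : 0 ≤ d) (z : ℝ) : tent m d z ≤ d := max_le hd (by linarith [abs_nonneg (z - m)])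
lemma tent_zero {m d z : ℝ} (h : d ≤ |z - m|) : tent m d z = 0 := max_eq_left (by linarith)
lemma tent_ge {m d z : ℝ} (h : |z - m| ≤ d) : d ≤ tent m (2 * d) z := le_max_of_le_right (by linarith)

lemma tent_supp (m d : ℝ) : HasCompactSupport (tent m d) := by
  refine HasCompactSupport.intro (isCompact_closedBall m d) fun z hz => tent_zero ?_
  rw [Metric.mem_closedBall, Real.dist_eq] at hz
  push Not at hz
  exact hz.le

/-- occupation density of the path on `[0,t]` -/
def Occ (w : ℝ → ℝ) (t : ℝ) (Lf : ℝ → ℝ) : Prop :=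
  Continuous Lf ∧ ∀ f : ℝ → ℝ, Continuous f → ∫ r in (0 : ℝ)..t, f (w r) = ∫ a : ℝ, f a * Lf a

variable {w : ℝ → ℝ} {t : ℝ} {Lf : ℝ → ℝ}

lemma Occ.nonneg (h : Occ w t Lf) (ht : 0 ≤ t) (a : ℝ) : 0 ≤ Lf a := by
  by_contra hc
  push Not at hc
  obtain ⟨d, hd, hball⟩ := Metric.mem_nhds_iff.1 (h.1.continuousAt.preimage_mem_nhds (Iio_mem_nhds hc))
  have hpos := Continuous.integral_pos_of_hasCompactSupport_nonneg_nonzero (μ := volume) (f := fun z => tent a d z * -Lf z) (x := a)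
    ((tent_cont a d).mul h.1.neg) ((tent_supp a d).mul_right) (fun z => by
      by_cases hz : |z - a| < d
      · have : z ∈ Metric.ball a d := by rw [Metric.mem_ball, Real.dist_eq]; exact hz
        have h2 : Lf z < 0 := hball this
        exact mul_nonneg (tent_nonneg _ _ _) (by linarith)
      · simp [tent_zero (not_lt.1 hz)]) (by simp [tent, hd.le, hd.ne', hc.ne])
  have e := h.2 _ (tent_cont a d)
  have h3 : 0 ≤ ∫ r in (0 : ℝ)..t, tent a d (w r) := intervalIntegral.integral_nonneg ht fun r _ => tent_nonneg _ _ _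
  simp only [mul_neg, integral_neg] at hpos
  linarith

lemma Occ.zero (h : Occ w t Lf) (ht : 0 ≤ t) {A : ℝ} (hA : ∀ r ∈ Icc 0 t, |w r| ≤ A) {a : ℝ} (ha : A < |a|) : Lf a = 0 := by
  by_contra hc
  have hd : 0 < |a| - A := by linarith
  have hpos := Continuous.integral_pos_of_hasCompactSupport_nonneg_nonzero (μ := volume) (f := fun z => tent a (|a| - A) z * Lf z) (x := a)
    ((tent_cont a _).mul h.1) ((tent_supp a _).mul_right) (fun z => mul_nonneg (tent_nonneg _ _ _) (h.nonneg ht z))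
    (by simp [tent, hc, hd.le, hd.ne'])
  rw [← h.2 _ (tent_cont a _)] at hpos
  have : ∫ r in (0 : ℝ)..t, tent a (|a| - A) (w r) = 0 := by
    suffices e0 : ∫ r in (0 : ℝ)..t, tent a (|a| - A) (w r) = ∫ r in (0 : ℝ)..t, (0 : ℝ) by
      rw [e0]; simp
    refine intervalIntegral.integral_congr fun r hr => ?_
    rw [uIcc_of_le ht] at hr
    refine tent_zero ?_
    have := abs_sub_abs_le_abs_sub a (w r)
    rw [abs_sub_comm] at this
    linarith [hA r hr]
  linarith

lemma Occ.bdd (h : Occ w t Lf) (hw : Continuous w) (ht : 0 ≤ t) : ∃ Λ, 0 < Λ ∧ ∀ a, Lf a ≤ Λ := by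
  obtain ⟨A, hA⟩ := (isCompact_Icc (a := (0:ℝ)) (b := t)).exists_bound_of_continuousOn hw.continuousOn
  obtain ⟨Λ, hΛ⟩ := (isCompact_Icc (a := -A) (b := A)).exists_bound_of_continuousOn h.1.continuousOn
  refine ⟨max Λ 1, by positivity, fun a => ?_⟩
  by_cases ha : |a| ≤ A
  · exact ((le_abs_self _).trans (hΛ a (abs_le.1 ha))).trans (le_max_left _ _)
  · rw [h.zero ht hA (not_le.1 ha)]; positivity

lemma blk_sum {g : ℝ → ℝ} (hg : Continuous g) (h : ℝ) (n : ℕ) :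
    ∫ r in (0:ℝ)..(n * h), g r = ∑ j ∈ Finset.range n, ∫ r in (0 + j * h)..(0 + (j + 1) * h), g r := by
  have := intervalIntegral.sum_integral_adjacent_intervals (f := g) (μ := volume) (a := fun j : ℕ => 0 + (j : ℝ) * h) (n := n)
    (fun k _ => hg.intervalIntegrable _ _)
  simp only [Nat.cast_add, Nat.cast_one, Nat.cast_zero, zero_mul, add_zero] at this
  rw [this]; simp

lemma Occ.count (hO : Occ w t Lf) (hw : Continuous w) (ht : 0 ≤ t) {Λ : ℝ} (hΛ : ∀ a, Lf a ≤ Λ) {h : ℝ} (hh : 0 < h) {n : ℕ} (hn : t = n * h)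
    {m d : ℝ} (hd : 0 < d) (S : Finset ℕ) (hSn : S ⊆ Finset.range n)
    (hS : ∀ j ∈ S, ∀ r ∈ Icc (0 + j * h) (0 + ((j : ℝ) + 1) * h), |w r - m| ≤ d) : S.card * h ≤ 8 * d * Λ := by
  have h1 := hO.2 _ (tent_cont m (2 * d))
  have hg : Continuous fun r => tent m (2 * d) (w r) := (tent_cont _ _).comp hw
  rw [hn, blk_sum hg] at h1
  have h2 : ∑ j ∈ S, h * d ≤ ∑ j ∈ Finset.range n, ∫ r in (0 + j * h)..(0 + ((j:ℝ) + 1) * h), tent m (2 * d) (w r) := by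
    refine le_trans (Finset.sum_le_sum fun j hj => ?_) (Finset.sum_le_sum_of_subset_of_nonneg hSn fun j _ _ => ?_)
    · have : ∫ r in (0 + j * h)..(0 + ((j:ℝ) + 1) * h), d ≤ ∫ r in (0 + j * h)..(0 + ((j:ℝ) + 1) * h), tent m (2 * d) (w r) :=
        intervalIntegral.integral_mono_on (by nlinarith) intervalIntegrable_const (hg.intervalIntegrable _ _)
          fun r hr => tent_ge (hS j hj r hr)
      rw [intervalIntegral.integral_const, smul_eq_mul] at this
      calc h * d = (0 + ((j:ℝ) + 1) * h - (0 + j * h)) * d := by ring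
        _ ≤ _ := this
    · exact intervalIntegral.integral_nonneg (by nlinarith) fun r _ => tent_nonneg _ _ _
  have h3 : ∫ a, tent m (2 * d) a * Lf a ≤ 8 * d * Λ * d := by
    have hntg : Integrable fun a => tent m (2 * d) a * Lf a :=
      ((tent_cont _ _).mul hO.1).integrable_of_hasCompactSupport (tent_supp _ _).mul_right
    calc ∫ a, tent m (2 * d) a * Lf a ≤ ∫ a, (Icc (m - 2 * d) (m + 2 * d)).indicator (fun _ => 2 * d * Λ) a := by
          refine integral_mono hntg ?_ fun a => ?_
          · exact (integrable_indicator_iff measurableSet_Icc).2 (integrableOn_const (by simp))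
          · by_cases ha : a ∈ Icc (m - 2 * d) (m + 2 * d)
            · rw [indicator_of_mem ha]
              exact mul_le_mul (tent_le (by linarith) _) (hΛ a) (hO.nonneg ht a) (by linarith)
            · rw [indicator_of_notMem ha]
              dsimp only
              rw [tent_zero, zero_mul]
              by_contra hc
              push Not at hc
              rw [abs_lt] at hc
              exact ha ⟨by linarith [hc.1], by linarith [hc.2]⟩
      _ = 8 * d * Λ * d := by
          rw [integral_indicator measurableSet_Icc, setIntegral_const, smul_eq_mul, Measure.real, Real.volume_Icc,
            ENNReal.toReal_ofReal (by linarith)]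
          ring
  rw [Finset.sum_const, nsmul_eq_mul] at h2
  rw [h1] at h2
  have : (S.card * h) * d ≤ (8 * d * Λ) * d := by linarith
  exact le_of_mul_le_mul_right this hd

lemma J_le_Wt (w : ℝ → ℝ) (s t : ℝ) (A : Set ℝ) (ε : ℝ) : J w (Icc s t) A ε ≤ Wt w s t ε := by
  unfold J Wt
  exact lintegral_mono' Measure.restrict_le_self le_rfl

lemma Wt_lt_top (hw : Continuous w) (s t : ℝ) {ε : ℝ} (hε : 0 < ε) : Wt w s t ε < ⊤ := by
  rcases lt_or_ge t s with hts | hst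
  · unfold Wt
    rw [Icc_eq_empty (not_le.2 hts)]
    have : ∀ b, V w (∅ : Set ℝ) b (b + ε) = 0 := fun b => V_zero (by simp)
    simp [this]
  have huc := (isCompact_Icc (a := s) (b := t)).uniformContinuousOn_of_continuous hw.continuousOn
  rw [Metric.uniformContinuousOn_iff] at huc
  obtain ⟨d, hd, hd2⟩ := huc ε hε
  obtain ⟨n, hn⟩ := exists_nat_gt ((t - s) / d)
  have hn0 : (0:ℝ) < n := lt_of_le_of_lt (by have := sub_nonneg.2 hst; positivity) hn
  have e : s + n * ((t - s) / n) = t := by field_simp; ring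
  have h := Wt_osc_blocks hw (s := s) (h := (t - s) / n) hε.le (by have := sub_nonneg.2 hst; positivity) n (by
    rw [e]
    intro u hu v hv huv
    have : dist (w v) (w u) < ε := hd2 v hv u hu (by
      rw [Real.dist_eq, abs_sub_comm]
      refine huv.trans_lt ?_
      rw [div_lt_iff₀ hn0]; rw [div_lt_iff₀ hd] at hn; linarith)
    rw [Real.dist_eq] at this
    exact ((le_abs_self _).trans_lt this).le)
  rw [e] at h
  exact h.trans_lt (ENNReal.mul_lt_top (by simp) ENNReal.ofReal_lt_top)

lemma J_fin (hw : Continuous w) (s t : ℝ) (A : Set ℝ) {ε : ℝ} (hε : 0 < ε) : J w (Icc s t) A ε ≠ ⊤ :=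
  ((J_le_Wt w s t A ε).trans_lt (Wt_lt_top hw s t hε)).ne

lemma J_blocks_le (hw : Continuous w) {h ε : ℝ} (hh : 0 ≤ h) (hε : 0 ≤ ε) (n : ℕ) (A : Set ℝ) :
    ∑ j ∈ Finset.range n, J w (Icc (0 + j * h) (0 + (j + 1) * h)) A ε ≤ J w (Icc 0 (n * h)) A ε := by
  unfold J
  rw [← lintegral_finsetSum _ fun j _ => measurable_V_Icc hw _ _ hε]
  refine lintegral_mono fun b => ?_
  have := V_blocks_le (w := w) (s := 0) (x := b) (y := b + ε) hh n
  rwa [zero_add (n * h)] at this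

lemma J_blocks_ge (hw : Continuous w) {h ε : ℝ} (hh : 0 ≤ h) (hε : 0 ≤ ε) (n : ℕ) (a δ : ℝ) :
    J w (Icc 0 (n * h)) (Ioc a (a + δ)) ε ≤ ∑ j ∈ Finset.range n, J w (Icc (0 + j * h) (0 + (j + 1) * h)) (Ioc a (a + δ)) ε
      + ((Finset.range n).filter fun j : ℕ => w (0 + j * h) ∈ Icc a (a + δ + ε)).card * ENNReal.ofReal ε := by
  have hm : ∀ j : ℕ, Measurable fun b : ℝ => (if 0 < j ∧ b ≤ w (0 + j * h) ∧ w (0 + j * h) ≤ b + ε then (1 : ℝ≥0∞) else 0) := by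
    intro j
    refine Measurable.ite ?_ measurable_const measurable_const
    exact MeasurableSet.inter (MeasurableSet.const _) (MeasurableSet.inter (measurableSet_le measurable_id measurable_const)
      (measurableSet_le measurable_const (measurable_id.add_const _)))
  have h1 : J w (Icc 0 (n * h)) (Ioc a (a + δ)) ε ≤ ∑ j ∈ Finset.range n, J w (Icc (0 + j * h) (0 + (j + 1) * h)) (Ioc a (a + δ)) ε
      + ∑ j ∈ Finset.range n, ∫⁻ b in Ioc a (a + δ), (if 0 < j ∧ b ≤ w (0 + j * h) ∧ w (0 + j * h) ≤ b + ε then 1 else 0) := by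
    unfold J
    rw [← lintegral_finsetSum _ fun j _ => measurable_V_Icc hw _ _ hε, ← lintegral_finsetSum _ fun j _ => hm j,
      ← lintegral_add_right _ (Finset.measurable_sum _ fun j _ => hm j)]
    refine lintegral_mono fun b => ?_
    have := V_blocks_ge (w := w) (s := 0) (x := b) (y := b + ε) hh n
    rwa [zero_add (n * h)] at this
  refine h1.trans ?_
  gcongr
  rw [← nsmul_eq_mul, ← Finset.sum_const, Finset.sum_filter]
  refine Finset.sum_le_sum fun j _ => ?_
  split_ifs with hj
  · rw [← lint_ind (w (0 + j * h)) ε]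
    refine lintegral_mono' Measure.restrict_le_self fun b => ?_
    split_ifs <;> simp_all
  · refine le_of_eq ?_
    suffices e0 : ∫⁻ b in Ioc a (a + δ), (if 0 < j ∧ b ≤ w (0 + j * h) ∧ w (0 + j * h) ≤ b + ε then (1 : ℝ≥0∞) else 0) =
        ∫⁻ b in Ioc a (a + δ), 0 by rw [e0]; simp
    refine setLIntegral_congr_fun measurableSet_Ioc fun b hb => ?_
    rw [if_neg]
    rintro ⟨_, h2, h3⟩
    exact hj ⟨hb.1.le.trans h2, h3.trans (by linarith [hb.2])⟩

/-- rescaled window average of the crossing numbers -/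
def Xw (H : ℝ) (w : ℝ → ℝ) (t ε δ a : ℝ) : ℝ := ε ^ (1 / H - 1) / δ * (J w (Icc 0 t) (Ioc a (a + δ)) ε).toReal

lemma sum_parity (x : ℕ → ℝ) (q : ℕ) : ∑ j ∈ Finset.range (2 * q + 1), x j =
    x 0 + ∑ i ∈ Finset.range q, x (2 * i + 1) + ∑ i ∈ Finset.range q, x (2 * i + 2) := by
  induction q with
  | zero => simp
  | succ q ih =>
    rw [show 2 * (q + 1) + 1 = 2 * q + 1 + 1 + 1 by ring, Finset.sum_range_succ, Finset.sum_range_succ, ih,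
      Finset.sum_range_succ, Finset.sum_range_succ]
    ring_nf

lemma one_step_det (hw : Continuous w) {H ε δ K η h : ℝ} {q : ℕ} (hε : 0 < ε) (hδ : 0 < δ) (hK : 0 < K) (hη : 0 ≤ η) (hh : 0 < h)
    (htq : t = ((2 * q + 1 : ℕ) : ℝ) * h) {a a' : ℝ}
    (hA : ∀ j < 2 * q + 1, ∀ a, J w (Icc (0 + j * h) (0 + ((j:ℝ) + 1) * h)) (Ioc a (a + δ)) ε ≤ ENNReal.ofReal (K * δ * ε ^ (1 - 1 / H)))
    (hb : ∀ b, b = 1 ∨ b = 2 → ∑ i ∈ Finset.range q,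
      ((phc w (ENNReal.ofReal (ε ^ (1 / H - 1) / (K * δ))) h δ ε (2 * i + b) a).toReal -
        (1 + η) * (phc w (ENNReal.ofReal (ε ^ (1 / H - 1) / (K * δ))) h δ ε (2 * i + b) a').toReal) ≤ η / K)
    (hc : ε ^ (1 / H) / δ * ((Finset.range (2 * q + 1)).filter fun j : ℕ => w (0 + j * h) ∈ Icc a (a + δ + ε)).card ≤ η) :
    Xw H w t ε δ a ≤ (1 + η) * Xw H w t ε δ a' + 3 * η + K := by
  set n := 2 * q + 1 with hn
  set kk := ENNReal.ofReal (ε ^ (1 / H - 1) / (K * δ)) with hkk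
  set e0 := ε ^ (1 / H - 1) with he0
  have he0pos : 0 < e0 := by positivity
  have he1 : ε ^ (1 - 1 / H) = e0⁻¹ := by rw [he0, ← Real.rpow_neg hε.le]; congr 1; ring
  have he2 : ε ^ (1 / H) = e0 * ε := by
    rw [he0, ← Real.rpow_add_one hε.ne']; congr 1; ring
  set Jj : ℕ → ℝ → ℝ := fun j a => (J w (Icc (0 + j * h) (0 + ((j:ℝ) + 1) * h)) (Ioc a (a + δ)) ε).toReal with hJj
  set p : ℕ → ℝ → ℝ := fun j a => (phc w kk h δ ε j a).toReal with hp
  have hpj : ∀ j < n, ∀ a, K * p j a = e0 / δ * Jj j a := by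
    intro j hj a
    have hfin := J_fin hw (0 + j * h) (0 + ((j:ℝ) + 1) * h) (Ioc a (a + δ)) hε
    have hle : kk * J w (Icc (0 + j * h) (0 + ((j:ℝ) + 1) * h)) (Ioc a (a + δ)) ε ≤ 1 := by
      calc _ ≤ kk * ENNReal.ofReal (K * δ * ε ^ (1 - 1 / H)) := by gcongr; exact hA j hj a
        _ = 1 := by
          rw [hkk, ← ENNReal.ofReal_mul (by positivity), he1]
          rw [show e0 / (K * δ) * (K * δ * e0⁻¹) = 1 by field_simp]; simp
    simp only [hp, hJj, phc, trn]
    rw [min_eq_left hle, ENNReal.toReal_mul, hkk, ENNReal.toReal_ofReal (by positivity)]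
    field_simp
  have hup : Xw H w t ε δ a ≤ ∑ j ∈ Finset.range n, K * p j a + η := by
    have h1 := J_blocks_ge hw hh.le hε.le n a δ
    rw [← htq] at h1
    have hS : ∑ j ∈ Finset.range n, J w (Icc (0 + j * h) (0 + ((j:ℝ) + 1) * h)) (Ioc a (a + δ)) ε ≠ ⊤ :=
      (ENNReal.sum_lt_top.2 fun j _ => (J_fin hw _ _ _ hε).lt_top).ne
    have h2 := ENNReal.toReal_mono (ENNReal.add_ne_top.2 ⟨hS, ENNReal.mul_ne_top (by simp) ENNReal.ofReal_ne_top⟩) h1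
    rw [ENNReal.toReal_add hS (ENNReal.mul_ne_top (by simp) ENNReal.ofReal_ne_top), ENNReal.toReal_sum (fun j _ => J_fin hw _ _ _ hε), ENNReal.toReal_mul,
      ENNReal.toReal_ofReal hε.le, ENNReal.toReal_natCast] at h2
    unfold Xw
    rw [Finset.sum_congr rfl fun j hj => hpj j (Finset.mem_range.1 hj) a, ← Finset.mul_sum]
    rw [he2] at hc
    calc _ ≤ e0 / δ * (∑ j ∈ Finset.range n, Jj j a + _) := mul_le_mul_of_nonneg_left h2 (by positivity)
      _ = e0 / δ * ∑ j ∈ Finset.range n, Jj j a + e0 * ε / δ * ((Finset.range n).filter fun j : ℕ => w (0 + j * h) ∈ Icc a (a + δ + ε)).card := by ring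
      _ ≤ _ := by gcongr
  have hlo : ∑ j ∈ Finset.range n, K * p j a' ≤ Xw H w t ε δ a' := by
    have h1 := J_blocks_le hw hh.le hε.le n (Ioc a' (a' + δ))
    rw [← htq] at h1
    have h2 := ENNReal.toReal_mono (J_fin hw _ _ _ hε) h1
    rw [ENNReal.toReal_sum (fun j _ => J_fin hw _ _ _ hε)] at h2
    unfold Xw
    rw [Finset.sum_congr rfl fun j hj => hpj j (Finset.mem_range.1 hj) a', ← Finset.mul_sum]
    exact mul_le_mul_of_nonneg_left h2 (by positivity)
  have hp1 : p 0 a ≤ 1 := trn_toReal_le _ _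
  have hp0 : 0 ≤ p 0 a' := ENNReal.toReal_nonneg
  rw [sum_parity] at hup hlo
  have hcl : ∀ b, b = 1 ∨ b = 2 → ∑ i ∈ Finset.range q, K * p (2 * i + b) a ≤ (1 + η) * ∑ i ∈ Finset.range q, K * p (2 * i + b) a' + η := by
    intro b hb'
    have h1 : ∑ i ∈ Finset.range q, (p (2 * i + b) a - (1 + η) * p (2 * i + b) a') ≤ η / K := hb b hb'
    rw [Finset.sum_sub_distrib, ← Finset.mul_sum] at h1
    have h2 := mul_le_mul_of_nonneg_left h1 hK.le
    rw [mul_div_cancel₀ _ hK.ne'] at h2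
    rw [← Finset.mul_sum, ← Finset.mul_sum]
    linarith
  have c1 := hcl 1 (Or.inl rfl)
  have c2 := hcl 2 (Or.inr rfl)
  have hKp : K * p 0 a ≤ K := by nlinarith
  have hKp' : 0 ≤ K * p 0 a' := by positivity
  nlinarith [mul_le_mul_of_nonneg_left hlo (by linarith : (0:ℝ) ≤ 1 + η)]
end M15
end

section
section M16
set_option linter.unusedSectionVars false

variable {w : ℝ → ℝ} {t : ℝ} {Lf : ℝ → ℝ}

lemma Xw_nonneg (H : ℝ) (w : ℝ → ℝ) (t : ℝ) {ε δ : ℝ} (hε : 0 ≤ ε) (hδ : 0 ≤ δ) (a : ℝ) : 0 ≤ Xw H w t ε δ a := by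
  unfold Xw; positivity

/-- number of crossings in a block under a Hölder bound -/
lemma holder_block (hw : Continuous w) {Ch α : ℝ} (hCh : 0 < Ch) (hα : 0 < α)
    (hH : ∀ u ∈ Icc 0 t, ∀ v ∈ Icc 0 t, |w u - w v| ≤ Ch * |u - v| ^ α) {s h ε : ℝ} (hs : 0 ≤ s) (hh : 0 < h) (hst : s + h ≤ t) (hε : 0 < ε) :
    Wt w s (s + h) ε ≤ ENNReal.ofReal ((h * (Ch / ε) ^ (1 / α) + 1) * ε) := by
  have hx : 0 < h * (Ch / ε) ^ (1 / α) := by positivity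
  set m := ⌈h * (Ch / ε) ^ (1 / α)⌉₊ with hm
  have hm0 : 0 < m := Nat.ceil_pos.2 hx
  have hm0' : (0:ℝ) < m := by exact_mod_cast hm0
  have e : s + m * (h / m) = s + h := by field_simp
  have h1 := Wt_osc_blocks hw (s := s) (h := h / m) hε.le (by positivity) m (by
    rw [e]
    intro u hu v hv huv
    have h2 := hH v ⟨hs.trans hv.1, hv.2.trans hst⟩ u ⟨hs.trans hu.1, hu.2.trans hst⟩
    have h3 : h / m ≤ (ε / Ch) ^ (1 / α) := by
      have h4 : h * (Ch / ε) ^ (1 / α) ≤ m := Nat.le_ceil _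
      have h5 : (ε / Ch) ^ (1 / α) = ((Ch / ε) ^ (1 / α))⁻¹ := by
        rw [← Real.inv_rpow (by positivity), inv_div]
      rw [h5, div_le_iff₀ hm0']
      have h6 : 0 < (Ch / ε) ^ (1 / α) := by positivity
      rw [← mul_le_mul_iff_right₀ h6, ← mul_assoc, mul_inv_cancel₀ h6.ne', one_mul, mul_comm]
      exact h4
    have h4 : |v - u| ^ α ≤ ε / Ch := by
      calc |v - u| ^ α ≤ ((ε / Ch) ^ (1 / α)) ^ α :=
            Real.rpow_le_rpow (abs_nonneg _) (by rw [abs_sub_comm]; exact huv.trans h3) hα.le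
        _ = ε / Ch := by
            rw [← Real.rpow_mul (by positivity), one_div, inv_mul_cancel₀ hα.ne', Real.rpow_one]
    calc w v - w u ≤ |w v - w u| := le_abs_self _
      _ ≤ Ch * |v - u| ^ α := h2
      _ ≤ Ch * (ε / Ch) := by gcongr
      _ = ε := by field_simp)
  rw [e] at h1
  refine h1.trans ?_
  rw [ENNReal.ofReal_mul (by positivity)]
  gcongr
  rw [← ENNReal.ofReal_natCast]
  exact ENNReal.ofReal_le_ofReal (Nat.ceil_lt_add_one hx.le).le

set_option maxHeartbeats 1000000 in
/-- deterministic smallness of the error terms of one step -/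
lemma one_step_small (hw : Continuous w) (ht : 0 < t) (hO : Occ w t Lf) {H Ch α θ κ c η : ℝ} (hH : 0 < H) (hCh : 0 < Ch) (hα : 0 < α) (hαH : α < H) (hH2 : H < 1 / 2)
    (hHo : ∀ u ∈ Icc 0 t, ∀ v ∈ Icc 0 t, |w u - w v| ≤ Ch * |u - v| ^ α)
    (hθ : 0 < θ) (hθ1 : θ ≤ 1) (hκ : 0 < κ) (hc : 0 < c) (hη : 0 < η)
    (e1 : 0 < θ * κ / 2 + 1 / H - 1 / α) (e2 : 2 * θ * (1 + κ) < 1 / H) (e3 : 0 < 1 / H + 2 * θ * (1 + κ) * (α - 1) - θ)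
    (δ : ℝ → ℝ) (hδ : ∀ ε, 0 < ε → ε ≤ 1 → c * ε ^ θ ≤ δ ε) :
    ∀ᶠ ε in 𝓝[>] (0:ℝ), ∀ h q, h = hn t (2 * θ * (1 + κ)) ε → q = qn (2 * θ * (1 + κ)) ε →
      0 < ε ∧ ε ≤ 1 ∧ 0 < δ ε ∧ 0 < h ∧
      t = ((2 * q + 1 : ℕ) : ℝ) * h ∧ 0 < h * ε ^ (-(θ * κ / 2)) / δ ε ∧ h * ε ^ (-(θ * κ / 2)) / δ ε ≤ η ∧
      (∀ j < 2 * q + 1, ∀ a, J w (Icc (0 + j * h) (0 + ((j:ℝ) + 1) * h)) (Ioc a (a + δ ε)) ε ≤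
        ENNReal.ofReal (h * ε ^ (-(θ * κ / 2)) / δ ε * δ ε * ε ^ (1 - 1 / H))) ∧
      ∀ a, ε ^ (1 / H) / δ ε * ((Finset.range (2 * q + 1)).filter fun j : ℕ => w (0 + j * h) ∈ Icc a (a + δ ε + ε)).card ≤ η := by
  obtain ⟨Λ, hΛ, hΛ2⟩ := hO.bdd hw ht.le
  set β := 2 * θ * (1 + κ) with hβd
  set σ := θ * κ / 2 with hσd
  have hβ : 0 < β := by positivity
  have hσ : 0 < σ := by positivity
  filter_upwards [ev_le_one, ev_pow (2 * Ch ^ (1 / α)) e1 one_pos, ev_pow (10 / t) (show 0 < 1 / H + σ - β by linarith) one_pos,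
    ev_pow (t / 2 / c) (show 0 < β - σ - θ by rw [hβd, hσd]; nlinarith [mul_pos hθ hκ]) hη,
    ev_pow (4 * Λ * (5 / t) * (1 + 1 / c)) (show 0 < 1 / H - β by linarith) (half_pos hη),
    ev_pow (8 * Λ * Ch * (t / 5) ^ (α - 1) / c) e3 (half_pos hη)] with ε hε12 p1 p2 p3 p4 p5 h q hh hq
  obtain ⟨hε, hε1⟩ := hε12
  have hδε : 0 < δ ε := lt_of_lt_of_le (by positivity) (hδ ε hε hε1)
  have hhp : 0 < h := by rw [hh]; exact hn_pos ht _ _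
  obtain ⟨hb1, hb2⟩ := hn_bd ht hβ.le hε hε1
  rw [← hh] at hb1 hb2
  have htq : t = ((2 * q + 1 : ℕ) : ℝ) * h := by
    rw [hh, hq]; unfold hn; push_cast; field_simp
  refine ⟨hε, hε1, hδε, hhp, htq, by positivity, ?_, ?_, ?_⟩
  · calc h * ε ^ (-σ) / δ ε ≤ (t / 2 * ε ^ β) * ε ^ (-σ) / (c * ε ^ θ) := by gcongr; exact hδ ε hε hε1
      _ = t / 2 / c * ε ^ (β - σ - θ) := by
        rw [show β - σ - θ = β + -σ - θ by ring, Real.rpow_sub hε, Real.rpow_add hε]; field_simp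
      _ ≤ η := p3
  · intro j hj a
    refine (J_le_Wt w _ _ _ ε).trans ?_
    have hle : (0:ℝ) + j * h + h ≤ t := by
      rw [htq]
      have : (j : ℝ) + 1 ≤ ((2 * q + 1 : ℕ) : ℝ) := by exact_mod_cast hj
      nlinarith
    have h1 := holder_block hw hCh hα hHo (s := 0 + j * h) (by positivity) hhp hle hε
    rw [show (0:ℝ) + ((j:ℝ) + 1) * h = 0 + j * h + h by ring]
    refine h1.trans (ENNReal.ofReal_le_ofReal ?_)
    rw [div_mul_cancel₀ _ hδε.ne']
    have x1 : (Ch / ε) ^ (1 / α) ≤ 1 / 2 * (ε ^ (-σ) * ε ^ (-(1 / H))) := by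
      rw [Real.div_rpow hCh.le hε.le, div_le_iff₀ (by positivity)]
      have : ε ^ (σ + 1 / H - 1 / α) = (ε ^ (-σ) * ε ^ (-(1 / H)))⁻¹ * (ε ^ (1 / α))⁻¹ := by
        rw [← Real.rpow_add hε, ← Real.rpow_neg hε.le, ← Real.rpow_neg hε.le, ← Real.rpow_add hε]; congr 1; ring
      rw [this] at p1
      have y1 : 0 < ε ^ (-σ) * ε ^ (-(1 / H)) := by positivity
      have y2 : 0 < ε ^ (1 / α) := by positivity
      generalize ε ^ (-σ) * ε ^ (-(1 / H)) = y at *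
      generalize ε ^ (1 / α) = y' at *
      have := mul_le_mul_of_nonneg_right p1 (by positivity : 0 ≤ y * y')
      field_simp at this
      linarith
    have x2 : 1 ≤ 1 / 2 * h * (ε ^ (-σ) * ε ^ (-(1 / H))) := by
      have : ε ^ (1 / H + σ - β) = (ε ^ (-σ) * ε ^ (-(1 / H)))⁻¹ * (ε ^ β)⁻¹ := by
        rw [← Real.rpow_add hε, ← Real.rpow_neg hε.le, ← Real.rpow_neg hε.le, ← Real.rpow_add hε]; congr 1; ring
      rw [this] at p2
      have y1 : 0 < ε ^ (-σ) * ε ^ (-(1 / H)) := by positivity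
      have y2 : 0 < ε ^ β := by positivity
      generalize ε ^ (-σ) * ε ^ (-(1 / H)) = y at *
      generalize ε ^ β = y' at *
      have := mul_le_mul_of_nonneg_right p2 (by positivity : 0 ≤ y * y' * t)
      field_simp at this
      have z : t / 5 * y' * y ≤ h * y := by gcongr
      nlinarith
    have e4 : ε ^ (1 - 1 / H) = ε * ε ^ (-(1 / H)) := by
      rw [show 1 - 1 / H = 1 + -(1 / H) by ring, Real.rpow_add hε, Real.rpow_one]
    rw [e4]
    calc (h * (Ch / ε) ^ (1 / α) + 1) * ε ≤ (h * (1 / 2 * (ε ^ (-σ) * ε ^ (-(1 / H)))) + 1 / 2 * h * (ε ^ (-σ) * ε ^ (-(1 / H)))) * ε := by gcongr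
      _ = _ := by ring
  · intro a
    set S := (Finset.range (2 * q + 1)).filter fun j : ℕ => w (0 + j * h) ∈ Icc a (a + δ ε + ε) with hS
    have h1 := hO.count hw ht.le hΛ2 hhp htq (m := a + (δ ε + ε) / 2) (d := (δ ε + ε) / 2 + Ch * h ^ α) (by positivity) S
      (Finset.filter_subset _ _) (by
        intro j hj r hr
        rw [hS, Finset.mem_filter, Finset.mem_range] at hj
        obtain ⟨hj1, hj2⟩ := hj
        have hle : (0:ℝ) + (j + 1) * h ≤ t := by
          rw [htq]
          have : (j : ℝ) + 1 ≤ ((2 * q + 1 : ℕ) : ℝ) := by exact_mod_cast hj1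
          nlinarith
        have h0 : (0:ℝ) ≤ 0 + j * h := by positivity
        have g1 := hHo r ⟨h0.trans hr.1, hr.2.trans hle⟩ (0 + j * h) ⟨h0, by linarith [hr.1, hr.2]⟩
        have g2 : |r - (0 + j * h)| ^ α ≤ h ^ α := by
          refine Real.rpow_le_rpow (abs_nonneg _) ?_ hα.le
          rw [abs_of_nonneg (by linarith [hr.1])]; linarith [hr.2]
        have g3 : |w (0 + j * h) - (a + (δ ε + ε) / 2)| ≤ (δ ε + ε) / 2 := by
          rw [abs_le]; constructor <;> linarith [hj2.1, hj2.2]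
        calc _ = |(w r - w (0 + j * h)) + (w (0 + j * h) - (a + (δ ε + ε) / 2))| := by congr 1; ring
          _ ≤ _ := abs_add_le _ _
          _ ≤ Ch * h ^ α + (δ ε + ε) / 2 := by gcongr; exact g1.trans (by gcongr)
          _ = _ := by ring)
    have h2 : (S.card : ℝ) ≤ 8 * ((δ ε + ε) / 2 + Ch * h ^ α) * Λ / h := by rwa [le_div_iff₀ hhp]
    have h3 : ε / δ ε ≤ 1 / c := by
      rw [div_le_div_iff₀ hδε hc]
      have : ε ≤ ε ^ θ := by
        calc ε = ε ^ (1:ℝ) := (Real.rpow_one _).symm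
          _ ≤ ε ^ θ := Real.rpow_le_rpow_of_exponent_ge hε hε1 hθ1
      calc ε * c ≤ ε ^ θ * c := by gcongr
        _ = c * ε ^ θ := by ring
        _ ≤ δ ε := hδ ε hε hε1
        _ = 1 * δ ε := by ring
    have h4 : h ^ (α - 1) ≤ (t / 5) ^ (α - 1) * ε ^ (β * (α - 1)) := by
      rw [Real.rpow_mul hε.le, ← Real.mul_rpow (by positivity) (by positivity)]
      exact Real.rpow_le_rpow_of_nonpos (by positivity) hb1 (by linarith)
    calc ε ^ (1 / H) / δ ε * S.card ≤ ε ^ (1 / H) / δ ε * (8 * ((δ ε + ε) / 2 + Ch * h ^ α) * Λ / h) := by gcongr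
      _ = 4 * Λ * (1 + ε / δ ε) * (ε ^ (1 / H) / h) + 8 * Λ * Ch * ε ^ (1 / H) * h ^ (α - 1) / δ ε := by
          rw [Real.rpow_sub hhp, Real.rpow_one]; field_simp; ring
      _ ≤ 4 * Λ * (1 + 1 / c) * (ε ^ (1 / H) / (t / 5 * ε ^ β)) + 8 * Λ * Ch * ε ^ (1 / H) * ((t / 5) ^ (α - 1) * ε ^ (β * (α - 1))) / (c * ε ^ θ) := by
          gcongr; exact hδ ε hε hε1
      _ = 4 * Λ * (5 / t) * (1 + 1 / c) * ε ^ (1 / H - β) + 8 * Λ * Ch * (t / 5) ^ (α - 1) / c * ε ^ (1 / H + β * (α - 1) - θ) := by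
          rw [Real.rpow_sub hε, Real.rpow_sub hε, Real.rpow_add hε]; field_simp
      _ ≤ η := by linarith

variable {Ω : Type*} [MeasurableSpace Ω] {P : Measure Ω} [IsProbabilityMeasure P] {H : ℝ} {B : ℝ → Ω → ℝ} {aH : ℝ}

lemma exists_alpha (hH : 0 < H) {θ κ : ℝ} (hθ : 0 < θ) (hθ1 : θ ≤ 1) (hκ : 0 < κ)
    (hκ2 : H * (1 + 2 * (1 + κ) * (1 - H)) < 1) (hH2 : H < 1 / 2) :
    ∃ α, 0 < α ∧ α < H ∧ 0 < θ * κ / 2 + 1 / H - 1 / α ∧ 0 < 1 / H + 2 * θ * (1 + κ) * (α - 1) - θ := by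
  have c1 : ContinuousAt (fun α : ℝ => θ * κ / 2 + 1 / H - 1 / α) H := by
    refine ContinuousAt.sub continuousAt_const ?_
    exact continuousAt_const.div continuousAt_id hH.ne'
  have c2 : ContinuousAt (fun α : ℝ => 1 / H + 2 * θ * (1 + κ) * (α - 1) - θ) H := by fun_prop
  have p1 : 0 < θ * κ / 2 + 1 / H - 1 / H := by have := mul_pos hθ hκ; linarith
  have p2 : 0 < 1 / H + 2 * θ * (1 + κ) * (H - 1) - θ := by
    have h1 : 1 + 2 * (1 + κ) * (1 - H) < 1 / H := by rw [lt_div_iff₀ hH]; linarith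
    have h2 : θ * (1 + 2 * (1 + κ) * (1 - H)) ≤ 1 * (1 + 2 * (1 + κ) * (1 - H)) := by
      refine mul_le_mul_of_nonneg_right hθ1 ?_
      have : 0 ≤ (1 + κ) * (1 - H) := mul_nonneg (by linarith) (by linarith)
      linarith
    linarith
  have ev := ((c1.eventually (lt_mem_nhds p1)).and (c2.eventually (lt_mem_nhds p2))).filter_mono (nhdsWithin_le_nhds (s := Iio H))
  have ev2 : ∀ᶠ α in 𝓝[<] H, α ∈ Ioo 0 H := Ioo_mem_nhdsLT hH
  obtain ⟨α, ⟨h1, h2⟩, h3⟩ := (ev.and ev2).exists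
  exact ⟨α, h3.1, h3.2, h1, h2⟩

lemma one_step (hB : IsFBM H P B) (ha : ∀ s t : ℝ, ∫ ω, (B t ω - B s ω) ^ 2 ∂P = aH * |t - s| ^ (2 * H))
    (haH : 0 < aH) (hH : 0 < H) (hH2 : H < 1 / 2) {θ κ c C t : ℝ} (hθ : 0 < θ) (hθ1 : θ ≤ 1) (hκ : 0 < κ)
    (hκ1 : 2 * H * (1 + 2 * κ) < 1) (hκ2 : H * (1 + 2 * (1 + κ) * (1 - H)) < 1) (hc : 0 < c) (hC : 0 < C)
    (ht : 0 < t) {r : ℝ} (hr0 : 0 < r) (hr1 : r < 1) (μ : ℝ → ℝ) (δ δ' : ℝ → ℝ)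
    (hδ : ∀ ε, 0 < ε → ε ≤ 1 → c * ε ^ θ ≤ δ ε) (hδ0 : ∀ ε, 0 < ε → ε ≤ 1 → 0 ≤ δ' ε)
    (hδ' : ∀ ε, 0 < ε → ε ≤ 1 → δ' ε ≤ C * ε ^ (2 * H * θ * (1 + 2 * κ)))
    (hO : ∀ᵐ ω ∂P, ∃ Lf, Occ (fun r => B r ω) t Lf) :
    ∀ᵐ ω ∂P, ∀ η > 0, ∀ᶠ n : ℕ in atTop, ∀ ε, ε = r ^ n → ∀ k k' : ℤ, |k| ≤ qn 2 ε → |k'| ≤ qn 2 ε → |k' * μ ε - k * μ ε| ≤ δ' ε →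
      Xw H (fun r => B r ω) t ε (δ ε) (k * μ ε) ≤ (1 + η) * Xw H (fun r => B r ω) t ε (δ ε) (k' * μ ε) + η := by
  obtain ⟨α, hα, hαH, e1, e3⟩ := exists_alpha hH hθ hθ1 hκ hκ2 hH2
  have e2 : 2 * θ * (1 + κ) < 1 / H := by
    rw [lt_div_iff₀ hH]
    have : θ * ((1 + κ) * H) ≤ 1 * ((1 + κ) * H) := mul_le_mul_of_nonneg_right hθ1 (by positivity)
    nlinarith [mul_pos hκ hH]
  set K : ℝ → ℝ := fun ε => hn t (2 * θ * (1 + κ)) ε * ε ^ (-(θ * κ / 2)) / δ ε with hK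
  have hall : ∀ᵐ ω ∂P, ∀ p : ℕ, _ := ae_all_iff.2 fun p : ℕ => bad_bc hB ha haH hH hH2 hθ hκ hc hC ht (η := 1 / ((p:ℝ) + 1)) (by positivity)
    (by rw [div_le_one (by positivity)]; linarith [(Nat.cast_nonneg p : (0:ℝ) ≤ p)]) hr0 hr1 μ δ δ' hδ hδ0 hδ'
    (fun ε => ENNReal.ofReal (ε ^ (1 / H - 1) / (K ε * δ ε))) (fun ε => ENNReal.ofReal_ne_top)
  filter_upwards [hall, fb_holder hB ha haH hα hαH ht, hO] with ω hω hHo hOcc η hη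
  obtain ⟨Ch, hCh, hHo⟩ := hHo
  obtain ⟨Lf, hLf⟩ := hOcc
  obtain ⟨p, hp⟩ := exists_nat_one_div_lt (show 0 < η / 4 by positivity)
  have hp0 : 0 < 1 / ((p:ℝ) + 1) := by positivity
  have hsm := one_step_small (hB.1 ω) ht hLf hH hCh hα hαH hH2 hHo hθ hθ1 hκ hc hp0 e1 e2 e3 δ hδ
  have htend : Tendsto (fun n : ℕ => r ^ n) atTop (𝓝[>] 0) :=
    tendsto_nhdsWithin_iff.2 ⟨tendsto_pow_atTop_nhds_zero_of_lt_one hr0.le hr1, Eventually.of_forall fun n => pow_pos hr0 n⟩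
  filter_upwards [hω p, htend.eventually hsm] with n h1 h2 ε hε k k' hk hk' hkk
  rw [← hε] at h2
  obtain ⟨hε0, hε1, hδε, hhp, htq, hK0, hKη, hA, hcc⟩ := h2 _ _ rfl rfl
  have h3 := one_step_det (hB.1 ω) hε0 hδε hK0 hp0.le hhp htq (H := H) (a := k * μ ε) (a' := k' * μ ε) hA
    (fun b hb => h1 ε hε k k' hk hk' hkk b hb) (hcc _)
  have h4 := Xw_nonneg H (fun r => B r ω) t hε0.le hδε.le (k' * μ ε)
  nlinarith
end M16
end

section
section M17
set_option linter.unusedSectionVars false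

lemma J_split (w : ℝ → ℝ) (S : Set ℝ) (ε a : ℝ) {δ : ℝ} (hδ : 0 ≤ δ) (m : ℕ) :
    J w S (Ioc a (a + m * δ)) ε = ∑ l ∈ Finset.range m, J w S (Ioc (a + l * δ) (a + l * δ + δ)) ε := by
  induction m with
  | zero => simp [J]
  | succ m ih =>
    rw [Finset.sum_range_succ, ← ih]
    have e : Ioc a (a + ((m + 1 : ℕ) : ℝ) * δ) = Ioc a (a + m * δ) ∪ Ioc (a + m * δ) (a + m * δ + δ) := by
      rw [Ioc_union_Ioc_eq_Ioc (by have : 0 ≤ m * δ := by positivity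
                                   linarith) (by linarith)]
      push_cast; congr 1; ring
    unfold J
    rw [e, lintegral_union measurableSet_Ioc]
    rw [Set.disjoint_left]
    intro x hx hx2
    exact absurd hx2.1 (not_lt.2 hx.2)

lemma Xw_avg {w : ℝ → ℝ} (hw : Continuous w) (H t a : ℝ) {ε δ : ℝ} (hε : 0 < ε) (hδ : 0 < δ) {m : ℕ} (hm : 0 < m) :
    Xw H w t ε (m * δ) a = (∑ l ∈ Finset.range m, Xw H w t ε δ (a + l * δ)) / m := by
  unfold Xw
  rw [J_split w _ ε a hδ.le m, ENNReal.toReal_sum (fun j _ => J_fin hw _ _ _ hε), ← Finset.mul_sum]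
  have : (0:ℝ) < m := by exact_mod_cast hm
  field_simp

lemma avg_le {f : ℕ → ℝ} {m : ℕ} (hm : 0 < m) {y η : ℝ} (h : ∀ l < m, f l ≤ (1 + η) * y + η) :
    (∑ l ∈ Finset.range m, f l) / m ≤ (1 + η) * y + η := by
  have hm' : (0:ℝ) < m := by exact_mod_cast hm
  rw [div_le_iff₀ hm']
  calc _ ≤ ∑ l ∈ Finset.range m, ((1 + η) * y + η) := Finset.sum_le_sum fun l hl => h l (Finset.mem_range.1 hl)
    _ = _ := by rw [Finset.sum_const, Finset.card_range, nsmul_eq_mul]; ring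

lemma le_avg {f : ℕ → ℝ} {m : ℕ} (hm : 0 < m) {y η : ℝ} (h : ∀ l < m, y ≤ (1 + η) * f l + η) :
    y ≤ (1 + η) * ((∑ l ∈ Finset.range m, f l) / m) + η := by
  have hm' : (0:ℝ) < m := by exact_mod_cast hm
  have h1 : ∑ l ∈ Finset.range m, y ≤ ∑ l ∈ Finset.range m, ((1 + η) * f l + η) :=
    Finset.sum_le_sum fun l hl => h l (Finset.mem_range.1 hl)
  rw [Finset.sum_const, Finset.sum_add_distrib, Finset.sum_const, Finset.card_range, nsmul_eq_mul, nsmul_eq_mul, ← Finset.mul_sum] at h1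
  have h2 : y * m ≤ ((1 + η) * ((∑ l ∈ Finset.range m, f l) / m) + η) * m := by
    field_simp
    linarith
  have hmp := hm'
  exact le_of_mul_le_mul_right h2 hmp

/-- number of mesh cells in the window of generation `i` -/
def mw (q : ℝ) (ε : ℝ) : ℕ → ℕ
  | 0 => 1
  | i + 1 => mw q ε i * qn (q ^ i - q ^ (i + 1)) ε

lemma mw_bd {q ε : ℝ} (hq : 0 < q) (hq1 : q < 1) (hε : 0 < ε) (hε1 : ε ≤ 1) (i : ℕ) :
    ε ^ (q ^ i - 1) ≤ mw q ε i ∧ (mw q ε i : ℝ) ≤ 2 ^ i * ε ^ (q ^ i - 1) := by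
  induction i with
  | zero => simp [mw]
  | succ i ih =>
    have hle : 0 ≤ q ^ i - q ^ (i + 1) := by
      rw [pow_succ]; nlinarith [pow_pos hq i]
    obtain ⟨h1, h2⟩ := qn_bd hle hε hε1
    have e : ε ^ (q ^ (i + 1) - 1) = ε ^ (q ^ i - 1) * ε ^ (-(q ^ i - q ^ (i + 1))) := by
      rw [← Real.rpow_add hε]; congr 1; ring
    rw [e]
    simp only [mw, Nat.cast_mul]
    constructor
    · exact mul_le_mul ih.1 h1 (by positivity) (by positivity)
    · calc _ ≤ (2 ^ i * ε ^ (q ^ i - 1)) * (2 * ε ^ (-(q ^ i - q ^ (i + 1)))) := mul_le_mul ih.2 h2 (by positivity) (by positivity)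
        _ = _ := by ring

lemma mw_pos {q ε : ℝ} (hq : 0 < q) (hq1 : q < 1) (hε : 0 < ε) (hε1 : ε ≤ 1) (i : ℕ) : 0 < mw q ε i := by
  have := (mw_bd hq hq1 hε hε1 i).1
  have h2 : (0:ℝ) < mw q ε i := lt_of_lt_of_le (by positivity) this
  exact_mod_cast h2

lemma dl_bd {q ε c0 : ℝ} (hq : 0 < q) (hq1 : q < 1) (hε : 0 < ε) (hε1 : ε ≤ 1) (hc0 : 0 < c0) (i : ℕ) :
    c0 * ε ^ (q ^ i) ≤ mw q ε i * (c0 * ε) ∧ mw q ε i * (c0 * ε) ≤ 2 ^ i * c0 * ε ^ (q ^ i) := by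
  obtain ⟨h1, h2⟩ := mw_bd hq hq1 hε hε1 i
  have e : ε ^ (q ^ i) = ε ^ (q ^ i - 1) * ε := by rw [← Real.rpow_add_one hε.ne']; congr 1; ring
  rw [e]
  constructor
  · calc _ = ε ^ (q ^ i - 1) * (c0 * ε) := by ring
      _ ≤ _ := by gcongr
  · calc _ ≤ (2 ^ i * ε ^ (q ^ i - 1)) * (c0 * ε) := by gcongr
      _ = _ := by ring

variable {Ω : Type*} [MeasurableSpace Ω] {P : Measure Ω} [IsProbabilityMeasure P] {H : ℝ} {B : ℝ → Ω → ℝ} {aH : ℝ}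

lemma compose_rel {x y z η η0 : ℝ} (hη : 0 < η) (h1 : η ≤ 1 / 4) (h0 : 4 * η ≤ η0) (hz : 0 ≤ z) (hxy : x ≤ (1 + η) * y + η)
    (hyz : y ≤ (1 + η) * z + η) : x ≤ (1 + η0) * z + η0 := by
  calc x ≤ (1 + η) * ((1 + η) * z + η) + η := hxy.trans (by gcongr)
    _ = (1 + η) * (1 + η) * z + (2 * η + η * η) := by ring
    _ ≤ (1 + η0) * z + η0 := by
      have : η * η ≤ η * 1 := by gcongr; linarith
      gcongr <;> nlinarith

lemma iterate_rel (hB : IsFBM H P B) (ha : ∀ s t : ℝ, ∫ ω, (B t ω - B s ω) ^ 2 ∂P = aH * |t - s| ^ (2 * H))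
    (haH : 0 < aH) (hH : 0 < H) (hH2 : H < 1 / 2) {κ c0 t : ℝ} (hκ : 0 < κ)
    (hκ1 : 2 * H * (1 + 2 * κ) < 1) (hκ2 : H * (1 + 2 * (1 + κ) * (1 - H)) < 1) (hc0 : 0 < c0)
    (ht : 0 < t) {r : ℝ} (hr0 : 0 < r) (hr1 : r < 1)
    (hO : ∀ᵐ ω ∂P, ∃ Lf, Occ (fun r => B r ω) t Lf) (i : ℕ) :
    ∀ᵐ ω ∂P, ∀ A : ℝ, ∀ η > 0, ∀ᶠ n : ℕ in atTop, ∀ ε, ε = r ^ n → ∀ k : ℤ, |k * (c0 * ε)| ≤ A →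
      Xw H (fun r => B r ω) t ε (c0 * ε) (k * (c0 * ε)) ≤
        (1 + η) * Xw H (fun r => B r ω) t ε (mw (2 * H * (1 + 2 * κ)) ε i * (c0 * ε)) (k * (c0 * ε)) + η ∧
      Xw H (fun r => B r ω) t ε (mw (2 * H * (1 + 2 * κ)) ε i * (c0 * ε)) (k * (c0 * ε)) ≤
        (1 + η) * Xw H (fun r => B r ω) t ε (c0 * ε) (k * (c0 * ε)) + η := by
  set q := 2 * H * (1 + 2 * κ) with hq
  have hq0 : 0 < q := by positivity
  induction i with
  | zero =>
    refine Eventually.of_forall fun ω A η hη => Eventually.of_forall fun n ε hε k hk => ?_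
    have hε0 : 0 < ε := by rw [hε]; positivity
    have := Xw_nonneg H (fun r => B r ω) t hε0.le (by positivity : 0 ≤ c0 * ε) (k * (c0 * ε))
    simp only [mw, Nat.cast_one, one_mul]
    constructor <;> nlinarith
  | succ i ih =>
    have hos := one_step hB ha haH hH hH2 (θ := q ^ i) (κ := κ) (c := c0) (C := 2 ^ (i + 1) * c0) (pow_pos hq0 i)
      (pow_le_one₀ hq0.le hκ1.le) hκ hκ1 hκ2 hc0 (by positivity) ht hr0 hr1 (fun ε => c0 * ε) (fun ε => mw q ε i * (c0 * ε))
      (fun ε => mw q ε (i + 1) * (c0 * ε)) (fun ε hε hε1 => (dl_bd hq0 hκ1 hε hε1 hc0 i).1) (fun ε hε hε1 => by positivity)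
      (fun ε hε hε1 => by
        have := (dl_bd hq0 hκ1 hε hε1 hc0 (i + 1)).2
        rw [show 2 * H * q ^ i * (1 + 2 * κ) = q ^ (i + 1) by rw [hq]; ring]
        exact this) hO
    filter_upwards [ih, hos] with ω h1 h2 A η0 hη0
    set η := min η0 1 / 4 with hη
    have hηp : 0 < η := by positivity
    have hη4 : η ≤ 1 / 4 := by rw [hη]; linarith [min_le_right η0 1]
    have hη5 : 4 * η ≤ η0 := by rw [hη]; linarith [min_le_left η0 1]
    have htend : Tendsto (fun n : ℕ => r ^ n) atTop (𝓝[>] 0) :=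
      tendsto_nhdsWithin_iff.2 ⟨tendsto_pow_atTop_nhds_zero_of_lt_one hr0.le hr1, Eventually.of_forall fun n => pow_pos hr0 n⟩
    filter_upwards [h1 A η hηp, h2 η hηp, htend.eventually ev_le_one,
      htend.eventually (ev_pow ((A + 2 ^ (i + 1) * c0) / c0) one_pos one_pos)] with n g1 g2 g3 g4 ε hε k hk
    rw [← hε] at g3 g4
    obtain ⟨hε0, hε1⟩ := g3
    rw [Real.rpow_one] at g4
    have hmi := mw_pos hq0 hκ1 hε0 hε1 i
    have hmi1 := mw_pos hq0 hκ1 hε0 hε1 (i + 1)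
    have hmq : 0 < qn (q ^ i - q ^ (i + 1)) ε := by
      by_contra hcon
      simp only [mw] at hmi1
      rw [Nat.eq_zero_of_not_pos hcon] at hmi1; simp at hmi1
    have hmi' : (0:ℝ) < mw q ε i := by exact_mod_cast hmi
    have hwid : (mw q ε (i + 1) : ℝ) * (c0 * ε) ≤ 2 ^ (i + 1) * c0 := by
      refine (dl_bd hq0 hκ1 hε0 hε1 hc0 (i + 1)).2.trans ?_
      have : ε ^ (q ^ (i + 1)) ≤ 1 := Real.rpow_le_one hε0.le hε1 (by positivity)
      have h0 : (0:ℝ) < 2 ^ (i + 1) * c0 := by positivity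
      nlinarith
    have hrange : ∀ k' : ℤ, |k' * (c0 * ε)| ≤ A + 2 ^ (i + 1) * c0 → |k'| ≤ qn 2 ε := by
      intro k' hk'
      rw [abs_mul, abs_of_pos (by positivity : 0 < c0 * ε)] at hk'
      have e1 := (qn_bd (β := 2) (by norm_num) hε0 hε1).1
      have e2 : ε ^ (-2:ℝ) = (ε ^ 2)⁻¹ := by rw [Real.rpow_neg hε0.le]; norm_cast
      have e3 : |(k':ℝ)| ≤ (ε ^ 2)⁻¹ := by
        rw [div_mul_eq_mul_div, div_le_iff₀ hc0] at g4
        rw [← one_div, le_div_iff₀ (by positivity)]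
        have : |(k':ℝ)| * (c0 * ε) * ε ≤ 1 * c0 := (mul_le_mul_of_nonneg_right hk' hε0.le).trans g4
        have h5 : (|(k':ℝ)| * ε ^ 2) * c0 ≤ 1 * c0 := by linarith
        exact le_of_mul_le_mul_right h5 hc0
      rw [e2] at e1
      have := e3.trans e1
      exact_mod_cast this
    have hX : Xw H (fun r => B r ω) t ε (mw q ε (i + 1) * (c0 * ε)) (k * (c0 * ε)) =
        (∑ l ∈ Finset.range (qn (q ^ i - q ^ (i + 1)) ε), Xw H (fun r => B r ω) t ε (mw q ε i * (c0 * ε)) (((k + l * mw q ε i : ℤ) : ℝ) * (c0 * ε))) /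
          qn (q ^ i - q ^ (i + 1)) ε := by
      have := Xw_avg (hB.1 ω) H t (k * (c0 * ε)) hε0 (δ := mw q ε i * (c0 * ε)) (by positivity) hmq
      rw [show (mw q ε (i + 1) : ℝ) * (c0 * ε) = qn (q ^ i - q ^ (i + 1)) ε * (mw q ε i * (c0 * ε)) by simp only [mw]; push_cast; ring, this]
      congr 1
      refine Finset.sum_congr rfl fun l _ => ?_
      congr 1; push_cast; ring
    have hpow : (0:ℝ) < 2 ^ (i + 1) * c0 := by positivity
    have hkk : |k| ≤ qn 2 ε := hrange k (by linarith)
    have hl : ∀ l < qn (q ^ i - q ^ (i + 1)) ε, |((k + l * mw q ε i : ℤ))| ≤ qn 2 ε ∧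
        |((k + l * mw q ε i : ℤ) : ℝ) * (c0 * ε) - k * (c0 * ε)| ≤ mw q ε (i + 1) * (c0 * ε) := by
      intro l hl
      have e1 : ((k + l * mw q ε i : ℤ) : ℝ) * (c0 * ε) - k * (c0 * ε) = l * mw q ε i * (c0 * ε) := by push_cast; ring
      have e2 : |((k + l * mw q ε i : ℤ) : ℝ) * (c0 * ε) - k * (c0 * ε)| ≤ mw q ε (i + 1) * (c0 * ε) := by
        rw [e1, abs_of_nonneg (by positivity)]
        gcongr
        simp only [mw]
        push_cast
        rw [mul_comm]
        gcongr
      refine ⟨hrange _ ?_, e2⟩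
      calc _ = |(((k + l * mw q ε i : ℤ) : ℝ) * (c0 * ε) - k * (c0 * ε)) + k * (c0 * ε)| := by congr 1; ring
        _ ≤ _ := abs_add_le _ _
        _ ≤ 2 ^ (i + 1) * c0 + A := add_le_add (e2.trans hwid) hk
        _ = _ := by ring
    obtain ⟨f1, f2⟩ := g1 ε hε k hk
    have hn0 := Xw_nonneg H (fun r => B r ω) t hε0.le (by positivity : 0 ≤ c0 * ε) (k * (c0 * ε))
    have hn1 := Xw_nonneg H (fun r => B r ω) t hε0.le (by positivity : 0 ≤ mw q ε (i + 1) * (c0 * ε)) (k * (c0 * ε))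
    refine ⟨compose_rel hηp hη4 hη5 hn1 f1 ?_, compose_rel hηp hη4 hη5 hn0 ?_ f2⟩
    · rw [hX]
      exact le_avg hmq fun l hl' => g2 ε hε k _ hkk (hl l hl').1 (hl l hl').2
    · rw [hX]
      exact avg_le hmq fun l hl' => g2 ε hε _ k (hl l hl').1 hkk (by rw [abs_sub_comm]; exact (hl l hl').2)

lemma exists_kappa (hH : 0 < H) (hH2 : H < 1 / 2) : ∃ κ, 0 < κ ∧ 2 * H * (1 + 2 * κ) < 1 ∧ H * (1 + 2 * (1 + κ) * (1 - H)) < 1 := by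
  have c1 : ContinuousAt (fun κ : ℝ => 2 * H * (1 + 2 * κ)) 0 := by fun_prop
  have c2 : ContinuousAt (fun κ : ℝ => H * (1 + 2 * (1 + κ) * (1 - H))) 0 := by fun_prop
  have ev := ((c1.eventually (gt_mem_nhds (show 2 * H * (1 + 2 * 0) < 1 by linarith))).and
    (c2.eventually (gt_mem_nhds (show H * (1 + 2 * (1 + 0) * (1 - H)) < 1 by nlinarith)))).filter_mono (nhdsWithin_le_nhds (s := Ioi 0))
  obtain ⟨κ, ⟨h1, h2⟩, h3⟩ := (ev.and self_mem_nhdsWithin).exists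
  exact ⟨κ, h3, h1, h2⟩

/-- comparison of the microscopic window with a window of size `ε ^ θ`, small `θ` -/
lemma step_one (hB : IsFBM H P B) (ha : ∀ s t : ℝ, ∫ ω, (B t ω - B s ω) ^ 2 ∂P = aH * |t - s| ^ (2 * H))
    (haH : 0 < aH) (hH : 0 < H) (hH2 : H < 1 / 2) {θ0 : ℝ} (hθ0 : 0 < θ0) {c0 : ℝ} (hc0 : 0 < c0) :
    ∃ θ C : ℝ, ∃ δ : ℝ → ℝ, 0 < θ ∧ θ < θ0 ∧ 0 < C ∧ (∀ ε, 0 < ε → ε ≤ 1 → c0 * ε ^ θ ≤ δ ε ∧ δ ε ≤ C * ε ^ θ) ∧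
    ∀ t r : ℝ, 0 < t → 0 < r → r < 1 → (∀ᵐ ω ∂P, ∃ Lf, Occ (fun r => B r ω) t Lf) →
    ∀ᵐ ω ∂P, ∀ A : ℝ, ∀ η > 0, ∀ᶠ n : ℕ in atTop, ∀ ε, ε = r ^ n → ∀ k : ℤ, |k * (c0 * ε)| ≤ A →
      Xw H (fun r => B r ω) t ε (c0 * ε) (k * (c0 * ε)) ≤
        (1 + η) * Xw H (fun r => B r ω) t ε (δ ε) (k * (c0 * ε)) + η ∧
      Xw H (fun r => B r ω) t ε (δ ε) (k * (c0 * ε)) ≤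
        (1 + η) * Xw H (fun r => B r ω) t ε (c0 * ε) (k * (c0 * ε)) + η := by
  obtain ⟨κ, hκ, hκ1, hκ2⟩ := exists_kappa hH hH2
  obtain ⟨i, hi⟩ := exists_pow_lt_of_lt_one hθ0 hκ1
  refine ⟨(2 * H * (1 + 2 * κ)) ^ i, 2 ^ i * c0, fun ε => mw (2 * H * (1 + 2 * κ)) ε i * (c0 * ε), by positivity, hi, by positivity,
    fun ε hε hε1 => dl_bd (by positivity) hκ1 hε hε1 hc0 i, fun t r ht hr0 hr1 hO => ?_⟩
  exact iterate_rel hB ha haH hH hH2 hκ hκ1 hκ2 hc0 ht hr0 hr1 hO i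
end M17
end

section
section M18
set_option linter.unusedSectionVars false

variable {Ω : Type*} [MeasurableSpace Ω] {P : Measure Ω} [IsProbabilityMeasure P] {H : ℝ} {B : ℝ → Ω → ℝ} {aH : ℝ}

lemma Wt_conc (hB : IsFBM H P B) (ha : ∀ s t : ℝ, ∫ ω, (B t ω - B s ω) ^ 2 ∂P = aH * |t - s| ^ (2 * H))
    (haH : 0 < aH) (hH : 0 < H) (hH2 : H < 1 / 2) {γ : ℝ}
    (hγ : ∀ t, 0 < t → gE P B t ≤ ENNReal.ofReal (γ * t) ∧ ENNReal.ofReal (γ * t - 1) ≤ gE P B t) (hγ0 : 0 ≤ γ) :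
    ∃ C : ℝ, 0 < C ∧ ∀ s h ε η N : ℝ, 0 < h → 0 < ε → 0 < η → N = h * ε ^ (-(1 / H)) → 1 ≤ N →
      P {ω | η * (ε * N) ≤ |(Wt (fun r => B r ω) s (s + h) ε).toReal - γ * (ε * N)|} ≤ ENNReal.ofReal (C * N ^ (-(1 / 4 : ℝ)) / η ^ 2) := by
  obtain ⟨C0, hC0, hvar⟩ := Wt_var hB ha haH hH hH2
  refine ⟨1 + C0, by positivity, fun s h ε η N hh hε hη hN hN1 => ?_⟩
  have hN0 : 0 < N := by linarith
  set W : Ω → ℝ := fun ω => (Wt (fun r => B r ω) s (s + h) ε).toReal with hW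
  have hWm : Measurable W := (Wt_meas hB s hh hε.le).ennreal_toReal
  have hfin : ∀ ω, Wt (fun r => B r ω) s (s + h) ε ≠ ⊤ := fun ω => (Wt_lt_top (hB.1 ω) _ _ hε).ne
  have hgfin : gE P B N ≠ ⊤ := (gE_lt hB ha haH hH hN0).ne
  have hsfin : sE P B N ≠ ⊤ := ne_top_of_le_ne_top (ENNReal.add_ne_top.2 ⟨ENNReal.pow_ne_top hgfin, ENNReal.ofReal_ne_top⟩) (hvar N hN1)
  have m1 : ∫⁻ ω, Wt (fun r => B r ω) s (s + h) ε ∂P = ENNReal.ofReal ε * gE P B N := by rw [hN]; exact Wt_mean hB ha haH hH s hh hε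
  have m2 : ∫⁻ ω, Wt (fun r => B r ω) s (s + h) ε ^ 2 ∂P = ENNReal.ofReal ε ^ 2 * sE P B N := by
    rw [hN]; exact Wt_moment hB ha haH hH s hh hε 2
  have i1 : Integrable W P := integrable_toReal_of_lintegral_ne_top (Wt_meas hB s hh hε.le).aemeasurable (by
    rw [m1]; exact ENNReal.mul_ne_top ENNReal.ofReal_ne_top hgfin)
  have e2 : (fun ω => W ω ^ 2) = fun ω => (Wt (fun r => B r ω) s (s + h) ε ^ 2).toReal := by
    ext ω; rw [ENNReal.toReal_pow]
  have i2 : Integrable (fun ω => W ω ^ 2) P := by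
    rw [e2]
    exact integrable_toReal_of_lintegral_ne_top ((Wt_meas hB s hh hε.le).pow_const 2).aemeasurable (by
      rw [m2]; exact ENNReal.mul_ne_top (ENNReal.pow_ne_top ENNReal.ofReal_ne_top) hsfin)
  set g := (gE P B N).toReal with hg
  set sv := (sE P B N).toReal with hsv
  have I1 : ∫ ω, W ω ∂P = ε * g := by
    rw [hW, integral_toReal (Wt_meas hB s hh hε.le).aemeasurable (Eventually.of_forall fun ω => (hfin ω).lt_top), m1, ENNReal.toReal_mul,
      ENNReal.toReal_ofReal hε.le]
  have I2 : ∫ ω, W ω ^ 2 ∂P = ε ^ 2 * sv := by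
    rw [e2, integral_toReal ((Wt_meas hB s hh hε.le).pow_const 2).aemeasurable
      (Eventually.of_forall fun ω => (ENNReal.pow_ne_top (hfin ω)).lt_top), m2, ENNReal.toReal_mul, ENNReal.toReal_pow,
      ENNReal.toReal_ofReal hε.le]
  have g1 : g ≤ γ * N := ENNReal.toReal_le_of_le_ofReal (by positivity) (hγ N hN0).1
  have g2 : γ * N - 1 ≤ g := (ENNReal.ofReal_le_iff_le_toReal hgfin).1 (hγ N hN0).2
  have s1 : sv ≤ g ^ 2 + C0 * N ^ (7 / 4 : ℝ) := by
    have := ENNReal.toReal_mono (ENNReal.add_ne_top.2 ⟨ENNReal.pow_ne_top hgfin, ENNReal.ofReal_ne_top⟩) (hvar N hN1)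
    rwa [ENNReal.toReal_add (ENNReal.pow_ne_top hgfin) ENNReal.ofReal_ne_top, ENNReal.toReal_pow, ENNReal.toReal_ofReal (by positivity)] at this
  have ef : (fun ω => (W ω - γ * (ε * N)) ^ 2) = fun ω => W ω ^ 2 - 2 * (γ * (ε * N)) * W ω + (γ * (ε * N)) ^ 2 := by
    ext ω; ring
  have If : Integrable (fun ω => (W ω - γ * (ε * N)) ^ 2) P := by
    rw [ef]; exact (i2.sub (i1.const_mul _)).add (integrable_const _)
  have i3 : Integrable (fun ω => W ω ^ 2 - 2 * (γ * (ε * N)) * W ω) P := i2.sub (i1.const_mul _)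
  have I3 : ∫ ω, (W ω - γ * (ε * N)) ^ 2 ∂P ≤ ε ^ 2 * ((1 + C0) * N ^ (7 / 4 : ℝ)) := by
    rw [ef, integral_add i3 (integrable_const _), integral_sub i2 (i1.const_mul _), integral_const_mul, I1, I2]
    simp only [integral_const, probReal_univ, smul_eq_mul, one_mul]
    have hp : 1 ≤ N ^ (7 / 4 : ℝ) := Real.one_le_rpow hN1 (by norm_num)
    have : sv - 2 * (γ * N) * g + (γ * N) ^ 2 ≤ (1 + C0) * N ^ (7 / 4 : ℝ) := by nlinarith
    calc _ = ε ^ 2 * (sv - 2 * (γ * N) * g + (γ * N) ^ 2) := by ring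
      _ ≤ _ := by gcongr
  have hch := mul_meas_ge_le_integral_of_nonneg (Eventually.of_forall fun ω => sq_nonneg (W ω - γ * (ε * N))) If ((η * (ε * N)) ^ 2)
  have hset : {ω | η * (ε * N) ≤ |W ω - γ * (ε * N)|} ⊆ {ω | (η * (ε * N)) ^ 2 ≤ (W ω - γ * (ε * N)) ^ 2} := by
    intro ω hω
    simp only [mem_ofPred_eq] at hω ⊢
    rw [← sq_abs (W ω - γ * (ε * N))]
    have : 0 ≤ η * (ε * N) := by positivity
    gcongr
  refine (measure_mono hset).trans ?_
  rw [← ofReal_measureReal]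
  refine ENNReal.ofReal_le_ofReal ?_
  have h5 := hch.trans I3
  have h6 : N ^ (7 / 4 : ℝ) = N ^ 2 * N ^ (-(1 / 4 : ℝ)) := by
    rw [← Real.rpow_natCast, ← Real.rpow_add hN0]; norm_num
  rw [h6] at h5
  rw [le_div_iff₀ (by positivity)]
  have h7 : (ε * N) ^ 2 * (P.real {ω | (η * (ε * N)) ^ 2 ≤ (W ω - γ * (ε * N)) ^ 2} * η ^ 2) ≤ (ε * N) ^ 2 * ((1 + C0) * N ^ (-(1 / 4 : ℝ))) := by
    calc _ = (η * (ε * N)) ^ 2 * P.real {ω | (η * (ε * N)) ^ 2 ≤ (W ω - γ * (ε * N)) ^ 2} := by ring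
      _ ≤ _ := h5
      _ = _ := by ring
  exact le_of_mul_le_mul_left h7 (by positivity)

/-- Borel–Cantelli along a geometric sequence with a power bound -/
lemma bc_geom_pow {r ρ : ℝ} (hr0 : 0 < r) (hr1 : r < 1) (hρ : 0 < ρ) {S : ℝ → Set Ω}
    (h : ∀ᶠ ε : ℝ in 𝓝[>] 0, P (S ε) ≤ ENNReal.ofReal (ε ^ ρ)) :
    ∀ᵐ ω ∂P, ∀ᶠ n : ℕ in atTop, ω ∉ S (r ^ n) := by
  have hc : Tendsto (fun x : ℝ => x ^ (1 / ρ)) (𝓝[>] 0) (𝓝[>] 0) := by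
    refine tendsto_nhdsWithin_iff.2 ⟨?_, ?_⟩
    · have := (Real.continuousAt_rpow_const 0 (1 / ρ) (Or.inr (by positivity))).tendsto
      rw [Real.zero_rpow (by positivity)] at this
      exact this.mono_left nhdsWithin_le_nhds
    · filter_upwards [self_mem_nhdsWithin] with x hx
      exact Real.rpow_pos_of_pos hx _
  have key := bc_geom (P := P) (r := r ^ ρ) (by positivity) (Real.rpow_lt_one hr0.le hr1 hρ) (S := fun x => S (x ^ (1 / ρ))) (by
    filter_upwards [hc.eventually h, self_mem_nhdsWithin] with x hx hx0
    rwa [← Real.rpow_mul (le_of_lt hx0), one_div_mul_cancel hρ.ne', Real.rpow_one] at hx)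
  filter_upwards [key] with ω hω
  filter_upwards [hω] with n hn
  have e : ((r ^ ρ) ^ n) ^ (1 / ρ) = r ^ n := by
    rw [← Real.rpow_natCast, ← Real.rpow_mul hr0.le, ← Real.rpow_mul hr0.le, ← Real.rpow_natCast]
    congr 1; field_simp
  rwa [e] at hn

/-- all mesoscopic blocks have the right crossing number -/
lemma blk_conc (hB : IsFBM H P B) (ha : ∀ s t : ℝ, ∫ ω, (B t ω - B s ω) ^ 2 ∂P = aH * |t - s| ^ (2 * H))
    (haH : 0 < aH) (hH : 0 < H) (hH2 : H < 1 / 2) {γ : ℝ}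
    (hγ : ∀ t, 0 < t → gE P B t ≤ ENNReal.ofReal (γ * t) ∧ ENNReal.ofReal (γ * t - 1) ≤ gE P B t) (hγ0 : 0 ≤ γ)
    {t r η β : ℝ} (ht : 0 < t) (hr0 : 0 < r) (hr1 : r < 1) (hη : 0 < η) (hβ : 0 < β) (hβ2 : 5 * β < 1 / H) :
    ∀ᵐ ω ∂P, ∀ᶠ n : ℕ in atTop, ∀ ε, ε = r ^ n → ∀ j < 2 * qn β ε + 1,
      |(Wt (fun r => B r ω) (0 + j * hn t β ε) (0 + j * hn t β ε + hn t β ε) ε).toReal - γ * (hn t β ε * ε ^ (1 - 1 / H))| ≤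
        η * (hn t β ε * ε ^ (1 - 1 / H)) := by
  obtain ⟨C, hC, hconc⟩ := Wt_conc hB ha haH hH hH2 hγ hγ0
  set ρ := (1 / H - 5 * β) / 8 with hρd
  have hρ : 0 < ρ := by rw [hρd]; linarith
  have key := bc_geom_pow (P := P) hr0 hr1 hρ (S := fun ε => ⋃ j ∈ Finset.range (2 * qn β ε + 1), {ω | η * (hn t β ε * ε ^ (1 - 1 / H)) ≤
    |(Wt (fun r => B r ω) (0 + j * hn t β ε) (0 + j * hn t β ε + hn t β ε) ε).toReal - γ * (hn t β ε * ε ^ (1 - 1 / H))|}) ?_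
  · filter_upwards [key] with ω hω
    filter_upwards [hω] with n hn ε hε j hj
    rw [← hε] at hn
    simp only [mem_iUnion, not_exists] at hn
    exact (not_le.1 (hn j (Finset.mem_range.2 hj))).le
  · filter_upwards [ev_le_one, ev_pow (5 / t) (show 0 < 1 / H - β by linarith) one_pos,
      ev_pow (5 * (C * (t / 5) ^ (-(1 / 4 : ℝ)) / η ^ 2)) hρ one_pos] with ε hε12 p1 p2
    obtain ⟨hε, hε1⟩ := hε12
    obtain ⟨hq1, hq2⟩ := qn_bd hβ.le hε hε1
    obtain ⟨hb1, hb2⟩ := hn_bd ht hβ.le hε hε1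
    have hhp := hn_pos ht β ε
    set h := hn t β ε with hhd
    set N := h * ε ^ (-(1 / H)) with hN
    have eN : h * ε ^ (1 - 1 / H) = ε * N := by
      rw [hN, show 1 - 1 / H = 1 + -(1 / H) by ring, Real.rpow_add hε, Real.rpow_one]; ring
    have hNlow : t / 5 * ε ^ (β - 1 / H) ≤ N := by
      rw [hN, show β - 1 / H = β + -(1 / H) by ring, Real.rpow_add hε, ← mul_assoc]; gcongr
    have hx : 0 < t / 5 * ε ^ (β - 1 / H) := by positivity
    have hN1 : 1 ≤ N := by
      refine le_trans ?_ hNlow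
      rw [show β - 1 / H = -(1 / H - β) by ring, Real.rpow_neg hε.le]
      have y : 0 < ε ^ (1 / H - β) := by positivity
      generalize ε ^ (1 / H - β) = y at *
      field_simp at p1 ⊢
      linarith
    have hNp : N ^ (-(1 / 4 : ℝ)) ≤ (t / 5) ^ (-(1 / 4 : ℝ)) * ε ^ ((β - 1 / H) * (-(1 / 4 : ℝ))) := by
      rw [Real.rpow_mul hε.le, ← Real.mul_rpow (by positivity) (by positivity)]
      exact Real.rpow_le_rpow_of_nonpos hx hNlow (by norm_num)
    rw [eN]
    refine (measure_biUnion_finset_le _ _).trans ?_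
    calc _ ≤ ∑ j ∈ Finset.range (2 * qn β ε + 1), ENNReal.ofReal (C * N ^ (-(1 / 4 : ℝ)) / η ^ 2) :=
          Finset.sum_le_sum fun j _ => hconc _ h ε η N hhp hε hη hN hN1
      _ = ENNReal.ofReal ((2 * qn β ε + 1) * (C * N ^ (-(1 / 4 : ℝ)) / η ^ 2)) := by
          rw [Finset.sum_const, Finset.card_range, nsmul_eq_mul, ENNReal.ofReal_mul (by positivity)]
          congr 1
          rw [← ENNReal.ofReal_natCast]; push_cast; rfl
      _ ≤ ENNReal.ofReal (ε ^ ρ) := by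
          refine ENNReal.ofReal_le_ofReal ?_
          have h1 : (1:ℝ) ≤ ε ^ (-β) := Real.one_le_rpow_of_pos_of_le_one_of_nonpos hε hε1 (by linarith)
          calc (2 * (qn β ε : ℝ) + 1) * (C * N ^ (-(1 / 4 : ℝ)) / η ^ 2) ≤
              (5 * ε ^ (-β)) * (C * ((t / 5) ^ (-(1 / 4 : ℝ)) * ε ^ ((β - 1 / H) * (-(1 / 4 : ℝ)))) / η ^ 2) := by
                gcongr; linarith
            _ = (5 * (C * (t / 5) ^ (-(1 / 4 : ℝ)) / η ^ 2) * ε ^ ρ) * ε ^ ρ := by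
                have : ε ^ (-β) * ε ^ ((β - 1 / H) * (-(1 / 4 : ℝ))) = ε ^ ρ * ε ^ ρ := by
                  rw [← Real.rpow_add hε, ← Real.rpow_add hε]; congr 1; rw [hρd]; ring
                linear_combination (5 * (C * (t / 5) ^ (-(1 / 4 : ℝ)) / η ^ 2)) * this
            _ ≤ 1 * ε ^ ρ := by gcongr
            _ = _ := one_mul _
end M18
end

section
section M19
set_option linter.unusedSectionVars false

/-- trapezoid supported on `[x,y]`, equal to one on `[x+ρ,y-ρ]` -/
def trap (x y ρ z : ℝ) : ℝ := max 0 (min 1 (min ((z - x) / ρ) ((y - z) / ρ)))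

lemma trap_cont (x y ρ : ℝ) : Continuous (trap x y ρ) := by unfold trap; fun_prop
lemma trap_nonneg (x y ρ z : ℝ) : 0 ≤ trap x y ρ z := le_max_left _ _
lemma trap_le (x y ρ z : ℝ) : trap x y ρ z ≤ 1 := max_le zero_le_one (min_le_left _ _)
lemma trap_one {x y ρ z : ℝ} (hρ : 0 < ρ) (h : z ∈ Icc (x + ρ) (y - ρ)) : trap x y ρ z = 1 := by
  unfold trap
  have h1 : 1 ≤ (z - x) / ρ := by rw [le_div_iff₀ hρ]; linarith [h.1]
  have h2 : 1 ≤ (y - z) / ρ := by rw [le_div_iff₀ hρ]; linarith [h.2]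
  rw [min_eq_left (le_min h1 h2)]; simp
lemma trap_zero {x y ρ z : ℝ} (hρ : 0 < ρ) (h : z ∉ Icc x y) : trap x y ρ z = 0 := by
  unfold trap
  refine max_eq_left (le_trans (min_le_right _ _) ?_)
  by_cases hz : x ≤ z
  · refine (min_le_right _ _).trans (div_nonpos_of_nonpos_of_nonneg ?_ hρ.le)
    by_contra hc
    exact h ⟨hz, by linarith⟩
  · refine (min_le_left _ _).trans (div_nonpos_of_nonpos_of_nonneg ?_ hρ.le)
    linarith

lemma trap_supp {x y ρ : ℝ} (hρ : 0 < ρ) : HasCompactSupport (trap x y ρ) :=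
  HasCompactSupport.intro (isCompact_Icc (a := x) (b := y)) fun _ hz => trap_zero hρ hz

variable {w : ℝ → ℝ} {t : ℝ} {Lf : ℝ → ℝ}

lemma Occ.cnt_up (hO : Occ w t Lf) (hw : Continuous w) (ht : 0 ≤ t) {h : ℝ} (hh : 0 < h) {n : ℕ} (hn : t = n * h)
    {x y ρ M : ℝ} (hρ : 0 < ρ) (hxy : x ≤ y) (hM : ∀ z ∈ Icc (x - ρ) (y + ρ), Lf z ≤ M) (S : Finset ℕ) (hSn : S ⊆ Finset.range n)
    (hS : ∀ j ∈ S, ∀ r ∈ Icc (0 + j * h) (0 + ((j : ℝ) + 1) * h), w r ∈ Icc x y) : S.card * h ≤ (y - x + 2 * ρ) * M := by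
  have h1 := hO.2 _ (trap_cont (x - ρ) (y + ρ) ρ)
  have hg : Continuous fun r => trap (x - ρ) (y + ρ) ρ (w r) := (trap_cont _ _ _).comp hw
  rw [hn, blk_sum hg] at h1
  have h2 : ∑ j ∈ S, h ≤ ∑ j ∈ Finset.range n, ∫ r in (0 + j * h)..(0 + ((j:ℝ) + 1) * h), trap (x - ρ) (y + ρ) ρ (w r) := by
    refine le_trans (Finset.sum_le_sum fun j hj => ?_) (Finset.sum_le_sum_of_subset_of_nonneg hSn fun j _ _ => ?_)
    · have : ∫ r in (0 + j * h)..(0 + ((j:ℝ) + 1) * h), (1:ℝ) ≤ ∫ r in (0 + j * h)..(0 + ((j:ℝ) + 1) * h), trap (x - ρ) (y + ρ) ρ (w r) :=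
        intervalIntegral.integral_mono_on (by nlinarith) intervalIntegrable_const (hg.intervalIntegrable _ _)
          fun r hr => by
            have := hS j hj r hr
            rw [trap_one hρ ⟨by linarith [this.1], by linarith [this.2]⟩]
      rw [intervalIntegral.integral_const, smul_eq_mul] at this
      linarith
    · exact intervalIntegral.integral_nonneg (by nlinarith) fun r _ => trap_nonneg _ _ _ _
  have hM0 : 0 ≤ M := (hO.nonneg ht x).trans (hM x ⟨by linarith, by linarith⟩)
  have h3 : ∫ a, trap (x - ρ) (y + ρ) ρ a * Lf a ≤ (y - x + 2 * ρ) * M := by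
    have hntg : Integrable fun a => trap (x - ρ) (y + ρ) ρ a * Lf a :=
      ((trap_cont _ _ _).mul hO.1).integrable_of_hasCompactSupport (trap_supp hρ).mul_right
    calc ∫ a, trap (x - ρ) (y + ρ) ρ a * Lf a ≤ ∫ a, (Icc (x - ρ) (y + ρ)).indicator (fun _ => M) a := by
          refine integral_mono hntg ?_ fun a => ?_
          · exact (integrable_indicator_iff measurableSet_Icc).2 (integrableOn_const (by simp))
          · by_cases ha : a ∈ Icc (x - ρ) (y + ρ)
            · rw [indicator_of_mem ha]
              calc _ ≤ 1 * M := mul_le_mul (trap_le _ _ _ _) (hM a ha) (hO.nonneg ht a) zero_le_one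
                _ = M := one_mul _
            · rw [indicator_of_notMem ha]
              dsimp only
              rw [trap_zero hρ ha, zero_mul]
      _ = (y - x + 2 * ρ) * M := by
          rw [integral_indicator measurableSet_Icc, setIntegral_const, smul_eq_mul, Measure.real, Real.volume_Icc,
            ENNReal.toReal_ofReal (by linarith)]
          ring
  rw [Finset.sum_const, nsmul_eq_mul] at h2
  linarith

lemma Occ.cnt_lo (hO : Occ w t Lf) (hw : Continuous w) (ht : 0 ≤ t) {h : ℝ} (hh : 0 < h) {n : ℕ} (hn : t = n * h)
    {x y ρ m : ℝ} (hρ : 0 < ρ) (hxy : x + 2 * ρ ≤ y) (hm : ∀ z ∈ Icc x y, m ≤ Lf z) (hm0 : 0 ≤ m) (S : Finset ℕ)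
    (hS : ∀ j ∈ Finset.range n, j ∉ S → ∀ r ∈ Icc (0 + j * h) (0 + ((j : ℝ) + 1) * h), w r ∉ Icc x y) : (y - x - 2 * ρ) * m ≤ S.card * h := by
  have h1 := hO.2 _ (trap_cont x y ρ)
  have hg : Continuous fun r => trap x y ρ (w r) := (trap_cont _ _ _).comp hw
  rw [hn, blk_sum hg] at h1
  have hj1 : ∀ j : ℕ, ∫ r in (0 + j * h)..(0 + ((j:ℝ) + 1) * h), trap x y ρ (w r) ≤ h := by
    intro j
    have : ∫ r in (0 + j * h)..(0 + ((j:ℝ) + 1) * h), trap x y ρ (w r) ≤ ∫ r in (0 + j * h)..(0 + ((j:ℝ) + 1) * h), (1:ℝ) :=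
      intervalIntegral.integral_mono_on (by nlinarith) (hg.intervalIntegrable _ _) intervalIntegrable_const
        fun r hr => trap_le _ _ _ _
    rw [intervalIntegral.integral_const, smul_eq_mul] at this
    linarith
  have hj0 : ∀ j ∈ Finset.range n, j ∉ S → ∫ r in (0 + j * h)..(0 + ((j:ℝ) + 1) * h), trap x y ρ (w r) = 0 := by
    intro j hj hjS
    have e : ∫ r in (0 + j * h)..(0 + ((j:ℝ) + 1) * h), trap x y ρ (w r) = ∫ r in (0 + j * h)..(0 + ((j:ℝ) + 1) * h), (0:ℝ) := by
      refine intervalIntegral.integral_congr fun r hr => ?_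
      rw [uIcc_of_le (by nlinarith)] at hr
      exact trap_zero hρ (hS j hj hjS r hr)
    rw [e]; simp
  have h2 : ∑ j ∈ Finset.range n, ∫ r in (0 + j * h)..(0 + ((j:ℝ) + 1) * h), trap x y ρ (w r) ≤ ∑ j ∈ S, h := by
    rw [← Finset.sum_inter_add_sum_sdiff (Finset.range n) S, Finset.sum_eq_zero (s := Finset.range n \ S), add_zero]
    · refine (Finset.sum_le_sum fun j _ => hj1 j).trans (Finset.sum_le_sum_of_subset_of_nonneg Finset.inter_subset_right fun _ _ _ => hh.le)
    · intro j hj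
      rw [Finset.mem_sdiff] at hj
      exact hj0 j hj.1 hj.2
  have h3 : (y - x - 2 * ρ) * m ≤ ∫ a, trap x y ρ a * Lf a := by
    have hntg : Integrable fun a => trap x y ρ a * Lf a :=
      ((trap_cont _ _ _).mul hO.1).integrable_of_hasCompactSupport (trap_supp hρ).mul_right
    calc (y - x - 2 * ρ) * m = ∫ a, (Icc (x + ρ) (y - ρ)).indicator (fun _ => m) a := by
          rw [integral_indicator measurableSet_Icc, setIntegral_const, smul_eq_mul, Measure.real, Real.volume_Icc,
            ENNReal.toReal_ofReal (by linarith)]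
          ring
      _ ≤ _ := by
          refine integral_mono ?_ hntg fun a => ?_
          · exact (integrable_indicator_iff measurableSet_Icc).2 (integrableOn_const (by simp))
          · by_cases ha : a ∈ Icc (x + ρ) (y - ρ)
            · rw [indicator_of_mem ha]
              dsimp only
              rw [trap_one hρ ha, one_mul]
              exact hm a ⟨by linarith [ha.1], by linarith [ha.2]⟩
            · rw [indicator_of_notMem ha]
              exact mul_nonneg (trap_nonneg _ _ _ _) (hO.nonneg ht a)
  rw [Finset.sum_const, nsmul_eq_mul] at h2
  linarith

lemma X_up (hO : Occ w t Lf) (hw : Continuous w) (ht : 0 ≤ t) {h : ℝ} (hh : 0 < h) {n : ℕ} (hn : t = n * h)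
    {H ε δ ρ G M a : ℝ} (hε : 0 < ε) (hδ : 0 < δ) (hερ : ε ≤ ρ)
    (hosc : ∀ j < n, ∀ u ∈ Icc (0 + j * h) (0 + ((j : ℝ) + 1) * h), ∀ v ∈ Icc (0 + j * h) (0 + ((j : ℝ) + 1) * h), |w u - w v| ≤ ρ)
    (hG : 0 ≤ G) (hW : ∀ j < n, Wt w (0 + j * h) (0 + ((j : ℝ) + 1) * h) ε ≤ ENNReal.ofReal (G * (h * ε ^ (1 - 1 / H))))
    (hM : ∀ z ∈ Icc (a - 3 * ρ) (a + δ + 3 * ρ), Lf z ≤ M) :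
    Xw H w t ε δ a ≤ (G + ε ^ (1 / H) / h) * ((δ + 6 * ρ) / δ) * M := by
  have hρ : 0 < ρ := by linarith
  set S := (Finset.range n).filter fun j : ℕ => ∀ r ∈ Icc (0 + j * h) (0 + ((j : ℝ) + 1) * h), w r ∈ Icc (a - 2 * ρ) (a + δ + 2 * ρ) with hS
  have hcnt := hO.cnt_up hw ht hh hn (x := a - 2 * ρ) (y := a + δ + 2 * ρ) (M := M) hρ (by linarith)
    (fun z hz => hM z ⟨by linarith [hz.1], by linarith [hz.2]⟩) S (Finset.filter_subset _ _)
    (fun j hj => (Finset.mem_filter.1 hj).2)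
  have hc2 : (((Finset.range n).filter fun j : ℕ => w (0 + j * h) ∈ Icc a (a + δ + ε)).card : ℝ≥0∞) ≤ S.card := by
    norm_cast
    refine Finset.card_le_card fun j hj => ?_
    rw [Finset.mem_filter] at hj
    rw [hS, Finset.mem_filter]
    refine ⟨hj.1, fun r hr => ?_⟩
    have := abs_le.1 (hosc j (Finset.mem_range.1 hj.1) r hr (0 + j * h) ⟨le_rfl, by nlinarith⟩)
    constructor <;> linarith [hj.2.1, hj.2.2]
  have hJ0 : ∀ j ∈ Finset.range n, j ∉ S → J w (Icc (0 + j * h) (0 + ((j : ℝ) + 1) * h)) (Ioc a (a + δ)) ε = 0 := by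
    intro j hj hjS
    unfold J
    have e : ∫⁻ b in Ioc a (a + δ), V w (Icc (0 + j * h) (0 + ((j : ℝ) + 1) * h)) b (b + ε) = ∫⁻ b in Ioc a (a + δ), 0 := by
      refine setLIntegral_congr_fun measurableSet_Ioc fun b hb => V_zero fun u hu v hv _ h1 h2 => hjS ?_
      rw [hS, Finset.mem_filter]
      refine ⟨hj, fun r hr => ?_⟩
      have y1 := abs_le.1 (hosc j (Finset.mem_range.1 hj) r hr u hu)
      have y2 := abs_le.1 (hosc j (Finset.mem_range.1 hj) r hr v hv)
      constructor <;> linarith [hb.1, hb.2]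
    rw [e]; simp
  have h1 := J_blocks_ge hw hh.le hε.le n a δ
  rw [← hn] at h1
  have h2 : J w (Icc 0 t) (Ioc a (a + δ)) ε ≤ S.card * ENNReal.ofReal (G * (h * ε ^ (1 - 1 / H)) + ε) := by
    refine h1.trans ?_
    rw [ENNReal.ofReal_add (by positivity) hε.le, mul_add]
    gcongr
    rw [← Finset.sum_subset (Finset.filter_subset _ _ : S ⊆ Finset.range n) hJ0, ← nsmul_eq_mul, ← Finset.sum_const]
    refine Finset.sum_le_sum fun j hj => ?_
    exact (J_le_Wt _ _ _ _ _).trans (hW j (Finset.mem_range.1 (Finset.mem_filter.1 hj).1))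
  have h3 : (J w (Icc 0 t) (Ioc a (a + δ)) ε).toReal ≤ S.card * (G * (h * ε ^ (1 - 1 / H)) + ε) := by
    have := ENNReal.toReal_mono (ENNReal.mul_ne_top (by simp) ENNReal.ofReal_ne_top) h2
    rwa [ENNReal.toReal_mul, ENNReal.toReal_natCast, ENNReal.toReal_ofReal (by positivity)] at this
  unfold Xw
  have e1 : ε ^ (1 - 1 / H) = (ε ^ (1 / H - 1))⁻¹ := by rw [← Real.rpow_neg hε.le]; congr 1; ring
  have e2 : ε ^ (1 / H) = ε ^ (1 / H - 1) * ε := by rw [← Real.rpow_add_one hε.ne']; congr 1; ring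
  have e0 : 0 < ε ^ (1 / H - 1) := by positivity
  rw [e1] at h3
  rw [e2]
  generalize ε ^ (1 / H - 1) = y at *
  calc _ ≤ y / δ * (S.card * (G * (h * y⁻¹) + ε)) := by gcongr
    _ = (G + y * ε / h) / δ * (S.card * h) := by field_simp
    _ ≤ (G + y * ε / h) / δ * ((a + δ + 2 * ρ - (a - 2 * ρ) + 2 * ρ) * M) := by gcongr
    _ = _ := by field_simp; ring

lemma X_lo (hO : Occ w t Lf) (hw : Continuous w) (ht : 0 ≤ t) {h : ℝ} (hh : 0 < h) {n : ℕ} (hn : t = n * h)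
    {H ε δ ρ G m a : ℝ} (hε : 0 < ε) (hδ : 0 < δ) (hρ : 0 < ρ) (hρδ : 4 * ρ ≤ δ)
    (hosc : ∀ j < n, ∀ u ∈ Icc (0 + j * h) (0 + ((j : ℝ) + 1) * h), ∀ v ∈ Icc (0 + j * h) (0 + ((j : ℝ) + 1) * h), |w u - w v| ≤ ρ)
    (hG : 0 ≤ G) (hW : ∀ j < n, ENNReal.ofReal (G * (h * ε ^ (1 - 1 / H))) ≤ Wt w (0 + j * h) (0 + ((j : ℝ) + 1) * h) ε)
    (hm0 : 0 ≤ m) (hm : ∀ z ∈ Icc a (a + δ), m ≤ Lf z) :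
    G * ((δ - 4 * ρ) / δ) * m ≤ Xw H w t ε δ a := by
  set S := (Finset.range n).filter fun j : ℕ => ∃ r ∈ Icc (0 + j * h) (0 + ((j : ℝ) + 1) * h), w r ∈ Icc (a + ρ) (a + δ - ρ) with hS
  have hcnt := hO.cnt_lo hw ht hh hn (x := a + ρ) (y := a + δ - ρ) (m := m) hρ (by linarith)
    (fun z hz => hm z ⟨by linarith [hz.1], by linarith [hz.2]⟩) hm0 S
    (fun j hj hjS r hr hwr => hjS (by rw [hS, Finset.mem_filter]; exact ⟨hj, r, hr, hwr⟩))
  have hJ : ∀ j ∈ S, J w (Icc (0 + j * h) (0 + ((j : ℝ) + 1) * h)) (Ioc a (a + δ)) ε = Wt w (0 + j * h) (0 + ((j : ℝ) + 1) * h) ε := by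
    intro j hj
    rw [hS, Finset.mem_filter] at hj
    obtain ⟨hj1, r, hr, hwr⟩ := hj
    unfold J Wt
    rw [← lintegral_indicator measurableSet_Ioc]
    refine lintegral_congr fun b => ?_
    by_cases hc : b ∈ Ioc a (a + δ)
    · rw [indicator_of_mem hc]
    rw [indicator_of_notMem hc]
    refine (V_zero fun u hu v hv _ h1 h2 => hc ?_).symm
    have y1 := abs_le.1 (hosc j (Finset.mem_range.1 hj1) r hr u hu)
    have y2 := abs_le.1 (hosc j (Finset.mem_range.1 hj1) r hr v hv)
    constructor <;> linarith [hwr.1, hwr.2]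
  have h1 := J_blocks_le hw hh.le hε.le n (Ioc a (a + δ))
  rw [← hn] at h1
  have h2 : S.card * ENNReal.ofReal (G * (h * ε ^ (1 - 1 / H))) ≤ J w (Icc 0 t) (Ioc a (a + δ)) ε := by
    refine le_trans ?_ h1
    refine le_trans ?_ (Finset.sum_le_sum_of_subset (Finset.filter_subset _ _ : S ⊆ Finset.range n))
    rw [← nsmul_eq_mul, ← Finset.sum_const]
    refine Finset.sum_le_sum fun j hj => ?_
    rw [hJ j hj]
    exact hW j (Finset.mem_range.1 (Finset.mem_filter.1 hj).1)
  have h3 : S.card * (G * (h * ε ^ (1 - 1 / H))) ≤ (J w (Icc 0 t) (Ioc a (a + δ)) ε).toReal := by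
    have := ENNReal.toReal_mono (J_fin hw _ _ _ hε) h2
    rwa [ENNReal.toReal_mul, ENNReal.toReal_natCast, ENNReal.toReal_ofReal (by positivity)] at this
  unfold Xw
  have e1 : ε ^ (1 - 1 / H) = (ε ^ (1 / H - 1))⁻¹ := by rw [← Real.rpow_neg hε.le]; congr 1; ring
  have e0 : 0 < ε ^ (1 / H - 1) := by positivity
  rw [e1] at h3
  generalize ε ^ (1 / H - 1) = y at *
  calc G * ((δ - 4 * ρ) / δ) * m = G / δ * ((a + δ - ρ - (a + ρ) - 2 * ρ) * m) := by field_simp; ring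
    _ ≤ G / δ * (S.card * h) := by gcongr
    _ = y / δ * (S.card * (G * (h * y⁻¹))) := by field_simp
    _ ≤ _ := by gcongr
end M19
end

section
lemma Occ.unif {w : ℝ → ℝ} {t : ℝ} {Lf : ℝ → ℝ} (h : Occ w t Lf) (hw : Continuous w) (ht : 0 ≤ t) : UniformContinuous Lf := by
  obtain ⟨A, hA⟩ := (isCompact_Icc (a := (0:ℝ)) (b := t)).exists_bound_of_continuousOn hw.continuousOn
  refine HasCompactSupport.uniformContinuous_of_continuous (HasCompactSupport.intro (isCompact_Icc (a := -A) (b := A)) fun x hx => ?_) h.1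
  refine h.zero ht (A := A) (fun r hr => by simpa using hA r hr) ?_
  by_contra hc
  exact hx (abs_le.1 (not_lt.1 hc))

lemma step_two_arith {γ ζ L Λ X : ℝ} (hγ : 0 ≤ γ) (hζ : 0 < ζ) (hζ1 : ζ ≤ 1) (hL : 0 ≤ L) (hLΛ : L ≤ Λ)
    (h1 : X ≤ (γ + 2 * ζ) * (1 + ζ) * (L + ζ)) (h2 : max (γ - ζ) 0 * (1 - ζ) * max (L - ζ) 0 ≤ X) :
    |X - γ * L| ≤ ζ * (γ + (γ + 4) * (Λ + 1)) := by
  rw [abs_le]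
  constructor
  · set g := max (γ - ζ) 0 with hg
    have a1 : γ - ζ ≤ g := le_max_left _ _
    have a2 : g ≤ γ := max_le (by linarith) hγ
    have a0 : 0 ≤ g := le_max_right _ _
    have a3 : L - ζ ≤ max (L - ζ) 0 := le_max_left _ _
    have a4 : 0 ≤ g * (1 - ζ) := mul_nonneg a0 (by linarith)
    have a5 := mul_le_mul_of_nonneg_left a3 a4
    have a6 : γ - ζ - ζ * γ ≤ g * (1 - ζ) := by nlinarith
    have a7 : g * (1 - ζ) ≤ γ := by nlinarith
    have a8 : (γ - ζ - ζ * γ) * L ≤ g * (1 - ζ) * L := mul_le_mul_of_nonneg_right a6 hL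
    have a9 : g * (1 - ζ) * ζ ≤ γ * ζ := mul_le_mul_of_nonneg_right a7 hζ.le
    have b1 : ζ * ((1 + γ) * L) ≤ ζ * ((γ + 4) * (Λ + 1)) := by
      gcongr ζ * (?_ * ?_) <;> linarith
    nlinarith
  · have c1 : (γ + 2 * ζ) * (1 + ζ) ≤ γ + ζ * (γ + 4) := by nlinarith
    have c2 : (γ + 2 * ζ) * (1 + ζ) * (L + ζ) ≤ (γ + ζ * (γ + 4)) * (L + ζ) := by gcongr
    have c3 : ζ * ((γ + 4) * (L + ζ)) ≤ ζ * ((γ + 4) * (Λ + 1)) := by gcongr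
    nlinarith

set_option maxHeartbeats 2000000 in
lemma step_two_det {w : ℝ → ℝ} {t : ℝ} {Lf : ℝ → ℝ} (hO : Occ w t Lf) (hw : Continuous w) (ht : 0 < t) {H γ r θ c0 C Ch : ℝ} {δ : ℝ → ℝ}
    (hH : 0 < H) (hγ : 0 ≤ γ) (hr0 : 0 < r) (hr1 : r < 1) (hθ : 0 < θ) (hθ1 : θ < 1 / 16) (hc0 : 0 < c0)
    (hδ : ∀ ε, 0 < ε → ε ≤ 1 → c0 * ε ^ θ ≤ δ ε ∧ δ ε ≤ C * ε ^ θ) (hCh : 0 < Ch)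
    (hold : ∀ u ∈ Icc 0 t, ∀ v ∈ Icc 0 t, |w u - w v| ≤ Ch * |u - v| ^ (H / 2))
    (hblk : ∀ η > 0, ∀ᶠ n : ℕ in atTop, ∀ ε, ε = r ^ n → ∀ j < 2 * qn (1 / (8 * H)) ε + 1,
      |(Wt w (0 + j * hn t (1 / (8 * H)) ε) (0 + j * hn t (1 / (8 * H)) ε + hn t (1 / (8 * H)) ε) ε).toReal -
        γ * (hn t (1 / (8 * H)) ε * ε ^ (1 - 1 / H))| ≤ η * (hn t (1 / (8 * H)) ε * ε ^ (1 - 1 / H)))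
    {η : ℝ} (hη : 0 < η) : ∀ᶠ n : ℕ in atTop, ∀ ε, ε = r ^ n → ∀ a, |Xw H w t ε (δ ε) a - γ * Lf a| ≤ η := by
  obtain ⟨Λ, hΛ0, hΛ⟩ := hO.bdd hw ht.le
  set K := γ + (γ + 4) * (Λ + 1) with hK
  have hK0 : 0 < K := by positivity
  set ζ := min 1 (η / K) with hζd
  have hζ : 0 < ζ := by positivity
  have hζ1 : ζ ≤ 1 := min_le_left _ _
  have hζη : ζ * K ≤ η := by rw [← le_div_iff₀ hK0]; exact min_le_right _ _
  obtain ⟨d, hd, hdL⟩ := Metric.uniformContinuous_iff.1 (hO.unif hw ht.le) ζ hζ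
  set β := 1 / (8 * H) with hβ
  have hβ0 : 0 < β := by positivity
  set D := Ch * (t / 2) ^ (H / 2) + 1 with hD
  have hD0 : 0 < D := by positivity
  have hβα : β * (H / 2) = 1 / 16 := by rw [hβ]; field_simp; norm_num
  have hβH : 0 < 1 / H - β := by
    have : 1 / H - β = 7 / (8 * H) := by rw [hβ]; field_simp; norm_num
    rw [this]; positivity
  have htend : Tendsto (fun n : ℕ => r ^ n) atTop (𝓝[>] 0) :=
    tendsto_nhdsWithin_iff.2 ⟨tendsto_pow_atTop_nhds_zero_of_lt_one hr0.le hr1, Eventually.of_forall fun n => pow_pos hr0 n⟩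
  have ev := htend.eventually ((ev_le_one.and (ev_pow (D / c0) (p := 1 / 16 - θ) (by linarith) (show 0 < ζ / 6 by positivity))).and
    ((ev_pow (5 / t) hβH hζ).and (ev_pow (2 * C) hθ hd)))
  filter_upwards [ev, hblk ζ hζ] with n hn1 hn2 ε hεn a
  obtain ⟨⟨⟨hε, hε1⟩, g1⟩, g2, g3⟩ := hn1
  rw [← hεn] at hε hε1 g1 g2 g3
  have hb := hn2 ε hεn
  obtain ⟨hδ1, hδ2⟩ := hδ ε hε hε1
  obtain ⟨hh1, hh2⟩ := hn_bd ht hβ0.le hε hε1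
  have hh := hn_pos ht β ε
  have hnt : t = ((2 * qn β ε + 1 : ℕ) : ℝ) * hn t β ε := by unfold hn; push_cast; field_simp
  set h := hn t β ε with hhd
  set N := 2 * qn β ε + 1 with hN
  set ρ := Ch * h ^ (H / 2) + ε with hρ
  have hρ0 : 0 < ρ := by positivity
  have hρD : ρ ≤ D * ε ^ (1 / 16 : ℝ) := by
    have q1 : h ^ (H / 2) ≤ (t / 2) ^ (H / 2) * ε ^ (1 / 16 : ℝ) := by
      rw [← hβα, Real.rpow_mul hε.le, ← Real.mul_rpow (by positivity) (by positivity)]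
      exact Real.rpow_le_rpow hh.le hh2 (by positivity)
    have q2 : ε ≤ ε ^ (1 / 16 : ℝ) := by
      simpa using Real.rpow_le_rpow_of_exponent_ge hε hε1 (show (1 / 16 : ℝ) ≤ 1 by norm_num)
    have := mul_le_mul_of_nonneg_left q1 hCh.le
    rw [hρ, hD]; nlinarith
  have hδ0 : 0 < δ ε := lt_of_lt_of_le (by positivity) hδ1
  have hρδ : 6 * ρ ≤ ζ * δ ε := by
    have e1 : ε ^ (1 / 16 : ℝ) = ε ^ (1 / 16 - θ) * ε ^ θ := by rw [← Real.rpow_add hε]; congr 1; ring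
    have e2 : D * ε ^ (1 / 16 - θ) ≤ ζ / 6 * c0 := by
      rw [div_mul_eq_mul_div, div_le_iff₀ hc0] at g1; exact g1
    have e3 := mul_le_mul_of_nonneg_right e2 (show 0 ≤ ε ^ θ by positivity)
    have e4 := mul_le_mul_of_nonneg_left hδ1 hζ.le
    rw [e1] at hρD
    nlinarith
  have hρδ' : 6 * ρ ≤ δ ε := hρδ.trans (by nlinarith)
  have hosc : ∀ j < N, ∀ u ∈ Icc (0 + j * h) (0 + ((j : ℝ) + 1) * h), ∀ v ∈ Icc (0 + j * h) (0 + ((j : ℝ) + 1) * h), |w u - w v| ≤ ρ := by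
    intro j hj u hu v hv
    have hj' : ((j : ℝ) + 1) * h ≤ N * h := by gcongr; exact_mod_cast hj
    have hj0 : 0 ≤ (j : ℝ) * h := by positivity
    have := hold u ⟨by linarith [hu.1], by linarith [hu.2]⟩ v ⟨by linarith [hv.1], by linarith [hv.2]⟩
    have h1 : |u - v| ^ (H / 2) ≤ h ^ (H / 2) := by
      refine Real.rpow_le_rpow (abs_nonneg _) ?_ (by positivity)
      rw [abs_le]; constructor <;> linarith [hu.1, hu.2, hv.1, hv.2]
    have := mul_le_mul_of_nonneg_left h1 hCh.le
    linarith
  have ej : ∀ j : ℕ, 0 + ((j : ℝ) + 1) * h = 0 + j * h + h := fun j => by ring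
  have hdd : δ ε + 3 * ρ < d := by nlinarith [hd]
  have hy : 0 < h * ε ^ (1 - 1 / H) := by positivity
  have hfin : ∀ j : ℕ, Wt w (0 + j * h) (0 + j * h + h) ε ≠ ⊤ := fun j => (Wt_lt_top hw _ _ hε).ne
  have hLa : ∀ z, |z - a| < d → |Lf z - Lf a| < ζ := fun z hz => hdL (by simpa [Real.dist_eq] using hz)
  have up := X_up hO hw ht.le hh hnt (H := H) (ε := ε) (δ := δ ε) (ρ := ρ) (G := γ + ζ) (M := Lf a + ζ) (a := a) hε hδ0
    (by rw [hρ]; linarith [show 0 < Ch * h ^ (H / 2) by positivity]) hosc (by positivity)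
    (fun j hj => by
      rw [ej]
      refine (ENNReal.le_ofReal_iff_toReal_le (hfin j) (by positivity)).2 ?_
      have := (abs_le.1 (hb j hj)).2
      linarith)
    (fun z hz => by
      have := (abs_lt.1 (hLa z (by rw [abs_lt]; constructor <;> linarith [hz.1, hz.2]))).2
      linarith)
  have lo := X_lo hO hw ht.le hh hnt (H := H) (ε := ε) (δ := δ ε) (ρ := ρ) (G := max (γ - ζ) 0) (m := max (Lf a - ζ) 0) (a := a) hε hδ0 hρ0
    (by linarith) hosc (le_max_right _ _)
    (fun j hj => by
      rw [ej]
      refine (ENNReal.ofReal_le_iff_le_toReal (hfin j)).2 ?_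
      have := (abs_le.1 (hb j hj)).1
      rcases max_cases (γ - ζ) 0 with ⟨q, _⟩ | ⟨q, _⟩ <;> rw [q]
      · linarith
      · simp) (le_max_right _ _)
    (fun z hz => max_le (by
      have := (abs_lt.1 (hLa z (by rw [abs_lt]; constructor <;> linarith [hz.1, hz.2]))).1
      linarith) (hO.nonneg ht.le z))
  have hL0 := hO.nonneg ht.le a
  refine (step_two_arith hγ hζ hζ1 hL0 (hΛ a) (up.trans ?_) (le_trans ?_ lo)).trans hζη
  · gcongr ?_ * ?_ * _
    · have : ε ^ (1 / H) / h ≤ ζ := by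
        rw [div_le_iff₀ hh]
        have e1 : ε ^ (1 / H) = ε ^ (1 / H - β) * ε ^ β := by rw [← Real.rpow_add hε]; congr 1; ring
        have e2 : ε ^ (1 / H - β) ≤ ζ * (t / 5) := by
          rw [div_mul_eq_mul_div, div_le_iff₀ ht] at g2; linarith
        rw [e1]
        calc _ ≤ ζ * (t / 5) * ε ^ β := by gcongr
          _ = ζ * (t / 5 * ε ^ β) := by ring
          _ ≤ _ := by gcongr
      linarith
    · rw [div_le_iff₀ hδ0]; linarith
  · gcongr _ * ?_ * _
    rw [le_div_iff₀ hδ0]; linarith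

variable {Ω : Type*} [MeasurableSpace Ω] {P : Measure Ω} [IsProbabilityMeasure P] {H : ℝ} {B : ℝ → Ω → ℝ} {aH : ℝ}

lemma step_three (hB : IsFBM H P B) (ha : ∀ s t : ℝ, ∫ ω, (B t ω - B s ω) ^ 2 ∂P = aH * |t - s| ^ (2 * H))
    (haH : 0 < aH) (hH : 0 < H) (hH2 : H < 1 / 2) {γ : ℝ}
    (hγ : ∀ t, 0 < t → gE P B t ≤ ENNReal.ofReal (γ * t) ∧ ENNReal.ofReal (γ * t - 1) ≤ gE P B t) (hγ0 : 0 ≤ γ)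
    {t r c0 : ℝ} (ht : 0 < t) (hr0 : 0 < r) (hr1 : r < 1) (hc0 : 0 < c0) {L : ℝ → Ω → ℝ}
    (hO : ∀ᵐ ω ∂P, Occ (fun r => B r ω) t (fun a => L a ω)) :
    ∀ᵐ ω ∂P, ∀ A : ℝ, ∀ η > 0, ∀ᶠ n : ℕ in atTop, ∀ ε, ε = r ^ n → ∀ k : ℤ, |k * (c0 * ε)| ≤ A →
      |Xw H (fun r => B r ω) t ε (c0 * ε) (k * (c0 * ε)) - γ * L (k * (c0 * ε)) ω| ≤ η := by
  obtain ⟨θ, C, δ, hθ, hθ1, hC, hδ, h1⟩ := step_one hB ha haH hH hH2 (θ0 := 1 / 16) (by norm_num) hc0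
  have hblk : ∀ᵐ ω ∂P, ∀ p : ℕ, ∀ᶠ n : ℕ in atTop, ∀ ε, ε = r ^ n → ∀ j < 2 * qn (1 / (8 * H)) ε + 1,
      |(Wt (fun r => B r ω) (0 + j * hn t (1 / (8 * H)) ε) (0 + j * hn t (1 / (8 * H)) ε + hn t (1 / (8 * H)) ε) ε).toReal -
        γ * (hn t (1 / (8 * H)) ε * ε ^ (1 - 1 / H))| ≤ (1 / ((p : ℝ) + 1)) * (hn t (1 / (8 * H)) ε * ε ^ (1 - 1 / H)) :=
    ae_all_iff.2 fun p => blk_conc hB ha haH hH hH2 hγ hγ0 ht hr0 hr1 (by positivity) (by positivity) (by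
      rw [show 5 * (1 / (8 * H)) = 5 / 8 * (1 / H) by field_simp]
      nlinarith [show 0 < 1 / H by positivity])
  filter_upwards [h1 t r ht hr0 hr1 (hO.mono fun ω h => ⟨_, h⟩), hblk, hO, fb_holder hB ha haH (show 0 < H / 2 by linarith)
    (by linarith) ht] with ω h1 hblk hO hhold A η hη
  obtain ⟨Ch, hCh, hhold⟩ := hhold
  have hw : Continuous fun r => B r ω := hB.1 ω
  obtain ⟨Λ, hΛ0, hΛ⟩ := hO.bdd hw ht.le
  have h2 : ∀ η > 0, ∀ᶠ n : ℕ in atTop, ∀ ε, ε = r ^ n → ∀ a, |Xw H (fun r => B r ω) t ε (δ ε) a - γ * L a ω| ≤ η := fun η hη =>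
    step_two_det hO hw ht hH hγ0 hr0 hr1 hθ hθ1 hc0 hδ hCh hhold (fun η hη => by
      obtain ⟨p, hp⟩ := exists_nat_one_div_lt hη
      filter_upwards [hblk p] with n hq ε hε j hj
      refine (hq ε hε j hj).trans ?_
      have : 0 < hn t (1 / (8 * H)) ε * ε ^ (1 - 1 / H) := by
        have : 0 < ε := by rw [hε]; positivity
        have := hn_pos ht (1 / (8 * H)) ε
        positivity
      gcongr) hη
  set ζ := min 1 (η / (γ * Λ + 4)) with hζd
  have hK : 0 < γ * Λ + 4 := by positivity
  have hζ : 0 < ζ := by positivity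
  have hζ1 : ζ ≤ 1 := min_le_left _ _
  have hζη : ζ * (γ * Λ + 4) ≤ η := by rw [← le_div_iff₀ hK]; exact min_le_right _ _
  filter_upwards [h1 A ζ hζ, h2 ζ hζ] with n h1 h2 ε hε k hk
  obtain ⟨p1, p2⟩ := h1 ε hε k hk
  have p3 := abs_le.1 (h2 ε hε (k * (c0 * ε)))
  have p4 := hΛ (k * (c0 * ε))
  have p5 := hO.nonneg ht.le (k * (c0 * ε))
  have p6 : γ * L (k * (c0 * ε)) ω ≤ γ * Λ := by gcongr
  have p7 := mul_nonneg hγ0 p5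
  have hε0 : 0 < ε := by rw [hε]; positivity
  have p8 := Xw_nonneg H (fun r => B r ω) t hε0.le (show 0 ≤ c0 * ε by positivity) (k * (c0 * ε))
  generalize Xw H (fun r => B r ω) t ε (c0 * ε) (k * (c0 * ε)) = X at *
  generalize Xw H (fun r => B r ω) t ε (δ ε) (k * (c0 * ε)) = Y at *
  generalize γ * L (k * (c0 * ε)) ω = Z at *
  have q1 : (1 + ζ) * Y ≤ (1 + ζ) * (Z + ζ) := by gcongr; linarith
  rw [abs_le]
  constructor
  · by_contra hc
    push Not at hc
    have : X ≤ Z := by linarith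
    nlinarith
  · nlinarith
end

section
section fin
variable {w : ℝ → ℝ} {t : ℝ} {Lf : ℝ → ℝ}

lemma up_le_Xw (hw : Continuous w) {H ε ε' μ a a0 : ℝ} (hε' : 0 < ε') (hμ : 0 < μ)
    (h : ∀ b ∈ Ioc a0 (a0 + μ), a < b ∧ b + ε' < a + ε) :
    ε' ^ (1 / H - 1) * upR ε (fun r => w r - a) 0 t ≤ Xw H w t ε' μ a0 := by
  have h1 : (upE ε (fun r => w r - a) 0 t : ℝ≥0∞) * ENNReal.ofReal μ ≤ J w (Icc 0 t) (Ioc a0 (a0 + μ)) ε' := by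
    have : ∫⁻ _ in Ioc a0 (a0 + μ), (upE ε (fun r => w r - a) 0 t : ℝ≥0∞) ≤ J w (Icc 0 t) (Ioc a0 (a0 + μ)) ε' :=
      setLIntegral_mono' measurableSet_Ioc fun b hb => up_le_V (h b hb).1 (h b hb).2
    simpa using this
  have h2 := ENNReal.toReal_mono (J_fin hw _ _ _ hε') h1
  rw [ENNReal.toReal_mul, ENNReal.toReal_ofReal hμ.le] at h2
  unfold Xw upR
  calc _ = ε' ^ (1 / H - 1) / μ * ((upE ε (fun r => w r - a) 0 t : ℝ≥0∞).toReal * μ) := by field_simp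
    _ ≤ _ := by gcongr

lemma Xw_le_up (hw : Continuous w) {H ε ε' μ a a0 : ℝ} (hε : 0 < ε) (hε' : 0 < ε') (hμ : 0 < μ)
    (h : ∀ b ∈ Ioc a0 (a0 + μ), b ≤ a ∧ a + ε ≤ b + ε') :
    Xw H w t ε' μ a0 ≤ ε' ^ (1 / H - 1) * upR ε (fun r => w r - a) 0 t := by
  have h1 : J w (Icc 0 t) (Ioc a0 (a0 + μ)) ε' ≤ (upE ε (fun r => w r - a) 0 t : ℝ≥0∞) * ENNReal.ofReal μ := by
    have : J w (Icc 0 t) (Ioc a0 (a0 + μ)) ε' ≤ ∫⁻ _ in Ioc a0 (a0 + μ), (upE ε (fun r => w r - a) 0 t : ℝ≥0∞) :=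
      setLIntegral_mono' measurableSet_Ioc fun b hb => V_le_up hw hε (h b hb).1 (h b hb).2
    simpa using this
  have h2 := ENNReal.toReal_mono (ENNReal.mul_ne_top (up_lt_top hw hε).ne ENNReal.ofReal_ne_top) h1
  rw [ENNReal.toReal_mul, ENNReal.toReal_ofReal hμ.le] at h2
  unfold Xw upR
  calc _ ≤ ε' ^ (1 / H - 1) / μ * ((upE ε (fun r => w r - a) 0 t : ℝ≥0∞).toReal * μ) := by gcongr
    _ = _ := by field_simp

lemma sandwich (hO : Occ w t Lf) (hw : Continuous w) (ht : 0 < t) {H γ r : ℝ} (hγ : 0 ≤ γ) (hp : 0 ≤ 1 / H - 1)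
    (hr0 : 0 < r) (hr1 : r < 1)
    (hX : ∀ A : ℝ, ∀ η > 0, ∀ᶠ n : ℕ in atTop, ∀ ε, ε = r ^ n → ∀ k : ℤ, |k * ((1 - r) / 2 * ε)| ≤ A →
      |Xw H w t ε ((1 - r) / 2 * ε) (k * ((1 - r) / 2 * ε)) - γ * Lf (k * ((1 - r) / 2 * ε))| ≤ η)
    (A : ℝ) {η : ℝ} (hη : 0 < η) : ∀ᶠ ε : ℝ in 𝓝[>] 0, ∀ a, |a| ≤ A →
      γ * Lf a - η ≤ (r ^ (1 / H - 1)) ^ (-2 : ℤ) * (ε ^ (1 / H - 1) * upR ε (fun r => w r - a) 0 t) ∧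
      (r ^ (1 / H - 1)) ^ 2 * (ε ^ (1 / H - 1) * upR ε (fun r => w r - a) 0 t) ≤ γ * Lf a + η := by
  set c0 := (1 - r) / 2 with hc0
  have hc : 0 < c0 := by rw [hc0]; linarith
  obtain ⟨d, hd, hdL⟩ := Metric.uniformContinuous_iff.1 (hO.unif hw ht.le) (η / (2 * (γ + 1))) (by positivity)
  obtain ⟨n0, hn0⟩ := eventually_atTop.1 (hX (A + 1) (η / 2) (by positivity))
  have hLd : ∀ x y, |x - y| < d → |γ * Lf x - γ * Lf y| ≤ η / 2 := fun x y h => by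
    have := (hdL (by simpa [Real.dist_eq] using h : dist x y < d)).le
    rw [Real.dist_eq] at this
    rw [← mul_sub, abs_mul, abs_of_nonneg hγ]
    calc _ ≤ (γ + 1) * (η / (2 * (γ + 1))) := by gcongr; linarith
      _ = _ := by field_simp
  filter_upwards [Ioo_mem_nhdsGT (show 0 < r ^ (n0 + 2) by positivity), Ioo_mem_nhdsGT (show 0 < min 1 d * r ^ 2 by positivity), ev_le_one]
    with ε h1 h2 h3 a ha
  have hε := h1.1
  obtain ⟨m, hm1, hm2⟩ := exists_nat_pow_near_of_lt_one hε h3.2 hr0 hr1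
  have hmn : n0 + 2 < m + 1 := (pow_lt_pow_iff_right_of_lt_one₀ hr0 hr1).1 (hm1.trans h1.2)
  obtain ⟨q, rfl⟩ : ∃ q, m = q + 1 := ⟨m - 1, by omega⟩
  -- grid approximations
  have grid : ∀ n : ℕ, q ≤ n → 0 < c0 * r ^ n ∧ 2 * (c0 * r ^ n) < min 1 d := by
    intro n hn
    refine ⟨by positivity, ?_⟩
    have e1 : r ^ n ≤ r ^ q := pow_le_pow_of_le_one hr0.le hr1.le hn
    have e2 : r ^ q * r ^ 2 < min 1 d * r ^ 2 := by rw [← pow_add]; exact lt_trans hm1 h2.2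
    have e3 : r ^ q < min 1 d := lt_of_mul_lt_mul_right e2 (by positivity)
    have : 2 * c0 ≤ 1 := by rw [hc0]; linarith
    nlinarith [show 0 < r ^ n by positivity]
  have near : ∀ n : ℕ, q ≤ n → ∀ k : ℤ, |k * (c0 * r ^ n) - a| ≤ 2 * (c0 * r ^ n) →
      |Xw H w t (r ^ n) (c0 * r ^ n) (k * (c0 * r ^ n)) - γ * Lf a| ≤ η := by
    intro n hn k hk
    have g := (grid n hn).2
    have g1 := min_le_left 1 d
    have g2 := min_le_right 1 d
    have := hn0 n (by omega) _ rfl k (by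
      have := abs_add_le (k * (c0 * r ^ n) - a) a
      rw [sub_add_cancel] at this; linarith)
    have h5 := hLd (k * (c0 * r ^ n)) a (by linarith)
    have := abs_add_le (Xw H w t (r ^ n) (c0 * r ^ n) (k * (c0 * r ^ n)) - γ * Lf (k * (c0 * r ^ n))) (γ * Lf (k * (c0 * r ^ n)) - γ * Lf a)
    rw [sub_add_sub_cancel] at this; linarith
  have hU : 0 ≤ upR ε (fun r => w r - a) 0 t := ENNReal.toReal_nonneg
  have fl : ∀ μ : ℝ, 0 < μ → (⌊a / μ⌋ : ℝ) * μ ≤ a ∧ a < (⌊a / μ⌋ : ℝ) * μ + μ := fun μ hμ => by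
    have e1 := Int.floor_le (a / μ)
    have e2 := Int.lt_floor_add_one (a / μ)
    rw [le_div_iff₀ hμ] at e1
    rw [div_lt_iff₀ hμ] at e2
    exact ⟨e1, by linarith⟩
  constructor
  · set μ := c0 * r ^ q with hμ
    have hμ0 := (grid q le_rfl).1
    obtain ⟨f1, f2⟩ := fl μ hμ0
    have e0 : r ^ (q + 1) = r * r ^ q := by ring
    have x1 := near q le_rfl (⌊a / μ⌋ - 1) (by push_cast; rw [← hμ, abs_le]; constructor <;> linarith)
    have x2 := Xw_le_up hw (H := H) (t := t) (ε' := r ^ q) (μ := μ) (a := a) (a0 := ((⌊a / μ⌋ - 1 : ℤ) : ℝ) * μ) hε (by positivity) hμ0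
      (fun b hb => by
        push_cast at hb
        have : 2 * μ = (1 - r) * r ^ q := by rw [hμ, hc0]; ring
        constructor <;> linarith [hb.1, hb.2])
    have x3 : (r ^ q) ^ (1 / H - 1) ≤ (r ^ (1 / H - 1)) ^ (-2 : ℤ) * ε ^ (1 / H - 1) := by
      have z : r ^ q ≤ r ^ (-2 : ℤ) * ε := by
        rw [zpow_neg, ← div_eq_inv_mul, le_div_iff₀ (by positivity)]
        have : r ^ q * r ^ (2 : ℤ) = r ^ (q + 1 + 1) := by rw [show (2 : ℤ) = ((2 : ℕ) : ℤ) from rfl, zpow_natCast]; ring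
        linarith
      have := Real.rpow_le_rpow (by positivity) z hp
      rw [Real.mul_rpow (by positivity) hε.le] at this
      rwa [← Real.rpow_intCast, ← Real.rpow_mul hr0.le, mul_comm (1 / H - 1), Real.rpow_mul hr0.le, Real.rpow_intCast]
    have x4 := mul_le_mul_of_nonneg_right x3 hU
    have := (abs_le.1 x1).1
    rw [← mul_assoc]; linarith
  · set μ := c0 * r ^ (q + 3) with hμ
    have hμ0 := (grid (q + 3) (by omega)).1
    obtain ⟨f1, f2⟩ := fl μ hμ0
    have e0 : r ^ (q + 3) = r * r ^ (q + 1 + 1) := by ring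
    have x1 := near (q + 3) (by omega) (⌊a / μ⌋ + 1) (by push_cast; rw [← hμ, abs_le]; constructor <;> linarith)
    have x2 := up_le_Xw hw (H := H) (t := t) (ε := ε) (ε' := r ^ (q + 3)) (μ := μ) (a := a) (a0 := ((⌊a / μ⌋ + 1 : ℤ) : ℝ) * μ) (by positivity) hμ0
      (fun b hb => by
        push_cast at hb
        have e1 : 2 * μ = (1 - r) * r ^ (q + 3) := by rw [hμ, hc0]; ring
        have e2 : r ^ (q + 3) < r * ε := by rw [e0]; gcongr
        have e3 : (2 - r) * r ^ (q + 3) < (2 - r) * (r * ε) := by gcongr; linarith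
        have e4 : 0 ≤ (1 - r) ^ 2 * ε := by positivity
        constructor
        · linarith [hb.1]
        · nlinarith [hb.2])
    have x3 : (r ^ (1 / H - 1)) ^ 2 * ε ^ (1 / H - 1) ≤ (r ^ (q + 3)) ^ (1 / H - 1) := by
      have z : r ^ 2 * ε ≤ r ^ (q + 3) := by
        calc _ ≤ r ^ 2 * r ^ (q + 1) := by gcongr
          _ = _ := by ring
      have := Real.rpow_le_rpow (by positivity) z hp
      rw [Real.mul_rpow (by positivity) hε.le] at this
      rwa [← Real.rpow_natCast, ← Real.rpow_mul hr0.le, mul_comm (1 / H - 1), Real.rpow_mul hr0.le, Real.rpow_natCast]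
    have x4 := mul_le_mul_of_nonneg_right x3 hU
    have := (abs_le.1 x1).2
    rw [← mul_assoc]; linarith

lemma up_zero {ε A a : ℝ} (hA : ∀ r ∈ Icc 0 t, |w r| ≤ A) (ha : A < |a|) : upR ε (fun r => w r - a) 0 t = 0 := by
  have : upSet ε (fun r => w r - a) 0 t = ∅ := by
    refine Set.eq_empty_of_forall_notMem fun p hp => ?_
    have h1 := hA _ hp.1
    have h2 : w p.1 - a = 0 := hp.2.2.2.1
    rw [sub_eq_zero.1 h2] at h1
    linarith
  simp [upR, upE, this]

/-- convergence for one fixed time -/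
def Cv (H γ : ℝ) (w : ℝ → ℝ) (t : ℝ) (Lf : ℝ → ℝ) : Prop :=
  ∀ η > 0, ∀ᶠ ε : ℝ in 𝓝[>] 0, ∀ a, |ε ^ (1 / H - 1) * upR ε (fun r => w r - a) 0 t - γ * Lf a| ≤ η

lemma Cv_zero (hO : Occ w 0 Lf) (hw0 : w 0 = 0) (H γ : ℝ) : (∀ a, Lf a = 0) ∧ Cv H γ w 0 Lf := by
  have hL : ∀ a, Lf a = 0 := by
    have : Lf = fun _ => 0 := by
      refine Continuous.ext_on (dense_compl_singleton (0 : ℝ)) hO.1 continuous_const fun a ha => ?_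
      refine hO.zero le_rfl (A := 0) (fun r hr => ?_) (abs_pos.2 ha)
      rw [le_antisymm hr.2 hr.1, hw0]; simp
    exact fun a => congrFun this a
  refine ⟨hL, fun η hη => Eventually.of_forall fun ε a => ?_⟩
  have : upSet ε (fun r => w r - a) 0 0 = ∅ := by
    refine Set.eq_empty_of_forall_notMem fun p hp => ?_
    linarith [hp.1.1, hp.2.1.2, hp.2.2.1]
  simp [upR, upE, this, hL, hη.le]

lemma Cv_of (hO : Occ w t Lf) (hw : Continuous w) (ht : 0 < t) {H γ : ℝ} (hγ : 0 ≤ γ) (hp : 0 ≤ 1 / H - 1)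
    (hX : ∀ q : ℕ, ∀ r : ℝ, r = 1 - 1 / ((q : ℝ) + 2) →
      ∀ A : ℝ, ∀ η > 0, ∀ᶠ n : ℕ in atTop, ∀ ε, ε = r ^ n → ∀ k : ℤ, |k * ((1 - r) / 2 * ε)| ≤ A →
      |Xw H w t ε ((1 - r) / 2 * ε) (k * ((1 - r) / 2 * ε)) - γ * Lf (k * ((1 - r) / 2 * ε))| ≤ η) : Cv H γ w t Lf := by
  intro η hη
  obtain ⟨A, hA⟩ := (isCompact_Icc (a := (0:ℝ)) (b := t)).exists_bound_of_continuousOn hw.continuousOn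
  simp only [Real.norm_eq_abs] at hA
  obtain ⟨Λ, hΛ0, hΛ⟩ := hO.bdd hw ht.le
  set K := γ * Λ + η with hK
  have hK0 : 0 < K := by positivity
  -- choose the ratio
  have hs : ∃ q : ℕ, ∃ s : ℝ, s = (1 - 1 / ((q : ℝ) + 2)) ^ (1 / H - 1) ∧ 0 < s ∧ 1 - η / (2 * K) < s ^ 2 ∧ (s ^ 2)⁻¹ < 1 + η / (2 * K) := by
    have t0 : Tendsto (fun q : ℕ => 1 - 1 / ((q : ℝ) + 2)) atTop (𝓝 1) := by
      have : Tendsto (fun q : ℕ => 1 / ((q : ℝ) + 2)) atTop (𝓝 0) := by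
        have := (tendsto_add_atTop_iff_nat 1).2 (tendsto_one_div_add_atTop_nhds_zero_nat (𝕜 := ℝ))
        refine this.congr fun q => ?_
        push_cast; ring_nf
      simpa using this.const_sub 1
    have t1 : Tendsto (fun q : ℕ => (1 - 1 / ((q : ℝ) + 2)) ^ (1 / H - 1)) atTop (𝓝 1) := by
      have := t0.rpow_const (p := 1 / H - 1) (Or.inl one_ne_zero)
      rwa [Real.one_rpow] at this
    have t2 : Tendsto (fun q : ℕ => ((1 - 1 / ((q : ℝ) + 2)) ^ (1 / H - 1)) ^ 2) atTop (𝓝 1) := by simpa using t1.pow 2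
    have t3 := t2.inv₀ one_ne_zero
    rw [inv_one] at t3
    have hx : 0 < η / (2 * K) := by positivity
    obtain ⟨q, h1, h2, h3⟩ := ((t1.eventually (lt_mem_nhds one_pos)).and ((t2.eventually (lt_mem_nhds (show 1 - η / (2 * K) < 1 by linarith))).and
      (t3.eventually (gt_mem_nhds (show 1 < 1 + η / (2 * K) by linarith))))).exists
    exact ⟨q, _, rfl, h1, h2, h3⟩
  obtain ⟨q, s, hs, hs0, hs1, hs2⟩ := hs
  have hq : (0 : ℝ) < 1 / ((q : ℝ) + 2) := by positivity
  have hq1 : 1 / ((q : ℝ) + 2) < 1 := by rw [div_lt_one (by positivity)]; linarith [show (0 : ℝ) ≤ q by positivity]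
  filter_upwards [sandwich hO hw ht hγ hp (by linarith) (by linarith) (hX q _ rfl) A (show 0 < η / 2 by positivity), ev_le_one] with ε h1 hε a
  by_cases ha : A < |a|
  · rw [up_zero hA ha, hO.zero ht.le hA ha]; simp [hη.le]
  obtain ⟨h2, h3⟩ := h1 a (not_lt.1 ha)
  rw [← hs] at h2 h3
  have hL := mul_nonneg hγ (hO.nonneg ht.le a)
  have hL2 : γ * Lf a ≤ γ * Λ := by gcongr; exact hΛ a
  rw [zpow_neg, show (2 : ℤ) = ((2 : ℕ) : ℤ) from rfl, zpow_natCast, ← div_eq_inv_mul, le_div_iff₀ (by positivity)] at h2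
  have hv : 0 < s ^ 2 := by positivity
  have hX0 : 0 ≤ ε ^ (1 / H - 1) * upR ε (fun r => w r - a) 0 t :=
    mul_nonneg (Real.rpow_nonneg hε.1.le _) ENNReal.toReal_nonneg
  generalize γ * Lf a = Z at *
  generalize ε ^ (1 / H - 1) * upR ε (fun r => w r - a) 0 t = X at *
  generalize s ^ 2 = v at *
  have e1 : η / (2 * K) * K = η / 2 := by field_simp
  have e2 : 0 < η / (2 * K) := by positivity
  generalize η / (2 * K) = ξ at *
  rw [abs_le]
  constructor
  · rcases le_total Z (η / 2) with hz | hz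
    · linarith
    · have : (Z - η / 2) * (1 - ξ) ≤ (Z - η / 2) * v := mul_le_mul_of_nonneg_left hs1.le (by linarith)
      nlinarith
  · have : X ≤ v⁻¹ * (Z + η / 2) := by rw [← div_eq_inv_mul, le_div_iff₀ hv]; linarith
    have : v⁻¹ * (Z + η / 2) ≤ (1 + ξ) * (Z + η / 2) := by gcongr
    nlinarith
end fin
end

section
lemma Cv_all {w : ℝ → ℝ} {L : ℝ → ℝ → ℝ} (hw : Continuous w) {H γ T : ℝ} (hγ : 0 ≤ γ) (hT : 0 < T)
    (hL : Continuous fun p : ℝ × ℝ => L p.1 p.2) (hO : ∀ t, 0 ≤ t → Occ w t (L t))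
    (hC : ∀ N i : ℕ, Cv H γ w (i * (T / (N + 1))) (L (i * (T / (N + 1))))) {δ : ℝ} (hδ : 0 < δ) :
    ∀ᶠ ε : ℝ in 𝓝[>] 0, ∀ t ∈ Icc 0 T, ∀ a, |ε ^ (1 / H - 1) * upR ε (fun r => w r - a) 0 t - γ * L t a| < δ := by
  obtain ⟨A, hA⟩ := (isCompact_Icc (a := (0:ℝ)) (b := 2 * T)).exists_bound_of_continuousOn hw.continuousOn
  simp only [Real.norm_eq_abs] at hA
  set η := δ / (4 * (γ + 1)) with hηd
  have hη : 0 < η := by positivity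
  have hu := (isCompact_Icc.prod isCompact_Icc : IsCompact (Icc 0 (2 * T) ×ˢ Icc (-A) A)).uniformContinuousOn_of_continuous hL.continuousOn
  obtain ⟨d, hd, hdL⟩ := Metric.uniformContinuousOn_iff.1 hu η hη
  have hLL : ∀ s ∈ Icc 0 (2 * T), ∀ t ∈ Icc 0 (2 * T), |s - t| < d → ∀ a, |γ * L s a - γ * L t a| ≤ δ / 4 := by
    intro s hs t ht hst a
    by_cases ha : A < |a|
    · rw [(hO s hs.1).zero hs.1 (fun r hr => hA r ⟨hr.1, hr.2.trans hs.2⟩) ha,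
        (hO t ht.1).zero ht.1 (fun r hr => hA r ⟨hr.1, hr.2.trans ht.2⟩) ha]
      simp; positivity
    have ha' : a ∈ Icc (-A) A := abs_le.1 (not_lt.1 ha)
    have := (hdL (s, a) ⟨hs, ha'⟩ (t, a) ⟨ht, ha'⟩ (by simpa [Prod.dist_eq, Real.dist_eq, hd] using hst)).le
    rw [Real.dist_eq] at this
    rw [← mul_sub, abs_mul, abs_of_nonneg hγ]
    calc _ ≤ (γ + 1) * η := by gcongr; linarith
      _ = _ := by rw [hηd]; field_simp
  obtain ⟨N, hN⟩ := exists_nat_one_div_lt (show 0 < d / T by positivity)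
  set h := T / ((N : ℝ) + 1) with hh
  have hh0 : 0 < h := by positivity
  have hhd : h < d := by
    rw [lt_div_iff₀ hT] at hN
    calc h = 1 / ((N : ℝ) + 1) * T := by rw [hh]; ring
      _ < d := hN
  have hhT : h ≤ T := div_le_self hT.le (by linarith [show (0 : ℝ) ≤ N by positivity])
  have ev : ∀ᶠ ε : ℝ in 𝓝[>] 0, ∀ i ∈ Finset.range (N + 3), ∀ a,
      |ε ^ (1 / H - 1) * upR ε (fun r => w r - a) 0 (i * h) - γ * L (i * h) a| ≤ δ / 4 :=
    (Finset.range (N + 3)).eventually_all.2 fun i _ => hC N i (δ / 4) (by positivity)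
  filter_upwards [ev, ev_le_one] with ε h1 hε t ht a
  set i := ⌊t / h⌋₊ with hi
  have i1 : (i : ℝ) * h ≤ t := by
    rw [← le_div_iff₀ hh0]; exact Nat.floor_le (div_nonneg ht.1 hh0.le)
  have i2 : t < ((i + 1 : ℕ) : ℝ) * h := by
    rw [← div_lt_iff₀ hh0]; push_cast; exact Nat.lt_floor_add_one _
  have i3 : i < N + 2 := by
    have : (i : ℝ) * h ≤ ((N : ℝ) + 1) * h := by
      have : ((N : ℝ) + 1) * h = T := by rw [hh]; field_simp
      linarith [ht.2]
    have := le_of_mul_le_mul_right this hh0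
    have : i ≤ N + 1 := by exact_mod_cast this
    omega
  have i4 : ((i + 1 : ℕ) : ℝ) * h = i * h + h := by push_cast; ring
  have i5 : 0 ≤ (i : ℝ) * h := by positivity
  have a1 := abs_le.1 (h1 i (by simp; omega) a)
  have a2 := abs_le.1 (h1 (i + 1) (by simp; omega) a)
  have b1 := abs_le.1 (hLL (i * h) ⟨i5, by linarith [ht.2]⟩ t ⟨ht.1, by linarith [ht.2]⟩ (by rw [abs_lt]; constructor <;> linarith) a)
  have b2 := abs_le.1 (hLL (((i + 1 : ℕ) : ℝ) * h) ⟨by linarith, by linarith [ht.2]⟩ t ⟨ht.1, by linarith [ht.2]⟩ (by rw [abs_lt]; constructor <;> linarith) a)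
  have hy : 0 ≤ ε ^ (1 / H - 1) := Real.rpow_nonneg hε.1.le _
  have c1 := mul_le_mul_of_nonneg_left (upR_mono hw (s := 0) (a := a) hε.1 i1) hy
  have c2 := mul_le_mul_of_nonneg_left (upR_mono hw (s := 0) (a := a) hε.1 i2.le) hy
  rw [abs_lt]
  constructor <;> linarith [a1.1, a2.2, b1.1, b2.2]
end

end UL

/-- **Uniform convergence to local time.** For `H ∈ (0,1/2)` and `T ∈ (0,∞)`,
almost surely `ε^{1/H-1} U_{0,t}(ε, B-a) → (c_H/2) L_t(a)` as `ε → 0⁺`, uniformly over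
`t ≤ T` and `a ∈ ℝ`. -/
theorem uniform_convergence_to_local_time
    {Ω : Type*} [MeasurableSpace Ω] (P : Measure Ω) [IsProbabilityMeasure P]
    (H : ℝ) (hH : H ∈ Set.Ioo (0 : ℝ) (1 / 2)) (B : ℝ → Ω → ℝ) (hB : IsFBM H P B)
    (L : ℝ → ℝ → Ω → ℝ)
    (hLcont : ∀ ω, Continuous fun p : ℝ × ℝ => L p.1 p.2 ω)
    (hLocc : ∀ᵐ ω ∂P, ∀ t : ℝ, 0 ≤ t → ∀ f : ℝ → ℝ, Continuous f →
        ∫ r in (0 : ℝ)..t, f (B r ω) = ∫ a : ℝ, f a * L t a ω)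
    (T : ℝ) (hT : 0 < T) :
    ∀ᵐ ω ∂P, ∀ δ : ℝ, 0 < δ → ∃ ε₀ : ℝ, 0 < ε₀ ∧
      ∀ ε : ℝ, 0 < ε → ε < ε₀ → ∀ t ∈ Set.Icc (0 : ℝ) T, ∀ a : ℝ,
        |ε ^ (1 / H - 1) * upR ε (fun r => B r ω - a) 0 t - cH P B / 2 * L t a ω| < δ := by
  obtain ⟨hH0, hH2⟩ := hH
  obtain ⟨aH, haH, ha⟩ := hB.2.2.2.2
  obtain ⟨γ, hγ0, hcγ, hγ⟩ := UL.exists_gamma hB ha haH hH0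
  have hOcc : ∀ᵐ ω ∂P, ∀ t, 0 ≤ t → UL.Occ (fun r => B r ω) t (fun a => L t a ω) :=
    hLocc.mono fun ω h t ht => ⟨(hLcont ω).comp (by fun_prop : Continuous fun a : ℝ => (t, a)), h t ht⟩
  have hX : ∀ᵐ ω ∂P, ∀ N i q : ℕ, 0 < (i : ℝ) * (T / (N + 1)) → ∀ A : ℝ, ∀ η > 0, ∀ᶠ n : ℕ in atTop, ∀ ε, ε = (1 - 1 / ((q : ℝ) + 2)) ^ n →
      ∀ k : ℤ, |k * ((1 - (1 - 1 / ((q : ℝ) + 2))) / 2 * ε)| ≤ A →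
      |UL.Xw H (fun r => B r ω) (i * (T / (N + 1))) ε ((1 - (1 - 1 / ((q : ℝ) + 2))) / 2 * ε) (k * ((1 - (1 - 1 / ((q : ℝ) + 2))) / 2 * ε)) -
        γ * L (i * (T / (N + 1))) (k * ((1 - (1 - 1 / ((q : ℝ) + 2))) / 2 * ε)) ω| ≤ η := by
    rw [ae_all_iff]; intro N
    rw [ae_all_iff]; intro i
    rw [ae_all_iff]; intro q
    by_cases ht : 0 < (i : ℝ) * (T / (N + 1))
    · have hq : (0 : ℝ) < 1 / ((q : ℝ) + 2) := by positivity
      have hq1 : 1 / ((q : ℝ) + 2) < 1 := by rw [div_lt_one (by positivity)]; linarith [show (0 : ℝ) ≤ q by positivity]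
      refine (UL.step_three hB ha haH hH0 hH2 hγ hγ0 ht (by linarith) (by linarith) (c0 := (1 - (1 - 1 / ((q : ℝ) + 2))) / 2)
        (r := 1 - 1 / ((q : ℝ) + 2)) (by linarith) (L := L (i * (T / (N + 1)))) (hOcc.mono fun ω h => h _ ht.le)).mono fun ω h _ => h
    · exact Eventually.of_forall fun ω h => absurd h ht
  filter_upwards [hOcc, hX] with ω hO hX δ hδ
  have hw : Continuous fun r => B r ω := hB.1 ω
  have hp : 0 ≤ 1 / H - 1 := by
    rw [sub_nonneg, le_div_iff₀ hH0]; linarith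
  have ev := UL.Cv_all hw (L := fun t a => L t a ω) (H := H) hγ0 hT (hLcont ω) hO (fun N i => by
    rcases (show 0 ≤ (i : ℝ) * (T / (N + 1)) by positivity).eq_or_lt with h0 | h0
    · rw [← h0]
      exact (UL.Cv_zero (hO 0 le_rfl) (hB.2.1 ω) H γ).2
    · exact UL.Cv_of (hO _ h0.le) hw h0 hγ0 hp fun q r hr => by rw [hr]; exact hX N i q h0) hδ
  obtain ⟨ε₀, hε₀, hs⟩ := mem_nhdsGT_iff_exists_Ioo_subset.1 ev
  refine ⟨ε₀, hε₀, fun ε h1 h2 t ht a => ?_⟩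
  rw [hcγ, mul_div_cancel_left₀ γ two_ne_zero]
  exact hs ⟨h1, h2⟩ t ht a

end
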